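/- Let f : S₁ → S₂ be a covering map from a closed surface S₁ onto a closed surface S₂, each equipped with a fixed metric inducing its topology. Let K ⊆ S₂ be a nonempty compact set and L = f⁻¹(K). Then for every class δ of the Schönflies equivalence ∼_L on L, the image f(δ) is exactly a class of the Schönflies equivalence ∼_K on K. -/

import Mathlib

open Set Metric Filter Topology unitInterval

/-- A space is locally euclidean of dimension 2 if every point has an open neighborhood
homeomorphic to `ℝ²`. A *closed surface* is a nonempty compact connected Hausdorff space
with this property. -/
def IsSurfaceLocallyEuclidean (S : Type*) [TopologicalSpace S] : Prop :=
  ∀ x : S, ∃ U : Set S, IsOpen U ∧ x ∈ U ∧ Nonempty (U ≃ₜ (ℝ × ℝ))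

/-- The Schönflies relation of a compact set `K` on a (metric) surface `S`: pairs `(x, x)`
with `x ∈ K`, together with pairs of distinct points `x, y ∈ K` for which there is a
topological embedding `φ` of the square `[0,1]²` into `S` (a marked quadrilateral with
marked sides `I₁ = φ([0,1]×{0})` and `I₂ = φ([0,1]×{1})`) such that
(a) `x ∈ I₁`, `y ∈ I₂` and `K ∩ ∂Q ⊆ I₁ ∪ I₂`;
(b) `K ∩ Q` has infinitely many pairwise distinct connected components `Qₙ`, each meeting
both `I₁` and `I₂`;
(c) the sequence `(Qₙ)` converges in the Hausdorff metric to a continuum `Q∞` containing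
both `x` and `y`. -/
def schonfliesRel {S : Type*} [MetricSpace S] (K : Set S) : Set (S × S) :=
  {p | p.1 ∈ K ∧ p.2 ∈ K ∧ (p.1 = p.2 ∨
    ∃ φ : unitInterval × unitInterval → S, Topology.IsEmbedding φ ∧
      p.1 ∈ φ '' {q | q.2 = 0} ∧ p.2 ∈ φ '' {q | q.2 = 1} ∧
      K ∩ (φ '' {q | q.1 = 0 ∨ q.1 = 1 ∨ q.2 = 0 ∨ q.2 = 1}) ⊆
        (φ '' {q | q.2 = 0}) ∪ (φ '' {q | q.2 = 1}) ∧
      ∃ Q : ℕ → Set S,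
        (∀ m n, m ≠ n → Q m ≠ Q n) ∧
        (∀ n, ∃ z ∈ K ∩ Set.range φ, Q n = connectedComponentIn (K ∩ Set.range φ) z) ∧
        (∀ n, (Q n ∩ φ '' {q | q.2 = 0}).Nonempty ∧ (Q n ∩ φ '' {q | q.2 = 1}).Nonempty) ∧
        ∃ Qinf : Set S, IsCompact Qinf ∧ IsConnected Qinf ∧
          Filter.Tendsto (fun n => Metric.hausdorffDist (Q n) Qinf) Filter.atTop (nhds 0) ∧
          p.1 ∈ Qinf ∧ p.2 ∈ Qinf)}

/-- The collection of closed equivalence relations on `K` containing a given relation `R`. -/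
def closedEquivsOn {S : Type*} [MetricSpace S] (K : Set S) (R : Set (S × S)) :
    Set (Set (S × S)) :=
  {E | R ⊆ E ∧ E ⊆ K ×ˢ K ∧ IsClosed E ∧ (∀ x ∈ K, (x, x) ∈ E) ∧
    (∀ x y, (x, y) ∈ E → (y, x) ∈ E) ∧
    (∀ x y z, (x, y) ∈ E → (y, z) ∈ E → (x, z) ∈ E)}

/-- The Schönflies equivalence `∼_K`: the smallest closed equivalence relation on `K`
containing the Schönflies relation `R_K`. -/
def schonfliesEquiv {S : Type*} [MetricSpace S] (K : Set S) : Set (S × S) :=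
  ⋂₀ closedEquivsOn K (schonfliesRel K)

/-- The Schönflies class `[x]_∼` of a point `x`. -/
def schonfliesClass {S : Type*} [MetricSpace S] (K : Set S) (x : S) : Set S :=
  {y | (x, y) ∈ schonfliesEquiv K}

/-- The decomposition `D_K = {[x]_∼ : x ∈ K}` of `K` into Schönflies classes. -/
def schonfliesDecomp {S : Type*} [MetricSpace S] (K : Set S) : Set (Set S) :=
  {C | ∃ x ∈ K, C = schonfliesClass K x}

/-! ### Hexagonal cells -/

noncomputable def hL0 (z : ℂ) : ℝ := 2 * z.re
noncomputable def hL1 (z : ℂ) : ℝ := z.re + 3 / 2 * z.im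
noncomputable def hL2 (z : ℂ) : ℝ := -z.re + 3 / 2 * z.im
noncomputable def hexG (z : ℂ) : ℝ := max |hL0 z| (max |hL1 z| |hL2 z|)
noncomputable def hctr (o : ℤ × ℤ) : ℂ := ⟨o.1 - o.2 / 2, o.2⟩
def hexCell (o : ℤ × ℤ) : Set ℂ := {z | hexG (z - hctr o) ≤ 1}

def hadj (a b : ℤ × ℤ) : Prop :=
  (b.1 = a.1 + 1 ∧ b.2 = a.2) ∨ (b.1 = a.1 + 1 ∧ b.2 = a.2 + 1) ∨ (b.1 = a.1 ∧ b.2 = a.2 + 1) ∨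
  (b.1 = a.1 - 1 ∧ b.2 = a.2) ∨ (b.1 = a.1 - 1 ∧ b.2 = a.2 - 1) ∨ (b.1 = a.1 ∧ b.2 = a.2 - 1)

lemma hadj_symm {a b : ℤ × ℤ} (h : hadj a b) : hadj b a := by
  unfold hadj at *; omega

lemma hexG_le_iff (z : ℂ) (t : ℝ) : hexG z ≤ t ↔
    (-t ≤ hL0 z ∧ hL0 z ≤ t) ∧ (-t ≤ hL1 z ∧ hL1 z ≤ t) ∧ (-t ≤ hL2 z ∧ hL2 z ≤ t) := by
  simp only [hexG, max_le_iff, abs_le]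

lemma continuous_hexG : Continuous hexG := by
  unfold hexG hL0 hL1 hL2; fun_prop

lemma isClosed_hexCell (o : ℤ × ℤ) : IsClosed (hexCell o) :=
  isClosed_le (continuous_hexG.comp (continuous_id.sub continuous_const)) continuous_const

lemma hexCell_cover (z : ℂ) : ∃ o, z ∈ hexCell o := by
  obtain ⟨N, ν, hN, h0, h1⟩ : ∃ (N : ℤ) (ν : ℝ), z.im = N + ν ∧ 0 ≤ ν ∧ ν < 1 :=
    ⟨⌊z.im⌋, Int.fract z.im, by simp, Int.fract_nonneg _, Int.fract_lt_one _⟩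
  obtain ⟨M, μ, hM, g0, g1⟩ : ∃ (N : ℤ) (ν : ℝ), z.re + z.im / 2 = N + ν ∧ 0 ≤ ν ∧ ν < 1 :=
    ⟨⌊z.re + z.im / 2⌋, Int.fract (z.re + z.im / 2), by simp, Int.fract_nonneg _,
      Int.fract_lt_one _⟩
  have hre : z.re = M + μ - (N + ν) / 2 := by linarith
  by_cases a1 : 2 * μ - ν ≤ 1 ∧ 2 * ν - μ ≤ 1 ∧ μ + ν ≤ 1
  · refine ⟨(M, N), ?_⟩
    simp only [hexCell, mem_ofPred_eq, hexG_le_iff, hL0, hL1, hL2, hctr, Complex.sub_re,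
      Complex.sub_im, hre, hN]
    refine ⟨⟨?_, ?_⟩, ⟨?_, ?_⟩, ⟨?_, ?_⟩⟩ <;> linarith [a1.1, a1.2.1, a1.2.2]
  by_cases a2 : 1 ≤ 2 * μ - ν ∧ 2 * ν - μ ≤ 0
  · refine ⟨(M + 1, N), ?_⟩
    simp only [hexCell, mem_ofPred_eq, hexG_le_iff, hL0, hL1, hL2, hctr, Complex.sub_re,
      Complex.sub_im, hre, hN]
    push_cast
    refine ⟨⟨?_, ?_⟩, ⟨?_, ?_⟩, ⟨?_, ?_⟩⟩ <;> linarith [a2.1, a2.2]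
  by_cases a3 : 1 ≤ 2 * ν - μ ∧ 2 * μ - ν ≤ 0
  · refine ⟨(M, N + 1), ?_⟩
    simp only [hexCell, mem_ofPred_eq, hexG_le_iff, hL0, hL1, hL2, hctr, Complex.sub_re,
      Complex.sub_im, hre, hN]
    push_cast
    refine ⟨⟨?_, ?_⟩, ⟨?_, ?_⟩, ⟨?_, ?_⟩⟩ <;> linarith [a3.1, a3.2]
  have a4 : 1 ≤ μ + ν ∧ 0 ≤ 2 * μ - ν ∧ 0 ≤ 2 * ν - μ := by
    by_cases b1 : 2 * μ - ν ≤ 1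
    · by_cases b2 : 2 * ν - μ ≤ 1
      · have b3 : ¬ (μ + ν ≤ 1) := fun h => a1 ⟨b1, b2, h⟩
        push Not at b3
        refine ⟨?_, ?_, ?_⟩ <;> linarith
      · push Not at b2
        have b3 : ¬ (2 * μ - ν ≤ 0) := fun h => a3 ⟨b2.le, h⟩
        push Not at b3
        refine ⟨?_, ?_, ?_⟩ <;> linarith
    · push Not at b1
      have b3 : ¬ (2 * ν - μ ≤ 0) := fun h => a2 ⟨b1.le, h⟩
      push Not at b3
      refine ⟨?_, ?_, ?_⟩ <;> linarith
  refine ⟨(M + 1, N + 1), ?_⟩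
  simp only [hexCell, mem_ofPred_eq, hexG_le_iff, hL0, hL1, hL2, hctr, Complex.sub_re,
    Complex.sub_im, hre, hN]
  push_cast
  refine ⟨⟨?_, ?_⟩, ⟨?_, ?_⟩, ⟨?_, ?_⟩⟩ <;> linarith [a4.1, a4.2.1, a4.2.2]

lemma hadj_of_mem {a b : ℤ × ℤ} {z : ℂ} (ha : z ∈ hexCell a) (hb : z ∈ hexCell b) (hab : a ≠ b) :
    hadj a b := by
  obtain ⟨m, n⟩ := a
  obtain ⟨m', n'⟩ := b
  simp only [hexCell, mem_ofPred_eq, hexG_le_iff, hL0, hL1, hL2, hctr, Complex.sub_re,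
      Complex.sub_im] at ha hb
  have e1 : ((2 * (m' - m) - (n' - n) : ℤ) : ℝ) ≤ (2 : ℤ) := by push_cast; linarith
  have e2 : ((-2 : ℤ) : ℝ) ≤ ((2 * (m' - m) - (n' - n) : ℤ) : ℝ) := by push_cast; linarith
  have e3 : (((m' - m) + (n' - n) : ℤ) : ℝ) ≤ (2 : ℤ) := by push_cast; linarith
  have e4 : ((-2 : ℤ) : ℝ) ≤ (((m' - m) + (n' - n) : ℤ) : ℝ) := by push_cast; linarith
  have e5 : ((2 * (n' - n) - (m' - m) : ℤ) : ℝ) ≤ (2 : ℤ) := by push_cast; linarith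
  have e6 : ((-2 : ℤ) : ℝ) ≤ ((2 * (n' - n) - (m' - m) : ℤ) : ℝ) := by push_cast; linarith
  rw [Int.cast_le] at e1 e2 e3 e4 e5 e6
  have : ¬ (m = m' ∧ n = n') := by rintro ⟨rfl, rfl⟩; exact hab rfl
  simp only [hadj]
  omega

/-- Cells adjacent share a point. -/
lemma hadj_inter {a b : ℤ × ℤ} (h : hadj a b) : (hexCell a ∩ hexCell b).Nonempty := by
  refine ⟨(hctr a + hctr b) / 2, ?_, ?_⟩ <;>
  · simp only [hexCell, mem_ofPred_eq, hexG_le_iff, hL0, hL1, hL2, hctr, Complex.sub_re,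
      Complex.sub_im, Complex.div_ofNat_re, Complex.div_ofNat_im, Complex.add_re, Complex.add_im]
    rcases h with h | h | h | h | h | h <;> rw [h.1, h.2] <;> push_cast <;>
    refine ⟨⟨?_, ?_⟩, ⟨?_, ?_⟩, ⟨?_, ?_⟩⟩ <;> linarith

def hstep (P : Set (ℤ × ℤ)) (x y : ℤ × ℤ) : Prop := hadj x y ∧ x ∈ P ∧ y ∈ P
def HConn (P : Set (ℤ × ℤ)) : Prop :=
  ∀ a ∈ P, ∀ b ∈ P, Relation.ReflTransGen (hstep P) a b

lemma hstep_symm {P : Set (ℤ × ℤ)} {x y : ℤ × ℤ} (h : hstep P x y) : hstep P y x :=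
  ⟨hadj_symm h.1, h.2.2, h.2.1⟩

lemma hreach_symm {P : Set (ℤ × ℤ)} {x y : ℤ × ℤ} (h : Relation.ReflTransGen (hstep P) x y) :
    Relation.ReflTransGen (hstep P) y x := by
  induction h with
  | refl => exact .refl
  | tail _ h2 ih => exact (Relation.ReflTransGen.single (hstep_symm h2)).trans ih

lemma hreach_mono {P Q : Set (ℤ × ℤ)} (hPQ : P ⊆ Q) {x y : ℤ × ℤ}
    (h : Relation.ReflTransGen (hstep P) x y) : Relation.ReflTransGen (hstep Q) x y :=
  Relation.ReflTransGen.mono (r := hstep P) (p := hstep Q) (fun _ _ h => ⟨h.1, hPQ h.2.1, hPQ h.2.2⟩) _ _ h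

lemma hreach_mem {P : Set (ℤ × ℤ)} {x y : ℤ × ℤ} (hx : x ∈ P)
    (h : Relation.ReflTransGen (hstep P) x y) : y ∈ P := by
  induction h with
  | refl => exact hx
  | tail _ h2 _ => exact h2.2.2

/-- crossing of the ray from `v` -/
def hcr (v a b : ℤ × ℤ) : Prop :=
  (b.2 = a.2 + 1 ∧ a.2 = v.2 ∧ v.1 < a.1) ∨ (a.2 = b.2 + 1 ∧ b.2 = v.2 ∧ v.1 < b.1)

lemma hcr_step (P : Set (ℤ × ℤ)) {v v' : ℤ × ℤ} (hv : v ∉ P) (hv' : v' ∉ P)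
    (h : hadj v v') : ∃ r : ℤ × ℤ → Prop, ∀ a ∈ P, ∀ b ∈ P, hadj a b →
      ((hcr v a b ↔ hcr v' a b) ↔ (r a ↔ r b)) := by
  have key : ∀ v v' : ℤ × ℤ, v ∉ P → v' ∉ P →
      ((v'.1 = v.1 + 1 ∧ v'.2 = v.2) ∨ (v'.1 = v.1 + 1 ∧ v'.2 = v.2 + 1) ∨
        (v'.1 = v.1 ∧ v'.2 = v.2 + 1)) → ∃ r : ℤ × ℤ → Prop, ∀ a ∈ P, ∀ b ∈ P, hadj a b →
      ((hcr v a b ↔ hcr v' a b) ↔ (r a ↔ r b)) := by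
    rintro ⟨x, y⟩ ⟨x', y'⟩ hv hv' h
    have ne : ∀ a ∈ P, ¬ (a.1 = x ∧ a.2 = y) ∧ ¬ (a.1 = x' ∧ a.2 = y') := by
      rintro ⟨a1, a2⟩ ha
      constructor
      · rintro ⟨rfl, rfl⟩; exact hv ha
      · rintro ⟨rfl, rfl⟩; exact hv' ha
    simp only at h
    rcases h with ⟨h1, h2⟩ | ⟨h1, h2⟩ | ⟨h1, h2⟩
    · refine ⟨fun _ => False, ?_⟩
      rintro ⟨a1, a2⟩ ha ⟨b1, b2⟩ hb hab
      have := ne _ ha; have := ne _ hb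
      simp only [hcr, hadj, iff_true] at *
      rcases hab with hab | hab | hab | hab | hab | hab <;> obtain ⟨rfl, rfl⟩ := hab <;> omega
    · refine ⟨fun a => a.2 = y' ∧ x' < a.1, ?_⟩
      rintro ⟨a1, a2⟩ ha ⟨b1, b2⟩ hb hab
      have := ne _ ha; have := ne _ hb
      simp only [hcr, hadj] at *
      rcases hab with hab | hab | hab | hab | hab | hab <;> obtain ⟨rfl, rfl⟩ := hab <;> omega
    · refine ⟨fun a => a.2 = y' ∧ x' < a.1, ?_⟩
      rintro ⟨a1, a2⟩ ha ⟨b1, b2⟩ hb hab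
      have := ne _ ha; have := ne _ hb
      simp only [hcr, hadj] at *
      rcases hab with hab | hab | hab | hab | hab | hab <;> obtain ⟨rfl, rfl⟩ := hab <;> omega
  rcases h with h | h | h | h | h | h
  · exact key v v' hv hv' (by omega)
  · exact key v v' hv hv' (by omega)
  · exact key v v' hv hv' (by omega)
  all_goals
    obtain ⟨r, hr⟩ := key v' v hv' hv (by omega)
    exact ⟨r, fun a ha b hb hab => by rw [← hr a ha b hb hab]; exact ⟨Iff.symm, Iff.symm⟩⟩

lemma hprop1 {a b c p q r s : Prop} (h1 : (a ↔ b) ↔ (p ↔ q)) (h2 : (b ↔ c) ↔ (r ↔ s)) :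
    (a ↔ c) ↔ ((p ↔ r) ↔ (q ↔ s)) := by
  by_cases a <;> by_cases b <;> by_cases c <;> by_cases p <;> by_cases q <;> by_cases r <;>
    by_cases s <;> simp_all

lemma hprop2 (p q r s : Prop) :
    ((p ↔ r) ↔ (q ↔ s)) ↔ ((p ↔ q) ↔ (r ↔ s)) := by
  by_cases p <;> by_cases q <;> by_cases r <;> by_cases s <;> simp_all

lemma hcr_exists (P : Set (ℤ × ℤ)) (hc : HConn Pᶜ) {v v' : ℤ × ℤ} (hv : v ∉ P) (hv' : v' ∉ P) :
    ∃ r : ℤ × ℤ → Prop, ∀ a ∈ P, ∀ b ∈ P, hadj a b →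
      ((hcr v a b ↔ hcr v' a b) ↔ (r a ↔ r b)) := by
  induction hc v hv v' hv' with
  | refl => exact ⟨fun _ => True, by simp⟩
  | @tail b c h1 h2 ih =>
    obtain ⟨r1, hr1⟩ := ih h2.2.1
    obtain ⟨r2, hr2⟩ := hcr_step P h2.2.1 h2.2.2 h2.1
    refine ⟨fun a => (r1 a ↔ r2 a), fun a ha b hb hab => ?_⟩
    exact hprop1 (hr1 a ha b hb hab) (hr2 a ha b hb hab)

def hdir : Fin 6 → ℤ × ℤ := ![(1, 0), (1, 1), (0, 1), (-1, 0), (-1, -1), (0, -1)]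

lemma hconst_of {P : Set (ℤ × ℤ)} (r : ℤ × ℤ → Prop)
    (h : ∀ a ∈ P, ∀ b ∈ P, hadj a b → (r a ↔ r b)) (hP : HConn P) {a b : ℤ × ℤ} (ha : a ∈ P)
    (hb : b ∈ P) : r a ↔ r b := by
  induction hP a ha b hb with
  | refl => rfl
  | tail h1 h2 ih => exact (ih h2.2.1).trans (h _ h2.2.1 _ h2.2.2 h2.1)

def HOpp (k : Fin 6) : Prop := ∀ (P : Set (ℤ × ℤ)) (c : ℤ × ℤ), HConn Pᶜ → c ∈ P → HConn (P \ {c}) →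
  c + hdir k ∉ P → c + hdir (k + 3) ∉ P → (c + hdir (k + 1) ∈ P ∨ c + hdir (k + 2) ∈ P) →
  (c + hdir (k + 4) ∈ P ∨ c + hdir (k + 5) ∈ P) → False

def HTwo (k : Fin 6) : Prop := ∀ (P : Set (ℤ × ℤ)) (c : ℤ × ℤ), HConn Pᶜ → c ∈ P → HConn (P \ {c}) →
  c + hdir k ∉ P → c + hdir (k + 1) ∈ P → c + hdir (k + 2) ∉ P →
  (c + hdir (k + 3) ∈ P ∨ c + hdir (k + 4) ∈ P ∨ c + hdir (k + 5) ∈ P) → False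

lemma hOpp_zero : HOpp 0 := by
  rintro P ⟨x, y⟩ hPc hc hPd h0 h3 hu hd
  obtain ⟨r, hr⟩ := hcr_exists P hPc h3 h0
  replace h0 : (x + 1, y + 0) ∉ P := h0
  replace h3 : (x + -1, y + 0) ∉ P := h3
  replace hu : (x + 1, y + 1) ∈ P ∨ (x + 0, y + 1) ∈ P := hu
  replace hd : (x + -1, y + -1) ∈ P ∨ (x + 0, y + -1) ∈ P := hd
  replace hr : ∀ a ∈ P, ∀ b ∈ P, hadj a b →
      ((hcr (x + -1, y + 0) a b ↔ hcr (x + 1, y + 0) a b) ↔ (r a ↔ r b)) := hr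
  simp only [add_zero] at *
  have ne : ∀ a ∈ P, ¬ (a.1 = x + 1 ∧ a.2 = y) ∧ ¬ (a.1 = x + -1 ∧ a.2 = y) := by
    rintro ⟨a1, a2⟩ ha
    constructor
    · rintro ⟨rfl, rfl⟩; exact h0 ha
    · rintro ⟨rfl, rfl⟩; exact h3 ha
  have cst : ∀ a ∈ P \ {(x, y)}, ∀ b ∈ P \ {(x, y)}, hadj a b → (r a ↔ r b) := by
    rintro ⟨a1, a2⟩ ⟨ha, ha'⟩ ⟨b1, b2⟩ ⟨hb, hb'⟩ hab
    rw [← hr (a1, a2) ha (b1, b2) hb hab]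
    have := ne _ ha; have := ne _ hb
    simp only [hcr, hadj, mem_singleton_iff, Prod.mk.injEq] at *
    omega
  have up : ∀ u : ℤ × ℤ, u ∈ P → u.2 = y + 1 → hadj (x, y) u → (u ∈ P \ {(x, y)} ∧ ¬ (r (x, y) ↔ r u)) := by
    rintro ⟨a, b⟩ hu h2 hadj'
    refine ⟨⟨hu, by simp only [mem_singleton_iff, Prod.mk.injEq] at h2 ⊢; omega⟩, ?_⟩
    rw [← hr (x, y) hc (a, b) hu hadj']
    clear hr cst ne
    simp only [hcr, hadj] at *
    rcases hadj' with hab | hab | hab | hab | hab | hab <;> grind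
  have dn : ∀ u : ℤ × ℤ, u ∈ P → u.2 = y - 1 → hadj (x, y) u → (u ∈ P \ {(x, y)} ∧ (r (x, y) ↔ r u)) := by
    rintro ⟨a, b⟩ hu h2 hadj'
    refine ⟨⟨hu, by simp only [mem_singleton_iff, Prod.mk.injEq] at h2 ⊢; omega⟩, ?_⟩
    rw [← hr (x, y) hc (a, b) hu hadj']
    clear hr cst ne
    simp only [hcr, hadj] at *
    rcases hadj' with hab | hab | hab | hab | hab | hab <;> omega
  obtain ⟨u, hu1, hu2⟩ : ∃ u, u ∈ P \ {(x, y)} ∧ ¬ (r (x, y) ↔ r u) := by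
    rcases hu with hu | hu
    · exact ⟨_, up _ hu rfl (by simp [hadj])⟩
    · exact ⟨_, up _ hu rfl (by simp [hadj])⟩
  obtain ⟨d, hd1, hd2⟩ : ∃ u, u ∈ P \ {(x, y)} ∧ (r (x, y) ↔ r u) := by
    rcases hd with hu | hu
    · exact ⟨_, dn _ hu rfl (by simp [hadj]; omega)⟩
    · exact ⟨_, dn _ hu rfl (by simp [hadj]; omega)⟩
  exact hu2 (hd2.trans (hconst_of r cst hPd hd1 hu1))

lemma hTwo_aux (x y a1 a2 b1 b2 : ℤ) (h1 : ¬ (a1 = x + 1 ∧ a2 = y) ∧ ¬ (a1 = x ∧ a2 = y + 1))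
    (h2 : ¬ (b1 = x + 1 ∧ b2 = y) ∧ ¬ (b1 = x ∧ b2 = y + 1)) (hab : hadj (a1, a2) (b1, b2)) :
    ((hcr (x + 1, y) (a1, a2) (b1, b2) ↔ hcr (x, y + 1) (a1, a2) (b1, b2)) ↔
      ((a2 = y + 1 ∧ x < a1) ↔ (b2 = y + 1 ∧ x < b1))) ↔
    ¬ (((a1, a2) = (x, y) ∧ (b1, b2) = (x + 1, y + 1)) ∨
      ((b1, b2) = (x, y) ∧ (a1, a2) = (x + 1, y + 1))) := by
  simp only [hcr, hadj, Prod.mk.injEq] at *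
  rcases hab with hab | hab | hab | hab | hab | hab <;> obtain ⟨rfl, rfl⟩ := hab <;> grind

lemma hTwo_zero : HTwo 0 := by
  rintro P ⟨x, y⟩ hPc hc hPd h0 h1 h2 hd
  obtain ⟨r0, hr0⟩ := hcr_exists P hPc h0 h2
  replace h0 : (x + 1, y + 0) ∉ P := h0
  replace h1 : (x + 1, y + 1) ∈ P := h1
  replace h2 : (x + 0, y + 1) ∉ P := h2
  replace hd : (x + -1, y + 0) ∈ P ∨ (x + -1, y + -1) ∈ P ∨ (x + 0, y + -1) ∈ P := hd
  replace hr0 : ∀ a ∈ P, ∀ b ∈ P, hadj a b →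
      ((hcr (x + 1, y + 0) a b ↔ hcr (x + 0, y + 1) a b) ↔ (r0 a ↔ r0 b)) := hr0
  simp only [add_zero] at *
  have ne : ∀ a ∈ P, ¬ (a.1 = x + 1 ∧ a.2 = y) ∧ ¬ (a.1 = x ∧ a.2 = y + 1) := by
    rintro ⟨a1, a2⟩ ha
    constructor
    · rintro ⟨rfl, rfl⟩; exact h0 ha
    · rintro ⟨rfl, rfl⟩; exact h2 ha
  obtain ⟨r, hr⟩ : ∃ r : ℤ × ℤ → Prop, ∀ a ∈ P, ∀ b ∈ P, hadj a b →
      ((r a ↔ r b) ↔ ¬ ((a = (x, y) ∧ b = (x + 1, y + 1)) ∨ (b = (x, y) ∧ a = (x + 1, y + 1)))) := by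
    refine ⟨fun a => (r0 a ↔ (a.2 = y + 1 ∧ x < a.1)), ?_⟩
    rintro ⟨a1, a2⟩ ha ⟨b1, b2⟩ hb hab
    have e := hr0 (a1, a2) ha (b1, b2) hb hab
    have := ne _ ha; have := ne _ hb
    have e2 : ((r0 (a1, a2) ↔ a2 = y + 1 ∧ x < a1) ↔ (r0 (b1, b2) ↔ b2 = y + 1 ∧ x < b1)) ↔
      ((r0 (a1, a2) ↔ r0 (b1, b2)) ↔ ((a2 = y + 1 ∧ x < a1) ↔ (b2 = y + 1 ∧ x < b1)))   := hprop2 _ _ _ _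
    rw [e2, ← e]
    exact hTwo_aux x y a1 a2 b1 b2 (ne _ ha) (ne _ hb) hab
  have cst : ∀ a ∈ P \ {(x, y)}, ∀ b ∈ P \ {(x, y)}, hadj a b → (r a ↔ r b) := by
    rintro a ⟨ha, ha'⟩ b ⟨hb, hb'⟩ hab
    rw [hr a ha b hb hab]
    simp only [mem_singleton_iff] at ha' hb'
    tauto
  obtain ⟨d, hd1, hd2⟩ : ∃ u, u ∈ P \ {(x, y)} ∧ (r (x, y) ↔ r u) := by
    rcases hd with hu | hu | hu
    · exact ⟨_, ⟨hu, by simp⟩, (hr _ hc _ hu (by simp [hadj]; omega)).2 (by simp)⟩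
    · exact ⟨_, ⟨hu, by simp⟩, (hr _ hc _ hu (by simp [hadj]; omega)).2 (by simp)⟩
    · exact ⟨_, ⟨hu, by simp⟩, (hr _ hc _ hu (by simp [hadj]; omega)).2 (by simp)⟩
  have hu1 : (x + 1, y + 1) ∈ P \ {(x, y)} := ⟨h1, by simp⟩
  exact (hr (x, y) hc _ h1 (by simp [hadj])).1 (hd2.trans (hconst_of r cst hPd hd1 hu1)) (by simp)

/-- rotation of the hexagonal lattice -/
def hrot (x : ℤ × ℤ) : ℤ × ℤ := (x.1 - x.2, x.1)
def hrotInv (x : ℤ × ℤ) : ℤ × ℤ := (x.2, x.2 - x.1)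
def hrotP (P : Set (ℤ × ℤ)) : Set (ℤ × ℤ) := {x | hrot x ∈ P}

lemma hrot_hrotInv (x : ℤ × ℤ) : hrot (hrotInv x) = x := by
  ext <;> simp [hrot, hrotInv]
lemma hrotInv_hrot (x : ℤ × ℤ) : hrotInv (hrot x) = x := by
  ext <;> simp [hrot, hrotInv]
lemma hrot_inj {x y : ℤ × ℤ} (h : hrot x = hrot y) : x = y := by
  rw [← hrotInv_hrot x, h, hrotInv_hrot]
lemma hrot_add_hdir (c : ℤ × ℤ) (k : Fin 6) : hrot (c + hdir k) = hrot c + hdir (k + 1) := by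
  fin_cases k <;> ext <;> simp [hrot, hdir] <;> ring
lemma hrotInv_hadj {a b : ℤ × ℤ} (h : hadj a b) : hadj (hrotInv a) (hrotInv b) := by
  simp only [hadj, hrotInv] at *; omega
lemma hrotInv_hreach {P : Set (ℤ × ℤ)} {a b : ℤ × ℤ} (h : Relation.ReflTransGen (hstep P) a b) :
    Relation.ReflTransGen (hstep (hrotP P)) (hrotInv a) (hrotInv b) :=
  Relation.ReflTransGen.lift (r := hstep P) (p := hstep (hrotP P)) hrotInv (fun x y hxy => ⟨hrotInv_hadj hxy.1, by
    simp only [hrotP, mem_ofPred_eq, hrot_hrotInv]; exact hxy.2.1, by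
    simp only [hrotP, mem_ofPred_eq, hrot_hrotInv]; exact hxy.2.2⟩) _ _ h
lemma hrotP_HConn {P : Set (ℤ × ℤ)} (h : HConn P) : HConn (hrotP P) := by
  intro a ha b hb
  have := hrotInv_hreach (h _ ha _ hb)
  rwa [hrotInv_hrot, hrotInv_hrot] at this
lemma hrotP_diff (P : Set (ℤ × ℤ)) (c : ℤ × ℤ) : hrotP P \ {hrotInv c} = hrotP (P \ {c}) := by
  ext x
  simp only [hrotP, Set.mem_sdiff, mem_ofPred_eq, mem_singleton_iff]
  refine and_congr_right fun _ => not_congr ⟨?_, ?_⟩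
  · rintro rfl; exact hrot_hrotInv c
  · rintro rfl; exact (hrotInv_hrot x).symm
lemma hrotP_mem (P : Set (ℤ × ℤ)) (c : ℤ × ℤ) (k : Fin 6) :
    hrotInv c + hdir k ∈ hrotP P ↔ c + hdir (k + 1) ∈ P := by
  simp only [hrotP, mem_ofPred_eq, hrot_add_hdir, hrot_hrotInv]

lemma hOpp_succ {k : Fin 6} (h : HOpp k) : HOpp (k + 1) := by
  intro P c h1 h2 h3 h4 h5 h6 h7
  have e := h (hrotP P) (hrotInv c) (hrotP_HConn h1)
    (by simp only [hrotP, mem_ofPred_eq, hrot_hrotInv]; exact h2)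
    (by rw [hrotP_diff]; exact hrotP_HConn h3)
  simp only [hrotP_mem] at e
  have r : ∀ j : Fin 6, k + 1 + j = k + j + 1 := fun j => add_right_comm _ _ _
  simp only [r] at *
  exact e h4 h5 h6 h7

lemma hTwo_succ {k : Fin 6} (h : HTwo k) : HTwo (k + 1) := by
  intro P c h1 h2 h3 h4 h5 h6 h7
  have e := h (hrotP P) (hrotInv c) (hrotP_HConn h1)
    (by simp only [hrotP, mem_ofPred_eq, hrot_hrotInv]; exact h2)
    (by rw [hrotP_diff]; exact hrotP_HConn h3)
  simp only [hrotP_mem] at e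
  have r : ∀ j : Fin 6, k + 1 + j = k + j + 1 := fun j => add_right_comm _ _ _
  simp only [r] at *
  exact e h4 h5 h6 h7

lemma fin6_ind {p : Fin 6 → Prop} (h0 : p 0) (hs : ∀ k, p k → p (k + 1)) (k : Fin 6) : p k := by
  have h1 : p 1 := hs 0 h0
  have h2 : p 2 := hs 1 h1
  have h3 : p 3 := hs 2 h2
  have h4 : p 4 := hs 3 h3
  have h5 : p 5 := hs 4 h4
  fin_cases k <;> assumption

set_option synthInstance.maxHeartbeats 400000 in
set_option synthInstance.maxSize 4000 in
lemma harc_bool : ∀ b0 b1 b2 b3 b4 b5 : Bool, (b0 || b1 || b2 || b3 || b4 || b5) →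
    !(b0 && b1 && b2 && b3 && b4 && b5) →
    (∀ k : Fin 6, !(!(![b0, b1, b2, b3, b4, b5] k) && !(![b0, b1, b2, b3, b4, b5] (k + 3)) &&
      (![b0, b1, b2, b3, b4, b5] (k + 1) || ![b0, b1, b2, b3, b4, b5] (k + 2)) &&
      (![b0, b1, b2, b3, b4, b5] (k + 4) || ![b0, b1, b2, b3, b4, b5] (k + 5)))) →
    (∀ k : Fin 6, !(!(![b0, b1, b2, b3, b4, b5] k) && ![b0, b1, b2, b3, b4, b5] (k + 1) &&
      !(![b0, b1, b2, b3, b4, b5] (k + 2)) && (![b0, b1, b2, b3, b4, b5] (k + 3) ||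
      ![b0, b1, b2, b3, b4, b5] (k + 4) || ![b0, b1, b2, b3, b4, b5] (k + 5)))) →
    ∃ k m : Fin 6, m ≠ 0 ∧ ∀ j : Fin 6, (![b0, b1, b2, b3, b4, b5] (k + j) = true ↔ j < m) := by
  decide +kernel

lemma harc {P : Set (ℤ × ℤ)} {c : ℤ × ℤ} (h1 : HConn Pᶜ) (h2 : c ∈ P) (h3 : HConn (P \ {c}))
    (hi : ∃ j, c + hdir j ∈ P) (ho : ∃ j, c + hdir j ∉ P) :
    ∃ k m : Fin 6, m ≠ 0 ∧ ∀ j : Fin 6, (c + hdir (k + j) ∈ P ↔ j < m) := by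
  classical
  have hO := fin6_ind hOpp_zero (fun k => hOpp_succ)
  have hT := fin6_ind hTwo_zero (fun k => hTwo_succ)
  let b : Fin 6 → Bool := fun j => decide (c + hdir j ∈ P)
  have hb : ![b 0, b 1, b 2, b 3, b 4, b 5] = b := by
    ext j; fin_cases j <;> rfl
  have key := harc_bool (b 0) (b 1) (b 2) (b 3) (b 4) (b 5)
  rw [hb] at key
  have g1 : (b 0 || b 1 || b 2 || b 3 || b 4 || b 5) = true := by
    obtain ⟨j, hj⟩ := hi
    fin_cases j <;> simp at hj <;> simp [b, hj]
  have g2 : (!(b 0 && b 1 && b 2 && b 3 && b 4 && b 5)) = true := by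
    obtain ⟨j, hj⟩ := ho
    fin_cases j <;> simp at hj <;> simp [b, hj]
  obtain ⟨k, m, hm, hj⟩ := key g1 g2 (by
      intro k
      have := hO k P c h1 h2 h3
      simp [b]
      tauto) (by
      intro k
      have := hT k P c h1 h2 h3
      simp [b]
      tauto)
  exact ⟨k, m, hm, fun j => by rw [← hj j]; simp [b]⟩

lemma hadj_iff {a b : ℤ × ℤ} : hadj a b ↔ ∃ j, b = a + hdir j := by
  constructor
  · rintro (h | h | h | h | h | h)
    · exact ⟨0, Prod.ext (by simp [hdir, h]) (by simp [hdir, h])⟩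
    · exact ⟨1, Prod.ext (by simp [hdir, h]) (by simp [hdir, h])⟩
    · exact ⟨2, Prod.ext (by simp [hdir, h]) (by simp [hdir, h])⟩
    · exact ⟨3, Prod.ext (by simp [hdir, h]; ring) (by simp [hdir, h])⟩
    · exact ⟨4, Prod.ext (by simp [hdir, h]; ring) (by simp [hdir, h]; ring)⟩
    · exact ⟨5, Prod.ext (by simp [hdir, h]) (by simp [hdir, h]; ring)⟩
  · rintro ⟨j, rfl⟩
    fin_cases j <;> simp [hadj, hdir] <;> omega

lemma hbdry {C : Set (ℤ × ℤ)} (hC : C.Finite) (hne : C.Nonempty) (w : ℤ × ℤ) :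
    ∃ t ∈ C, ∃ j, t + hdir j ∉ C ∧ t + hdir j ≠ w := by
  obtain ⟨t, ht, hmax⟩ := hC.exists_maximalFor (fun x => x.2) C hne
  refine ⟨t, ht, ?_⟩
  have h1 : ∀ x : ℤ × ℤ, x.2 = t.2 + 1 → x ∉ C := by
    intro x hx hxC
    have := hmax hxC (by simp [hx])
    simp only at this
    omega
  by_cases hw : t + hdir 1 = w
  · refine ⟨2, h1 _ (by simp [hdir]), ?_⟩
    rw [← hw]
    simp [hdir]
  · exact ⟨1, h1 _ (by simp [hdir]), hw⟩

/-- (C1) -/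
lemma hexists_removable {P : Set (ℤ × ℤ)} (hP : P.Finite) (hc : HConn P) (h2 : P.Nontrivial) :
    ∃ c ∈ P, (∃ j, c + hdir j ∉ P) ∧ HConn (P \ {c}) := by
  classical
  obtain ⟨z, hz, z', hz', hzz⟩ := h2
  let Z : ℤ × ℤ → Set (ℤ × ℤ) := fun c => {x | Relation.ReflTransGen (hstep (P \ {c})) z x}
  let B : Set (ℤ × ℤ) := {c | c ∈ P ∧ c ≠ z ∧ ∃ j, c + hdir j ∉ P}
  have hBf : B.Finite := hP.subset fun c hc => hc.1
  have hBne : B.Nonempty := by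
    obtain ⟨t, ht, j, hj1, hj2⟩ := hbdry (C := P \ {z}) (hP.subset sdiff_subset)
      ⟨z', hz', fun h => hzz (by simpa using h.symm)⟩ z
    exact ⟨t, ht.1, ht.2, j, fun h => hj1 ⟨h, hj2⟩⟩
  obtain ⟨c, hcB, hmax⟩ := hBf.exists_maximalFor (fun c => (Z c).ncard) B hBne
  refine ⟨c, hcB.1, hcB.2.2, ?_⟩
  have hZsub : ∀ d, d ≠ z → Z d ⊆ P \ {d} := fun d hd x hx =>
    hreach_mem ⟨hz, fun h => hd (by simpa using h.symm)⟩ hx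
  suffices hall : ∀ x ∈ P \ {c}, x ∈ Z c from
    fun a ha b hb => (hreach_symm (hall a ha)).trans (hall b hb)
  by_contra hcon
  push Not at hcon
  obtain ⟨x, hx, hxZ⟩ := hcon
  let C : Set (ℤ × ℤ) := {y | Relation.ReflTransGen (hstep (P \ {c})) x y}
  have hCsub : C ⊆ P \ {c} := fun y hy => hreach_mem hx hy
  have hCZ : ∀ y ∈ C, y ∉ Z c := fun y hy hy' => hxZ (hy'.trans (hreach_symm hy))
  obtain ⟨t, ht, j, hj1, hj2⟩ := hbdry (C := C) (hP.subset (hCsub.trans sdiff_subset))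
    ⟨x, Relation.ReflTransGen.refl⟩ c
  have htP := hCsub ht
  have htz : t ≠ z := by rintro rfl; exact hCZ _ ht Relation.ReflTransGen.refl
  have htB : t ∈ B := ⟨htP.1, htz, j, fun h => hj1 (ht.tail
    ⟨hadj_iff.2 ⟨j, rfl⟩, htP, h, hj2⟩)⟩
  have hsub : Z c ⊆ Z t := by
    intro y hy
    change Relation.ReflTransGen (hstep (P \ {c})) z y at hy
    change Relation.ReflTransGen (hstep (P \ {t})) z y
    induction hy with
    | refl => exact .refl
    | tail h1 h2 ih =>
      have n1 : ∀ w, w ∈ Z c → w ≠ t := by rintro w hw rfl; exact hCZ _ ht hw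
      exact ih.tail ⟨h2.1, ⟨h2.2.1.1, n1 _ h1⟩, ⟨h2.2.2.1, n1 _ (h1.tail h2)⟩⟩
  have hct : c ≠ t := fun h => htP.2 h.symm
  have hcZt : c ∈ Z t := by
    by_contra hcn
    have : ∀ y, Relation.ReflTransGen (hstep P) z y → y ∈ Z c := by
      intro y hy
      induction hy with
      | refl => exact .refl
      | @tail u v h1 h2 ih =>
        by_cases hv : v = c
        · subst hv
          refine absurd ?_ hcn
          have hut : u ≠ t := by rintro rfl; exact hCZ _ ht ih
          exact Relation.ReflTransGen.tail (hsub ih) ⟨h2.1, ⟨h2.2.1, hut⟩, ⟨h2.2.2, hct⟩⟩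
        · have hu := hZsub c hcB.2.1 ih
          exact Relation.ReflTransGen.tail ih ⟨h2.1, hu, h2.2.2, hv⟩
    exact hxZ (this x (hc z hz x hx.1))
  have hlt : (Z c).ncard < (Z t).ncard := by
    refine ncard_lt_ncard ⟨hsub, fun h => ?_⟩ (hP.subset ((hZsub t htz).trans sdiff_subset))
    exact (hZsub c hcB.2.1 (h hcZt)).2 rfl
  have := hmax htB hlt.le
  simp only at this
  omega

/-- radial rescaling -/
lemma radial_homeo (γ : ℂ → ℝ) (hγ : Continuous γ) (hh : ∀ (t : ℝ) (w : ℂ), 0 ≤ t → γ (t • w) = t * γ w)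
    (hp : ∀ w, w ≠ 0 → 0 < γ w) :
    ∃ R : ℂ ≃ₜ ℂ, ∀ w, ‖R w‖ = γ w ∧ ∃ t : ℝ, 0 < t ∧ R w = t • w := by
  have h0 : γ 0 = 0 := by simpa using hh 0 0 le_rfl
  obtain ⟨c, hc, hcb⟩ : ∃ c : ℝ, 0 < c ∧ ∀ w, c * ‖w‖ ≤ γ w := by
    obtain ⟨w0, hw0, hmin⟩ := (isCompact_sphere (0 : ℂ) 1).exists_isMinOn ⟨1, by simp⟩ hγ.continuousOn
    refine ⟨γ w0, hp _ (by rintro rfl; simp at hw0), fun w => ?_⟩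
    by_cases hw : w = 0
    · simp [hw, h0]
    have hn : 0 < ‖w‖ := norm_pos_iff.2 hw
    have h1 := hmin (show (‖w‖⁻¹ : ℝ) • w ∈ sphere (0 : ℂ) 1 by simp [norm_smul, hn.ne'])
    simp only [mem_ofPred_eq] at h1
    rw [hh _ _ (by positivity), inv_mul_eq_div, le_div_iff₀ hn] at h1
    exact h1
  let A : ℂ → ℂ := fun w => (γ w / ‖w‖) • w
  let B : ℂ → ℂ := fun w => (‖w‖ / γ w) • w
  have nA : ∀ w, ‖A w‖ = γ w := by
    intro w
    by_cases hw : w = 0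
    · simp [A, hw, h0]
    · have hn : 0 < ‖w‖ := norm_pos_iff.2 hw
      simp only [A, norm_smul, Real.norm_eq_abs]
      rw [abs_of_pos (div_pos (hp w hw) hn)]; field_simp
  have cA : Continuous A := by
    rw [continuous_iff_continuousAt]
    intro w
    by_cases hw : w = 0
    · subst hw
      have : Tendsto (fun w => ‖A w‖) (𝓝 0) (𝓝 0) := by
        simp only [nA]; simpa [h0] using hγ.tendsto 0
      have := tendsto_zero_iff_norm_tendsto_zero.2 this
      simpa [ContinuousAt, A] using this
    · exact ((hγ.continuousAt.div continuous_norm.continuousAt (norm_ne_zero_iff.2 hw))).smul continuousAt_id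
  have cB : Continuous B := by
    rw [continuous_iff_continuousAt]
    intro w
    by_cases hw : w = 0
    · subst hw
      have hb : ∀ w, ‖B w‖ ≤ c⁻¹ * ‖w‖ := by
        intro w
        by_cases hw : w = 0
        · simp [B, hw]
        · have hn : 0 < ‖w‖ := norm_pos_iff.2 hw
          simp only [B, norm_smul, Real.norm_eq_abs]
          rw [abs_of_pos (div_pos hn (hp w hw))]
          refine mul_le_mul_of_nonneg_right ?_ hn.le
          rw [div_le_iff₀ (hp w hw), inv_mul_eq_div, le_div_iff₀ hc, mul_comm]
          exact hcb w
      have : Tendsto B (𝓝 0) (𝓝 0) := by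
        refine squeeze_zero_norm hb ?_
        have : Tendsto (fun w : ℂ => c⁻¹ * ‖w‖) (𝓝 0) (𝓝 (c⁻¹ * ‖(0 : ℂ)‖)) :=
          (continuous_const.mul continuous_norm).tendsto 0
        simpa using this
      simpa [ContinuousAt, B] using this
    · exact ((continuous_norm.continuousAt.div hγ.continuousAt (hp w hw).ne')).smul continuousAt_id
  refine ⟨⟨⟨A, B, ?_, ?_⟩, cA, cB⟩, fun w => ⟨nA w, ?_⟩⟩
  · intro w
    by_cases hw : w = 0
    · simp [A, B, hw]
    · have hn : 0 < ‖w‖ := norm_pos_iff.2 hw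
      have hg := hp w hw
      have e : γ (A w) = γ w / ‖w‖ * γ w := hh _ _ (by positivity)
      simp only [B]
      rw [nA, e]
      simp only [A, smul_smul]
      have : γ w / (γ w / ‖w‖ * γ w) * (γ w / ‖w‖) = 1 := by field_simp
      rw [this, one_smul]
  · intro w
    by_cases hw : w = 0
    · simp [A, B, hw]
    · have hn : 0 < ‖w‖ := norm_pos_iff.2 hw
      have hg := hp w hw
      have e : γ (B w) = ‖w‖ / γ w * γ w := hh _ _ (by positivity)
      have e2 : ‖B w‖ = ‖w‖ / γ w * ‖w‖ := by
        simp only [B, norm_smul, Real.norm_eq_abs]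
        rw [abs_of_pos (div_pos hn hg)]
      simp only [A]
      rw [e2, e]
      simp only [B, smul_smul]
      have : ‖w‖ / γ w * γ w / (‖w‖ / γ w * ‖w‖) * (‖w‖ / γ w) = 1 := by field_simp
      rw [this, one_smul]
  · by_cases hw : w = 0
    · exact ⟨1, one_pos, by simp [A, hw]⟩
    · exact ⟨γ w / ‖w‖, div_pos (hp w hw) (norm_pos_iff.2 hw), rfl⟩

noncomputable def lensS (x : ℝ) : ℝ := √(max 0 (1 - x ^ 2))
noncomputable def lensK (s y : ℝ) : ℝ := min 0 (max (-4 / 5 * y - 6 / 5 * s) (4 * y - 6 * s))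

lemma lensK_inv (s y : ℝ) (hs : 0 ≤ s) : lensK s (-(y + lensK s y)) = lensK s y := by
  unfold lensK
  rcases le_total (-4 / 5 * y - 6 / 5 * s) (4 * y - 6 * s) with h1 | h1
  · rw [max_eq_right h1]
    rcases le_total 0 (4 * y - 6 * s) with h2 | h2
    · rw [min_eq_left h2]
      rw [min_eq_left]
      exact le_max_of_le_left (by linarith)
    · rw [min_eq_right h2, max_eq_left (by linarith), min_eq_right (by linarith)]; ring
  · rw [max_eq_left h1]
    rcases le_total 0 (-4 / 5 * y - 6 / 5 * s) with h2 | h2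
    · rw [min_eq_left h2]
      rw [min_eq_left]
      exact le_max_of_le_right (by linarith)
    · rw [min_eq_right h2, max_eq_right (by linarith), min_eq_right (by linarith)]; ring

noncomputable def lensHomeo : ℂ ≃ₜ ℂ where
  toFun w := ⟨w.re, w.im + lensK (lensS w.re) w.im⟩
  invFun w := ⟨w.re, w.im - lensK (lensS w.re) (-w.im)⟩
  left_inv w := by
    apply Complex.ext
    · rfl
    · simp only [lensK_inv _ _ (Real.sqrt_nonneg _), lensS]; ring
  right_inv w := by
    apply Complex.ext
    · rfl
    · have := lensK_inv (lensS w.re) (-w.im) (Real.sqrt_nonneg _)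
      simp only
      rw [show -(-w.im + lensK (lensS w.re) (-w.im)) = w.im - lensK (lensS w.re) (-w.im) by ring] at this
      rw [this]; ring
  continuous_toFun := by
    have : (fun w : ℂ => (⟨w.re, w.im + lensK (lensS w.re) w.im⟩ : ℂ)) =
      fun w : ℂ => (w.re : ℂ) + ((w.im + lensK (lensS w.re) w.im : ℝ) : ℂ) * Complex.I := by
      ext w; apply Complex.ext <;> simp
    rw [this]; unfold lensK lensS; fun_prop
  continuous_invFun := by
    have : (fun w : ℂ => (⟨w.re, w.im - lensK (lensS w.re) (-w.im)⟩ : ℂ)) =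
      fun w : ℂ => (w.re : ℂ) + ((w.im - lensK (lensS w.re) (-w.im) : ℝ) : ℂ) * Complex.I := by
      ext w; apply Complex.ext <;> simp
    rw [this]; unfold lensK lensS; fun_prop

lemma cnorm_sq (w : ℂ) : ‖w‖ ^ 2 = w.re ^ 2 + w.im ^ 2 := by
  rw [Complex.sq_norm, Complex.normSq_apply]; ring

lemma lens_maps (Y : Set ℂ) (h1 : ∀ w, ‖w‖ < 1 → w ∉ Y)
    (h2 : ∀ w : ℂ, 0 ≤ w.im → 1 ≤ ‖w‖ → ‖w‖ ≤ 3 / 2 → w ∈ Y)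
    (h3 : ∀ w : ℂ, w.im < 0 → 1 ≤ ‖w‖ → ‖w‖ < 2 → w ∉ Y) (w : ℂ) :
    w ∈ Y ↔ (lensHomeo w ∈ Y ∨ ‖lensHomeo w‖ ≤ 1) := by
  set s := lensS w.re with hs
  have hs0 : 0 ≤ s := Real.sqrt_nonneg _
  have le1 : ∀ {w : ℂ}, ‖w‖ ≤ 1 ↔ w.re ^ 2 + w.im ^ 2 ≤ 1 := by
    intro w; rw [← cnorm_sq, sq_le_one_iff₀ (norm_nonneg _)]
  by_cases hk : |w.im| < 3 / 2 * s
  · rw [abs_lt] at hk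
    have hs1 : 0 < s := by linarith
    have hs2 : s ^ 2 = 1 - w.re ^ 2 := by
      have : 0 < max 0 (1 - w.re ^ 2) := Real.sqrt_pos.1 hs1
      rw [hs, lensS, Real.sq_sqrt this.le]
      rcases lt_max_iff.1 this with h | h
      · exact absurd h (lt_irrefl _)
      · exact max_eq_right h.le
    have box : ∀ v : ℂ, v.re = w.re → -(3 / 2 * s) < v.im → v.im < 3 / 2 * s →
        (v ∈ Y ↔ s ≤ v.im) ∧ (‖v‖ ≤ 1 ↔ -s ≤ v.im ∧ v.im ≤ s) := by
      intro v hv hv1 hv2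
      have e1 : ‖v‖ ≤ 1 ↔ -s ≤ v.im ∧ v.im ≤ s := by
        rw [le1, hv, ← abs_le, ← sq_le_sq₀ (abs_nonneg _) hs0, sq_abs]
        constructor <;> intro h <;> linarith
      have e2 : ‖v‖ ≤ 3 / 2 := by
        have : ‖v‖ ^ 2 ≤ (3 / 2) ^ 2 := by
          rw [cnorm_sq, hv]; nlinarith [sq_nonneg w.re]
        exact abs_le_of_sq_le_sq' this (by norm_num) |>.2
      refine ⟨⟨fun h => ?_, fun h => ?_⟩, e1⟩
      · by_contra hlt
        push Not at hlt
        by_cases hh : -s ≤ v.im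
        · rcases lt_or_eq_of_le (e1.2 ⟨hh, hlt.le⟩) with h' | h'
          · exact h1 v h' h
          · rcases lt_or_ge v.im 0 with h4 | h4
            · exact h3 v h4 h'.ge (by linarith) h
            · have : ‖v‖ ^ 2 = 1 := by rw [h']; norm_num
              rw [cnorm_sq, hv] at this
              nlinarith
        · push Not at hh
          have : 1 ≤ ‖v‖ := by
            by_contra h5
            push Not at h5
            have := (e1.1 h5.le).1
            linarith
          exact h3 v (by linarith) this (by linarith) h
      · have : 1 ≤ ‖v‖ := by
          have : (1 : ℝ) ^ 2 ≤ ‖v‖ ^ 2 := by rw [cnorm_sq, hv]; nlinarith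
          exact abs_le_of_sq_le_sq' this (norm_nonneg _) |>.2
        exact h2 v (by linarith) this e2
    have hL : (lensHomeo w).re = w.re ∧ (lensHomeo w).im = w.im + lensK s w.im := ⟨rfl, rfl⟩
    have hkk : lensK s w.im = max (-4 / 5 * w.im - 6 / 5 * s) (4 * w.im - 6 * s) :=
      min_eq_right (max_le (by linarith) (by linarith))
    have b1 := (box w rfl hk.1 hk.2).1
    have hm1 := le_max_left (-4 / 5 * w.im - 6 / 5 * s) (4 * w.im - 6 * s)
    have hm2 := le_max_right (-4 / 5 * w.im - 6 / 5 * s) (4 * w.im - 6 * s)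
    have hm3 : max (-4 / 5 * w.im - 6 / 5 * s) (4 * w.im - 6 * s) < 0 :=
      max_lt (by linarith) (by linarith)
    have b2 := box (lensHomeo w) rfl (by rw [hL.2, hkk]; linarith)
      (by rw [hL.2, hkk]; linarith)
    rw [b1, b2.1, b2.2, hL.2, hkk]
    constructor
    · intro h
      rcases le_total s (w.im + max (-4 / 5 * w.im - 6 / 5 * s) (4 * w.im - 6 * s)) with h' | h'
      · exact Or.inl h'
      · exact Or.inr ⟨by linarith, h'⟩
    · intro h
      have : -s ≤ w.im + max (-4 / 5 * w.im - 6 / 5 * s) (4 * w.im - 6 * s) := by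
        rcases h with h | h
        · linarith
        · exact h.1
      by_contra hlt
      push Not at hlt
      have : max (-4 / 5 * w.im - 6 / 5 * s) (4 * w.im - 6 * s) < -s - w.im :=
        max_lt (by linarith) (by linarith)
      linarith
  · have hk0 : lensK s w.im = 0 := by
      push Not at hk
      refine min_eq_left ?_
      rcases le_abs.1 hk with h | h
      · exact le_max_of_le_right (by linarith)
      · exact le_max_of_le_left (by linarith)
    have hL : lensHomeo w = w := by
      apply Complex.ext
      · rfl
      · change w.im + lensK s w.im = w.im
        rw [hk0, add_zero]
    rw [hL]
    refine ⟨Or.inl, fun h => h.elim id fun h => ?_⟩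
    have h' := le1.1 h
    push Not at hk
    have hs2 : s ^ 2 = 1 - w.re ^ 2 := by
      rw [hs, lensS, max_eq_right (by nlinarith [sq_nonneg w.im]), Real.sq_sqrt (by nlinarith [sq_nonneg w.im])]
    have h4 : (3 / 2 * s) ^ 2 ≤ w.im ^ 2 := by rw [← sq_abs w.im]; gcongr
    have h5 : s = 0 := by nlinarith
    have h6 : w.im = 0 := by
      have : w.im ^ 2 ≤ 0 := by nlinarith
      nlinarith [pow_eq_zero_iff (two_ne_zero) |>.1 (le_antisymm this (sq_nonneg _))]
    have h7 : ‖w‖ ^ 2 = 1 := by rw [cnorm_sq, h6]; nlinarith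
    have h8 : ‖w‖ = 1 := (pow_eq_one_iff_of_nonneg (norm_nonneg w) two_ne_zero).1 h7
    exact h2 w h6.ge h8.ge (by linarith)

lemma hexG_smul (t : ℝ) (z : ℂ) (ht : 0 ≤ t) : hexG (t • z) = t * hexG z := by
  have h0 : hL0 (t • z) = t * hL0 z := by simp [hL0]; ring
  have h1 : hL1 (t • z) = t * hL1 z := by simp [hL1]; ring
  have h2 : hL2 (t • z) = t * hL2 z := by simp [hL2]; ring
  simp only [hexG, h0, h1, h2, abs_mul, abs_of_nonneg ht]
  rw [mul_max_of_nonneg _ _ ht, mul_max_of_nonneg _ _ ht]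

lemma hexG_pos (z : ℂ) (hz : z ≠ 0) : 0 < hexG z := by
  by_contra h
  push Not at h
  have := (hexG_le_iff z 0).1 h
  simp only [hL0, hL1] at this
  exact hz (Complex.ext (by simp; linarith) (by simp; linarith))

def ConeMap (g : ℂ → ℝ) : Prop := ∃ Ψ : ℂ ≃ₜ ℂ, (∀ z, (Ψ z).im = g z) ∧
  ∀ (t : ℝ) (z : ℂ), 0 ≤ t → Ψ (t • z) = t • Ψ z

lemma continuous_cmk {X : Type*} [TopologicalSpace X] {a b : X → ℝ} (ha : Continuous a)
    (hb : Continuous b) : Continuous (fun x => (⟨a x, b x⟩ : ℂ)) := by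
  have : (fun x => (⟨a x, b x⟩ : ℂ)) = fun x => (a x : ℂ) + (b x : ℂ) * Complex.I := by
    ext x; apply Complex.ext <;> simp
  rw [this]; fun_prop

/-- from a linear pair -/
lemma cone_min (a b c d : ℝ) (h : a * d - b * c ≠ 0) :
    ConeMap (fun z => min (a * z.re + b * z.im) (c * z.re + d * z.im)) := by
  let D := a * d - b * c
  refine ⟨⟨⟨fun z => ⟨(a * z.re + b * z.im) - (c * z.re + d * z.im),
      min (a * z.re + b * z.im) (c * z.re + d * z.im)⟩,
    fun w => ⟨(d * (w.im + max w.re 0) - b * (w.im + max (-w.re) 0)) / D,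
      (-c * (w.im + max w.re 0) + a * (w.im + max (-w.re) 0)) / D⟩, ?_, ?_⟩, ?_, ?_⟩, fun z => rfl, ?_⟩
  · intro z
    have e1 : min (a * z.re + b * z.im) (c * z.re + d * z.im) +
      max ((a * z.re + b * z.im) - (c * z.re + d * z.im)) 0 = a * z.re + b * z.im := by
      rcases le_total (a * z.re + b * z.im) (c * z.re + d * z.im) with h | h
      · rw [min_eq_left h, max_eq_right (by linarith)]; ring
      · rw [min_eq_right h, max_eq_left (by linarith)]; ring
    have e2 : min (a * z.re + b * z.im) (c * z.re + d * z.im) +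
      max (-((a * z.re + b * z.im) - (c * z.re + d * z.im))) 0 = c * z.re + d * z.im := by
      rcases le_total (a * z.re + b * z.im) (c * z.re + d * z.im) with h | h
      · rw [min_eq_left h, max_eq_left (by linarith)]; ring
      · rw [min_eq_right h, max_eq_right (by linarith)]; ring
    simp only [e1, e2]
    apply Complex.ext
    · change _ / (a * d - b * c) = _
      rw [div_eq_iff h]; ring
    · change _ / (a * d - b * c) = _
      rw [div_eq_iff h]; ring
  · intro w
    have e1 : ∀ p q : ℝ, a * ((d * p - b * q) / D) + b * ((-c * p + a * q) / D) = p := by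
      intro p q; rw [mul_div_assoc', mul_div_assoc', ← add_div, div_eq_iff (show D ≠ 0 from h)]
      simp only [D]; ring
    have e2 : ∀ p q : ℝ, c * ((d * p - b * q) / D) + d * ((-c * p + a * q) / D) = q := by
      intro p q; rw [mul_div_assoc', mul_div_assoc', ← add_div, div_eq_iff (show D ≠ 0 from h)]
      simp only [D]; ring
    simp only [e1, e2]
    apply Complex.ext
    · simp only
      rcases le_total w.re 0 with h | h
      · rw [max_eq_right h, max_eq_left (by linarith)]; ring
      · rw [max_eq_left h, max_eq_right (by linarith)]; ring
    · simp only
      rcases le_total w.re 0 with h | h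
      · rw [max_eq_right h, max_eq_left (by linarith), min_eq_left (by linarith)]; ring
      · rw [max_eq_left h, max_eq_right (by linarith), min_eq_right (by linarith)]; ring
  · exact continuous_cmk (by fun_prop) (by fun_prop)
  · exact continuous_cmk (by fun_prop) (by fun_prop)
  · intro t z ht
    apply Complex.ext
    · simp; ring
    · simp only [Complex.real_smul, Homeomorph.homeomorph_mk_coe, Equiv.coe_fn_mk, Complex.mul_re, Complex.ofReal_re,
        Complex.ofReal_im, Complex.mul_im, zero_mul, sub_zero, add_zero]
      rw [mul_min_of_nonneg _ _ ht]
      congr 1 <;> ring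

lemma cone_neg {g : ℂ → ℝ} (h : ConeMap g) : ConeMap (fun z => - g z) := by
  obtain ⟨Ψ, h1, h2⟩ := h
  exact ⟨Ψ.trans (Homeomorph.neg ℂ), fun z => by simp [h1], fun t z ht => by
    change -(Ψ (t • z)) = t • (-(Ψ z))
    rw [h2 t z ht, smul_neg]⟩

lemma cone_lin : ConeMap (fun z => hL1 z) := by
  refine ⟨⟨⟨fun z => ⟨z.re, hL1 z⟩, fun w => ⟨w.re, 2 / 3 * (w.im - w.re)⟩, ?_, ?_⟩, ?_, ?_⟩,
    fun z => rfl, ?_⟩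
  · intro z; apply Complex.ext <;> simp [hL1]
    ring
  · intro z; apply Complex.ext <;> simp [hL1]
    ring
  · exact continuous_cmk (by fun_prop) (by unfold hL1; fun_prop)
  · exact continuous_cmk (by fun_prop) (by fun_prop)
  · intro t z ht
    apply Complex.ext <;> simp [hL1]
    ring

def hexU (P : Set (ℤ × ℤ)) : Set ℂ := ⋃ o ∈ P, hexCell o

lemma mem_hexU {P : Set (ℤ × ℤ)} {z : ℂ} : z ∈ hexU P ↔ ∃ o ∈ P, z ∈ hexCell o := by
  simp [hexU]

/-- relative membership -/
lemma mem_hexCell_add (c o : ℤ × ℤ) (z : ℂ) : z ∈ hexCell (c + o) ↔ z - hctr c ∈ hexCell o := by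
  have : z - hctr (c + o) = z - hctr c - hctr o := by
    apply Complex.ext <;> simp [hctr] <;> ring
  simp only [hexCell, mem_ofPred_eq, this]

lemma hcell_dir (z : ℂ) : (z ∈ hexCell (hdir 0) ↔ (1 ≤ hL0 z ∧ hL0 z ≤ 3) ∧ (0 ≤ hL1 z ∧ hL1 z ≤ 2) ∧ (-2 ≤ hL2 z ∧ hL2 z ≤ 0)) ∧
    (z ∈ hexCell (hdir 1) ↔ (0 ≤ hL0 z ∧ hL0 z ≤ 2) ∧ (1 ≤ hL1 z ∧ hL1 z ≤ 3) ∧ (0 ≤ hL2 z ∧ hL2 z ≤ 2)) ∧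
    (z ∈ hexCell (hdir 2) ↔ (-2 ≤ hL0 z ∧ hL0 z ≤ 0) ∧ (0 ≤ hL1 z ∧ hL1 z ≤ 2) ∧ (1 ≤ hL2 z ∧ hL2 z ≤ 3)) ∧
    (z ∈ hexCell (hdir 3) ↔ (-3 ≤ hL0 z ∧ hL0 z ≤ -1) ∧ (-2 ≤ hL1 z ∧ hL1 z ≤ 0) ∧ (0 ≤ hL2 z ∧ hL2 z ≤ 2)) ∧
    (z ∈ hexCell (hdir 4) ↔ (-2 ≤ hL0 z ∧ hL0 z ≤ 0) ∧ (-3 ≤ hL1 z ∧ hL1 z ≤ -1) ∧ (-2 ≤ hL2 z ∧ hL2 z ≤ 0)) ∧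
    (z ∈ hexCell (hdir 5) ↔ (0 ≤ hL0 z ∧ hL0 z ≤ 2) ∧ (-2 ≤ hL1 z ∧ hL1 z ≤ 0) ∧ (-3 ≤ hL2 z ∧ hL2 z ≤ -1)) := by
  rw [show hdir 0 = (1, 0) from rfl, show hdir 1 = (1, 1) from rfl, show hdir 2 = (0, 1) from rfl,
    show hdir 3 = (-1, 0) from rfl, show hdir 4 = (-1, -1) from rfl, show hdir 5 = (0, -1) from rfl]
  simp only [hexCell, mem_ofPred_eq, hexG_le_iff, hctr, hL0, hL1, hL2, Complex.sub_re, Complex.sub_im,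
    Int.cast_one, Int.cast_zero, Int.cast_neg]
  refine ⟨?_, ?_, ?_, ?_, ?_, ?_⟩ <;>
  · constructor
    · rintro ⟨⟨_, _⟩, ⟨_, _⟩, ⟨_, _⟩⟩
      refine ⟨⟨?_, ?_⟩, ⟨?_, ?_⟩, ⟨?_, ?_⟩⟩ <;> linarith
    · rintro ⟨⟨_, _⟩, ⟨_, _⟩, ⟨_, _⟩⟩
      refine ⟨⟨?_, ?_⟩, ⟨?_, ?_⟩, ⟨?_, ?_⟩⟩ <;> linarith

lemma hL2_eq (z : ℂ) : hL2 z = hL1 z - hL0 z := by simp only [hL0, hL1, hL2]; ring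

lemma one_le_hexG {z : ℂ} (h : 1 ≤ hexG z) : 1 ≤ hL0 z ∨ 1 ≤ hL1 z ∨ 1 ≤ hL2 z ∨ hL0 z ≤ -1 ∨
    hL1 z ≤ -1 ∨ hL2 z ≤ -1 := by
  simp only [hexG, le_max_iff, le_abs] at h
  rcases h with (h | h) | (h | h) | (h | h)
  all_goals first | (have := h; grind)

lemma cone_data (m : Fin 6) (hm : m ≠ 0) : ∃ g : ℂ → ℝ, ConeMap g ∧
    (∀ z, 0 ≤ g z → 1 ≤ hexG z → hexG z ≤ 3 / 2 → ∃ j < m, z ∈ hexCell (hdir j)) ∧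
    (∀ z, ∀ j < m, z ∈ hexCell (hdir j) → 0 ≤ g z) := by
  have main : ∀ g : ℂ → ℝ, ConeMap g →
    (∀ z, (0 ≤ g z → ∃ j < m, (j = 0 ∧ 0 ≤ hL1 z ∧ hL2 z ≤ 0) ∨ (j = 1 ∧ 0 ≤ hL0 z ∧ 0 ≤ hL2 z) ∨
      (j = 2 ∧ 0 ≤ hL1 z ∧ hL0 z ≤ 0) ∨ (j = 3 ∧ hL1 z ≤ 0 ∧ 0 ≤ hL2 z) ∨
      (j = 4 ∧ hL0 z ≤ 0 ∧ hL2 z ≤ 0)) ∧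
      ∀ j < m, ((j = 0 ∧ 0 ≤ hL1 z ∧ hL2 z ≤ 0) ∨ (j = 1 ∧ 0 ≤ hL0 z ∧ 0 ≤ hL2 z) ∨
      (j = 2 ∧ 0 ≤ hL1 z ∧ hL0 z ≤ 0) ∨ (j = 3 ∧ hL1 z ≤ 0 ∧ 0 ≤ hL2 z) ∨
      (j = 4 ∧ hL0 z ≤ 0 ∧ hL2 z ≤ 0)) → 0 ≤ g z) → ∃ g : ℂ → ℝ, ConeMap g ∧
    (∀ z, 0 ≤ g z → 1 ≤ hexG z → hexG z ≤ 3 / 2 → ∃ j < m, z ∈ hexCell (hdir j)) ∧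
    (∀ z, ∀ j < m, z ∈ hexCell (hdir j) → 0 ≤ g z) := by
    intro g hg hz
    refine ⟨g, hg, ?_, ?_⟩
    · intro z h0 h1 h2
      obtain ⟨j, hj, hc⟩ := (hz z).1 h0
      refine ⟨j, hj, ?_⟩
      have h1' := one_le_hexG h1
      rw [hexG_le_iff] at h2
      obtain ⟨⟨_, _⟩, ⟨_, _⟩, ⟨_, _⟩⟩ := h2
      have e := hL2_eq z
      obtain ⟨c0, c1, c2, c3, c4, c5⟩ := hcell_dir z
      rcases hc with ⟨rfl, _, _⟩ | ⟨rfl, _, _⟩ | ⟨rfl, _, _⟩ | ⟨rfl, _, _⟩ | ⟨rfl, _, _⟩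
      · rw [c0]; rcases h1' with h | h | h | h | h | h <;>
          refine ⟨⟨?_, ?_⟩, ⟨?_, ?_⟩, ⟨?_, ?_⟩⟩ <;> linarith
      · rw [c1]; rcases h1' with h | h | h | h | h | h <;>
          refine ⟨⟨?_, ?_⟩, ⟨?_, ?_⟩, ⟨?_, ?_⟩⟩ <;> linarith
      · rw [c2]; rcases h1' with h | h | h | h | h | h <;>
          refine ⟨⟨?_, ?_⟩, ⟨?_, ?_⟩, ⟨?_, ?_⟩⟩ <;> linarith
      · rw [c3]; rcases h1' with h | h | h | h | h | h <;>
          refine ⟨⟨?_, ?_⟩, ⟨?_, ?_⟩, ⟨?_, ?_⟩⟩ <;> linarith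
      · rw [c4]; rcases h1' with h | h | h | h | h | h <;>
          refine ⟨⟨?_, ?_⟩, ⟨?_, ?_⟩, ⟨?_, ?_⟩⟩ <;> linarith
    · intro z j hj hc
      refine (hz z).2 j hj ?_
      obtain ⟨c0, c1, c2, c3, c4, c5⟩ := hcell_dir z
      fin_cases j
      · exact Or.inl ⟨rfl, by have := c0.1 hc; exact ⟨this.2.1.1, this.2.2.2⟩⟩
      · exact Or.inr (Or.inl ⟨rfl, by have := c1.1 hc; exact ⟨this.1.1, this.2.2.1⟩⟩)
      · exact Or.inr (Or.inr (Or.inl ⟨rfl, by have := c2.1 hc; exact ⟨this.2.1.1, this.1.2⟩⟩))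
      · exact Or.inr (Or.inr (Or.inr (Or.inl ⟨rfl, by have := c3.1 hc; exact ⟨this.2.1.2, this.2.2.1⟩⟩)))
      · exact Or.inr (Or.inr (Or.inr (Or.inr ⟨rfl, by have := c4.1 hc; exact ⟨this.1.2, this.2.2.2⟩⟩)))
      · exact absurd hj (not_lt.2 (Fin.le_last m))
  have hm' : m = 1 ∨ m = 2 ∨ m = 3 ∨ m = 4 ∨ m = 5 := by omega
  rcases hm' with rfl | rfl | rfl | rfl | rfl
  · refine main (fun z => min (hL1 z) (- hL2 z)) ?_ ?_
    · convert cone_min 1 (3 / 2) 1 (-3 / 2) (by norm_num) using 3 <;> simp [hL1, hL2]; ring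
    · intro z; have e := hL2_eq z
      refine ⟨fun h => ?_, ?_⟩
      · simp only [neg_nonneg, le_min_iff, min_le_iff] at h
        rcases le_total (hL0 z) 0 with g0 | g0 <;> rcases le_total (hL1 z) 0 with g1 | g1 <;>
          rcases le_total (hL2 z) 0 with g2 | g2 <;>
          obtain ⟨h, h'⟩ := h <;>
          first
            | exact ⟨0, by decide, Or.inl ⟨rfl, by linarith, by linarith⟩⟩
      · rintro j hj (⟨rfl, _, _⟩ | ⟨rfl, _, _⟩ | ⟨rfl, _, _⟩ | ⟨rfl, _, _⟩ | ⟨rfl, _, _⟩) <;>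
          first
            | (exfalso; revert hj; decide)
            | exact le_min (by linarith) (by linarith)
  · refine main (fun z => min (hL0 z) (hL1 z)) ?_ ?_
    · convert cone_min 2 0 1 (3 / 2) (by norm_num) using 3 <;> simp [hL1, hL0]
    · intro z; have e := hL2_eq z
      refine ⟨fun h => ?_, ?_⟩
      · simp only [neg_nonneg, le_min_iff, min_le_iff] at h
        rcases le_total (hL0 z) 0 with g0 | g0 <;> rcases le_total (hL1 z) 0 with g1 | g1 <;>
          rcases le_total (hL2 z) 0 with g2 | g2 <;>
          obtain ⟨h, h'⟩ := h <;>
          first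
            | exact ⟨0, by decide, Or.inl ⟨rfl, by linarith, by linarith⟩⟩
            | exact ⟨1, by decide, Or.inr (Or.inl ⟨rfl, by linarith, by linarith⟩)⟩
      · rintro j hj (⟨rfl, _, _⟩ | ⟨rfl, _, _⟩ | ⟨rfl, _, _⟩ | ⟨rfl, _, _⟩ | ⟨rfl, _, _⟩) <;>
          first
            | (exfalso; revert hj; decide)
            | exact le_min (by linarith) (by linarith)
  · refine main (fun z => hL1 z) cone_lin ?_
    · intro z; have e := hL2_eq z
      refine ⟨fun h => ?_, ?_⟩
      · rcases le_total (hL0 z) 0 with g0 | g0 <;> rcases le_total (hL1 z) 0 with g1 | g1 <;>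
          rcases le_total (hL2 z) 0 with g2 | g2 <;>
          first
            | exact ⟨0, by decide, Or.inl ⟨rfl, by linarith, by linarith⟩⟩
            | exact ⟨1, by decide, Or.inr (Or.inl ⟨rfl, by linarith, by linarith⟩)⟩
            | exact ⟨2, by decide, Or.inr (Or.inr (Or.inl ⟨rfl, by linarith, by linarith⟩))⟩
      · rintro j hj (⟨rfl, _, _⟩ | ⟨rfl, _, _⟩ | ⟨rfl, _, _⟩ | ⟨rfl, _, _⟩ | ⟨rfl, _, _⟩) <;>
          first
            | (exfalso; revert hj; decide)
            | linarith
  · refine main (fun z => - min (- hL1 z) (- hL2 z)) (cone_neg ?_) ?_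
    · convert cone_min (-1) (-3 / 2) 1 (-3 / 2) (by norm_num) using 3 <;> simp [hL1, hL2] <;> ring
    · intro z; have e := hL2_eq z
      refine ⟨fun h => ?_, ?_⟩
      · simp only [neg_nonneg, le_min_iff, min_le_iff] at h
        rcases le_total (hL0 z) 0 with g0 | g0 <;> rcases le_total (hL1 z) 0 with g1 | g1 <;>
          rcases le_total (hL2 z) 0 with g2 | g2 <;>
          rcases h with h | h <;>
          first
            | exact ⟨0, by decide, Or.inl ⟨rfl, by linarith, by linarith⟩⟩
            | exact ⟨1, by decide, Or.inr (Or.inl ⟨rfl, by linarith, by linarith⟩)⟩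
            | exact ⟨2, by decide, Or.inr (Or.inr (Or.inl ⟨rfl, by linarith, by linarith⟩))⟩
            | exact ⟨3, by decide, Or.inr (Or.inr (Or.inr (Or.inl ⟨rfl, by linarith, by linarith⟩)))⟩
      · rintro j hj (⟨rfl, _, _⟩ | ⟨rfl, _, _⟩ | ⟨rfl, _, _⟩ | ⟨rfl, _, _⟩ | ⟨rfl, _, _⟩) <;>
          first
            | (exfalso; revert hj; decide)
            | (rw [neg_nonneg]; first | exact min_le_of_left_le (by linarith) | exact min_le_of_right_le (by linarith))
  · refine main (fun z => - min (hL0 z) (- hL1 z)) (cone_neg ?_) ?_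
    · convert cone_min 2 0 (-1) (-3 / 2) (by norm_num) using 3 <;> simp [hL1, hL0]; ring
    · intro z; have e := hL2_eq z
      refine ⟨fun h => ?_, ?_⟩
      · simp only [neg_nonneg, le_min_iff, min_le_iff] at h
        rcases le_total (hL0 z) 0 with g0 | g0 <;> rcases le_total (hL1 z) 0 with g1 | g1 <;>
          rcases le_total (hL2 z) 0 with g2 | g2 <;>
          rcases h with h | h <;>
          first
            | exact ⟨0, by decide, Or.inl ⟨rfl, by linarith, by linarith⟩⟩
            | exact ⟨1, by decide, Or.inr (Or.inl ⟨rfl, by linarith, by linarith⟩)⟩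
            | exact ⟨2, by decide, Or.inr (Or.inr (Or.inl ⟨rfl, by linarith, by linarith⟩))⟩
            | exact ⟨3, by decide, Or.inr (Or.inr (Or.inr (Or.inl ⟨rfl, by linarith, by linarith⟩)))⟩
            | exact ⟨4, by decide, Or.inr (Or.inr (Or.inr (Or.inr ⟨rfl, by linarith, by linarith⟩)))⟩
      · rintro j hj (⟨rfl, _, _⟩ | ⟨rfl, _, _⟩ | ⟨rfl, _, _⟩ | ⟨rfl, _, _⟩ | ⟨rfl, _, _⟩) <;>
          first
            | (exfalso; revert hj; decide)
            | (rw [neg_nonneg]; first | exact min_le_of_left_le (by linarith) | exact min_le_of_right_le (by linarith))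

lemma hexCell_far {o : ℤ × ℤ} {z : ℂ} (hz : z ∈ hexCell o) (h2 : hexG z < 2) (ho : o ≠ 0) :
    ∃ j, o = hdir j := by
  obtain ⟨m, n⟩ := o
  have h2' : (-2 < hL0 z ∧ hL0 z < 2) ∧ (-2 < hL1 z ∧ hL1 z < 2) ∧ (-2 < hL2 z ∧ hL2 z < 2) := by
    simpa only [hexG, max_lt_iff, abs_lt] using h2
  simp only [hexCell, mem_ofPred_eq, hexG_le_iff, hL0, hL1, hL2, hctr, Complex.sub_re,
      Complex.sub_im] at hz h2'
  have e1 : ((2 * m - n : ℤ) : ℝ) < (3 : ℤ) := by push_cast; linarith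
  have e2 : ((-3 : ℤ) : ℝ) < ((2 * m - n : ℤ) : ℝ) := by push_cast; linarith
  have e3 : ((m + n : ℤ) : ℝ) < (3 : ℤ) := by push_cast; linarith
  have e4 : ((-3 : ℤ) : ℝ) < ((m + n : ℤ) : ℝ) := by push_cast; linarith
  have e5 : ((2 * n - m : ℤ) : ℝ) < (3 : ℤ) := by push_cast; linarith
  have e6 : ((-3 : ℤ) : ℝ) < ((2 * n - m : ℤ) : ℝ) := by push_cast; linarith
  rw [Int.cast_lt] at e1 e2 e3 e4 e5 e6
  have h0 : ¬ (m = 0 ∧ n = 0) := by rintro ⟨rfl, rfl⟩; exact ho rfl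
  have : hadj 0 (m, n) := by simp only [hadj, Prod.fst_zero, Prod.snd_zero]; omega
  obtain ⟨j, hj⟩ := hadj_iff.1 this
  exact ⟨j, by simpa using hj⟩

lemma hexCell_dir_one_le {j : Fin 6} {z : ℂ} (hz : z ∈ hexCell (hdir j)) : 1 ≤ hexG z := by
  obtain ⟨c0, c1, c2, c3, c4, c5⟩ := hcell_dir z
  simp only [hexG, le_max_iff, le_abs]
  fin_cases j
  · have := c0.1 hz; exact Or.inl (Or.inl this.1.1)
  · have := c1.1 hz; exact Or.inr (Or.inl (Or.inl this.2.1.1))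
  · have := c2.1 hz; exact Or.inr (Or.inr (Or.inl this.2.2.1))
  · have := c3.1 hz; exact Or.inl (Or.inr (by linarith [this.1.2]))
  · have := c4.1 hz; exact Or.inr (Or.inl (Or.inr (by linarith [this.2.1.2])))
  · have := c5.1 hz; exact Or.inr (Or.inr (Or.inr (by linarith [this.2.2.2])))

lemma hexDisc_step0 (P : Set (ℤ × ℤ)) (c : ℤ × ℤ) (hc : c ∈ P) (m : Fin 6) (hm : m ≠ 0)
    (hj : ∀ j : Fin 6, (c + hdir j ∈ P ↔ j < m)) :
    ∃ h : ℂ ≃ₜ ℂ, h '' hexU (P \ {c}) = hexU P := by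
  obtain ⟨g, ⟨Ψ, hΨ1, hΨ2⟩, hg1, hg2⟩ := cone_data m hm
  have hΨ0 : Ψ 0 = 0 := by simpa using hΨ2 0 0 le_rfl
  have hinv : ∀ (t : ℝ) (w : ℂ), 0 ≤ t → Ψ.symm (t • w) = t • Ψ.symm w := by
    intro t w ht
    rw [Homeomorph.symm_apply_eq, hΨ2 t _ ht, Homeomorph.apply_symm_apply]
  obtain ⟨R, hR⟩ := radial_homeo (fun w => hexG (Ψ.symm w)) (continuous_hexG.comp Ψ.symm.continuous)
    (fun t w ht => by rw [hinv t w ht, hexG_smul _ _ ht])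
    (fun w hw => hexG_pos _ (fun h => hw (by rw [Homeomorph.symm_apply_eq, hΨ0] at h; exact h)))
  let χ : ℂ ≃ₜ ℂ := (Homeomorph.subRight (hctr c)).trans (Ψ.trans R)
  have hχ : ∀ z, χ z = R (Ψ (z - hctr c)) := fun z => rfl
  have hχn : ∀ z, ‖χ z‖ = hexG (z - hctr c) := by
    intro z; rw [hχ, (hR _).1, Homeomorph.symm_apply_apply]
  have hχim : ∀ z, 0 ≤ (χ z).im ↔ 0 ≤ g (z - hctr c) := by
    intro z
    obtain ⟨t, ht, e⟩ := (hR (Ψ (z - hctr c))).2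
    rw [hχ, e]
    simp only [Complex.real_smul, Complex.mul_im, Complex.ofReal_re, Complex.ofReal_im, zero_mul,
      add_zero, hΨ1]
    exact mul_nonneg_iff_of_pos_left ht
  have hsplit : ∀ z, z ∈ hexU P ↔ z ∈ hexU (P \ {c}) ∨ hexG (z - hctr c) ≤ 1 := by
    intro z
    simp only [mem_hexU]
    constructor
    · rintro ⟨o, ho, hz⟩
      by_cases h : o = c
      · subst h; exact Or.inr hz
      · exact Or.inl ⟨o, ⟨ho, h⟩, hz⟩
    · rintro (⟨o, ho, hz⟩ | h)
      · exact ⟨o, ho.1, hz⟩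
      · exact ⟨c, hc, h⟩
  have hnear : ∀ z, z ∈ hexU (P \ {c}) → hexG (z - hctr c) < 2 →
      ∃ j < m, z - hctr c ∈ hexCell (hdir j) := by
    intro z hz h2
    obtain ⟨o, ⟨ho, hoc⟩, hz⟩ := mem_hexU.1 hz
    have e : o = c + (o - c) := by abel
    rw [e, mem_hexCell_add] at hz
    obtain ⟨j, hj'⟩ := hexCell_far hz h2 (sub_ne_zero.2 hoc)
    rw [hj'] at hz
    refine ⟨j, (hj j).1 ?_, hz⟩
    rw [← hj', ← e]; exact ho
  have key := lens_maps {w | χ.symm w ∈ hexU (P \ {c})} (by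
      intro w hw h
      have hw' : hexG (χ.symm w - hctr c) < 1 := by rw [← hχn, Homeomorph.apply_symm_apply]; exact hw
      obtain ⟨j, _, hj'⟩ := hnear _ h (by linarith)
      have := hexCell_dir_one_le hj'
      linarith) (by
      intro w h0 h1 h2
      rw [← χ.apply_symm_apply w, hχn] at h1 h2
      rw [← χ.apply_symm_apply w, hχim] at h0
      obtain ⟨j, hjm, hz⟩ := hg1 _ h0 h1 h2
      refine mem_hexU.2 ⟨c + hdir j, ⟨(hj j).2 hjm, ?_⟩, (mem_hexCell_add _ _ _).2 hz⟩
      simp only [mem_singleton_iff, add_eq_left]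
      fin_cases j <;> simp [hdir]) (by
      intro w h0 h1 h2 h
      rw [← χ.apply_symm_apply w, hχn] at h2
      obtain ⟨j, hjm, hz⟩ := hnear _ h h2
      have := (hχim _).2 (hg2 _ j hjm hz)
      rw [χ.apply_symm_apply] at this
      linarith)
  refine ⟨χ.trans (lensHomeo.trans χ.symm), ?_⟩
  ext z
  rw [Homeomorph.image_eq_preimage_symm, mem_preimage]
  set z' := (χ.trans (lensHomeo.trans χ.symm)).symm z with hz'
  have hz : z = χ.symm (lensHomeo (χ z')) := by
    have : (χ.trans (lensHomeo.trans χ.symm)) z' = z := by rw [hz', Homeomorph.apply_symm_apply]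
    exact this.symm
  rw [hsplit, hz, ← hχn, χ.apply_symm_apply]
  have := key (χ z')
  simp only [mem_ofPred_eq, χ.symm_apply_apply] at this
  exact this

noncomputable def crot : ℂ ≃ₜ ℂ where
  toFun z := ⟨z.re / 2 - 3 / 4 * z.im, z.re + z.im / 2⟩
  invFun z := ⟨z.re / 2 + 3 / 4 * z.im, -z.re + z.im / 2⟩
  left_inv z := by apply Complex.ext <;> simp <;> ring
  right_inv z := by apply Complex.ext <;> simp <;> ring
  continuous_toFun := continuous_cmk (by fun_prop) (by fun_prop)
  continuous_invFun := continuous_cmk (by fun_prop) (by fun_prop)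

lemma hexG_crot (z : ℂ) : hexG (crot z) = hexG z := by
  have e0 : hL0 (crot z) = - hL2 z := by simp [crot, hL0, hL2]; ring
  have e1 : hL1 (crot z) = hL0 z := by simp [crot, hL0, hL1]; ring
  have e2 : hL2 (crot z) = hL1 z := by simp [crot, hL1, hL2]; ring
  simp only [hexG, e0, e1, e2, abs_neg]
  rw [max_comm, max_assoc]

lemma crot_hexCell (o : ℤ × ℤ) (z : ℂ) : crot z ∈ hexCell (hrot o) ↔ z ∈ hexCell o := by
  have : crot z - hctr (hrot o) = crot (z - hctr o) := by
    apply Complex.ext <;> simp [crot, hctr, hrot] <;> ring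
  simp only [hexCell, mem_ofPred_eq, this, hexG_crot]

lemma crot_image (P : Set (ℤ × ℤ)) : crot '' hexU (hrotP P) = hexU P := by
  ext z
  rw [Homeomorph.image_eq_preimage_symm, mem_preimage, mem_hexU, mem_hexU]
  constructor
  · rintro ⟨o, ho, hz⟩
    rw [← crot_hexCell, Homeomorph.apply_symm_apply] at hz
    exact ⟨_, ho, hz⟩
  · rintro ⟨o, ho, hz⟩
    refine ⟨hrotInv o, ?_, ?_⟩
    · simp only [hrotP, mem_ofPred_eq, hrot_hrotInv]; exact ho
    · rw [← crot_hexCell, Homeomorph.apply_symm_apply, hrot_hrotInv]; exact hz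

lemma hexDisc_stepk (k : Fin 6) : ∀ (P : Set (ℤ × ℤ)) (c : ℤ × ℤ), c ∈ P → ∀ m : Fin 6, m ≠ 0 →
    (∀ j : Fin 6, (c + hdir (k + j) ∈ P ↔ j < m)) →
    ∃ h : ℂ ≃ₜ ℂ, h '' hexU (P \ {c}) = hexU P := by
  refine fin6_ind (p := fun k => ∀ (P : Set (ℤ × ℤ)) (c : ℤ × ℤ), c ∈ P → ∀ m : Fin 6, m ≠ 0 →
    (∀ j : Fin 6, (c + hdir (k + j) ∈ P ↔ j < m)) →
    ∃ h : ℂ ≃ₜ ℂ, h '' hexU (P \ {c}) = hexU P) ?_ ?_ k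
  · intro P c hc m hm hj
    exact hexDisc_step0 P c hc m hm (by simpa using hj)
  · intro k ih P c hc m hm hj
    obtain ⟨h, hh⟩ := ih (hrotP P) (hrotInv c)
      (by simp only [hrotP, mem_ofPred_eq, hrot_hrotInv]; exact hc) m hm (fun j => by
        rw [hrotP_mem, ← hj j, add_right_comm])
    refine ⟨crot.symm.trans (h.trans crot), ?_⟩
    rw [hrotP_diff] at hh
    rw [← crot_image P, ← hh, ← crot_image (P \ {c})]
    ext z
    simp [image_image]

lemma hexDisc_single (o : ℤ × ℤ) : ∃ h : ℂ ≃ₜ ℂ, h '' closedBall 0 1 = hexCell o := by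
  obtain ⟨R, hR⟩ := radial_homeo hexG continuous_hexG (fun t w ht => hexG_smul t w ht) hexG_pos
  refine ⟨R.symm.trans (Homeomorph.addRight (hctr o)), ?_⟩
  ext z
  rw [Homeomorph.image_eq_preimage_symm, mem_preimage, mem_closedBall_zero_iff]
  have : (R.symm.trans (Homeomorph.addRight (hctr o))).symm z = R (z - hctr o) := by
    rw [Homeomorph.symm_apply_eq]; simp
  rw [this, (hR _).1]; rfl

theorem hexDisc {P : Set (ℤ × ℤ)} (hf : P.Finite) (hne : P.Nonempty) (h1 : HConn P)
    (h2 : HConn Pᶜ) : ∃ h : ℂ ≃ₜ ℂ, h '' closedBall 0 1 = hexU P := by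
  obtain ⟨n, hn⟩ : ∃ n, P.ncard = n := ⟨_, rfl⟩
  induction n generalizing P with
  | zero => exact absurd ((ncard_eq_zero hf).1 hn) hne.ne_empty
  | succ n ih =>
    by_cases hnt : P.Nontrivial
    · obtain ⟨c, hc, ⟨j, hj⟩, hcon⟩ := hexists_removable hf h1 hnt
      obtain ⟨d, hd, hdc⟩ := hnt.exists_ne c
      have hi : ∃ j, c + hdir j ∈ P := by
        rcases Relation.ReflTransGen.cases_head (h1 c hc d hd) with h | ⟨e, he, _⟩
        · exact absurd h.symm hdc
        · obtain ⟨j, rfl⟩ := hadj_iff.1 he.1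
          exact ⟨j, he.2.2⟩
      obtain ⟨k, m, hm, hkm⟩ := harc h2 hc hcon hi ⟨j, hj⟩
      obtain ⟨h, hh⟩ := hexDisc_stepk k P c hc m hm hkm
      have hconc : HConn (P \ {c})ᶜ := by
        have hsub : Pᶜ ⊆ (P \ {c})ᶜ := compl_subset_compl.2 sdiff_subset
        have hcm : c ∈ (P \ {c})ᶜ := by simp
        have base : ∀ a ∈ (P \ {c})ᶜ, Relation.ReflTransGen (hstep (P \ {c})ᶜ) (c + hdir j) a := by
          intro a ha
          by_cases hac : a = c
          · subst hac
            exact Relation.ReflTransGen.single ⟨hadj_symm (hadj_iff.2 ⟨j, rfl⟩), hsub hj, ha⟩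
          · have : a ∈ Pᶜ := fun h => ha ⟨h, hac⟩
            exact hreach_mono hsub (h2 _ hj _ this)
        exact fun a ha b hb => (hreach_symm (base a ha)).trans (base b hb)
      obtain ⟨h', hh'⟩ := ih (hf.subset sdiff_subset) ⟨d, hd, hdc⟩ hcon hconc (by
        rw [ncard_sdiff_singleton_of_mem hc, hn]; rfl)
      exact ⟨h'.trans h, by rw [← hh, ← hh', ← image_comp]; rfl⟩
    · rw [not_nontrivial_iff] at hnt
      obtain ⟨o, ho⟩ := hne
      have : P = {o} := hnt.eq_singleton_of_mem ho
      subst this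
      obtain ⟨h, hh⟩ := hexDisc_single o
      exact ⟨h, by rw [hh]; simp [hexU]⟩

lemma hexCell_bound {o : ℤ × ℤ} {z : ℂ} (hz : z ∈ hexCell o) :
    |z.re - (o.1 - o.2 / 2)| ≤ 1 / 2 ∧ |z.im - o.2| ≤ 2 / 3 := by
  simp only [hexCell, mem_ofPred_eq, hexG_le_iff, hL0, hL1, hL2, hctr, Complex.sub_re,
    Complex.sub_im] at hz
  constructor <;> rw [abs_le] <;> constructor <;> linarith [hz.1.1, hz.1.2, hz.2.1.1, hz.2.1.2, hz.2.2.1, hz.2.2.2]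

lemma hexCell_finite (R : ℝ) : {o : ℤ × ℤ | ∃ z ∈ hexCell o, ‖z‖ ≤ R}.Finite := by
  apply Set.Finite.subset (s := Icc (-⌈2 * R + 3⌉) ⌈2 * R + 3⌉ ×ˢ Icc (-⌈2 * R + 3⌉) ⌈2 * R + 3⌉)
    ((finite_Icc _ _).prod (finite_Icc _ _))
  rintro o ⟨z, hz, hR⟩
  have h1 := (Complex.abs_re_le_norm z).trans hR
  have h2 := (Complex.abs_im_le_norm z).trans hR
  obtain ⟨h3, h4⟩ := hexCell_bound hz
  rw [abs_le] at h1 h2 h3 h4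
  have h5 := Int.le_ceil (2 * R + 3)
  have hR0 : 0 ≤ R := (norm_nonneg z).trans hR
  simp only [mem_prod, mem_Icc]
  refine ⟨⟨?_, ?_⟩, ?_, ?_⟩ <;> (rify; linarith)

lemma isClosed_hexU (P : Set (ℤ × ℤ)) : IsClosed (hexU P) := by
  rw [hexU, biUnion_eq_iUnion]
  apply LocallyFinite.isClosed_iUnion
  · intro z
    refine ⟨ball z 1, ball_mem_nhds z one_pos, ((hexCell_finite (‖z‖ + 1)).preimage
      Subtype.val_injective.injOn).subset ?_⟩
    rintro ⟨o, ho⟩ ⟨w, hw, hw2⟩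
    refine ⟨w, hw, ?_⟩
    rw [mem_ball_iff_norm] at hw2
    have := norm_add_le (w - z) z
    simp at this; linarith
  · intro o; exact isClosed_hexCell _

lemma hex_one_comp {P : Set (ℤ × ℤ)} {p : ℤ × ℤ} {X : Set ℂ} (hX : IsPreconnected X)
    (hXP : X ⊆ hexU P) (hp : p ∈ P) (hm : (X ∩ hexCell p).Nonempty) :
    X ⊆ hexU {o | Relation.ReflTransGen (hstep P) p o} := by
  set T := {o | Relation.ReflTransGen (hstep P) p o}
  have hTP : T ⊆ P := fun o ho => hreach_mem hp ho
  by_contra hn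
  obtain ⟨x, hx, hxT⟩ := not_subset.1 hn
  have := isPreconnected_closed_iff.1 hX (hexU T) (hexU (P \ T)) (isClosed_hexU _) (isClosed_hexU _)
    (by
      intro z hz
      obtain ⟨o, ho, hzo⟩ := mem_hexU.1 (hXP hz)
      by_cases h : o ∈ T
      · exact Or.inl (mem_hexU.2 ⟨o, h, hzo⟩)
      · exact Or.inr (mem_hexU.2 ⟨o, ⟨ho, h⟩, hzo⟩))
    (by
      obtain ⟨z, hz, hz2⟩ := hm
      exact ⟨z, hz, mem_hexU.2 ⟨p, .refl, hz2⟩⟩)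
    (by
      obtain ⟨o, ho, hzo⟩ := mem_hexU.1 (hXP hx)
      exact ⟨x, hx, mem_hexU.2 ⟨o, ⟨ho, fun h => hxT (mem_hexU.2 ⟨o, h, hzo⟩)⟩, hzo⟩⟩)
  obtain ⟨z, _, h1, h2⟩ := this
  obtain ⟨a, ha, hza⟩ := mem_hexU.1 h1
  obtain ⟨b, hb, hzb⟩ := mem_hexU.1 h2
  refine hb.2 (Relation.ReflTransGen.tail ha ⟨hadj_of_mem hza hzb ?_, hTP ha, hb.1⟩)
  rintro rfl; exact hb.2 ha

lemma hconn_meeting {Ω : Set ℂ} (hΩ : IsPreconnected Ω) : HConn {o | (Ω ∩ hexCell o).Nonempty} := by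
  intro a ha b hb
  set P := {o | (Ω ∩ hexCell o).Nonempty}
  have h := hex_one_comp (P := P) hΩ (fun z hz => by
    obtain ⟨o, ho⟩ := hexCell_cover z
    exact mem_hexU.2 ⟨o, ⟨z, hz, ho⟩, ho⟩) ha ha
  obtain ⟨z, hz, hzb⟩ := hb
  obtain ⟨o, ho, hzo⟩ := mem_hexU.1 (h hz)
  by_cases hob : o = b
  · exact hob ▸ ho
  · exact Relation.ReflTransGen.tail ho ⟨hadj_of_mem hzo hzb hob, hreach_mem ha ho, ⟨z, hz, hzb⟩⟩

lemma hconn_comp {P : Set (ℤ × ℤ)} {p : ℤ × ℤ} :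
    HConn {o | Relation.ReflTransGen (hstep P) p o} := by
  have key : ∀ a, Relation.ReflTransGen (hstep P) p a →
      Relation.ReflTransGen (hstep {o | Relation.ReflTransGen (hstep P) p o}) p a := by
    intro a ha
    induction ha with
    | refl => exact .refl
    | tail h1 h2 ih => exact ih.tail ⟨h2.1, h1, h1.tail h2⟩
  intro a ha b hb
  exact (hreach_symm (key a ha)).trans (key b hb)

lemma hconn_compl_comp {O : Set (ℤ × ℤ)} (hO : HConn O) (hne : O.Nonempty) {p : ℤ × ℤ} (hp : p ∈ Oᶜ) :
    HConn {o | Relation.ReflTransGen (hstep Oᶜ) p o}ᶜ := by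
  set T := {o | Relation.ReflTransGen (hstep Oᶜ) p o}
  have hTP : T ⊆ Oᶜ := fun o ho => hreach_mem hp ho
  have hOT : O ⊆ Tᶜ := fun o ho h => hTP h ho
  obtain ⟨o₀, ho₀⟩ := hne
  have hall : HConn (univ : Set (ℤ × ℤ)) := by
    have := hconn_meeting (isPreconnected_univ (α := ℂ))
    have e : {o | ((univ : Set ℂ) ∩ hexCell o).Nonempty} = univ := by
      ext o
      simp only [univ_inter, mem_ofPred_eq, mem_univ, iff_true]
      refine ⟨hctr o, ?_⟩
      simp [hexCell, hexG, hL0, hL1, hL2]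
    rwa [e] at this
  have key : ∀ b ∈ Tᶜ, ∃ o ∈ O, Relation.ReflTransGen (hstep Tᶜ) b o := by
    intro b
    induction hall b trivial o₀ trivial using Relation.ReflTransGen.head_induction_on with
    | refl => exact fun _ => ⟨o₀, ho₀, .refl⟩
    | head h1 h2 ih =>
      rename_i b c
      intro hb
      by_cases hbO : b ∈ O
      · exact ⟨b, hbO, .refl⟩
      have hc : c ∈ Tᶜ := by
        intro hc
        exact hb (Relation.ReflTransGen.tail hc ⟨hadj_symm h1.1, hTP hc, hbO⟩)
      obtain ⟨o, ho, h⟩ := ih hc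
      exact ⟨o, ho, Relation.ReflTransGen.head ⟨h1.1, hb, hc⟩ h⟩
  intro a ha b hb
  obtain ⟨o, ho, h1⟩ := key a ha
  obtain ⟨o', ho', h2⟩ := key b hb
  exact h1.trans ((hreach_mono hOT (hO o ho o' ho')).trans (hreach_symm h2))

theorem cell_domains (Φ : ℂ ≃ₜ ℂ) {Ω : Set ℂ} (hΩ : IsPreconnected Ω) (R : ℝ) (hR : ∀ z, R < ‖z‖ → z ∈ Ω) :
    ∃ (J : Type) (_ : Finite J) (h : J → (ℂ ≃ₜ ℂ)),
      (∀ i, ∀ z ∈ h i '' sphere 0 1, ∃ o, (∃ w ∈ Ω, Φ w ∈ hexCell o) ∧ Φ z ∈ hexCell o) ∧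
      (∀ i, ∀ z ∈ h i '' closedBall 0 1, ∃ o, Φ z ∈ hexCell o ∧ ∀ w ∈ Ω, Φ w ∉ hexCell o) ∧
      (∀ X : Set ℂ, IsConnected X → (∀ z ∈ X, ∃ o, Φ z ∈ hexCell o ∧ ∀ w ∈ Ω, Φ w ∉ hexCell o) →
        ∃ i, X ⊆ h i '' closedBall 0 1) := by
  set O := {o | ((Φ '' Ω) ∩ hexCell o).Nonempty} with hOdef
  have hmO : ∀ o, o ∉ O ↔ ∀ w ∈ Ω, Φ w ∉ hexCell o := by
    intro o
    simp only [hOdef, mem_ofPred_eq, Set.Nonempty, not_exists, mem_inter_iff, mem_image]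
    constructor
    · intro h w hw hwo; exact h _ ⟨⟨w, hw, rfl⟩, hwo⟩
    · rintro h _ ⟨⟨w, hw, rfl⟩, hwo⟩; exact h w hw hwo
  have hO : HConn O := hconn_meeting (hΩ.image _ Φ.continuous.continuousOn)
  have hne : O.Nonempty := by
    have hz : (⟨|R| + 1, 0⟩ : ℂ) ∈ Ω := by
      apply hR
      refine lt_of_lt_of_le ?_ (Complex.abs_re_le_norm _)
      simp only
      exact lt_of_lt_of_le (lt_of_le_of_lt (le_abs_self R) (lt_add_one _)) (le_abs_self _)
    obtain ⟨o, ho⟩ := hexCell_cover (Φ ⟨|R| + 1, 0⟩)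
    exact ⟨o, _, mem_image_of_mem _ hz, ho⟩
  have hfin : (Oᶜ).Finite := by
    obtain ⟨R', hR'⟩ := ((isCompact_closedBall (0 : ℂ) R).image Φ.continuous).isBounded.subset_closedBall 0
    refine (hexCell_finite R').subset ?_
    intro o ho
    refine ⟨hctr o, by simp [hexCell, hexG, hL0, hL1, hL2], ?_⟩
    have h1 := (hmO o).1 ho
    have : Φ.symm (hctr o) ∈ closedBall (0 : ℂ) R := by
      rw [mem_closedBall_zero_iff]
      by_contra hc
      push Not at hc
      exact h1 _ (hR _ hc) (by simp [hexCell, hexG, hL0, hL1, hL2])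
    simpa using hR' (mem_image_of_mem Φ this)
  let T : ↥(Oᶜ) → Set (ℤ × ℤ) := fun p => {o | Relation.ReflTransGen (hstep Oᶜ) p.1 o}
  have hT : ∀ p, T p ⊆ Oᶜ := fun p o ho => hreach_mem p.2 ho
  have hd : ∀ p, ∃ h : ℂ ≃ₜ ℂ, h '' closedBall 0 1 = hexU (T p) := fun p =>
    hexDisc (hfin.subset (hT p)) ⟨p.1, .refl⟩ hconn_comp (hconn_compl_comp hO hne p.2)
  choose h hh using hd
  have himg : ∀ p (S : Set ℂ), ((h p).trans Φ.symm) '' S = Φ.symm '' (h p '' S) := by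
    intro p S; ext z; simp
  refine ⟨↥(Oᶜ), hfin.to_subtype, fun p => (h p).trans Φ.symm, ?_, ?_, ?_⟩
  · rintro p _ ⟨u, hu, rfl⟩
    have hu1 : h p u ∈ hexU (T p) := (hh p) ▸ mem_image_of_mem _ (sphere_subset_closedBall hu)
    have hcl : h p u ∈ closure (hexU (T p))ᶜ := by
      rw [← hh p, ← (h p).image_compl, ← (h p).image_closure]
      refine mem_image_of_mem _ ?_
      rw [closure_compl, interior_closedBall _ one_ne_zero]
      rw [mem_sphere_zero_iff_norm] at hu
      simp [hu]
    have hcl2 : h p u ∈ hexU (T p)ᶜ := by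
      refine closure_minimal ?_ (isClosed_hexU (T p)ᶜ) hcl
      intro z hz
      obtain ⟨o, ho⟩ := hexCell_cover z
      exact mem_hexU.2 ⟨o, fun h => hz (mem_hexU.2 ⟨o, h, ho⟩), ho⟩
    obtain ⟨a, ha, hza⟩ := mem_hexU.1 hu1
    obtain ⟨b, hb, hzb⟩ := mem_hexU.1 hcl2
    have hbO : b ∈ O := by
      by_contra hbO
      refine hb (Relation.ReflTransGen.tail ha ⟨hadj_of_mem hza hzb ?_, hT p ha, hbO⟩)
      rintro rfl; exact hb ha
    obtain ⟨_, ⟨w, hw, rfl⟩, hwb⟩ := hbO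
    exact ⟨b, ⟨w, hw, hwb⟩, by simpa using hzb⟩
  · intro p z hz
    rw [himg, hh] at hz
    obtain ⟨y, hy, rfl⟩ := hz
    obtain ⟨a, ha, hza⟩ := mem_hexU.1 hy
    exact ⟨a, by simpa using hza, (hmO a).1 (hT p ha)⟩
  · intro X hX hXc
    obtain ⟨x, hx⟩ := hX.1
    obtain ⟨p, hp, hp2⟩ := hXc x hx
    refine ⟨⟨p, (hmO p).2 hp2⟩, ?_⟩
    rw [himg, hh]
    have := hex_one_comp (P := Oᶜ) (p := p) (hX.isPreconnected.image Φ Φ.continuous.continuousOn)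
      (by
        rintro _ ⟨z, hz, rfl⟩
        obtain ⟨o, ho, ho2⟩ := hXc z hz
        exact mem_hexU.2 ⟨o, (hmO o).2 ho2, ho⟩) ((hmO p).2 hp2) ⟨Φ x, mem_image_of_mem _ hx, hp⟩
    intro z hz
    exact ⟨Φ z, this (mem_image_of_mem _ hz), by simp⟩

noncomputable def hzig (x : ℝ) : ℝ := -2 / 3 + 2 / 3 * infDist x (range ((↑) : ℤ → ℝ))

lemma hzig_cont : Continuous hzig := by
  unfold hzig
  exact continuous_const.add (continuous_const.mul (continuous_infDist_pt _))

lemma hzig_le (x : ℝ) (m : ℤ) : hzig x ≤ -2 / 3 + 2 / 3 * |x - m| := by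
  have : infDist x (range ((↑) : ℤ → ℝ)) ≤ dist x m := infDist_le_dist_of_mem (mem_range_self m)
  rw [Real.dist_eq] at this
  unfold hzig; linarith

lemma hzig_le' (x : ℝ) : hzig x ≤ -1 / 3 := by
  have := hzig_le x (round x)
  linarith [abs_sub_round x]

lemma hzig_ge (x : ℝ) : -2 / 3 ≤ hzig x := by
  have : 0 ≤ infDist x (range ((↑) : ℤ → ℝ)) := infDist_nonneg
  unfold hzig; linarith

lemma hzig_ge' (x : ℝ) (m : ℤ) : -1 / 3 - 2 / 3 * |x - (m + 1 / 2)| ≤ hzig x := by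
  have : 1 / 2 - |x - (m + 1 / 2)| ≤ infDist x (range ((↑) : ℤ → ℝ)) := by
    rw [le_infDist (range_nonempty _)]
    rintro _ ⟨j, rfl⟩
    rw [Real.dist_eq]
    have h1 : (1 / 2 : ℝ) ≤ |(m : ℝ) + 1 / 2 - j| := by
      rcases le_or_gt j m with h | h
      · have : (j : ℝ) ≤ m := by exact_mod_cast h
        rw [le_abs]; left; linarith
      · have : (m : ℝ) + 1 ≤ j := by exact_mod_cast h
        rw [le_abs]; right; linarith
    have h2 := abs_sub_abs_le_abs_sub ((m : ℝ) + 1 / 2 - j) (((m : ℝ) + 1 / 2) - x)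
    have h3 : ((m : ℝ) + 1 / 2 - j) - (((m : ℝ) + 1 / 2) - x) = x - j := by ring
    rw [h3, abs_sub_comm _ x] at h2
    linarith
  unfold hzig; linarith

noncomputable def hgrid (k : ℝ) (hk : k ≠ 0) : ℂ ≃ₜ ℂ where
  toFun z := ⟨k * z.re, k * z.im + hzig (k * z.re)⟩
  invFun w := ⟨w.re / k, (w.im - hzig w.re) / k⟩
  left_inv z := by apply Complex.ext <;> simp [hk]
  right_inv w := by
    have : k * (w.re / k) = w.re := by field_simp
    apply Complex.ext <;> simp only [this]
    field_simp; ring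
  continuous_toFun := by
    have := hzig_cont
    exact continuous_cmk (by fun_prop) (by fun_prop)
  continuous_invFun := by
    have := hzig_cont
    exact continuous_cmk (by fun_prop) (by fun_prop)

theorem grid_exists {δ : ℝ} (hδ : 0 < δ) : ∃ Φ : ℂ ≃ₜ ℂ,
    (∀ o z w, Φ z ∈ hexCell o → Φ w ∈ hexCell o → dist z w < δ) ∧
    (∀ (o : ℤ × ℤ) z, 0 ≤ o.2 → Φ z ∈ hexCell o → 0 ≤ z.im) ∧
    (∀ (o : ℤ × ℤ) z, o.2 < 0 → Φ z ∈ hexCell o → z.im ≤ 0) ∧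
    (∀ (o : ℤ × ℤ), o.2 < 0 → ∃ z, Φ z ∈ hexCell o ∧ z.im < 0) := by
  have hk : 0 < 4 / δ := by positivity
  set k := 4 / δ with hkd
  have hre : ∀ z, (hgrid k hk.ne' z).re = k * z.re := fun z => rfl
  have him : ∀ z, (hgrid k hk.ne' z).im = k * z.im + hzig (k * z.re) := fun z => rfl
  refine ⟨hgrid k hk.ne', ?_, ?_, ?_, ?_⟩
  · intro o z w hz hw
    obtain ⟨a1, a2⟩ := hexCell_bound hz
    obtain ⟨b1, b2⟩ := hexCell_bound hw
    rw [hre, abs_le] at a1 b1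
    rw [him, abs_le] at a2 b2
    have c1 := hzig_ge (k * z.re)
    have c2 := hzig_le' (k * z.re)
    have c3 := hzig_ge (k * w.re)
    have c4 := hzig_le' (k * w.re)
    rw [dist_eq_norm]
    have d1 : |(z - w).re| ≤ 1 / k := by
      rw [le_div_iff₀ hk, show |(z - w).re| * k = |(z - w).re * k| by rw [abs_mul, abs_of_pos hk], abs_le, Complex.sub_re]
      constructor <;> nlinarith
    have d2 : |(z - w).im| ≤ 2 / k := by
      rw [le_div_iff₀ hk, show |(z - w).im| * k = |(z - w).im * k| by rw [abs_mul, abs_of_pos hk], abs_le, Complex.sub_im]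
      constructor <;> nlinarith
    refine lt_of_le_of_lt (Complex.norm_le_abs_re_add_abs_im _) ?_
    refine lt_of_le_of_lt (add_le_add d1 d2) ?_
    rw [hkd]; field_simp; norm_num
  · rintro ⟨m, n⟩ z ho hz
    obtain ⟨a1, a2⟩ := hexCell_bound hz
    simp only at ho
    simp only [him] at a2
    have : 0 ≤ k * z.im := by
      rcases eq_or_lt_of_le ho with h | h
      · subst h
        simp only [hexCell, mem_ofPred_eq, hexG_le_iff, hL0, hL1, hL2, hctr, Complex.sub_re,
          Complex.sub_im, hre, him] at hz
        push_cast at hz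
        have := hzig_le (k * z.re) m
        rcases abs_cases (k * z.re - m) with h | h <;>
        linarith [hz.1.1, hz.1.2, hz.2.1.1, hz.2.1.2, hz.2.2.1, hz.2.2.2]
      · have h1 : (1 : ℝ) ≤ n := by exact_mod_cast h
        rw [abs_le] at a2
        linarith [hzig_le' (k * z.re)]
    by_contra hc
    push Not at hc
    nlinarith
  · rintro ⟨m, n⟩ z ho hz
    obtain ⟨a1, a2⟩ := hexCell_bound hz
    simp only at ho
    simp only [him] at a2
    have : k * z.im ≤ 0 := by
      rcases eq_or_lt_of_le (show n ≤ -1 by omega) with h | h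
      · subst h
        simp only [hexCell, mem_ofPred_eq, hexG_le_iff, hL0, hL1, hL2, hctr, Complex.sub_re,
          Complex.sub_im, hre, him] at hz
        push_cast at hz
        have := hzig_ge' (k * z.re) m
        rcases abs_cases (k * z.re - (m + 1 / 2)) with h | h <;>
        linarith [hz.1.1, hz.1.2, hz.2.1.1, hz.2.1.2, hz.2.2.1, hz.2.2.2]
      · have h1 : (n : ℝ) ≤ -2 := by exact_mod_cast (show n ≤ -2 by omega)
        rw [abs_le] at a2
        linarith [hzig_ge (k * z.re)]
    by_contra hc
    push Not at hc
    nlinarith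
  · rintro ⟨m, n⟩ ho
    refine ⟨(hgrid k hk.ne').symm (hctr (m, n)), by simp [hexCell, hexG, hL0, hL1, hL2], ?_⟩
    have h1 := him ((hgrid k hk.ne').symm (hctr (m, n)))
    rw [Homeomorph.apply_symm_apply] at h1
    have h2 : (n : ℝ) ≤ -1 := by exact_mod_cast (show n ≤ -1 by simp only at ho; omega)
    simp only [hctr] at h1
    have h3 := hzig_ge (k * ((hgrid k hk.ne').symm (⟨m - n / 2, n⟩ : ℂ)).re)
    by_contra hc
    push Not at hc
    simp only [hctr] at hc
    nlinarith

lemma split_clopen {X : Type*} [TopologicalSpace X] [T2Space X] [CompactSpace X] {Y1 Y2 : Set X}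
    (h1 : IsClosed Y1) (h2 : IsClosed Y2)
    (hno : ∀ C : Set X, IsPreconnected C → (C ∩ Y1).Nonempty → (C ∩ Y2).Nonempty → False) :
    ∃ V : Set X, IsClopen V ∧ Y1 ⊆ V ∧ Disjoint V Y2 := by
  have key : ∀ y ∈ Y1, ∃ V : Set X, IsClopen V ∧ y ∈ V ∧ Disjoint V Y2 := by
    intro y hy
    have hd : Disjoint (connectedComponent y) Y2 := by
      rw [Set.disjoint_iff_inter_eq_empty, ← not_nonempty_iff_eq_empty]
      exact fun h => hno _ isPreconnected_connectedComponent ⟨y, mem_connectedComponent, hy⟩ h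
    rw [connectedComponent_eq_iInter_isClopen] at hd
    haveI : Nonempty {s : Set X // IsClopen s ∧ y ∈ s} := ⟨⟨univ, isClopen_univ, mem_univ _⟩⟩
    have := h2.isCompact.elim_directed_family_closed
      (fun s : {s : Set X // IsClopen s ∧ y ∈ s} => (s : Set X))
      (fun s => s.2.1.1) (by
        rw [Set.disjoint_iff_inter_eq_empty, inter_comm] at hd; exact hd)
      (by
        intro a b
        exact ⟨⟨a.1 ∩ b.1, a.2.1.inter b.2.1, a.2.2, b.2.2⟩, inter_subset_left, inter_subset_right⟩)
    obtain ⟨s, hs⟩ := this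
    exact ⟨s.1, s.2.1, s.2.2, by rw [Set.disjoint_iff_inter_eq_empty, inter_comm]; exact hs⟩
  choose! V hV using key
  obtain ⟨t, htY, hcov⟩ := h1.isCompact.elim_nhds_subcover V (fun y hy => (hV y hy).1.2.mem_nhds (hV y hy).2.1)
  refine ⟨⋃ y ∈ t, V y, t.finite_toSet.isClopen_biUnion (fun y hy => (hV y (htY y hy)).1), hcov, ?_⟩
  simp only [disjoint_iUnion_left]
  exact fun y hy => (hV y (htY y hy)).2.2

lemma split_compact {X : Type*} [TopologicalSpace X] [T2Space X] {W Y1 Y2 : Set X}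
    (hW : IsCompact W) (h1 : IsClosed Y1) (h2 : IsClosed Y2)
    (hno : ∀ C ⊆ W, IsPreconnected C → (C ∩ Y1).Nonempty → (C ∩ Y2).Nonempty → False) :
    ∃ W1 W2 : Set X, IsCompact W1 ∧ IsCompact W2 ∧ W1 ∪ W2 = W ∧ Disjoint W1 W2 ∧
      W ∩ Y1 ⊆ W1 ∧ W ∩ Y2 ⊆ W2 := by
  have := isCompact_iff_compactSpace.1 hW
  obtain ⟨V, hV, hV1, hV2⟩ := split_clopen (X := W) (Y1 := Subtype.val ⁻¹' Y1) (Y2 := Subtype.val ⁻¹' Y2)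
    (h1.preimage continuous_subtype_val) (h2.preimage continuous_subtype_val) (by
      rintro C hC ⟨x, hx, hx1⟩ ⟨y, hy, hy1⟩
      exact hno (Subtype.val '' C) (by rintro _ ⟨z, _, rfl⟩; exact z.2)
        (hC.image _ continuous_subtype_val.continuousOn) ⟨x, ⟨x, hx, rfl⟩, hx1⟩ ⟨y, ⟨y, hy, rfl⟩, hy1⟩)
  refine ⟨Subtype.val '' V, Subtype.val '' Vᶜ, hV.1.isCompact.image continuous_subtype_val,
    hV.compl.1.isCompact.image continuous_subtype_val, ?_, ?_, ?_, ?_⟩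
  · rw [← image_union]; simp
  · exact (disjoint_image_iff Subtype.val_injective).2 disjoint_compl_right
  · rintro x ⟨hx, hx1⟩
    exact ⟨⟨x, hx⟩, hV1 hx1, rfl⟩
  · rintro x ⟨hx, hx1⟩
    exact ⟨⟨x, hx⟩, fun h => disjoint_left.1 hV2 h hx1, rfl⟩

/-- compact connected hull in a relatively open connected subset of a compact convex set -/
lemma hull_exists {E : Type*} [NormedAddCommGroup E] [NormedSpace ℝ E] {S A C : Set E} (hS : IsCompact S)
    (hSc : Convex ℝ S) (hA : IsClosed A) (hU : IsPreconnected (S \ A)) (hne : (S \ A).Nonempty)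
    (hC : IsCompact C) (hCU : C ⊆ S \ A) :
    ∃ X, IsCompact X ∧ IsConnected X ∧ C ⊆ X ∧ X ⊆ S \ A := by
  obtain ⟨x0, hx0⟩ := hne
  have hloc : ∀ x ∈ S \ A, ∃ r > 0, S ∩ closedBall x r ⊆ S \ A := by
    intro x hx
    obtain ⟨r, hr, h⟩ := Metric.nhds_basis_closedBall.mem_iff.1 (hA.isOpen_compl.mem_nhds hx.2)
    exact ⟨r, hr, fun y hy => ⟨hy.1, h hy.2⟩⟩
  choose! r hr hrs using hloc
  have hnb : ∀ x ∈ S \ A, ∀ y ∈ S ∩ closedBall x (r x), ∃ B, IsCompact B ∧ IsConnected B ∧ x ∈ B ∧ y ∈ B ∧ B ⊆ S \ A := by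
    intro x hx y hy
    refine ⟨segment ℝ x y, ?_, ?_, left_mem_segment _ _ _, right_mem_segment _ _ _, ?_⟩
    · rw [segment_eq_image_lineMap]
      exact isCompact_Icc.image (AffineMap.lineMap_continuous)
    · exact ⟨⟨x, left_mem_segment _ _ _⟩, (convex_segment x y).isPreconnected⟩
    · refine Subset.trans ?_ (hrs x hx)
      exact (hSc.inter (convex_closedBall x (r x))).segment_subset
        ⟨hx.1, mem_closedBall_self (hr x hx).le⟩ hy
  let R : Set E := {x | ∃ Y, IsCompact Y ∧ IsConnected Y ∧ x0 ∈ Y ∧ x ∈ Y ∧ Y ⊆ S \ A}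
  have hR : S \ A ⊆ R := by
    have hstep : ∀ x ∈ S \ A, ∀ y ∈ S ∩ closedBall x (r x), (x ∈ R ↔ y ∈ R) := by
      intro x hx y hy
      obtain ⟨B, hB, hBc, hxB, hyB, hBs⟩ := hnb x hx y hy
      constructor
      · rintro ⟨Y, hY, hYc, h0, hxY, hYs⟩
        exact ⟨Y ∪ B, hY.union hB, hYc.union ⟨x, hxY, hxB⟩ hBc, .inl h0, .inr hyB, union_subset hYs hBs⟩
      · rintro ⟨Y, hY, hYc, h0, hxY, hYs⟩
        exact ⟨Y ∪ B, hY.union hB, hYc.union ⟨y, hxY, hyB⟩ hBc, .inl h0, .inr hxB, union_subset hYs hBs⟩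
    have hx0R : x0 ∈ R := ⟨{x0}, isCompact_singleton, isConnected_singleton, rfl, rfl, by simpa using hx0⟩
    by_contra hcon
    obtain ⟨y, hyU, hyR⟩ := not_subset.1 hcon
    let O1 : Set E := ⋃ x ∈ (S \ A) ∩ R, ball x (r x)
    let O2 : Set E := ⋃ x ∈ (S \ A) \ R, ball x (r x)
    have ho1 : IsOpen O1 := isOpen_biUnion fun _ _ => isOpen_ball
    have ho2 : IsOpen O2 := isOpen_biUnion fun _ _ => isOpen_ball
    obtain ⟨z, hz, hz1, hz2⟩ := hU O1 O2 ho1 ho2 (by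
      intro x hx
      by_cases hxR : x ∈ R
      · exact .inl (mem_biUnion (⟨hx, hxR⟩ : x ∈ (S \ A) ∩ R) (mem_ball_self (hr x hx)))
      · exact .inr (mem_biUnion (⟨hx, hxR⟩ : x ∈ (S \ A) \ R) (mem_ball_self (hr x hx))))
      ⟨x0, hx0, mem_biUnion (⟨hx0, hx0R⟩ : x0 ∈ (S \ A) ∩ R) (mem_ball_self (hr x0 hx0))⟩
      ⟨y, hyU, mem_biUnion (⟨hyU, hyR⟩ : y ∈ (S \ A) \ R) (mem_ball_self (hr y hyU))⟩
    simp only [O1, O2, mem_iUnion] at hz1 hz2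
    obtain ⟨a, ⟨ha, haR⟩, hza⟩ := hz1
    obtain ⟨b, ⟨hb, hbR⟩, hzb⟩ := hz2
    have e1 := (hstep a ha z ⟨hz.1, ball_subset_closedBall hza⟩).1 haR
    exact hbR ((hstep b hb z ⟨hz.1, ball_subset_closedBall hzb⟩).2 e1)
  have hbig : ∀ x ∈ S \ A, ∃ Y, IsCompact Y ∧ IsConnected Y ∧ x0 ∈ Y ∧ S ∩ closedBall x (r x) ⊆ Y ∧ Y ⊆ S \ A := by
    intro x hx
    obtain ⟨Y, hY, hYc, h0, hxY, hYs⟩ := hR hx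
    refine ⟨Y ∪ (S ∩ closedBall x (r x)), hY.union (hS.inter_right isClosed_closedBall), ?_, .inl h0,
      subset_union_right, union_subset hYs (hrs x hx)⟩
    have hxx : x ∈ S ∩ closedBall x (r x) := ⟨hx.1, mem_closedBall_self (hr x hx).le⟩
    exact hYc.union ⟨x, hxY, hxx⟩ ⟨⟨x, hxx⟩, (hSc.inter (convex_closedBall x (r x))).isPreconnected⟩
  choose! Y hY using hbig
  obtain ⟨t, ht, hcov⟩ := hC.elim_nhds_subcover (fun x => closedBall x (r x))
    (fun x hx => closedBall_mem_nhds x (hr x (hCU hx)))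
  refine ⟨{x0} ∪ ⋃ x ∈ t, Y x, isCompact_singleton.union (t.isCompact_biUnion fun x hx => (hY x (hCU (ht x hx))).1), ?_, ?_, ?_⟩
  · refine ⟨⟨x0, .inl rfl⟩, isPreconnected_of_forall x0 ?_⟩
    rintro y (rfl | hy)
    · exact ⟨{y}, subset_union_left, rfl, rfl, isPreconnected_singleton⟩
    · simp only [mem_iUnion] at hy
      obtain ⟨x, hx, hyx⟩ := hy
      refine ⟨Y x, fun z hz => .inr (mem_biUnion hx hz), (hY x (hCU (ht x hx))).2.2.1, hyx, (hY x (hCU (ht x hx))).2.1.isPreconnected⟩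
  · intro x hx
    obtain ⟨y, hy, hxy⟩ := mem_iUnion₂.1 (hcov hx)
    exact .inr (mem_biUnion hy ((hY y (hCU (ht y hy))).2.2.2.1 ⟨(hCU hx).1, hxy⟩))
  · rintro x (rfl | hx)
    · exact hx0
    · obtain ⟨y, hy, hxy⟩ := mem_iUnion₂.1 hx
      exact (hY y (hCU (ht y hy))).2.2.2.2 hxy


lemma haus_right {X : Type*} [MetricSpace X] {Q L : Set X} (hQ : IsCompact Q) (hL : IsCompact L)
    (hQn : Q.Nonempty) (hLn : L.Nonempty) {ε : ℝ} (h : hausdorffDist Q L < ε) {x : X} (hx : x ∈ L) :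
    ∃ y ∈ Q, dist y x < ε := by
  have hne := hausdorffEDist_ne_top_of_nonempty_of_bounded hQn hLn hQ.isBounded hL.isBounded
  obtain ⟨y, hy, h⟩ := exists_dist_lt_of_hausdorffDist_lt' hx h hne
  exact ⟨y, hy, h⟩

lemma haus_left {X : Type*} [MetricSpace X] {Q L : Set X} (hQ : IsCompact Q) (hL : IsCompact L)
    (hQn : Q.Nonempty) (hLn : L.Nonempty) {ε : ℝ} (h : hausdorffDist Q L < ε) {x : X} (hx : x ∈ Q) :
    ∃ y ∈ L, dist x y < ε := by
  have hne := hausdorffEDist_ne_top_of_nonempty_of_bounded hQn hLn hQ.isBounded hL.isBounded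
  exact exists_dist_lt_of_hausdorffDist_lt hx h hne

/-- Hausdorff-convergent subsequence -/
lemma hausdorff_subseq {X : Type*} [MetricSpace X] [CompactSpace X] (Q : ℕ → Set X)
    (hQ : ∀ n, IsCompact (Q n)) (hc : ∀ n, IsConnected (Q n)) :
    ∃ (φ : ℕ → ℕ) (L : Set X), StrictMono φ ∧ IsCompact L ∧ IsConnected L ∧
      Tendsto (fun n => hausdorffDist (Q (φ n)) L) atTop (𝓝 0) := by
  let q : ℕ → TopologicalSpace.NonemptyCompacts X := fun n => ⟨⟨Q n, hQ n⟩, (hc n).1⟩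
  obtain ⟨L, φ, hφ, hL⟩ := CompactSpace.tendsto_subseq q
  have hT : Tendsto (fun n => hausdorffDist (Q (φ n)) L) atTop (𝓝 0) := by
    have := tendsto_iff_dist_tendsto_zero.1 hL
    exact this
  refine ⟨φ, L, hφ, L.isCompact, ⟨L.nonempty, ?_⟩, hT⟩
  rw [isPreconnected_closed_iff]
  rintro F1 F2 h1 h2 hcov ⟨a, haL, ha⟩ ⟨b, hbL, hb⟩
  by_contra hemp
  have hdis : Disjoint ((L : Set X) ∩ F1) ((L : Set X) ∩ F2) := by
    rw [Set.disjoint_left]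
    exact fun x hx hx' => hemp ⟨x, hx.1, hx.2, hx'.2⟩
  obtain ⟨δ, hδ, hd⟩ := hdis.exists_thickenings (L.isCompact.inter_right h1) (L.isCompact.isClosed.inter h2)
  obtain ⟨n, hn⟩ := (hT.eventually (gt_mem_nhds hδ)).exists
  obtain ⟨a', ha', haa⟩ := haus_right (hQ _) L.isCompact (hc _).1 L.nonempty hn haL
  obtain ⟨b', hb', hbb⟩ := haus_right (hQ _) L.isCompact (hc _).1 L.nonempty hn hbL
  obtain ⟨z, hz, hz1, hz2⟩ := (hc (φ n)).2 _ _ (isOpen_thickening (δ := δ) (E := (L : Set X) ∩ F1))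
    (isOpen_thickening (δ := δ) (E := (L : Set X) ∩ F2)) (by
      intro x hx
      obtain ⟨y, hy, hxy⟩ := haus_left (hQ _) L.isCompact (hc _).1 L.nonempty hn hx
      rcases hcov hy with h | h
      · exact .inl (mem_thickening_iff.2 ⟨y, ⟨hy, h⟩, hxy⟩)
      · exact .inr (mem_thickening_iff.2 ⟨y, ⟨hy, h⟩, hxy⟩))
    ⟨a', ha', mem_thickening_iff.2 ⟨a, ⟨haL, ha⟩, haa⟩⟩ ⟨b', hb', mem_thickening_iff.2 ⟨b, ⟨hbL, hb⟩, hbb⟩⟩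
  exact Set.disjoint_left.1 hd hz1 hz2

lemma exists_log {V : Type*} [NormedAddCommGroup V] [NormedSpace ℝ V] (G : V → ℂ) (hG : Continuous G)
    (h0 : ∀ z, G z ≠ 0) : ∃ g : V → ℂ, Continuous g ∧ ∀ z, Complex.exp (g z) = G z := by
  let G' : C(V, {z : ℂ // z ≠ 0}) := ⟨fun z => ⟨G z, h0 z⟩, by fun_prop⟩
  obtain ⟨F, ⟨-, hF⟩, -⟩ := Complex.isCoveringMap_exp.existsUnique_continuousMap_lifts G' 0
    (Complex.log (G 0)) (by simp [G', Complex.exp_log (h0 0)])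
  refine ⟨F, F.continuous, fun z => ?_⟩
  have := congrFun hF z
  exact congrArg Subtype.val this

lemma log_unique {X : Type*} [TopologicalSpace X] {s : Set X} (hs : IsPreconnected s) {g1 g2 : X → ℂ}
    (h1 : ContinuousOn g1 s) (h2 : ContinuousOn g2 s)
    (he : ∀ z ∈ s, Complex.exp (g1 z) = Complex.exp (g2 z)) {x y : X} (hx : x ∈ s) (hy : y ∈ s) :
    g1 y - g1 x = g2 y - g2 x := by
  have := Complex.isCoveringMap_exp.eqOn_of_comp_eqOn hs h1
    (h2.add (continuousOn_const (c := g1 x - g2 x)) : ContinuousOn (fun z => g2 z + (g1 x - g2 x)) s) (by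
      intro z hz
      simp only [Function.comp, Subtype.mk.injEq, Pi.add_apply]
      rw [Complex.exp_add, Complex.exp_sub, he x hx, he z hz, div_self (Complex.exp_ne_zero _), mul_one]) hx
      (by simp) hy
  simp only [Pi.add_apply] at this
  rw [this]; ring

/-- Clamp-type retraction: log on a convex compact set given by a retraction. -/
lemma exists_log_retract {V : Type*} [NormedAddCommGroup V] [NormedSpace ℝ V] (S : Set V) (r : V → V)
    (hr : Continuous r) (hrS : ∀ z, r z ∈ S) (hid : ∀ z ∈ S, r z = z) (G : V → ℂ) (hG : ContinuousOn G S)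
    (h0 : ∀ z ∈ S, G z ≠ 0) :
    ∃ g : V → ℂ, Continuous g ∧ ∀ z ∈ S, Complex.exp (g z) = G z := by
  obtain ⟨g, hg, he⟩ := exists_log (G ∘ r) (hG.comp_continuous hr hrS) (fun z => h0 _ (hrS z))
  exact ⟨g, hg, fun z hz => by rw [he]; simp [hid z hz]⟩

/-- radial retraction to the unit disc -/
noncomputable def radr (z : ℂ) : ℂ := ((max 1 ‖z‖)⁻¹ : ℝ) • z

lemma continuous_radr : Continuous radr := by
  unfold radr
  refine Continuous.smul (Continuous.inv₀ (by fun_prop : Continuous fun z : ℂ => max (1:ℝ) ‖z‖) (fun z => ?_)) continuous_id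
  have := le_max_left 1 ‖z‖
  positivity

lemma radr_mem (z : ℂ) : radr z ∈ closedBall (0 : ℂ) 1 := by
  have := le_max_left 1 ‖z‖
  have h2 := le_max_right 1 ‖z‖
  simp only [mem_closedBall, dist_zero_right, radr, norm_smul, norm_inv, Real.norm_eq_abs]
  rw [abs_of_pos (by positivity), inv_mul_le_iff₀ (by positivity)]; linarith

lemma radr_of_mem {z : ℂ} (hz : z ∈ closedBall (0 : ℂ) 1) : radr z = z := by
  simp only [mem_closedBall, dist_zero_right] at hz
  simp [radr, max_eq_left hz]

lemma radr_dist (z w : ℂ) (hw : w ∈ closedBall (0 : ℂ) 1) : dist (radr z) w ≤ dist z w := by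
  rcases le_total ‖z‖ 1 with h | h
  · rw [radr_of_mem (by simpa using h)]
  · simp only [mem_closedBall, dist_zero_right] at hw
    simp only [radr, max_eq_right h]
    set n := ‖z‖ with hn
    have hn0 : 0 < n := by linarith
    rw [dist_eq_norm, dist_eq_norm]
    refine le_of_sq_le_sq ?_ (norm_nonneg _)
    have e : ∀ u v : ℂ, ‖u - v‖ ^ 2 = ‖u‖ ^ 2 - 2 * (u * (starRingEnd ℂ) v).re + ‖v‖ ^ 2 := by
      intro u v
      rw [Complex.sq_norm, Complex.normSq_sub, Complex.normSq_eq_norm_sq, Complex.normSq_eq_norm_sq]; ring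
    rw [e, e]
    have h1 : ‖(n⁻¹ : ℝ) • z‖ = 1 := by rw [norm_smul, norm_inv, Real.norm_of_nonneg hn0.le, ← hn, inv_mul_cancel₀ hn0.ne']
    have h2 : ((n⁻¹ : ℝ) • z * (starRingEnd ℂ) w).re = n⁻¹ * (z * (starRingEnd ℂ) w).re := by
      rw [smul_mul_assoc, Complex.smul_re, smul_eq_mul]
    rw [h1, h2]
    set c := (z * (starRingEnd ℂ) w).re with hc
    have h3 : c ≤ n := by
      calc c ≤ ‖z * (starRingEnd ℂ) w‖ := Complex.re_le_norm _
        _ = n * ‖w‖ := by rw [norm_mul, Complex.norm_conj]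
        _ ≤ n := by nlinarith
    have h4 : c * (1 - n⁻¹) ≤ n * (1 - n⁻¹) := by
      apply mul_le_mul_of_nonneg_right h3
      have : n⁻¹ ≤ 1 := inv_le_one_of_one_le₀ h
      linarith
    have h5 : n * n⁻¹ = 1 := mul_inv_cancel₀ hn0.ne'
    rw [← hn]
    nlinarith

lemma log_stab {X : Type*} [TopologicalSpace X] [CompactSpace X] (g : X × I → ℂ) (hg : Continuous g)
    (h0 : ∀ p, g p ≠ 0) (hl : ∃ l : X → ℂ, Continuous l ∧ ∀ x, Complex.exp (l x) = g (x, 0)) :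
    ∃ l : X → ℂ, Continuous l ∧ ∀ x, Complex.exp (l x) = g (x, 1) := by
  obtain ⟨l, hlc, hle⟩ := hl
  let H : C(I × X, {z : ℂ // z ≠ 0}) := ⟨fun p => ⟨g (p.2, p.1), h0 _⟩, by fun_prop⟩
  let cov := Complex.isCoveringMap_exp
  let l' := cov.liftHomotopy H ⟨l, hlc⟩ (by
    intro a; simp [H, hle])
  refine ⟨fun x => l' (1, x), by fun_prop, fun x => ?_⟩
  have := congrFun (cov.liftHomotopy_lifts H ⟨l, hlc⟩ (by intro a; simp [H, hle])) (1, x)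
  exact congrArg Subtype.val this

lemma circle_preconn : IsPreconnected (sphere (0 : ℂ) 1) :=
  isPreconnected_sphere (by rw [Complex.rank_real_complex]; norm_num) 0 1

lemma odd_no_log (o : sphere (0 : ℂ) 1 → ℂ) (l : sphere (0 : ℂ) 1 → ℂ) (hl : Continuous l)
    (he : ∀ x, Complex.exp (l x) = o x) (hodd : ∀ x, o (-x) = - o x) : False := by
  have : PreconnectedSpace (sphere (0 : ℂ) 1) := Subtype.preconnectedSpace circle_preconn
  let x : sphere (0 : ℂ) 1 := ⟨1, by simp⟩
  have h := log_unique (isPreconnected_univ (α := sphere (0 : ℂ) 1)) (g1 := fun x => l (-x))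
    (g2 := fun x => l x + Real.pi * Complex.I)
    (by fun_prop) (by fun_prop) (by
      intro z _
      rw [Complex.exp_add, Complex.exp_pi_mul_I, he, he, hodd]; ring) (mem_univ x) (mem_univ (-x))
  simp only [neg_neg] at h
  have h2 : l x = l (-x) := by linear_combination h / 2
  have h3 := he x
  rw [h2, he, hodd] at h3
  have : o x = 0 := by linear_combination -h3 / 2
  exact Complex.exp_ne_zero _ ((he x).trans this)

lemma iod_unit (F : ℂ → ℂ) (hc : ContinuousOn F (closedBall 0 1)) (hi : InjOn F (closedBall 0 1)) :
    F '' closedBall 0 1 ∈ 𝓝 (F 0) := by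
  have hsub : sphere (0 : ℂ) 1 ⊆ closedBall 0 1 := sphere_subset_closedBall
  have h0 : (0 : ℂ) ∈ closedBall (0 : ℂ) 1 := by simp
  obtain ⟨z0, hz0, hmin⟩ := (isCompact_sphere (0 : ℂ) 1).exists_isMinOn ⟨1, by simp⟩
    (f := fun z => ‖F z - F 0‖) ((hc.mono hsub).sub continuousOn_const).norm
  set δ := ‖F z0 - F 0‖ with hδ
  have hδ0 : 0 < δ := by
    rw [hδ, norm_pos_iff, sub_ne_zero]
    intro h
    have := hi (hsub hz0) h0 h
    simp [this] at hz0
  refine mem_of_superset (ball_mem_nhds (F 0) hδ0) ?_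
  intro w hw
  by_contra hwn
  have hB : Continuous fun x : closedBall (0 : ℂ) 1 => F x := continuousOn_iff_continuous_domRestrict.1 hc
  have hS : Continuous fun x : sphere (0 : ℂ) 1 => F x :=
    continuousOn_iff_continuous_domRestrict.1 (hc.mono hsub)
  obtain ⟨l, hl, hle⟩ := exists_log_retract (closedBall (0 : ℂ) 1) radr continuous_radr radr_mem
    (fun z hz => radr_of_mem hz) (fun z => F z - w) (hc.sub continuousOn_const) (by
      intro z hz h
      exact hwn ⟨z, hz, sub_eq_zero.1 h⟩)
  obtain ⟨l2, hl2, hle2⟩ := log_stab (X := sphere (0 : ℂ) 1)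
    (fun p => F p.1 - (w + ((p.2 : ℝ) : ℂ) * (F 0 - w)))
    (by
      refine Continuous.sub (hS.comp continuous_fst) ?_
      fun_prop)
    (by
      rintro ⟨⟨z, hz⟩, t⟩ h
      have h1 : δ ≤ ‖F z - F 0‖ := hmin hz
      have h2 : F z - F 0 = ((1 - (t : ℝ) : ℝ) : ℂ) * (w - F 0) := by
        push_cast
        simp only at h
        linear_combination h
      rw [h2, norm_mul, Complex.norm_real, Real.norm_of_nonneg (by linarith [t.2.2])] at h1
      rw [mem_ball, dist_eq_norm] at hw
      nlinarith [t.2.1, t.2.2, norm_nonneg (w - F 0)])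
    ⟨fun x => l x, by fun_prop, by
      intro x
      rw [hle _ (hsub x.2)]; simp⟩
  have hA : ∀ (z : sphere (0 : ℂ) 1) (t : I), ((1 + (t : ℝ))⁻¹ : ℝ) • (z : ℂ) ∈ closedBall (0 : ℂ) 1 := by
    rintro ⟨z, hz⟩ t
    simp only [mem_sphere_iff_norm, sub_zero] at hz
    have := t.2.1
    simp only [mem_closedBall, dist_zero_right, norm_smul, hz, mul_one]
    rw [Real.norm_of_nonneg (by positivity)]
    exact inv_le_one_of_one_le₀ (by linarith)
  have hA2 : ∀ (z : sphere (0 : ℂ) 1) (t : I), (-((t : ℝ) * (1 + (t : ℝ))⁻¹) : ℝ) • (z : ℂ) ∈ closedBall (0 : ℂ) 1 := by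
    rintro ⟨z, hz⟩ t
    simp only [mem_sphere_iff_norm, sub_zero] at hz
    have := t.2.1
    simp only [mem_closedBall, dist_zero_right, norm_smul, hz, mul_one, norm_neg]
    rw [Real.norm_of_nonneg (by positivity)]
    rw [← div_eq_mul_inv, div_le_one (by linarith)]
    linarith
  have hcinv : Continuous fun p : (sphere (0 : ℂ) 1) × I => ((1 + (p.2 : ℝ))⁻¹ : ℝ) := by
    refine Continuous.inv₀ (by fun_prop) ?_
    rintro ⟨z, t⟩
    have := t.2.1
    simp only
    positivity
  obtain ⟨l3, hl3, hle3⟩ := log_stab (X := sphere (0 : ℂ) 1)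
    (fun p => F (((1 + (p.2 : ℝ))⁻¹ : ℝ) • (p.1 : ℂ)) - F ((-((p.2 : ℝ) * (1 + (p.2 : ℝ))⁻¹) : ℝ) • (p.1 : ℂ)))
    (by
      refine Continuous.sub (hc.comp_continuous (by fun_prop) fun p => hA p.1 p.2)
        (hc.comp_continuous (by fun_prop) fun p => hA2 p.1 p.2))
    (by
      rintro ⟨z, t⟩ h
      have := hi (hA z t) (hA2 z t) (sub_eq_zero.1 h)
      have ht := t.2.1
      have hz : (z : ℂ) ≠ 0 := by
        intro h
        have := z.2
        simp [h] at this
      have h3 := smul_left_injective ℝ hz this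
      have h4 : 0 < (1 + (t : ℝ))⁻¹ := by positivity
      nlinarith)
    ⟨l2, hl2, by
      intro x
      rw [hle2]; simp⟩
  refine odd_no_log _ l3 hl3 hle3 ?_
  intro x
  simp only [Icc.coe_one, coe_neg_sphere]
  norm_num

lemma iod_plane (F : ℂ → ℂ) (a : ℂ) (r : ℝ) (hr : 0 < r) (hc : ContinuousOn F (closedBall a r))
    (hi : InjOn F (closedBall a r)) : F '' closedBall a r ∈ 𝓝 (F a) := by
  have hm : ∀ z ∈ closedBall (0 : ℂ) 1, a + r • z ∈ closedBall a r := by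
    intro z hz
    simp only [mem_closedBall, dist_zero_right, dist_self_add_left, norm_smul, Real.norm_of_nonneg hr.le] at hz ⊢
    nlinarith
  have := iod_unit (fun z => F (a + r • z)) (hc.comp (by fun_prop) hm) (by
    intro x hx y hy h
    have := hi (hm x hx) (hm y hy) h
    exact smul_right_injective ℂ hr.ne' (add_left_cancel this))
  simp only [smul_zero, add_zero] at this
  refine mem_of_superset this ?_
  rintro _ ⟨z, hz, rfl⟩
  exact ⟨_, hm z hz, rfl⟩

lemma iod_surface {S : Type*} [TopologicalSpace S] (hS : IsSurfaceLocallyEuclidean S) (φ : ℂ → S) (a : ℂ)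
    (r : ℝ) (hr : 0 < r) (hc : ContinuousOn φ (closedBall a r)) (hi : InjOn φ (closedBall a r)) :
    φ '' closedBall a r ∈ 𝓝 (φ a) := by
  obtain ⟨U, hU, haU, ⟨e⟩⟩ := hS (φ a)
  have h1 : ∀ᶠ z in 𝓝 a, z ∈ closedBall a r ∧ φ z ∈ U := by
    have hb := closedBall_mem_nhds a hr
    exact (eventually_mem_set.2 hb).and ((hc.continuousAt hb).eventually (hU.mem_nhds haU))
  obtain ⟨ρ, hρ, hsub⟩ := nhds_basis_closedBall.eventually_iff.1 h1
  let e' : U ≃ₜ ℂ := e.trans Complex.equivRealProdCLM.symm.toHomeomorph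
  classical
  let F : ℂ → ℂ := fun z => if h : φ z ∈ U then e' ⟨φ z, h⟩ else 0
  have hFe : ∀ z (h : φ z ∈ U), F z = e' ⟨φ z, h⟩ := fun z h => by simp [F, h]
  have hFc : ContinuousOn F (closedBall a ρ) := by
    rw [continuousOn_iff_continuous_domRestrict]
    have : (closedBall a ρ).domRestrict F = fun z : closedBall a ρ => e' ⟨φ z, (hsub z.2).2⟩ := by
      ext z; exact hFe _ _
    rw [this]
    refine e'.continuous.comp (Continuous.subtype_mk ?_ _)
    exact continuousOn_iff_continuous_domRestrict.1 (hc.mono fun z hz => (hsub hz).1)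
  have hFi : InjOn F (closedBall a ρ) := by
    intro x hx y hy h
    rw [hFe x (hsub hx).2, hFe y (hsub hy).2] at h
    exact hi (hsub hx).1 (hsub hy).1 (congrArg Subtype.val (e'.injective h))
  have h2 := iod_plane F a ρ hρ hFc hFi
  rw [hFe a haU] at h2
  have h3 : e'.symm '' (F '' closedBall a ρ) ∈ 𝓝 (⟨φ a, haU⟩ : U) := by
    have := e'.symm.isOpenMap.image_mem_nhds h2
    simpa using this
  have h4 := hU.isOpenMap_subtype_val.image_mem_nhds h3
  refine mem_of_superset h4 ?_
  rintro _ ⟨_, ⟨_, ⟨z, hz, rfl⟩, rfl⟩, rfl⟩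
  refine ⟨z, (hsub hz).1, ?_⟩
  rw [hFe z (hsub hz).2]; simp

lemma exp_two_pi_clamp {t : ℝ} (h : ¬ (t ∈ Icc (1/4 : ℝ) (3/4))) :
    Complex.exp (2 * Real.pi * Complex.I * ((max 0 (min 1 (2 * t - 1/2)) : ℝ) : ℂ)) = 1 := by
  rcases lt_or_ge t (1/4) with h1 | h1
  · rw [max_eq_left ((min_le_right _ _).trans (by linarith))]; simp
  · have : 3/4 < t := by
      by_contra hc; exact h ⟨h1, not_lt.1 hc⟩
    rw [min_eq_left (by linarith), max_eq_right zero_le_one]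
    simp [Complex.exp_two_pi_mul_I]

lemma tool_theta {S I' J : Set ℂ} (hS : IsCompact S) (r : ℂ → ℂ)
    (hr : Continuous r) (hrS : ∀ z, r z ∈ S) (hid : ∀ z ∈ S, r z = z) (θ : ℂ → ℝ) (hθ : Continuous θ)
    (hI : IsClosed I') (hJ : IsClosed J) (hIS : I' ⊆ S) (hJS : J ⊆ S)
    (hIc : IsPreconnected I') (hJc : IsPreconnected J) {p p' : ℂ} (hpI : p ∈ I') (hpJ : p ∈ J)
    (hp'I : p' ∈ I') (hp'J : p' ∈ J) (h0 : θ p = 0) (h1 : θ p' = 1) :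
    ∃ sg : Set ℂ, IsCompact sg ∧ IsPreconnected sg ∧ sg ⊆ S ∩ θ ⁻¹' Icc (1/4 : ℝ) (3/4) ∧ (sg ∩ I').Nonempty ∧
      (sg ∩ J).Nonempty := by
  by_contra hcon
  have hW : IsCompact (S ∩ θ ⁻¹' Icc (1/4 : ℝ) (3/4)) := hS.inter_right (isClosed_Icc.preimage hθ)
  obtain ⟨W1, W2, hW1, hW2, hU, hd, hs1, hs2⟩ := split_compact hW hI hJ (by
    intro C hC hCc hCI hCJ
    refine hcon ⟨closure C, hW.of_isClosed_subset isClosed_closure (hW.isClosed.closure_subset_iff.2 hC), hCc.closure,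
      hW.isClosed.closure_subset_iff.2 hC, ?_, ?_⟩
    · exact hCI.mono (inter_subset_inter_left _ subset_closure)
    · exact hCJ.mono (inter_subset_inter_left _ subset_closure))
  obtain ⟨b, hb0, hb1, -⟩ := exists_continuous_zero_one_of_isClosed hW2.isClosed hW1.isClosed hd.symm
  let E : ℂ → ℂ := fun z => Complex.exp (2 * Real.pi * Complex.I * ((max 0 (min 1 (2 * θ z - 1/2)) : ℝ) : ℂ))
  let G : ℂ → ℂ := fun z => 1 + (b z : ℂ) * (E z - 1)
  have hEc : Continuous E := by fun_prop
  have hGc : Continuous G := by fun_prop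
  have hGW1 : ∀ z ∈ W1, G z = E z := by
    intro z hz; simp only [G]; rw [hb1 hz]; simp
  have hGW2 : ∀ z ∈ W2, G z = 1 := by
    intro z hz; simp only [G]; rw [hb0 hz]; simp
  have hGo : ∀ z, θ z ∉ Icc (1/4 : ℝ) (3/4) → G z = 1 ∧ E z = 1 := by
    intro z hz
    have : E z = 1 := exp_two_pi_clamp hz
    simp [G, this]
  obtain ⟨g, hg, hge⟩ := exists_log_retract S r hr hrS hid G hGc.continuousOn (by
    intro z hz
    by_cases hzθ : θ z ∈ Icc (1/4 : ℝ) (3/4)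
    · have : z ∈ W1 ∪ W2 := hU ▸ ⟨hz, hzθ⟩
      rcases this with h | h
      · rw [hGW1 z h]; exact Complex.exp_ne_zero _
      · rw [hGW2 z h]; exact one_ne_zero
    · rw [(hGo z hzθ).1]; exact one_ne_zero)
  have e1 := log_unique hIc hg.continuousOn
    (g2 := fun z => 2 * Real.pi * Complex.I * ((max 0 (min 1 (2 * θ z - 1/2)) : ℝ) : ℂ))
    (by fun_prop) (by
      intro z hz
      rw [hge z (hIS hz)]
      by_cases hzθ : θ z ∈ Icc (1/4 : ℝ) (3/4)
      · exact hGW1 z (hs1 ⟨⟨hIS hz, hzθ⟩, hz⟩)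
      · rw [(hGo z hzθ).1]; exact (hGo z hzθ).2.symm) hpI hp'I
  have e2 := log_unique hJc hg.continuousOn (g2 := fun z => 0)
    (by fun_prop) (by
      intro z hz
      rw [hge z (hJS hz), Complex.exp_zero]
      by_cases hzθ : θ z ∈ Icc (1/4 : ℝ) (3/4)
      · exact hGW2 z (hs2 ⟨⟨hJS hz, hzθ⟩, hz⟩)
      · exact (hGo z hzθ).1) hpJ hp'J
  rw [e2] at e1
  simp only [h0, h1] at e1
  norm_num at e1

section Conj

local notation "cj" => starRingEnd ℂ

lemma slit_one_sub {a b : ℂ} (ha : ‖a‖ = 1) (hb : ‖b‖ ≤ 1) (hab : a ≠ b) : 1 - cj a * b ∈ Complex.slitPlane := by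
  have h1 : ‖cj a * b‖ ≤ 1 := by rw [norm_mul, Complex.norm_conj, ha, one_mul]; exact hb
  have h2 : (cj a * b).re ≤ 1 := (Complex.re_le_norm _).trans h1
  rw [Complex.mem_slitPlane_iff]
  by_contra hc
  push Not at hc
  simp only [Complex.sub_re, Complex.one_re, Complex.sub_im, Complex.one_im] at hc
  have hre : (cj a * b).re = 1 := by linarith [hc.1]
  have him : (cj a * b).im = 0 := by linarith [hc.2]
  have h3 : cj a * b = 1 := Complex.ext (by simpa using hre) (by simpa using him)
  apply hab
  have h4 : a * cj a = 1 := by rw [Complex.mul_conj, Complex.normSq_eq_norm_sq, ha]; simp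
  calc a = a * (cj a * b) := by rw [h3, mul_one]
    _ = (a * cj a) * b := by ring
    _ = b := by rw [h4, one_mul]

lemma path_near {A : Set ℂ} (hA : IsConnected A) (hAD : A ⊆ closedBall 0 1) {e e' : ℂ} (he : e ∈ A) (he' : e' ∈ A)
    {ε : ℝ} (hε : 0 < ε) : ∃ α : ℝ → ℂ, Continuous α ∧ α 0 = e ∧ α 1 = e' ∧ ∀ t, ‖α t‖ ≤ 1 ∧
      ∃ a ∈ A, dist (α t) a < ε := by
  have h1 : IsConnected (thickening ε A) := by
    refine ⟨⟨e, self_subset_thickening hε A he⟩, ?_⟩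
    rw [thickening_eq_biUnion_ball]
    apply isPreconnected_of_forall e
    intro y hy
    obtain ⟨a, ha, hya⟩ := mem_iUnion₂.1 hy
    refine ⟨A ∪ ball a ε, ?_, Or.inl he, Or.inr hya, ?_⟩
    · apply union_subset
      · intro z hz; exact mem_iUnion₂.2 ⟨z, hz, mem_ball_self hε⟩
      · exact subset_biUnion_of_mem (u := fun a => ball a ε) ha
    · exact hA.2.union a ha (mem_ball_self hε) (convex_ball a ε).isPreconnected
  have h2 := (isOpen_thickening.isConnected_iff_isPathConnected).1 h1
  obtain ⟨γ, hγ⟩ := h2.joinedIn e (self_subset_thickening hε A he) e' (self_subset_thickening hε A he')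
  refine ⟨fun t => radr (γ.extend t), continuous_radr.comp γ.continuous_extend, ?_, ?_, ?_⟩
  · simp [radr_of_mem (hAD he)]
  · simp [radr_of_mem (hAD he')]
  · intro t
    refine ⟨by simpa using radr_mem (γ.extend t), ?_⟩
    have : γ.extend t ∈ thickening ε A := hγ _
    obtain ⟨a, ha, hd⟩ := mem_thickening_iff.1 this
    exact ⟨a, ha, (radr_dist _ _ (hAD ha)).trans_lt hd⟩

/-- crossing lemma on the unit disc -/
lemma crossing {A C : Set ℂ} (hA : IsConnected A) (hC : IsConnected C) (hAk : IsCompact A) (hCk : IsCompact C)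
    (hAD : A ⊆ closedBall 0 1) (hCD : C ⊆ closedBall 0 1) {e e' p p' : ℂ} (he : e ∈ A) (he' : e' ∈ A) (hp : p ∈ C)
    (hp' : p' ∈ C) (ne : ‖e‖ = 1) (ne' : ‖e'‖ = 1) (np : ‖p‖ = 1) (np' : ‖p'‖ = 1)
    (hPi : ((e - p') * cj (e - p) * (e' - p) * cj (e' - p')).re < 0) : (A ∩ C).Nonempty := by
  by_contra hcon
  have hdis : Disjoint A C := disjoint_iff_inter_eq_empty.2 (not_nonempty_iff_eq_empty.1 hcon)
  obtain ⟨δ, hδ, hd⟩ := hdis.exists_thickenings hAk hCk.isClosed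
  obtain ⟨α, hα, hα0, hα1, hαA⟩ := path_near hA hAD he he' hδ
  obtain ⟨γ, hγ, hγ0, hγ1, hγC⟩ := path_near hC hCD hp hp' hδ
  have hne : ∀ s t, α s ≠ γ t := by
    intro s t h
    have h1 : α s ∈ thickening δ A := mem_thickening_iff.2 (hαA s).2
    have h2 : γ t ∈ thickening δ C := mem_thickening_iff.2 (hγC t).2
    rw [← h] at h2
    exact disjoint_left.1 hd h1 h2
  obtain ⟨g, hg, hge⟩ := exists_log (V := ℝ × ℝ) (fun q => α q.1 - γ q.2) (by fun_prop)
    (fun q => sub_ne_zero.2 (hne _ _))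
  have unit : ∀ a : ℂ, ‖a‖ = 1 → a * cj a = 1 := by
    intro a ha; rw [Complex.mul_conj, Complex.normSq_eq_norm_sq, ha]; simp
  -- horizontal edges (fixed s, varying t)
  have E1 : ∀ s a, α s = a → ‖a‖ = 1 → g (s, 1) - g (s, 0) =
      Complex.log (1 - cj a * p') - Complex.log (1 - cj a * p) := by
    intro s a hs ha
    have ha0 : a ≠ 0 := by rintro rfl; simp at ha
    have := log_unique (isPreconnected_univ (α := ℝ)) (g1 := fun t => g (s, t))
      (g2 := fun t => Complex.log a + Complex.log (1 - cj a * γ t)) (by fun_prop)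
      (by
        refine continuousOn_const.add (ContinuousOn.clog (by fun_prop) ?_)
        intro t _
        exact slit_one_sub ha (hγC t).1 (hs ▸ hne s t))
      (by
        intro t _
        rw [hge, Complex.exp_add, Complex.exp_log ha0,
          Complex.exp_log (Complex.slitPlane_ne_zero (slit_one_sub ha (hγC t).1 (hs ▸ hne s t)))]
        simp only [hs]
        linear_combination γ t * unit a ha) (mem_univ (0:ℝ)) (mem_univ 1)
    rw [this, hγ0, hγ1]; ring
  have E2 : ∀ t a, γ t = a → ‖a‖ = 1 → g (1, t) - g (0, t) =
      Complex.log (1 - cj a * e') - Complex.log (1 - cj a * e) := by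
    intro s a hs ha
    have ha0 : a ≠ 0 := by rintro rfl; simp at ha
    have := log_unique (isPreconnected_univ (α := ℝ)) (g1 := fun t => g (t, s))
      (g2 := fun t => Complex.log (-a) + Complex.log (1 - cj a * α t)) (by fun_prop)
      (by
        refine continuousOn_const.add (ContinuousOn.clog (by fun_prop) ?_)
        intro t _
        exact slit_one_sub ha (hαA t).1 (hs ▸ (hne t s).symm))
      (by
        intro t _
        rw [hge, Complex.exp_add, Complex.exp_log (neg_ne_zero.2 ha0),
          Complex.exp_log (Complex.slitPlane_ne_zero (slit_one_sub ha (hαA t).1 (hs ▸ (hne t s).symm)))]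
        simp only [hs]
        linear_combination α t * (-unit a ha)) (mem_univ (0:ℝ)) (mem_univ 1)
    rw [this, hα0, hα1]; ring
  have a1 := E1 0 e hα0 ne
  have a2 := E1 1 e' hα1 ne'
  have a3 := E2 0 p hγ0 np
  have a4 := E2 1 p' hγ1 np'
  have hep : e ≠ p := by rw [← hα0, ← hγ0]; exact hne _ _
  have hep' : e ≠ p' := by rw [← hα0, ← hγ1]; exact hne _ _
  have hepr : e' ≠ p := by rw [← hα1, ← hγ0]; exact hne _ _
  have hepq : e' ≠ p' := by rw [← hα1, ← hγ1]; exact hne _ _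
  have cl : ∀ a b : ℂ, ‖a‖ = 1 → ‖b‖ = 1 → a ≠ b →
      Complex.log (1 - cj b * a) = cj (Complex.log (1 - cj a * b)) := by
    intro a b ha hb hab
    rw [← Complex.log_conj _ (Complex.slitPlane_arg_ne_pi (slit_one_sub ha hb.le hab))]
    simp [mul_comm]
  rw [cl e p ne np hep, cl e' p ne' np hepr] at a3
  rw [cl e p' ne np' hep', cl e' p' ne' np' hepq] at a4
  have ex : ∀ a b : ℂ, ‖a‖ = 1 → ‖b‖ = 1 → a ≠ b → a - b = a * Complex.exp (Complex.log (1 - cj a * b)) := by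
    intro a b ha hb hab
    rw [Complex.exp_log (Complex.slitPlane_ne_zero (slit_one_sub ha hb.le hab))]
    linear_combination b * unit a ha
  rw [ex e p ne np hep, ex e p' ne np' hep', ex e' p ne' np hepr, ex e' p' ne' np' hepq] at hPi
  set l1 := Complex.log (1 - cj e * p')
  set l2 := Complex.log (1 - cj e * p)
  set l3 := Complex.log (1 - cj e' * p')
  set l4 := Complex.log (1 - cj e' * p)
  have hs : (l1 - l2) + (cj l3 - cj l1) - (l3 - l4) - (cj l4 - cj l2) = 0 := by
    rw [← a1, ← a2, ← a3, ← a4]; ring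
  have him := congrArg Complex.im hs
  simp only [Complex.sub_im, Complex.add_im, Complex.conj_im, Complex.zero_im] at him
  have hP : e * Complex.exp l1 * cj (e * Complex.exp l2) * (e' * Complex.exp l4) * cj (e' * Complex.exp l3)
      = ((Real.exp (l1 + cj l2 + l4 + cj l3).re : ℝ) : ℂ) := by
    have : l1 + cj l2 + l4 + cj l3 = (((l1 + cj l2 + l4 + cj l3).re : ℝ) : ℂ) := by
      apply Complex.ext
      · simp
      · simp only [Complex.add_im, Complex.conj_im, Complex.ofReal_im]; linarith
    rw [Complex.ofReal_exp, ← this, Complex.exp_add, Complex.exp_add, Complex.exp_add]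
    simp only [map_mul, Complex.exp_conj]
    linear_combination (Complex.exp l1 * cj (Complex.exp l2) * Complex.exp l4 * cj (Complex.exp l3)) *
      (unit e ne * (e' * cj e') + unit e' ne')
  rw [hP, Complex.ofReal_re] at hPi
  exact absurd hPi (not_lt.2 (Real.exp_pos _).le)

lemma unit_mul_conj {a : ℂ} (ha : ‖a‖ = 1) : a * cj a = 1 := by
  rw [Complex.mul_conj, Complex.normSq_eq_norm_sq, ha]; simp

lemma unit_tau {a b : ℂ} (ha : ‖a‖ = 1) (hb : ‖b‖ = 1) (h : a + b ≠ 0) :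
    a - b = Complex.I * ((((a - b) / (a + b)).im : ℝ) : ℂ) * (a + b) := by
  have h1 := unit_mul_conj ha
  have h2 := unit_mul_conj hb
  have hr : ((a - b) / (a + b)).re = 0 := by
    have h3 : cj ((a - b) / (a + b)) = - ((a - b) / (a + b)) := by
      rw [map_div₀, map_sub, map_add]
      have h4 : cj a + cj b ≠ 0 := by
        rw [← map_add]; exact (map_ne_zero _).2 h
      field_simp
      linear_combination (2:ℂ) * h1 - 2 * h2
    have := congrArg Complex.re h3
    simp only [Complex.conj_re, Complex.neg_re] at this
    linarith
  have h5 : (a - b) / (a + b) = Complex.I * ((((a - b) / (a + b)).im : ℝ) : ℂ) := by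
    conv_lhs => rw [← Complex.re_add_im ((a - b) / (a + b)), hr]
    simp [mul_comm]
  rw [← h5, div_mul_cancel₀ _ h]

lemma ni_pair {x z : ℂ} (hx : ‖x‖ = 1) (hz : ‖z‖ = 1) (hne : x ≠ z) : ∃ ε > 0, ∀ e e' p p' : ℂ,
    dist e x < ε → dist e' z < ε → dist p x < ε → dist p' z < ε →
    0 < ((e - p') * (e' - p) * cj (e + p) * cj (e' + p')).re := by
  have hc : Continuous fun q : ℂ × ℂ × ℂ × ℂ =>
    ((q.1 - q.2.2.2) * (q.2.1 - q.2.2.1) * cj (q.1 + q.2.2.1) * cj (q.2.1 + q.2.2.2)).re := by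
    fun_prop
  have h0 : 0 < ((x - z) * (z - x) * cj (x + x) * cj (z + z)).re := by
    have h1 := unit_mul_conj hx
    have h2 := unit_mul_conj hz
    have : (x - z) * (z - x) * cj (x + x) * cj (z + z) = ((4 * Complex.normSq (x - z) : ℝ) : ℂ) := by
      rw [Complex.ofReal_mul, ← Complex.mul_conj]
      simp only [map_add, map_sub]
      push_cast
      linear_combination 4 * (-x * cj z * h1 - z * cj x * h2 + (z * cj z) * h1 + (x * cj x) * h2)
    rw [this, Complex.ofReal_re]
    have : 0 < Complex.normSq (x - z) := Complex.normSq_pos.2 (sub_ne_zero.2 hne)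
    linarith
  have := (hc.tendsto (x, z, x, z)).eventually (lt_mem_nhds h0)
  obtain ⟨ε, hε, hb⟩ := Metric.eventually_nhds_iff.1 this
  refine ⟨ε, hε, fun e e' p p' h1 h2 h3 h4 => ?_⟩
  exact hb (y := (e, e', p, p')) (by
    simp only [Prod.dist_eq, max_lt_iff]; exact ⟨h1, h2, h3, h4⟩)

lemma ni_cross {A C : Set ℂ} (hA : IsConnected A) (hC : IsConnected C) (hAk : IsCompact A) (hCk : IsCompact C)
    (hAD : A ⊆ closedBall 0 1) (hCD : C ⊆ closedBall 0 1) {e e' p p' : ℂ} (he : e ∈ A) (he' : e' ∈ A) (hp : p ∈ C)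
    (hp' : p' ∈ C) (ne : ‖e‖ = 1) (ne' : ‖e'‖ = 1) (np : ‖p‖ = 1) (np' : ‖p'‖ = 1)
    (hκ : 0 < ((e - p') * (e' - p) * cj (e + p) * cj (e' + p')).re)
    (hτ : 0 < ((e - p) / (e + p)).im * ((e' - p') / (e' + p')).im) : (A ∩ C).Nonempty := by
  refine crossing hA hC hAk hCk hAD hCD he he' hp hp' ne ne' np np' ?_
  have h1 : e + p ≠ 0 := by intro h; simp [h] at hκ
  have h2 : e' + p' ≠ 0 := by intro h; simp [h] at hκ
  have e1 := congrArg cj (unit_tau ne np h1)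
  have e2 := congrArg cj (unit_tau ne' np' h2)
  rw [e1, mul_assoc, e2]
  set t1 := ((e - p) / (e + p)).im
  set t2 := ((e' - p') / (e' + p')).im
  have : (e - p') * cj (Complex.I * (t1 : ℂ) * (e + p)) * ((e' - p) * cj (Complex.I * (t2 : ℂ) * (e' + p')))
    = ((-(t1 * t2) : ℝ) : ℂ) * ((e - p') * (e' - p) * cj (e + p) * cj (e' + p')) := by
    simp only [map_mul, Complex.conj_I, Complex.conj_ofReal]
    push_cast
    linear_combination ((t1 * t2 : ℂ) * (e - p') * (e' - p) * cj (e + p) * cj (e' + p')) * Complex.I_sq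
  rw [this, Complex.re_ofReal_mul]
  nlinarith

lemma ni {x y z : ℂ} (hx : ‖x‖ = 1) (hy : ‖y‖ = 1) (hz : ‖z‖ = 1) (hxy : x ≠ y) (hxz : x ≠ z) (hyz : y ≠ z) :
    ∃ ε > 0, ∀ A C : Set ℂ, IsConnected A → IsConnected C → IsCompact A → IsCompact C → A ⊆ closedBall 0 1 →
      C ⊆ closedBall 0 1 →
      (∃ a ∈ A, ‖a‖ = 1 ∧ dist a x < ε) → (∃ a ∈ A, ‖a‖ = 1 ∧ dist a y < ε) → (∃ a ∈ A, ‖a‖ = 1 ∧ dist a z < ε) →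
      (∃ a ∈ C, ‖a‖ = 1 ∧ dist a x < ε) → (∃ a ∈ C, ‖a‖ = 1 ∧ dist a y < ε) → (∃ a ∈ C, ‖a‖ = 1 ∧ dist a z < ε) →
      (A ∩ C).Nonempty := by
  obtain ⟨ε1, h1, H1⟩ := ni_pair hx hy hxy
  obtain ⟨ε2, h2, H2⟩ := ni_pair hx hz hxz
  obtain ⟨ε3, h3, H3⟩ := ni_pair hy hz hyz
  refine ⟨min ε1 (min ε2 ε3), by positivity, ?_⟩
  rintro A C hA hC hAk hCk hAD hCD ⟨a1, ha1, na1, d1⟩ ⟨a2, ha2, na2, d2⟩ ⟨a3, ha3, na3, d3⟩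
    ⟨c1, hc1, nc1, d1'⟩ ⟨c2, hc2, nc2, d2'⟩ ⟨c3, hc3, nc3, d3'⟩
  simp only [lt_min_iff] at d1 d2 d3 d1' d2' d3'
  by_contra hcon
  have k1 := H1 a1 a2 c1 c2 d1.1 d2.1 d1'.1 d2'.1
  have k2 := H2 a1 a3 c1 c3 d1.2.1 d3.2.1 d1'.2.1 d3'.2.1
  have k3 := H3 a2 a3 c2 c3 d2.2.2 d3.2.2 d2'.2.2 d3'.2.2
  have tne : ∀ a c : ℂ, a ∈ A → c ∈ C → ‖a‖ = 1 → ‖c‖ = 1 → a + c ≠ 0 → ((a - c) / (a + c)).im ≠ 0 := by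
    intro a c ha hc na nc hs h
    have := unit_tau na nc hs
    rw [h] at this
    simp only [Complex.ofReal_zero, mul_zero, zero_mul, sub_eq_zero] at this
    exact hcon ⟨a, ha, this ▸ hc⟩
  have t1 := tne a1 c1 ha1 hc1 na1 nc1 (by intro h; simp [h] at k1)
  have t2 := tne a2 c2 ha2 hc2 na2 nc2 (by intro h; simp [h] at k1)
  have t3 := tne a3 c3 ha3 hc3 na3 nc3 (by intro h; simp [h] at k2)
  have n1 : ¬ _ := fun h => hcon (ni_cross hA hC hAk hCk hAD hCD ha1 ha2 hc1 hc2 na1 na2 nc1 nc2 k1 h)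
  have n2 : ¬ _ := fun h => hcon (ni_cross hA hC hAk hCk hAD hCD ha1 ha3 hc1 hc3 na1 na3 nc1 nc3 k2 h)
  have n3 : ¬ _ := fun h => hcon (ni_cross hA hC hAk hCk hAD hCD ha2 ha3 hc2 hc3 na2 na3 nc2 nc3 k3 h)
  generalize ((a1 - c1) / (a1 + c1)).im = u1 at *
  generalize ((a2 - c2) / (a2 + c2)).im = u2 at *
  generalize ((a3 - c3) / (a3 + c3)).im = u3 at *
  rcases lt_or_gt_of_ne t1 with s1 | s1 <;> rcases lt_or_gt_of_ne t2 with s2 | s2 <;>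
    rcases lt_or_gt_of_ne t3 with s3 | s3 <;>
    first
    | exact n1 (mul_pos_of_neg_of_neg s1 s2)
    | exact n1 (mul_pos s1 s2)
    | exact n2 (mul_pos_of_neg_of_neg s1 s3)
    | exact n2 (mul_pos s1 s3)
    | exact n3 (mul_pos_of_neg_of_neg s2 s3)
    | exact n3 (mul_pos s2 s3)

lemma sides_neg {e e' : ℂ} (he : ‖e‖ = 1) (he' : ‖e'‖ = 1) (hne : e ≠ e') : ∃ ν : ℂ, ‖ν‖ = 1 ∧
    ((e - (-ν)) * cj (e - ν) * (e' - ν) * cj (e' - (-ν))).re < 0 := by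
  set r := ‖e - e'‖ with hr
  have hr0 : 0 < r := norm_pos_iff.2 (sub_ne_zero.2 hne)
  have hrc : (r : ℂ) ≠ 0 := by exact_mod_cast hr0.ne'
  have u1 := unit_mul_conj he
  have u2 := unit_mul_conj he'
  have hrr : (e - e') * cj (e - e') = (r : ℂ) ^ 2 := by
    rw [Complex.mul_conj, Complex.normSq_eq_norm_sq, ← hr]; push_cast; rfl
  refine ⟨Complex.I * (e - e') / r, ?_, ?_⟩
  · rw [norm_div, norm_mul, Complex.norm_I, one_mul, Complex.norm_real, Real.norm_of_nonneg hr0.le, ← hr, div_self hr0.ne']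
  · set ν := Complex.I * (e - e') / r with hν
    have hνc : cj ν = - Complex.I * (cj e - cj e') / r := by
      simp [hν]
    have h1 : ν * cj ν = 1 := by
      rw [hνc, hν]
      simp only [map_sub] at hrr
      field_simp
      rw [← hrr]
      linear_combination (-(e - e') * (cj e - cj e')) * Complex.I_sq
    have h2 : e * cj ν = ν * cj e' := by
      rw [hνc, hν]
      field_simp
      linear_combination -u1 + u2
    have h2' : cj e * ν = cj ν * e' := by
      have := congrArg cj h2
      simpa using this
    have key : (e - (-ν)) * cj (e - ν) * (e' - ν) * cj (e' - (-ν)) =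
        (1 + e * cj e') * cj (1 + e * cj e') - 4
          + (2 * (e * cj ν) * cj (1 + e * cj e') - cj (2 * (e * cj ν) * cj (1 + e * cj e'))) := by
      simp only [map_sub, map_add, map_neg, map_mul, Complex.conj_conj, map_one, map_ofNat]
      have a1 : (e - -ν) * (cj e' - -cj ν) = 1 + e * cj e' + 2 * (e * cj ν) := by
        linear_combination h1 - h2
      have a2 : (cj e - cj ν) * (e' - ν) = 1 + cj e * e' - 2 * (cj e * ν) := by
        linear_combination h1 + h2'
      have a3 : (e * cj ν) * (cj e * ν) = 1 := by linear_combination (ν * cj ν) * u1 + h1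
      calc (e - -ν) * (cj e - cj ν) * (e' - ν) * (cj e' - -cj ν)
          = ((e - -ν) * (cj e' - -cj ν)) * ((cj e - cj ν) * (e' - ν)) := by ring
        _ = _ := by
          rw [a1, a2]; linear_combination (-4 : ℂ) * a3
    rw [key]
    have k2 : ∀ w : ℂ, (w - cj w).re = 0 := by intro w; simp
    have k3 : (1 + e * cj e') * cj (1 + e * cj e') = 4 - (r : ℂ) ^ 2 := by
      rw [← hrr]
      simp only [map_sub, map_add, map_mul, Complex.conj_conj, map_one]
      linear_combination (2 + (e' * cj e') - 1) * u1 + 2 * u2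
    rw [Complex.add_re, k2, k3, add_zero]
    have : ((4 : ℂ) - (r : ℂ) ^ 2 - 4).re = - r ^ 2 := by
      norm_cast; simp
    rw [this]
    nlinarith

lemma at_most_one {A : Set ℂ} (hAk : IsCompact A) (hA : IsConnected A) (hAD : A ⊆ closedBall 0 1)
    (hU : IsPreconnected (closedBall (0 : ℂ) 1 \ A))
    (hhin : ∀ w : ℂ, ‖w‖ = 1 → ∀ ε > 0, ∃ p : ℂ, ‖p‖ = 1 ∧ dist p w < ε ∧ p ∉ A) {e e' : ℂ}
    (he : e ∈ A) (he' : e' ∈ A) (ne : ‖e‖ = 1) (ne' : ‖e'‖ = 1) : e = e' := by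
  by_contra hne
  obtain ⟨ν, hν, hneg⟩ := sides_neg ne ne' hne
  have hc : Continuous fun q : ℂ × ℂ => ((e - q.2) * cj (e - q.1) * (e' - q.1) * cj (e' - q.2)).re := by
    fun_prop
  have h0 := (hc.tendsto (ν, -ν)).eventually (gt_mem_nhds hneg)
  obtain ⟨ε, hε, hb⟩ := Metric.eventually_nhds_iff.1 h0
  obtain ⟨p, np, dp, hp⟩ := hhin ν hν ε hε
  obtain ⟨p', np', dp', hp'⟩ := hhin (-ν) (by simpa using hν) ε hε
  have hPi := hb (y := (p, p')) (by simp only [Prod.dist_eq, max_lt_iff]; exact ⟨dp, dp'⟩)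
  obtain ⟨X, hX, hXc, hCX, hXs⟩ := hull_exists (isCompact_closedBall (0:ℂ) 1) (convex_closedBall _ _) hAk.isClosed hU
    ⟨p, by simp [np], hp⟩ (C := {p, p'}) (by simp) (by
      rintro w (rfl | rfl)
      · exact ⟨by simp [np], hp⟩
      · exact ⟨by simp [np'], hp'⟩)
  obtain ⟨w, hw, hw'⟩ := crossing hA hXc hAk hX hAD (hXs.trans sdiff_subset) he he' (hCX (by simp)) (hCX (by simp))
    ne ne' np np' hPi
  exact (hXs hw').2 hw

end Conj

lemma isClosed_ccIn {X : Type*} [TopologicalSpace X] {F : Set X} (hF : IsClosed F) (x : X) :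
    IsClosed (connectedComponentIn F x) := by
  by_cases hx : x ∈ F
  · rw [← closure_subset_iff_isClosed]
    exact isPreconnected_connectedComponentIn.closure.subset_connectedComponentIn
      (subset_closure (mem_connectedComponentIn hx))
      (closure_minimal (connectedComponentIn_subset _ _) hF)
  · rw [connectedComponentIn_eq_empty hx]; exact isClosed_empty

lemma preconn_preimage {X Y : Type*} [TopologicalSpace X] [TopologicalSpace Y] [T2Space Y] {M : Set X}
    (hM : IsCompact M) {G : X → Y} (hc : ContinuousOn G M) (hi : InjOn G M) {Z : Set Y}
    (hZ : IsPreconnected Z) (hZM : Z ⊆ G '' M) : IsPreconnected (M ∩ G ⁻¹' Z) := by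
  have : CompactSpace M := isCompact_iff_compactSpace.1 hM
  have hemb : Topology.IsClosedEmbedding (M.domRestrict G) :=
    (continuousOn_iff_continuous_domRestrict.1 hc).isClosedEmbedding (injOn_iff_injective.1 hi)
  have h1 : (M.domRestrict G) '' {x | G x ∈ Z} = Z := by
    ext z
    constructor
    · rintro ⟨x, hx, rfl⟩; exact hx
    · intro hz
      obtain ⟨x, hx, rfl⟩ := hZM hz
      exact ⟨⟨x, hx⟩, hz, rfl⟩
  have h2 : IsPreconnected {x : M | G x ∈ Z} := by
    rw [← hemb.isInducing.isPreconnected_image, h1]; exact hZ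
  have h3 := h2.image Subtype.val continuous_subtype_val.continuousOn
  convert h3 using 1
  ext x
  simp only [mem_inter_iff, mem_preimage, mem_image, mem_ofPred_eq, Subtype.exists, exists_and_right, exists_eq_right]
  constructor
  · rintro ⟨a, b⟩; exact ⟨a, b⟩
  · rintro ⟨a, b⟩; exact ⟨a, b⟩

lemma haus_lim_mem {X : Type*} [MetricSpace X] {Q : ℕ → Set X} {L : Set X} (hQ : ∀ n, IsCompact (Q n))
    (hL : IsCompact L) (hLn : L.Nonempty)
    (h : Tendsto (fun n => hausdorffDist (Q n) L) atTop (𝓝 0)) {x : ℕ → X} {y : X}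
    (hx : ∀ n, x n ∈ Q n) (hy : Tendsto x atTop (𝓝 y)) : y ∈ L := by
  rw [hL.isClosed.mem_iff_infDist_zero hLn]
  have h1 : Tendsto (fun n => infDist (x n) L) atTop (𝓝 (infDist y L)) :=
    ((continuous_infDist_pt L).tendsto y).comp hy
  have h2 : Tendsto (fun n => infDist (x n) L) atTop (𝓝 0) := by
    refine squeeze_zero (fun n => infDist_nonneg) (fun n => ?_) h
    refine infDist_le_hausdorffDist_of_mem (hx n)
      (hausdorffEDist_ne_top_of_nonempty_of_bounded ⟨_, hx n⟩ hLn (hQ n).isBounded hL.isBounded)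
  exact tendsto_nhds_unique h1 h2

lemma disc_norm {g1 g2 : ℂ} (h1 : ‖g1‖ = 1) (h2 : ‖g2‖ = 1) (hne : g1 ≠ g2) :
    ∃ N : ℂ ≃ₜ ℂ, N '' closedBall 0 1 = closedBall 0 1 ∧ N '' sphere 0 1 = sphere 0 1 ∧
      N g1 = 1 ∧ N g2 = -1 ∧
      ∀ z, z ∈ closedBall (0 : ℂ) 1 → ∃ t > 0, (N z).im = t * ((z - g2) * (starRingEnd ℂ) (g1 - g2)).im := by
  set r := ‖g1 - g2‖ with hr
  have hrpos : 0 < r := norm_pos_iff.2 (sub_ne_zero.2 hne)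
  set e : ℂ := (g1 - g2) / r with he
  have hene : ‖e‖ = 1 := by
    rw [he, norm_div, Complex.norm_real, Real.norm_of_nonneg hrpos.le, ← hr, div_self hrpos.ne']
  have he0 : e ≠ 0 := by rw [← norm_pos_iff, hene]; exact one_pos
  have hec : (starRingEnd ℂ) e * e = 1 := by
    rw [mul_comm, Complex.mul_conj, Complex.normSq_eq_norm_sq, hene]; simp
  set p : ℂ := (g1 + g2) / 2 with hp
  have hp1 : ‖p‖ < 1 := by
    have h := parallelogram_law_with_norm ℝ g1 g2
    rw [h1, h2, ← hr] at h
    have : ‖p‖ = ‖g1 + g2‖ / 2 := by rw [hp, norm_div]; simp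
    rw [this]
    nlinarith [norm_nonneg (g1 + g2)]
  -- the rigid motion
  let A : ℂ ≃ₜ ℂ := (Homeomorph.subRight p).trans (Homeomorph.mulRight₀ ((starRingEnd ℂ) e) (by simpa using he0))
  have hA : ∀ z, A z = (z - p) * (starRingEnd ℂ) e := fun z => rfl
  have hAd : ∀ z w, dist (A z) (A w) = dist z w := by
    intro z w
    rw [dist_eq_norm, dist_eq_norm, hA, hA, ← sub_mul, norm_mul, RCLike.norm_conj, hene]; simp
  have hAb : A '' closedBall 0 1 = closedBall (A 0) 1 := by
    ext y
    constructor
    · rintro ⟨z, hz, rfl⟩; rw [mem_closedBall, hAd]; exact hz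
    · intro hy
      refine ⟨A.symm y, ?_, by simp⟩
      rw [mem_closedBall, ← hAd]; simpa using hy
  have hAs : A '' ball 0 1 = ball (A 0) 1 := by
    ext y
    constructor
    · rintro ⟨z, hz, rfl⟩; rw [mem_ball, hAd]; exact hz
    · intro hy
      refine ⟨A.symm y, ?_, by simp⟩
      rw [mem_ball, ← hAd]; simpa using hy
  have hA0 : ‖A 0‖ < 1 := by rw [hA, norm_mul, RCLike.norm_conj, hene]; simpa using hp1
  set s := closedBall (A 0) 1
  set t := closedBall (0 : ℂ) 1
  have hs0 : s ∈ 𝓝 0 := closedBall_mem_nhds_of_mem (by rw [mem_ball, dist_zero_left]; exact hA0)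
  have ht0 : t ∈ 𝓝 0 := closedBall_mem_nhds 0 one_pos
  have hsb : Bornology.IsVonNBounded ℝ s := NormedSpace.isVonNBounded_of_isBounded _ isBounded_closedBall
  have htb : Bornology.IsVonNBounded ℝ t := NormedSpace.isVonNBounded_of_isBounded _ isBounded_closedBall
  let R := gaugeRescaleHomeomorph s t (convex_closedBall _ _) hs0 hsb (convex_closedBall _ _) ht0 htb
  have hR1 : R '' s = t := by
    have := image_gaugeRescaleHomeomorph_closure (convex_closedBall (A 0) 1) hs0 hsb (convex_closedBall (0:ℂ) 1) ht0 htb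
    rwa [isClosed_closedBall.closure_eq, isClosed_closedBall.closure_eq] at this
  have hR2 : R '' ball (A 0) 1 = ball 0 1 := by
    have := image_gaugeRescaleHomeomorph_interior (convex_closedBall (A 0) 1) hs0 hsb (convex_closedBall (0:ℂ) 1) ht0 htb
    rwa [interior_closedBall _ one_ne_zero, interior_closedBall _ one_ne_zero] at this
  have hR3 : ∀ w, ∃ c > 0, R w = (c : ℝ) • w := by
    intro w
    rcases eq_or_ne w 0 with rfl | hw
    · exact ⟨1, one_pos, by simp [R, gaugeRescaleHomeomorph, gaugeRescaleEquiv]⟩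
    · exact ⟨gauge s w / gauge t w, div_pos ((gauge_pos (absorbent_nhds_zero hs0) hsb).2 hw)
        ((gauge_pos (absorbent_nhds_zero ht0) htb).2 hw), rfl⟩
  have himg : ∀ S : Set ℂ, (A.trans R) '' S = R '' (A '' S) := by
    intro S; ext z; simp
  have hsph : (A.trans R) '' sphere 0 1 = sphere 0 1 := by
    rw [← closedBall_sdiff_ball, image_sdiff (A.trans R).injective, himg, himg, hAb, hAs, hR1, hR2]
  have hN : ∀ z, (A.trans R) z = R (A z) := fun z => rfl
  have hAg1 : A g1 = ((r / 2 : ℝ) : ℂ) := by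
    have : g1 - p = ((r / 2 : ℝ) : ℂ) * e := by
      have hrc : (r : ℂ) ≠ 0 := by exact_mod_cast hrpos.ne'
      rw [he, hp]; push_cast; field_simp; ring
    rw [hA, this, mul_assoc, mul_comm e, hec, mul_one]
  have hAg2 : A g2 = ((-(r / 2) : ℝ) : ℂ) := by
    have : g2 - p = ((-(r / 2) : ℝ) : ℂ) * e := by
      have hrc : (r : ℂ) ≠ 0 := by exact_mod_cast hrpos.ne'
      rw [he, hp]; push_cast; field_simp; ring
    rw [hA, this, mul_assoc, mul_comm e, hec, mul_one]
  have hn : ∀ g, ‖g‖ = 1 → ‖(A.trans R) g‖ = 1 := by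
    intro g hg
    have : (A.trans R) g ∈ sphere (0 : ℂ) 1 := hsph ▸ mem_image_of_mem _ (by simpa using hg)
    simpa using this
  refine ⟨A.trans R, by rw [himg, hAb, hR1], hsph, ?_, ?_, ?_⟩
  · have := hn g1 h1
    rw [hN, hAg1] at this ⊢
    obtain ⟨c, hc, hRc⟩ := hR3 ((r / 2 : ℝ) : ℂ)
    rw [hRc, norm_smul, Complex.norm_real, Real.norm_of_nonneg hc.le,
      Real.norm_of_nonneg (by positivity)] at this
    rw [hRc, Complex.real_smul, ← Complex.ofReal_mul, this]; simp
  · have := hn g2 h2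
    rw [hN, hAg2] at this ⊢
    obtain ⟨c, hc, hRc⟩ := hR3 ((-(r / 2) : ℝ) : ℂ)
    rw [hRc, norm_smul, Complex.norm_real, Real.norm_of_nonneg hc.le, norm_neg,
      Real.norm_of_nonneg (by positivity)] at this
    rw [hRc, Complex.real_smul, ← Complex.ofReal_mul, mul_neg, this]; simp
  · intro z _
    obtain ⟨c, hc, hRc⟩ := hR3 (A z)
    refine ⟨c / r, by positivity, ?_⟩
    rw [hN, hRc, Complex.smul_im, smul_eq_mul, hA]
    have e1 : (z - g2) * (starRingEnd ℂ) (g1 - g2) = r * ((z - p) * (starRingEnd ℂ) e) + ((r * r / 2 : ℝ) : ℂ) := by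
      have hge : g1 - g2 = r * e := by
        have hrc : (r : ℂ) ≠ 0 := by exact_mod_cast hrpos.ne'
        rw [he]; field_simp
      have : z - g2 = (z - p) + (r / 2 : ℝ) * e := by
        have hrc : (r : ℂ) ≠ 0 := by exact_mod_cast hrpos.ne'
        rw [he, hp]; push_cast; field_simp; ring
      rw [this, hge, map_mul, Complex.conj_ofReal, add_mul]
      push_cast
      linear_combination (r : ℂ) * r / 2 * hec
    rw [e1, Complex.add_im, Complex.ofReal_im, add_zero, Complex.im_ofReal_mul]
    field_simp

structure QData {S : Type*} [MetricSpace S] (K : Set S) (G : ℂ → S) (C : ℕ → Set ℂ) (a b : ℕ → ℂ)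
    (a' b' : ℂ) : Prop where
  cont : ContinuousOn G (closedBall 0 1)
  inj : InjOn G (closedBall 0 1)
  conn : ∀ n, IsPreconnected (C n)
  sub : ∀ n, C n ⊆ closedBall 0 1 ∩ G ⁻¹' K
  sep : ∀ X ⊆ closedBall 0 1 ∩ G ⁻¹' K, IsPreconnected X → ∀ n m, (X ∩ C n).Nonempty →
    (X ∩ C m).Nonempty → n = m
  ha : ∀ n, a n ∈ C n ∩ sphere 0 1
  hb : ∀ n, b n ∈ C n ∩ sphere 0 1
  ta : Tendsto a atTop (𝓝 a')
  tb : Tendsto b atTop (𝓝 b')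

lemma QData.transfer {S : Type*} [MetricSpace S] {K : Set S} {G : ℂ → S} {C : ℕ → Set ℂ} {a b : ℕ → ℂ}
    {a' b' : ℂ} (h : QData K G C a b a' b') (N : ℂ ≃ₜ ℂ) (hN : N '' closedBall 0 1 = closedBall 0 1)
    (hN2 : N '' sphere 0 1 = sphere 0 1) :
    QData K (G ∘ N.symm) (fun n => N '' C n) (N ∘ a) (N ∘ b) (N a') (N b') := by
  have hs : MapsTo N.symm (closedBall 0 1) (closedBall 0 1) := by
    intro z hz; rw [← hN] at hz; obtain ⟨w, hw, rfl⟩ := hz; simpa using hw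
  have hs' : MapsTo N (closedBall 0 1) (closedBall 0 1) := by
    intro z hz; rw [← hN]; exact mem_image_of_mem _ hz
  have hs2 : MapsTo N (sphere 0 1) (sphere 0 1) := by
    intro z hz; rw [← hN2]; exact mem_image_of_mem _ hz
  refine ⟨h.cont.comp N.symm.continuous.continuousOn hs, h.inj.comp N.symm.injective.injOn hs,
    fun n => (h.conn n).image _ N.continuous.continuousOn, ?_, ?_, ?_, ?_,
    (N.continuous.tendsto _).comp h.ta, (N.continuous.tendsto _).comp h.tb⟩
  · rintro n _ ⟨z, hz, rfl⟩
    exact ⟨hs' (h.sub n hz).1, by simpa using (h.sub n hz).2⟩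
  · intro X hX hXc n m h1 h2
    refine h.sep (N.symm '' X) ?_ (hXc.image _ N.symm.continuous.continuousOn) n m ?_ ?_
    · rintro _ ⟨z, hz, rfl⟩; exact ⟨hs (hX hz).1, (hX hz).2⟩
    · obtain ⟨_, hz, w, hw, rfl⟩ := h1
      exact ⟨w, ⟨_, hz, by simp⟩, hw⟩
    · obtain ⟨_, hz, w, hw, rfl⟩ := h2
      exact ⟨w, ⟨_, hz, by simp⟩, hw⟩
  · exact fun n => ⟨mem_image_of_mem _ (h.ha n).1, hs2 (h.ha n).2⟩
  · exact fun n => ⟨mem_image_of_mem _ (h.hb n).1, hs2 (h.hb n).2⟩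

lemma QData.isCompact {S : Type*} [MetricSpace S] {K : Set S} {G : ℂ → S} {C : ℕ → Set ℂ} {a b : ℕ → ℂ}
    {a' b' : ℂ} (h : QData K G C a b a' b') (hK : IsClosed K) : IsCompact (closedBall 0 1 ∩ G ⁻¹' K) :=
  (isCompact_closedBall (0 : ℂ) 1).of_isClosed_subset
    (h.cont.preimage_isClosed_of_isClosed isClosed_closedBall hK) inter_subset_left

lemma QData.quad {S : Type*} [MetricSpace S] [CompactSpace S] {K : Set S} {G : ℂ → S} {C : ℕ → Set ℂ}
    {a b : ℕ → ℂ} {a' b' : ℂ} (h : QData K G C a b a' b') (hK : IsClosed K)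
    (h1 : G 1 ∉ K) (h2 : G (-1) ∉ K) (ha : 0 < a'.im) (hb : b'.im < 0) :
    (G b', G a') ∈ schonfliesRel K := by
  have hMk := h.isCompact hK
  set M := closedBall 0 1 ∩ G ⁻¹' K with hM
  have ha's : a' ∈ sphere (0 : ℂ) 1 := isClosed_sphere.mem_of_tendsto h.ta (Eventually.of_forall fun n => (h.ha n).2)
  have hb's : b' ∈ sphere (0 : ℂ) 1 := isClosed_sphere.mem_of_tendsto h.tb (Eventually.of_forall fun n => (h.hb n).2)
  have ha'M : a' ∈ M := hMk.isClosed.mem_of_tendsto h.ta (Eventually.of_forall fun n => h.sub n (h.ha n).1)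
  have hb'M : b' ∈ M := hMk.isClosed.mem_of_tendsto h.tb (Eventually.of_forall fun n => h.sub n (h.hb n).1)
  obtain ⟨c, hc0, hc1, hcM⟩ : ∃ c : ℝ, 0 < c ∧ c < 1 ∧ ∀ z ∈ M, |z.re| < c := by
    obtain ⟨z0, hz0, hmax⟩ := hMk.exists_isMaxOn ⟨a', ha'M⟩ (f := fun z : ℂ => |z.re|)
      (by fun_prop)
    have hlt : |z0.re| < 1 := by
      have hn : ‖z0‖ ≤ 1 := by simpa using hz0.1
      by_contra hge
      push Not at hge
      have hsq : z0.re * z0.re + z0.im * z0.im ≤ 1 := by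
        rw [← Complex.normSq_apply, Complex.normSq_eq_norm_sq]
        exact pow_le_one₀ (norm_nonneg _) hn
      have h3 : 1 ≤ z0.re * z0.re := by rw [← abs_mul_abs_self]; nlinarith
      have h4 : z0.im = 0 := by nlinarith
      have h5 : z0.re = 1 ∨ z0.re = -1 := by
        have : z0.re * z0.re = 1 := by nlinarith
        exact mul_self_eq_one_iff.1 this
      rcases h5 with h5 | h5
      · exact h1 (by rw [← show z0 = 1 from Complex.ext (by simp [h5]) (by simp [h4])]; exact hz0.2)
      · exact h2 (by rw [← show z0 = -1 from Complex.ext (by simp [h5]) (by simp [h4])]; exact hz0.2)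
    refine ⟨(1 + |z0.re|) / 2, by positivity, by linarith, fun z hz => ?_⟩
    have : |z.re| ≤ |z0.re| := hmax hz
    linarith
  let ψ : unitInterval × unitInterval → ℂ := fun q =>
    ⟨c * (2 * (q.1 : ℝ) - 1), (2 * (q.2 : ℝ) - 1) * √(1 - (c * (2 * (q.1 : ℝ) - 1)) ^ 2)⟩
  have hψc : Continuous ψ := continuous_cmk (by fun_prop) (by fun_prop)
  have hx : ∀ q : unitInterval × unitInterval, |c * (2 * (q.1 : ℝ) - 1)| ≤ c := by
    intro q
    have e1 := q.1.2.1
    have e2 := q.1.2.2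
    rw [abs_mul, abs_of_pos hc0]
    have : |2 * (q.1 : ℝ) - 1| ≤ 1 := by rw [abs_le]; constructor <;> linarith
    nlinarith
  have hpos : ∀ x : ℝ, |x| ≤ c → 0 < 1 - x ^ 2 := by
    intro x hx
    rw [abs_le] at hx
    nlinarith
  have hψi : Function.Injective ψ := by
    intro p q hpq
    have e1 : c * (2 * (p.1 : ℝ) - 1) = c * (2 * (q.1 : ℝ) - 1) := congrArg Complex.re hpq
    have e2 : (2 * (p.2 : ℝ) - 1) * √(1 - (c * (2 * (p.1 : ℝ) - 1)) ^ 2) =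
      (2 * (q.2 : ℝ) - 1) * √(1 - (c * (2 * (q.1 : ℝ) - 1)) ^ 2) := congrArg Complex.im hpq
    rw [e1] at e2
    have e3 := mul_right_cancel₀ (Real.sqrt_pos.2 (hpos _ (hx q))).ne' e2
    have e4 := mul_left_cancel₀ hc0.ne' e1
    exact Prod.ext (Subtype.ext (by linarith)) (Subtype.ext (by linarith))
  have hψΔ : ∀ q, ψ q ∈ closedBall (0 : ℂ) 1 := by
    intro q
    rw [mem_closedBall_zero_iff, ← sq_le_one_iff₀ (norm_nonneg _), ← Complex.normSq_eq_norm_sq, Complex.normSq_apply]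
    simp only [ψ]
    have e1 := q.2.2.1
    have e2 := q.2.2.2
    have e3 := Real.mul_self_sqrt (hpos _ (hx q)).le
    have e4 := hpos _ (hx q)
    set x := c * (2 * (q.1 : ℝ) - 1)
    have e5 : (2 * (q.2 : ℝ) - 1) * (2 * (q.2 : ℝ) - 1) ≤ 1 := by nlinarith
    have : (2 * (q.2 : ℝ) - 1) * √(1 - x ^ 2) * ((2 * (q.2 : ℝ) - 1) * √(1 - x ^ 2)) =
      ((2 * (q.2 : ℝ) - 1) * (2 * (q.2 : ℝ) - 1)) * (1 - x ^ 2) := by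
      linear_combination ((2 * (q.2 : ℝ) - 1) * (2 * (q.2 : ℝ) - 1)) * e3
    rw [this]; nlinarith
  have hψs : ∀ z ∈ closedBall (0 : ℂ) 1, |z.re| ≤ c → ∃ q, ψ q = z ∧
      (z ∈ sphere (0 : ℂ) 1 → (z.im < 0 → q.2 = 0) ∧ (0 < z.im → q.2 = 1)) := by
    intro z hz hzc
    have hz1 : z.re * z.re + z.im * z.im ≤ 1 := by
      rw [← Complex.normSq_apply, Complex.normSq_eq_norm_sq]
      exact pow_le_one₀ (norm_nonneg _) (by simpa using hz)
    have hp := hpos _ hzc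
    have hsq := Real.sqrt_pos.2 hp
    have hms := Real.mul_self_sqrt hp.le
    set y := √(1 - z.re ^ 2)
    have hy : |z.im| ≤ y := by
      rw [← abs_of_pos hsq]; exact sq_le_sq.1 (by nlinarith)
    rw [abs_le] at hy hzc
    have g1 : z.re / c ≤ 1 := by rw [div_le_one hc0]; exact hzc.2
    have g2 : -1 ≤ z.re / c := by rw [le_div_iff₀ hc0]; linarith [hzc.1]
    have g3 : z.im / y ≤ 1 := by rw [div_le_one hsq]; exact hy.2
    have g4 : -1 ≤ z.im / y := by rw [le_div_iff₀ hsq]; linarith [hy.1]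
    refine ⟨(⟨(z.re / c + 1) / 2, by linarith, by linarith⟩, ⟨(z.im / y + 1) / 2, by linarith, by linarith⟩), ?_, ?_⟩
    · have e1 : c * (2 * ((z.re / c + 1) / 2) - 1) = z.re := by field_simp; ring
      apply Complex.ext
      · exact e1
      · simp only [ψ, e1]
        change (2 * ((z.im / y + 1) / 2) - 1) * y = z.im
        field_simp; ring
    · intro hzs
      have hz2 : z.re * z.re + z.im * z.im = 1 := by
        rw [← Complex.normSq_apply, Complex.normSq_eq_norm_sq, mem_sphere_zero_iff_norm.1 hzs]; norm_num
      constructor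
      · intro hneg
        have : z.im = -y := by nlinarith
        refine Subtype.ext ?_
        simp only [this, Set.Icc.coe_zero]; field_simp; norm_num
      · intro hneg
        have : z.im = y := by nlinarith
        refine Subtype.ext ?_
        simp only [this, Set.Icc.coe_one]; field_simp; norm_num
  have hφc : Continuous (G ∘ ψ) := h.cont.comp_continuous hψc hψΔ
  have hφi : Function.Injective (G ∘ ψ) := fun p q hpq => hψi (h.inj (hψΔ p) (hψΔ q) hpq)
  have hKr : K ∩ range (G ∘ ψ) = G '' M := by
    ext y
    constructor
    · rintro ⟨hy, q, rfl⟩; exact ⟨ψ q, ⟨hψΔ q, hy⟩, rfl⟩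
    · rintro ⟨z, hz, rfl⟩
      obtain ⟨q, hq, _⟩ := hψs z hz.1 (hcM z hz).le
      exact ⟨hz.2, q, by simp [hq]⟩
  have hbot : ∀ z ∈ M, z ∈ sphere (0 : ℂ) 1 → z.im < 0 → G z ∈ (G ∘ ψ) '' {q | q.2 = 0} := by
    intro z hz hzs hzi
    obtain ⟨q, hq, hq2⟩ := hψs z hz.1 (hcM z hz).le
    exact ⟨q, (hq2 hzs).1 hzi, by simp [hq]⟩
  have htop : ∀ z ∈ M, z ∈ sphere (0 : ℂ) 1 → 0 < z.im → G z ∈ (G ∘ ψ) '' {q | q.2 = 1} := by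
    intro z hz hzs hzi
    obtain ⟨q, hq, hq2⟩ := hψs z hz.1 (hcM z hz).le
    exact ⟨q, (hq2 hzs).2 hzi, by simp [hq]⟩
  have hGM : IsCompact (G '' M) := hMk.image_of_continuousOn (h.cont.mono inter_subset_left)
  let Q : ℕ → Set S := fun n => connectedComponentIn (G '' M) (G (b n))
  have hbM : ∀ n, G (b n) ∈ G '' M := fun n => mem_image_of_mem _ (h.sub n (h.hb n).1)
  have hCQ : ∀ n, G '' C n ⊆ Q n := fun n =>
    ((h.conn n).image G (h.cont.mono fun z hz => (h.sub n hz).1)).subset_connectedComponentIn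
      (mem_image_of_mem _ (h.hb n).1) (image_mono (h.sub n))
  have hQk : ∀ n, IsCompact (Q n) := fun n => (isClosed_ccIn hGM.isClosed _).isCompact
  have hQc : ∀ n, IsConnected (Q n) := fun n => isConnected_connectedComponentIn_iff.2 (hbM n)
  have hQd : ∀ m n, Q m = Q n → m = n := by
    intro m n hmn
    have hpre := preconn_preimage hMk (h.cont.mono inter_subset_left) (h.inj.mono inter_subset_left)
      (isPreconnected_connectedComponentIn (F := G '' M) (x := G (b n))) (connectedComponentIn_subset _ _)
    refine h.sep _ inter_subset_left hpre m n ⟨b m, ⟨h.sub m (h.hb m).1, ?_⟩, (h.hb m).1⟩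
      ⟨b n, ⟨h.sub n (h.hb n).1, mem_connectedComponentIn (hbM n)⟩, (h.hb n).1⟩
    change G (b m) ∈ Q n
    rw [← hmn]; exact mem_connectedComponentIn (hbM m)
  obtain ⟨n0, hn0⟩ : ∃ n0, ∀ n ≥ n0, 0 < (a n).im ∧ (b n).im < 0 := by
    have e1 := ((Complex.continuous_im.tendsto _).comp h.ta).eventually (lt_mem_nhds ha)
    have e2 := ((Complex.continuous_im.tendsto _).comp h.tb).eventually (gt_mem_nhds hb)
    exact eventually_atTop.1 (e1.and e2)
  obtain ⟨τ, L, hτ, hLk, hLc, hLt⟩ := hausdorff_subseq (fun n => Q (n + n0)) (fun n => hQk _) (fun n => hQc _)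
  have hcG : ∀ (u : ℕ → ℂ) (u' : ℂ), (∀ n, u n ∈ C n ∩ sphere 0 1) → Tendsto u atTop (𝓝 u') → u' ∈ M → G u' ∈ L := by
    intro u u' hu htu hu'
    have t1 : Tendsto (fun n => G (u n)) atTop (𝓝 (G u')) := by
      have := (h.cont u' hu'.1).tendsto
      refine this.comp (tendsto_nhdsWithin_iff.2 ⟨htu, Eventually.of_forall fun n => (h.sub n (hu n).1).1⟩)
    refine haus_lim_mem (fun n => hQk _) hLk hLc.1 hLt (x := fun n => G (u (τ n + n0)))
      (fun n => hCQ _ (mem_image_of_mem _ (hu _).1)) ?_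
    exact t1.comp ((tendsto_add_atTop_nat n0).comp hτ.tendsto_atTop)
  refine ⟨hb'M.2, ha'M.2, Or.inr ⟨G ∘ ψ, (hφc.isClosedEmbedding hφi).isEmbedding,
    hbot b' hb'M hb's hb, htop a' ha'M ha's ha, ?_, fun n => Q (τ n + n0), ?_, ?_, ?_, L, hLk, hLc, hLt,
    hcG b b' h.hb h.tb hb'M, hcG a a' h.ha h.ta ha'M⟩⟩
  · rintro _ ⟨hy, q, hq, rfl⟩
    have hqM : ψ q ∈ M := ⟨hψΔ q, hy⟩
    have hlt := hcM _ hqM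
    rcases hq with hq | hq | hq | hq
    · exfalso
      simp only [ψ, hq, Set.Icc.coe_zero] at hlt
      rw [abs_lt] at hlt; linarith
    · exfalso
      simp only [ψ, hq, Set.Icc.coe_one] at hlt
      rw [abs_lt] at hlt; linarith
    · exact Or.inl ⟨q, hq, rfl⟩
    · exact Or.inr ⟨q, hq, rfl⟩
  · intro m n hmn heq
    have e1 := hQd _ _ heq
    exact hmn (hτ.injective (by omega))
  · intro n
    rw [hKr]
    exact ⟨G (b (τ n + n0)), hbM _, rfl⟩
  · intro n
    have hh := hn0 (τ n + n0) (by omega)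
    exact ⟨⟨_, mem_connectedComponentIn (hbM _), hbot _ (h.sub _ (h.hb _).1) (h.hb _).2 hh.2⟩,
      ⟨_, hCQ _ (mem_image_of_mem _ (h.ha _).1), htop _ (h.sub _ (h.ha _).1) (h.ha _).2 hh.1⟩⟩

lemma halfcircle_preconn (e : ℝ) (he : e = 1 ∨ e = -1) :
    IsPreconnected {z : ℂ | ‖z‖ = 1 ∧ 0 ≤ e * z.im} := by
  have : {z : ℂ | ‖z‖ = 1 ∧ 0 ≤ e * z.im} = (fun x : ℝ => (⟨x, e * √(1 - x ^ 2)⟩ : ℂ)) '' Icc (-1) 1 := by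
    have hee : e * e = 1 := by rcases he with rfl | rfl <;> norm_num
    ext z
    constructor
    · rintro ⟨h1, h2⟩
      have hz2 : z.re * z.re + z.im * z.im = 1 := by
        rw [← Complex.normSq_apply, Complex.normSq_eq_norm_sq, h1]; norm_num
      refine ⟨z.re, ⟨by nlinarith, by nlinarith⟩, Complex.ext rfl ?_⟩
      have : √(1 - z.re ^ 2) = e * z.im := by
        rw [Real.sqrt_eq_iff_mul_self_eq (by nlinarith) h2]
        linear_combination -(z.im * z.im * hee + hz2)
      simp only [this]; linear_combination z.im * hee
    · rintro ⟨x, hx, rfl⟩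
      have h0 : 0 ≤ 1 - x ^ 2 := by nlinarith [hx.1, hx.2]
      constructor
      · rw [← sq_eq_sq₀ (norm_nonneg _) zero_le_one, ← Complex.normSq_eq_norm_sq, Complex.normSq_apply]
        simp only
        linear_combination e * e * Real.mul_self_sqrt h0 + (1 - x ^ 2) * hee
      · simp only
        have := Real.sqrt_nonneg (1 - x ^ 2)
        rw [← mul_assoc, hee]; simp
  rw [this]
  refine isPreconnected_Icc.image _ (Continuous.continuousOn ?_)
  exact continuous_cmk (by fun_prop) (by fun_prop)

lemma QData.swap {S : Type*} [MetricSpace S] {K : Set S} {G : ℂ → S} {C : ℕ → Set ℂ} {a b : ℕ → ℂ}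
    {a' b' : ℂ} (h : QData K G C a b a' b') : QData K G C b a b' a' :=
  ⟨h.cont, h.inj, h.conn, h.sub, h.sep, h.hb, h.ha, h.tb, h.ta⟩

lemma quad_lemma {S : Type*} [MetricSpace S] [CompactSpace S] {K : Set S} {G : ℂ → S} {C : ℕ → Set ℂ}
    {a b : ℕ → ℂ} {a' b' : ℂ} (h : QData K G C a b a' b') (hK : IsClosed K) {Z1 Z2 : Set ℂ}
    (hZ1 : IsClosed Z1) (hZ2 : IsClosed Z2) (hd : Disjoint Z1 Z2)
    (hZ : ∀ z ∈ sphere (0 : ℂ) 1, G z ∈ K → z ∈ Z1 ∪ Z2) (haZ : ∀ n, a n ∈ Z1) (hbZ : ∀ n, b n ∈ Z2) :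
    (G a', G b') ∈ schonfliesRel K := by
  have ha's : a' ∈ sphere (0 : ℂ) 1 := isClosed_sphere.mem_of_tendsto h.ta (Eventually.of_forall fun n => (h.ha n).2)
  have hb's : b' ∈ sphere (0 : ℂ) 1 := isClosed_sphere.mem_of_tendsto h.tb (Eventually.of_forall fun n => (h.hb n).2)
  have ha'Z : a' ∈ Z1 := hZ1.mem_of_tendsto h.ta (Eventually.of_forall haZ)
  have hb'Z : b' ∈ Z2 := hZ2.mem_of_tendsto h.tb (Eventually.of_forall hbZ)
  have hne : a' ≠ b' := fun e => hd.ne_of_mem ha'Z hb'Z e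
  have ha'M : a' ∈ closedBall (0 : ℂ) 1 ∩ G ⁻¹' K :=
    (h.isCompact hK).isClosed.mem_of_tendsto h.ta (Eventually.of_forall fun n => h.sub n (h.ha n).1)
  have hb'M : b' ∈ closedBall (0 : ℂ) 1 ∩ G ⁻¹' K :=
    (h.isCompact hK).isClosed.mem_of_tendsto h.tb (Eventually.of_forall fun n => h.sub n (h.hb n).1)
  obtain ⟨N, hN1, hN2, hNa, hNb, -⟩ := disc_norm (mem_sphere_zero_iff_norm.1 ha's) (mem_sphere_zero_iff_norm.1 hb's) hne
  have hNa' : N.symm 1 = a' := by rw [← hNa]; simp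
  have hNb' : N.symm (-1) = b' := by rw [← hNb]; simp
  have key : ∀ e : ℝ, (e = 1 ∨ e = -1) → ∃ g : ℂ, ‖g‖ = 1 ∧ 0 < e * g.im ∧ G (N.symm g) ∉ K := by
    intro e he
    by_contra hcon
    push Not at hcon
    have hsub : {z : ℂ | ‖z‖ = 1 ∧ 0 ≤ e * z.im} ⊆ (N.symm ⁻¹' Z1) ∪ (N.symm ⁻¹' Z2) := by
      rintro z ⟨hz1, hz2⟩
      have hzs : N.symm z ∈ sphere (0 : ℂ) 1 := by
        have : z ∈ N '' sphere 0 1 := by rw [hN2]; simpa using hz1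
        obtain ⟨w, hw, rfl⟩ := this; simpa using hw
      apply hZ _ hzs
      rcases hz2.lt_or_eq with h3 | h3
      · exact hcon z hz1 h3
      · have h4 : z.im = 0 := by rcases he with rfl | rfl <;> linarith
        have hz2 : z.re * z.re + z.im * z.im = 1 := by
          rw [← Complex.normSq_apply, Complex.normSq_eq_norm_sq, hz1]; norm_num
        rw [h4] at hz2
        rcases mul_self_eq_one_iff.1 (show z.re * z.re = 1 by linarith) with h5 | h5
        · rw [show z = 1 from Complex.ext (by simp [h5]) (by simp [h4]), hNa']; exact ha'M.2
        · rw [show z = -1 from Complex.ext (by simp [h5]) (by simp [h4]), hNb']; exact hb'M.2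
    have := isPreconnected_closed_iff.1 (halfcircle_preconn e he) _ _ (hZ1.preimage N.symm.continuous)
      (hZ2.preimage N.symm.continuous) hsub ⟨1, by simp, by simpa [hNa'] using ha'Z⟩ ⟨-1, by simp, by simpa [hNb'] using hb'Z⟩
    obtain ⟨z, -, hz1, hz2⟩ := this
    exact hd.ne_of_mem hz1 hz2 rfl
  obtain ⟨g1, hg1, hi1, hG1⟩ := key 1 (Or.inl rfl)
  obtain ⟨g2, hg2, hi2, hG2⟩ := key (-1) (Or.inr rfl)
  have hi1 : 0 < g1.im := by linarith
  have hi2 : g2.im < 0 := by linarith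
  obtain ⟨N2, hM1, hM2, hMa, hMb, hs⟩ := disc_norm hg1 hg2 (fun e => by rw [e] at hi1; linarith)
  have H := ((h.transfer N hN1 hN2).transfer N2 hM1 hM2).swap
  have hre : ∀ g : ℂ, ‖g‖ = 1 → g.im ≠ 0 → -1 < g.re ∧ g.re < 1 := by
    intro z hz1 hz0
    have hz2 : z.re * z.re + z.im * z.im = 1 := by
      rw [← Complex.normSq_apply, Complex.normSq_eq_norm_sq, hz1]; norm_num
    have := mul_self_pos.2 hz0
    constructor <;> nlinarith
  have r1 := hre g1 hg1 hi1.ne'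
  have r2 := hre g2 hg2 hi2.ne
  have Hq := H.quad hK (by
      have : N2.symm 1 = g1 := by rw [← hMa]; simp
      simpa [this] using hG1) (by
      have : N2.symm (-1) = g2 := by rw [← hMb]; simp
      simpa [this] using hG2)
    (by
      rw [hNb]
      obtain ⟨t, ht, hte⟩ := hs (-1) (by simp)
      rw [hte]
      refine mul_pos ht ?_
      simp [Complex.mul_im]
      nlinarith [r1.1, r2.1, mul_pos hi1 (show 0 < 1 + g2.re by linarith [r2.1]), mul_pos (neg_pos.2 hi2) (show 0 < 1 + g1.re by linarith [r1.1])])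
    (by
      rw [hNa]
      obtain ⟨t, ht, hte⟩ := hs 1 (by simp)
      rw [hte]
      refine mul_neg_of_pos_of_neg ht ?_
      simp [Complex.mul_im]
      nlinarith [r1.1, r2.1, mul_pos hi1 (show 0 < 1 - g2.re by linarith [r2.2]), mul_pos (neg_pos.2 hi2) (show 0 < 1 - g1.re by linarith [r1.2])])
  simpa using Hq

lemma hex_unique {a b : ℤ × ℤ} {z : ℂ} (ha : hexG (z - hctr a) < 1) (hb : z ∈ hexCell b) : b = a := by
  have hlt : ∀ z, hexG z < 1 ↔
    (-1 < hL0 z ∧ hL0 z < 1) ∧ (-1 < hL1 z ∧ hL1 z < 1) ∧ (-1 < hL2 z ∧ hL2 z < 1) := by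
    intro z; simp only [hexG, max_lt_iff, abs_lt]
  obtain ⟨m, n⟩ := a
  obtain ⟨m', n'⟩ := b
  simp only [hlt] at ha
  simp only [hexCell, mem_ofPred_eq, hexG_le_iff, hL0, hL1, hL2, hctr, Complex.sub_re,
      Complex.sub_im] at ha hb
  have e1 : ((2 * (m' - m) - (n' - n) : ℤ) : ℝ) < (2 : ℤ) := by push_cast; linarith
  have e2 : ((-2 : ℤ) : ℝ) < ((2 * (m' - m) - (n' - n) : ℤ) : ℝ) := by push_cast; linarith
  have e3 : (((m' - m) + (n' - n) : ℤ) : ℝ) < (2 : ℤ) := by push_cast; linarith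
  have e4 : ((-2 : ℤ) : ℝ) < (((m' - m) + (n' - n) : ℤ) : ℝ) := by push_cast; linarith
  have e5 : ((2 * (n' - n) - (m' - m) : ℤ) : ℝ) < (2 : ℤ) := by push_cast; linarith
  have e6 : ((-2 : ℤ) : ℝ) < ((2 * (n' - n) - (m' - m) : ℤ) : ℝ) := by push_cast; linarith
  rw [Int.cast_lt] at e1 e2 e3 e4 e5 e6
  have : m = m' ∧ n = n' := by omega
  rw [this.1, this.2]

lemma cell_approx (Φ : ℂ ≃ₜ ℂ) {o : ℤ × ℤ} {z : ℂ} (hz : Φ z ∈ hexCell o) {U : Set ℂ} (hU : U ∈ 𝓝 z) :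
    ∃ w ∈ U, ∀ b, Φ w ∈ hexCell b → b = o := by
  let p : ℝ → ℂ := fun t => Φ.symm (hctr o + t • (Φ z - hctr o))
  have hp : Continuous p := Φ.symm.continuous.comp (by fun_prop)
  have hp1 : p 1 = z := by simp [p]
  have h1 : p ⁻¹' U ∈ 𝓝 (1 : ℝ) := hp.continuousAt.preimage_mem_nhds (by rw [hp1]; exact hU)
  have h2 : ∀ᶠ t in 𝓝[<] (1 : ℝ), p t ∈ U := mem_nhdsWithin_of_mem_nhds h1
  have h3 : ∀ᶠ t in 𝓝[<] (1 : ℝ), t ∈ Ico 0 1 := Ico_mem_nhdsLT one_pos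
  obtain ⟨t, ht, ht2⟩ := (h2.and h3).exists
  refine ⟨p t, ht, fun b hb => hex_unique ?_ hb⟩
  have hz' : hexG (Φ z - hctr o) ≤ 1 := hz
  simp only [p, Homeomorph.apply_symm_apply, add_sub_cancel_left]
  rw [hexG_smul _ _ ht2.1]
  have := mul_le_mul_of_nonneg_left hz' ht2.1
  linarith [ht2.2]

lemma cells_closed (Φ : ℂ ≃ₜ ℂ) (P : Set (ℤ × ℤ)) : IsClosed {z | ∃ o ∈ P, Φ z ∈ hexCell o} := by
  have : {z | ∃ o ∈ P, Φ z ∈ hexCell o} = Φ ⁻¹' hexU P := by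
    ext z; simp only [mem_ofPred_eq, mem_preimage, mem_hexU]
  rw [this]; exact (isClosed_hexU P).preimage Φ.continuous

/-- The box. -/
def boxB : Set ℂ := {z | |z.re| ≤ 1 ∧ 0 ≤ z.im ∧ z.im ≤ 2}

lemma boxB_eq : boxB = Complex.reCLM ⁻¹' Icc (-1) 1 ∩ Complex.imCLM ⁻¹' Icc 0 2 := by
  ext z; simp [boxB, abs_le]

lemma boxB_convex : Convex ℝ boxB := by
  rw [boxB_eq]
  exact ((convex_Icc _ _).linear_preimage Complex.reCLM.toLinearMap).inter
    ((convex_Icc _ _).linear_preimage Complex.imCLM.toLinearMap)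

lemma boxB_closed : IsClosed boxB := by
  rw [boxB_eq]
  exact (isClosed_Icc.preimage Complex.reCLM.continuous).inter (isClosed_Icc.preimage Complex.imCLM.continuous)

lemma boxB_compact : IsCompact boxB := by
  refine (isCompact_closedBall (0 : ℂ) 3).of_isClosed_subset boxB_closed ?_
  intro z hz
  rw [mem_closedBall_zero_iff]
  have := Complex.norm_le_abs_re_add_abs_im z
  have h2 : |z.im| ≤ 2 := by rw [abs_le]; constructor <;> linarith [hz.2.1, hz.2.2]
  linarith [hz.1]

lemma segment_preconn (x y : ℂ) : IsPreconnected (segment ℝ x y) := (convex_segment x y).isPreconnected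

lemma segment_compact (x y : ℂ) : IsCompact (segment ℝ x y) := by
  rw [segment_eq_image_lineMap]
  exact isCompact_Icc.image (AffineMap.lineMap_continuous)

/-- Stage 1 -/
lemma fl_cut {h : ℂ → ℝ} (hh : Continuous h) {E : Set ℂ} (hEk : IsClosed E) (hEB : E ⊆ boxB) {q : ℂ} (hqE : q ∈ E)
    {s : ℝ} (hs : h q = s) {A : Set ℂ} (hA : A = connectedComponentIn (E ∩ {z | h z = s}) q) {ε0 : ℝ} (hε0 : 0 < ε0)
    (hBA : IsPreconnected (boxB \ A)) (hne : ∃ z ∈ boxB, ε0 ≤ infDist z A) :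
    ∃ (δ : ℂ → ℝ) (ρ μ : ℝ) (X1 : Set ℂ), (∀ z w, |δ z - δ w| ≤ dist z w) ∧ δ q = 0 ∧ 0 < ρ ∧ 0 < μ ∧
      IsCompact X1 ∧ IsPreconnected X1 ∧ X1 ⊆ boxB ∧ (∀ z ∈ boxB, ε0 / 2 ≤ infDist z A → z ∈ X1) ∧
      (∀ z ∈ X1, ρ ≤ δ z) ∧ (∀ w ∈ X1, ∀ a ∈ boxB, a ∉ X1 → ∃ p ∈ segment ℝ w a, δ p < ρ) ∧
      (∀ z ∈ E, μ ≤ |h z - s| + |δ z - ρ|) := by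
  have hY : IsCompact (E ∩ {z | h z = s}) :=
    boxB_compact.of_isClosed_subset (hEk.inter (isClosed_eq hh continuous_const)) (inter_subset_left.trans hEB)
  set Y := E ∩ {z | h z = s} with hYd
  have hqY : q ∈ Y := ⟨hqE, hs⟩
  have hqA : q ∈ A := hA ▸ mem_connectedComponentIn hqY
  have hAc : IsClosed A := hA ▸ isClosed_ccIn hY.isClosed q
  have hD0 : IsCompact {z | z ∈ boxB ∧ ε0 / 2 ≤ infDist z A} :=
    boxB_compact.inter_right (isClosed_le continuous_const (continuous_infDist_pt A))
  set D0 := {z | z ∈ boxB ∧ ε0 / 2 ≤ infDist z A}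
  obtain ⟨z0, hz0, hz0'⟩ := hne
  have hz0D : z0 ∈ D0 := ⟨hz0, by linarith⟩
  have hD0A : D0 ⊆ boxB \ A := fun z hz => ⟨hz.1, fun hzA => by
    have := hz.2; rw [infDist_zero_of_mem hzA] at this; linarith⟩
  obtain ⟨X0, hX0k, hX0c, hDX, hX0⟩ := hull_exists boxB_compact boxB_convex hAc hBA ⟨z0, hD0A hz0D⟩ hD0 hD0A
  obtain ⟨Y1, Y2, hY1, hY2, hU, hd, hq1, hX2⟩ := split_compact hY (isClosed_singleton (x := q)) hX0k.isClosed (by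
    rintro C hC hCc ⟨_, hqC, rfl⟩ ⟨x, hxC, hx⟩
    exact (hX0 hx).2 (hA ▸ hCc.subset_connectedComponentIn hqC hC hxC))
  have hqY1 : q ∈ Y1 := hq1 ⟨hqY, rfl⟩
  have hdX : ∀ z ∈ X0 ∪ Y2, z ∉ Y1 := by
    rintro z (hz | hz) hz1
    · exact hd.ne_of_mem hz1 (hX2 ⟨hU ▸ Or.inl hz1, hz⟩) rfl
    · exact hd.ne_of_mem hz1 hz rfl
  obtain ⟨zm, hzm, hmin⟩ := (hX0k.union hY2).exists_isMinOn ⟨z0, Or.inl (hDX hz0D)⟩ (continuous_infDist_pt Y1).continuousOn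
  have hpos : 0 < infDist zm Y1 := (hY1.isClosed.notMem_iff_infDist_pos ⟨q, hqY1⟩).1 (hdX zm hzm)
  have hmin' : ∀ z ∈ X0 ∪ Y2, infDist zm Y1 ≤ infDist z Y1 := fun z hz => hmin hz
  set ρ := infDist zm Y1 / 2
  have hρ : 0 < ρ := by positivity
  have hW : IsCompact {z | z ∈ boxB ∧ ρ ≤ infDist z Y1} :=
    boxB_compact.inter_right (isClosed_le continuous_const (continuous_infDist_pt Y1))
  set W := {z | z ∈ boxB ∧ ρ ≤ infDist z Y1}
  have hX0W : X0 ⊆ W := fun z hz => ⟨(hX0 hz).1, by have := hmin' z (Or.inl hz); simp only [ρ]; linarith⟩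
  have hx0 := hDX hz0D
  set X1 := connectedComponentIn W z0 with hX1
  have hX1W : X1 ⊆ W := connectedComponentIn_subset _ _
  have hX01 : X0 ⊆ X1 := hX0c.isPreconnected.subset_connectedComponentIn hx0 hX0W
  have hX1k : IsCompact X1 := hW.of_isClosed_subset (isClosed_ccIn hW.isClosed _) hX1W
  have hEc : IsCompact E := boxB_compact.of_isClosed_subset hEk hEB
  obtain ⟨e, he, hemin⟩ := hEc.exists_isMinOn ⟨q, hqE⟩ (f := fun z => |h z - s| + |infDist z Y1 - ρ|)
    (Continuous.continuousOn (by have := continuous_infDist_pt Y1; fun_prop))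
  refine ⟨fun z => infDist z Y1, ρ, |h e - s| + |infDist e Y1 - ρ|, X1, ?_, infDist_zero_of_mem hqY1, hρ, ?_, hX1k,
    isPreconnected_connectedComponentIn, fun z hz => (hX1W hz).1, fun z hz hz2 => hX01 (hDX ⟨hz, hz2⟩),
    fun z hz => (hX1W hz).2, ?_, fun z hz => hemin hz⟩
  · intro z w
    have := (lipschitz_infDist_pt Y1).dist_le_mul z w
    simpa [Real.dist_eq] using this
  · by_contra hcon
    have h1 := abs_nonneg (h e - s)
    have h2 := abs_nonneg (infDist e Y1 - ρ)
    have h3 : h e = s := by have : |h e - s| = 0 := by linarith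
                            linarith [abs_eq_zero.1 this]
    have h4 : infDist e Y1 = ρ := by have : |infDist e Y1 - ρ| = 0 := by linarith
                                     linarith [abs_eq_zero.1 this]
    have : e ∈ Y1 ∪ Y2 := hU ▸ ⟨he, h3⟩
    rcases this with h5 | h5
    · rw [infDist_zero_of_mem h5] at h4; linarith
    · have := hmin' e (Or.inr h5); simp only [ρ] at h4 hρ; linarith
  · intro w hw a ha haX
    by_contra hcon
    push Not at hcon
    apply haX
    have hsW : segment ℝ w a ⊆ W := fun p hp => ⟨boxB_convex.segment_subset (hX1W hw).1 ha hp, hcon p hp⟩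
    have h1 := (segment_preconn w a).subset_connectedComponentIn (left_mem_segment ℝ w a) hsW
    rw [hX1, connectedComponentIn_eq hw]
    exact h1 (right_mem_segment ℝ w a)

noncomputable def boxR (z : ℂ) : ℂ := ⟨max (-1) (min 1 z.re), max 0 (min 2 z.im)⟩

lemma boxR_cont : Continuous boxR := continuous_cmk (by fun_prop) (by fun_prop)

lemma boxR_mem (z : ℂ) : boxR z ∈ boxB := by
  refine ⟨?_, le_max_left _ _, max_le (by norm_num) (min_le_left _ _)⟩
  simp only [boxR]
  rw [abs_le]
  exact ⟨le_max_left _ _, max_le (by norm_num) (min_le_left _ _)⟩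

lemma boxR_id {z : ℂ} (hz : z ∈ boxB) : boxR z = z := by
  obtain ⟨h1, h2, h3⟩ := hz
  rw [abs_le] at h1
  apply Complex.ext
  · simp only [boxR]; rw [min_eq_right h1.2, max_eq_right h1.1]
  · simp only [boxR]; rw [min_eq_right h3, max_eq_right h2]

lemma fl_arc {M Cn Cm X1 : Set ℂ} (hM : IsCompact M) (hMB : M ⊆ boxB) (hn : IsCompact Cn) (hm : IsCompact Cm)
    (hnc : IsPreconnected Cn) (hmc : IsPreconnected Cm) (hnM : Cn ⊆ M) (hmM : Cm ⊆ M)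
    (hsep : ∀ X ⊆ M, IsPreconnected X → (X ∩ Cn).Nonempty → (X ∩ Cm).Nonempty → False)
    (hX : IsCompact X1) (hXc : IsPreconnected X1) (hXB : X1 ⊆ boxB) (hnX : (Cn ∩ X1).Nonempty)
    (hmX : (Cm ∩ X1).Nonempty) {p p' : ℂ} (hp : p ∈ Cn) (hp' : p' ∈ Cm) :
    ∃ sg, IsCompact sg ∧ IsPreconnected sg ∧ Disjoint sg M ∧ (sg ∩ segment ℝ p p').Nonempty ∧
      (sg ∩ X1).Nonempty := by
  obtain ⟨M1, M2, hM1, hM2, hU, hd, hs1, hs2⟩ := split_compact hM hn.isClosed hm.isClosed hsep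
  obtain ⟨θ, h0, h1, -⟩ := exists_continuous_zero_one_of_isClosed hM1.isClosed hM2.isClosed hd
  have hn1 : Cn ⊆ M1 := fun z hz => hs1 ⟨hnM hz, hz⟩
  have hm1 : Cm ⊆ M2 := fun z hz => hs2 ⟨hmM hz, hz⟩
  have hJc : IsPreconnected (Cn ∪ X1 ∪ Cm) := by
    obtain ⟨x, hx, hx1⟩ := hnX
    obtain ⟨y, hy, hy1⟩ := hmX
    exact (hnc.union x hx hx1 hXc).union y (Or.inr hy1) hy hmc
  obtain ⟨sg, hk, hc, hsub, hI, hJ⟩ := tool_theta (I' := segment ℝ p p') (J := Cn ∪ X1 ∪ Cm) boxB_compact boxR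
    boxR_cont boxR_mem (fun z hz => boxR_id hz) θ θ.continuous (segment_compact p p').isClosed
    ((hn.union hX).union hm).isClosed (boxB_convex.segment_subset (hMB (hnM hp)) (hMB (hmM hp')))
    (union_subset (union_subset (hnM.trans hMB) hXB) (hmM.trans hMB)) (segment_preconn p p') hJc
    (left_mem_segment ℝ p p') (Or.inl (Or.inl hp)) (right_mem_segment ℝ p p') (Or.inr hp')
    (h0 (hn1 hp)) (h1 (hm1 hp'))
  have hdis : ∀ z ∈ sg, z ∉ M := by
    intro z hz hzM
    have hz2 := (hsub hz).2
    rw [← hU] at hzM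
    rcases hzM with h | h
    · have := h0 h; simp only [mem_preimage, this] at hz2; norm_num at hz2
    · have := h1 h; simp only [mem_preimage, this] at hz2; norm_num at hz2
  refine ⟨sg, hk, hc, disjoint_left.2 hdis, hI, ?_⟩
  obtain ⟨z, hz, (hz1 | hz1) | hz1⟩ := hJ
  · exact absurd (hnM hz1) (hdis z hz)
  · exact ⟨z, hz, hz1⟩
  · exact absurd (hmM hz1) (hdis z hz)

lemma omega_conn {X1 c : Set ℂ} (hX : IsPreconnected X1) (hc : IsPreconnected c) (hXc : (X1 ∩ c).Nonempty)
    (h2 : (⟨0, 2⟩ : ℂ) ∈ X1) : IsPreconnected (boxBᶜ ∪ X1 ∪ c) := by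
  have e1 : IsPreconnected {z : ℂ | 2 < z.im} := (convex_halfSpace_im_gt 2).isPreconnected
  have e2 : IsPreconnected {z : ℂ | z.im < 0} := (convex_halfSpace_im_lt 0).isPreconnected
  have e3 : IsPreconnected {z : ℂ | 1 < z.re} := (convex_halfSpace_re_gt 1).isPreconnected
  have e4 : IsPreconnected {z : ℂ | z.re < -1} := (convex_halfSpace_re_lt (-1)).isPreconnected
  have f1 := e1.union (⟨2, 3⟩ : ℂ) (by norm_num) (by norm_num) e3
  have f2 := f1.union (⟨-2, 3⟩ : ℂ) (Or.inl (by norm_num)) (by norm_num) e4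
  have f3 := f2.union (⟨-2, -3⟩ : ℂ) (Or.inr (by norm_num)) (by norm_num) e2
  have hB : boxBᶜ = {z : ℂ | 2 < z.im} ∪ {z : ℂ | 1 < z.re} ∪ {z : ℂ | z.re < -1} ∪ {z : ℂ | z.im < 0} := by
    ext z
    simp only [boxB, mem_compl_iff, mem_ofPred_eq, abs_le, mem_union]
    constructor
    · intro h
      by_contra hcon
      push Not at hcon
      exact h ⟨⟨hcon.1.2, hcon.1.1.2⟩, hcon.2, hcon.1.1.1⟩
    · rintro (((h | h) | h) | h) h' <;> linarith [h'.1.1, h'.1.2, h'.2.1, h'.2.2]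
  rw [← hB] at f3
  have f4 : IsPreconnected (insert (⟨0, 2⟩ : ℂ) boxBᶜ) := by
    refine f3.subset_closure (subset_insert _ _) (insert_subset ?_ subset_closure)
    rw [Metric.mem_closure_iff]
    intro ε hε
    refine ⟨⟨0, 2 + ε / 2⟩, fun h => ?_, ?_⟩
    · have := h.2.2; simp only at this; linarith
    · rw [Complex.dist_of_re_eq (by simp)]
      simp only [Real.dist_eq]; rw [abs_lt]; constructor <;> linarith
  obtain ⟨x, hx1, hxc⟩ := hXc
  have f5 := (f4.union _ (mem_insert _ _) h2 hX).union x (Or.inr hx1) hxc hc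
  have : boxBᶜ ∪ X1 = insert (⟨0, 2⟩ : ℂ) boxBᶜ ∪ X1 := by
    rw [insert_union, insert_eq_of_mem (show (⟨0, 2⟩ : ℂ) ∈ boxBᶜ ∪ X1 from Or.inr h2)]
  rwa [this]

theorem final_lemma {S : Type*} [MetricSpace S] [CompactSpace S] {K : Set S} (hK : IsClosed K) {F : ℂ → S}
    (hF : Continuous F) {Hs : S → ℝ} (hHs : Continuous Hs) (hHK : ∀ p ∈ schonfliesRel K, Hs p.1 = Hs p.2)
    {C : ℕ → Set ℂ} (hCk : ∀ n, IsCompact (C n)) (hCc : ∀ n, IsPreconnected (C n))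
    (hCM : ∀ n, C n ⊆ boxB ∩ F ⁻¹' K)
    (hsep : ∀ X ⊆ boxB ∩ F ⁻¹' K, IsPreconnected X → ∀ n m, (X ∩ C n).Nonempty → (X ∩ C m).Nonempty → n = m)
    {qs : ℕ → ℂ} (hqs : ∀ n, qs n ∈ C n) {q : ℂ} (hq : Tendsto qs atTop (𝓝 q)) (hqi : 0 < q.im)
    {E : Set ℂ} (hEk : IsClosed E) (hEM : E ⊆ boxB ∩ F ⁻¹' K)
    (hE : ∀ (k : ℕ → ℕ) (z : ℕ → ℂ) (x : ℂ), StrictMono k → (∀ j, z j ∈ C (k j)) → Tendsto z atTop (𝓝 x) → x ∈ E)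
    {A : Set ℂ} (hA : A = connectedComponentIn (E ∩ {z | Hs (F z) = Hs (F q)}) q) {ε0 : ℝ} (hε0 : 0 < ε0)
    (hbox : ∀ z : ℂ, 0 ≤ z.im → infDist z A < ε0 → z ∈ boxB) (hBA : IsPreconnected (boxB \ A))
    (hinj : InjOn F {z | z ∈ boxB ∧ infDist z A < ε0}) (hfar : ∀ n, ∃ z ∈ C n, ε0 ≤ infDist z A) : False := by
  have hqE : q ∈ E := hE id qs q strictMono_id hqs hq
  have hhc : Continuous fun z => Hs (F z) := hHs.comp hF
  obtain ⟨δ, ρ, μ, X1, hδ, hδq, hρ, hμ, hX1k, hX1c, hX1B, hX0, hX1ρ, hX1m, hμE⟩ :=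
    fl_cut hhc hEk (hEM.trans inter_subset_left) hqE rfl hA hε0 hBA (by
      obtain ⟨z, hz, hz2⟩ := hfar 0; exact ⟨z, (hCM 0 hz).1, hz2⟩)
  have hMk : IsCompact (boxB ∩ F ⁻¹' K) := boxB_compact.inter_right (hK.preimage hF)
  set M := boxB ∩ F ⁻¹' K with hMd
  have hCX : ∀ n, (C n ∩ X1).Nonempty := by
    intro n
    obtain ⟨z, hz, hz2⟩ := hfar n
    exact ⟨z, hz, hX0 z (hCM n hz).1 (by linarith)⟩
  -- the radius r
  obtain ⟨r, hr, hrρ, hri, hrh⟩ : ∃ r > 0, 3 * r < ρ ∧ 3 * r < q.im ∧ ∀ z, dist z q < 3 * r → |Hs (F z) - Hs (F q)| < μ / 4 := by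
    obtain ⟨d, hd, hd2⟩ := Metric.continuousAt_iff.1 (hhc.continuousAt (x := q)) (μ / 4) (by positivity)
    refine ⟨min (d / 3) (min (ρ / 4) (q.im / 4)), by positivity, ?_, ?_, ?_⟩
    · linarith [(min_le_right (d / 3) (min (ρ / 4) (q.im / 4))).trans (min_le_left _ _)]
    · linarith [(min_le_right (d / 3) (min (ρ / 4) (q.im / 4))).trans (min_le_right _ _)]
    · intro z hz
      have := hd2 (x := z) (by linarith [min_le_left (d / 3) (min (ρ / 4) (q.im / 4))])
      simpa [Real.dist_eq] using this
  have hX1q : ∀ z ∈ X1, 3 * r < dist z q := by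
    intro z hz
    have h1 := hX1ρ z hz
    have h2 := hδ z q
    rw [hδq, sub_zero] at h2
    linarith [le_abs_self (δ z)]
  -- the arc
  obtain ⟨n0, hn0⟩ := eventually_atTop.1 (hq.eventually (ball_mem_nhds q hr))
  obtain ⟨sg, hsgk, hsgc, hsgM, ⟨g, hgs, hgI⟩, ⟨g', hgs', hgX⟩⟩ := fl_arc hMk inter_subset_left (hCk n0) (hCk (n0 + 1))
    (hCc _) (hCc _) (hCM _) (hCM _) (fun X hX hXc h1 h2 => by have := hsep X hX hXc n0 (n0 + 1) h1 h2; omega)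
    hX1k hX1c hX1B (hCX _) (hCX _) (hqs n0) (hqs (n0 + 1))
  have hgb : g ∈ ball q r := (convex_ball q r).segment_subset (hn0 n0 le_rfl) (hn0 (n0 + 1) (by omega)) hgI
  have hgq : segment ℝ g q ⊆ ball q r := (convex_ball q r).segment_subset hgb (mem_ball_self hr)
  set c := sg ∪ segment ℝ g q with hc
  have hcc : IsPreconnected c := hsgc.union g hgs (left_mem_segment ℝ g q) (segment_preconn g q)
  have hqc : q ∈ c := Or.inr (right_mem_segment ℝ g q)
  obtain ⟨ν, hν, hνM⟩ : ∃ ν > 0, ∀ z ∈ M, ∀ w ∈ sg, ν ≤ dist z w := by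
    obtain ⟨ν, hν, h⟩ := hsgM.exists_thickenings hsgk hMk.isClosed
    refine ⟨ν, hν, fun z hz w hw => ?_⟩
    by_contra hlt
    push Not at hlt
    refine h.ne_of_mem (a := w) (b := w) (self_subset_thickening hν _ hw) (mem_thickening_iff.2 ⟨z, hz, ?_⟩) rfl
    rwa [dist_comm]
  set Ω := boxBᶜ ∪ X1 ∪ c with hΩd
  have h2i : (⟨0, 2⟩ : ℂ) ∈ X1 := by
    refine hX0 _ (by refine ⟨by simp, by simp, by simp⟩) ?_
    by_contra hlt
    push Not at hlt
    have := hbox ⟨0, 2 + ε0 / 4⟩ (by simp only; linarith) (by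
      have h1 := infDist_le_infDist_add_dist (s := A) (x := (⟨0, 2 + ε0 / 4⟩ : ℂ)) (y := ⟨0, 2⟩)
      rw [Complex.dist_of_re_eq (by simp)] at h1
      simp only [Real.dist_eq, add_sub_cancel_left, abs_of_pos (show 0 < ε0 / 4 by positivity)] at h1
      linarith)
    have := this.2.2
    simp only at this; linarith
  have hΩ : IsPreconnected Ω := omega_conn hX1c hcc ⟨g', hgX, Or.inl hgs'⟩ h2i
  have hΩR : ∀ z : ℂ, 3 < ‖z‖ → z ∈ Ω := by
    intro z hz
    left; left
    intro hzB
    have := Complex.norm_le_abs_re_add_abs_im z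
    have h2 : |z.im| ≤ 2 := by rw [abs_le]; constructor <;> linarith [hzB.2.1, hzB.2.2]
    linarith [hzB.1]
  -- the mesh
  obtain ⟨m, hm, hmr, hmν, hmε, hmμ⟩ : ∃ m > 0, m < r ∧ m < ν ∧ m < ε0 / 2 ∧ m < μ / 4 :=
    ⟨min r (min ν (min (ε0 / 2) (μ / 4))) / 2, by positivity,
      by linarith [min_le_left r (min ν (min (ε0 / 2) (μ / 4)))],
      by linarith [(min_le_right r (min ν (min (ε0 / 2) (μ / 4)))).trans (min_le_left _ _)],
      by linarith [((min_le_right r (min ν (min (ε0 / 2) (μ / 4)))).trans (min_le_right _ _)).trans (min_le_left _ _)],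
      by linarith [((min_le_right r (min ν (min (ε0 / 2) (μ / 4)))).trans (min_le_right _ _)).trans (min_le_right _ _)]⟩
  obtain ⟨Φ, hΦm, hΦ0, hΦn, hΦn2⟩ := grid_exists hm
  obtain ⟨J, hJf, h, hsph, hcell, hcov⟩ := cell_domains Φ hΩ 3 hΩR
  set G1 := {z | ∃ o ∈ {o | ∃ w ∈ X1, Φ w ∈ hexCell o}, Φ z ∈ hexCell o} with hG1
  set G2 := {z | ∃ o ∈ {o | ∃ w ∈ c, Φ w ∈ hexCell o}, Φ z ∈ hexCell o} with hG2
  set P2 := {z | ∃ o ∈ {o | ∀ w ∈ Ω, Φ w ∉ hexCell o}, Φ z ∈ hexCell o} with hP2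
  have cG1 : IsClosed G1 := cells_closed Φ _
  have cG2 : IsClosed G2 := cells_closed Φ _
  have cP2 : IsClosed P2 := cells_closed Φ _
  have hP2Ω : ∀ z ∈ P2, z ∉ Ω := by rintro z ⟨o, ho, hz⟩ hzΩ; exact ho z hzΩ hz
  have hP2B : P2 ⊆ boxB := by
    intro z hz; by_contra h; exact hP2Ω z hz (Or.inl (Or.inl h))
  have hP2X : ∀ z ∈ P2, z ∉ X1 := fun z hz h => hP2Ω z hz (Or.inl (Or.inr h))
  have hP2d : ∀ z ∈ P2, infDist z A < ε0 / 2 := by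
    intro z hz; by_contra h; push Not at h
    exact hP2X z hz (hX0 z (hP2B hz) h)
  have hG1q : ∀ z ∈ G1, 2 * r < dist z q := by
    rintro z ⟨o, ⟨w, hw, hwo⟩, hz⟩
    have h1 := hX1q w hw
    have h2 := hΦm o z w hz hwo
    have h3 := dist_triangle w z q
    rw [dist_comm w z] at h3
    linarith
  have hG2q : ∀ z ∈ G2, z ∈ M → dist z q < 2 * r := by
    rintro z ⟨o, ⟨w, hw, hwo⟩, hz⟩ hzM
    have h2 := hΦm o z w hz hwo
    rcases hw with hw | hw
    · exact absurd (hνM z hzM w hw) (by linarith)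
    · have h1 := mem_ball.1 (hgq hw)
      linarith [dist_triangle z w q]
  have hrow : ∀ z : ℂ, 0 ≤ z.im → ∃ o : ℤ × ℤ, 0 ≤ o.2 ∧ Φ z ∈ hexCell o := by
    have hcl := cells_closed Φ {o | 0 ≤ o.2}
    have hsub : {z : ℂ | 0 < z.im} ⊆ {z | ∃ o ∈ {o : ℤ × ℤ | 0 ≤ o.2}, Φ z ∈ hexCell o} := by
      intro z hz
      obtain ⟨o, ho⟩ := hexCell_cover (Φ z)
      refine ⟨o, ?_, ho⟩
      by_contra hneg
      have := hΦn o z (not_le.1 hneg) ho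
      exact absurd hz (not_lt.2 this)
    intro z hz
    have := hcl.closure_subset_iff.2 hsub
    rw [Complex.closure_setOfPred_lt_im] at this
    exact this hz
  -- points near a cell meeting Ω
  have hnear : ∀ z ∈ boxB, ∀ o, Φ z ∈ hexCell o → (∃ w ∈ Ω, Φ w ∈ hexCell o) → 0 ≤ o.2 → z ∈ G1 ∨ z ∈ G2 := by
    rintro z hzB o hz ⟨w, (hw | hw) | hw, hwo⟩ ho
    · left
      have h1 := hΦ0 o w ho hwo
      have h2 : ε0 ≤ infDist w A := by
        by_contra hlt; exact hw (hbox w h1 (not_le.1 hlt))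
      have h3 := infDist_le_infDist_add_dist (s := A) (x := w) (y := z)
      rw [dist_comm] at h3
      have h4 := hΦm o z w hz hwo
      have h5 := hX0 z hzB (by linarith)
      exact ⟨o, ⟨z, h5, hz⟩, hz⟩
    · left; exact ⟨o, ⟨w, hw, hwo⟩, hz⟩
    · right; exact ⟨o, ⟨w, hw, hwo⟩, hz⟩
  have hcover : ∀ z ∈ boxB, z ∈ P2 ∨ z ∈ G1 ∨ z ∈ G2 := by
    intro z hz
    obtain ⟨o, ho, hzo⟩ := hrow z hz.2.1
    by_cases hoΩ : ∃ w ∈ Ω, Φ w ∈ hexCell o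
    · exact Or.inr (hnear z hz o hzo hoΩ ho)
    · left; exact ⟨o, fun w hw hwo => hoΩ ⟨w, hw, hwo⟩, hzo⟩
  have hG12 : ∀ z ∈ M, z ∈ G1 → z ∈ G2 → False := fun z hz h1 h2 => by
    linarith [hG1q z h1, hG2q z h2 hz]
  -- q_n is eventually in G2
  obtain ⟨n1, hn1⟩ : ∃ n1, ∀ n ≥ n1, qs n ∈ G2 := by
    have hcl := cells_closed Φ {o | ¬ ∃ w ∈ c, Φ w ∈ hexCell o}
    have hqn : q ∉ {z | ∃ o ∈ {o | ¬ ∃ w ∈ c, Φ w ∈ hexCell o}, Φ z ∈ hexCell o} := by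
      rintro ⟨o, ho, hqo⟩; exact ho ⟨q, hqc, hqo⟩
    obtain ⟨n1, hn1⟩ := eventually_atTop.1 (hq.eventually (hcl.isOpen_compl.mem_nhds hqn))
    refine ⟨n1, fun n hn => ?_⟩
    obtain ⟨o, ho⟩ := hexCell_cover (Φ (qs n))
    refine ⟨o, ?_, ho⟩
    by_contra hcon
    exact hn1 n hn ⟨o, hcon, ho⟩
  have hpieces : ∀ n, ∃ (X : Set ℂ) (a b : ℂ), X ⊆ C (n + n1) ∧ IsPreconnected X ∧ X ⊆ P2 ∧ a ∈ X ∧ b ∈ X ∧ a ∈ G1 ∧ b ∈ G2 := by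
    intro n
    by_contra hcon
    set Cn := C (n + n1)
    obtain ⟨W1, W2, hW1, hW2, hU, hd, hs1, hs2⟩ := split_compact ((hCk (n + n1)).inter_right cP2) cG1 cG2 (by
      rintro X hX hXc ⟨a, ha, ha1⟩ ⟨b, hb, hb1⟩
      exact hcon ⟨X, a, b, fun z hz => (hX hz).1, hXc, fun z hz => (hX hz).2, ha, hb, ha1, hb1⟩)
    obtain ⟨x, hxC, hxX⟩ := hCX (n + n1)
    obtain ⟨ox, hox⟩ := hexCell_cover (Φ x)
    have := isPreconnected_closed_iff.1 (hCc (n + n1)) (W1 ∪ C (n + n1) ∩ G1) (W2 ∪ C (n + n1) ∩ G2)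
      (hW1.isClosed.union ((hCk _).isClosed.inter cG1)) (hW2.isClosed.union ((hCk _).isClosed.inter cG2)) (by
        intro z hz
        rcases hcover z (hCM _ hz).1 with h | h | h
        · have : z ∈ W1 ∪ W2 := hU ▸ ⟨hz, h⟩
          rcases this with h | h
          · exact Or.inl (Or.inl h)
          · exact Or.inr (Or.inl h)
        · exact Or.inl (Or.inr ⟨hz, h⟩)
        · exact Or.inr (Or.inr ⟨hz, h⟩))
      ⟨x, hxC, Or.inr ⟨hxC, ox, ⟨x, hxX, hox⟩, hox⟩⟩ ⟨qs (n + n1), hqs _, Or.inr ⟨hqs _, hn1 _ (by omega)⟩⟩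
    obtain ⟨z, hz, hz1, hz2⟩ := this
    have hsub1 : ∀ z ∈ W1, z ∈ C (n + n1) ∩ P2 := fun z hz => hU ▸ Or.inl hz
    have hsub2 : ∀ z ∈ W2, z ∈ C (n + n1) ∩ P2 := fun z hz => hU ▸ Or.inr hz
    rcases hz1 with h1 | h1 <;> rcases hz2 with h2 | h2
    · exact hd.ne_of_mem h1 h2 rfl
    · exact hd.ne_of_mem h1 (hs2 ⟨hsub1 z h1, h2.2⟩) rfl
    · exact hd.ne_of_mem (hs1 ⟨hsub2 z h2, h1.2⟩) h2 rfl
    · exact hG12 z (hCM _ hz) h1.2 h2.2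
  choose X a b hXC hXc hXP haX hbX haG hbG using hpieces
  have hXi : ∀ n, ∃ i, X n ⊆ h i '' closedBall 0 1 := fun n =>
    hcov (X n) ⟨⟨a n, haX n⟩, hXc n⟩ (fun z hz => by
      obtain ⟨o, ho, hzo⟩ := hXP n hz; exact ⟨o, hzo, ho⟩)
  choose ι hι using hXi
  obtain ⟨i, hi⟩ : ∃ i, ∃ᶠ n in atTop, ι n = i := by
    by_contra hcon
    push Not at hcon
    have : ∀ᶠ n in atTop, ∀ i, ι n ≠ i := eventually_all.2 fun i => hcon i
    obtain ⟨n, hn⟩ := this.exists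
    exact hn _ rfl
  obtain ⟨k, hk, hki⟩ := extraction_of_frequently_atTop hi
  have haB : ∀ n, (a n, b n) ∈ boxB ×ˢ boxB := fun n => ⟨hP2B (hXP n (haX n)), hP2B (hXP n (hbX n))⟩
  obtain ⟨⟨a', b'⟩, -, k2, hk2, htab⟩ := (boxB_compact.prod boxB_compact).tendsto_subseq (fun n => haB (k n))
  have hta : Tendsto (fun n => a (k (k2 n))) atTop (𝓝 a') := (continuous_fst.tendsto _).comp htab
  have htb : Tendsto (fun n => b (k (k2 n))) atTop (𝓝 b') := (continuous_snd.tendsto _).comp htab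
  have hkk : StrictMono fun n => k (k2 n) + n1 := fun x y hxy => by
    have := hk (hk2 hxy); simp only; omega
  have ha'E : a' ∈ E := hE _ _ a' hkk (fun j => hXC _ (haX _)) hta
  have hb'E : b' ∈ E := hE _ _ b' hkk (fun j => hXC _ (hbX _)) htb
  have hδc : Continuous δ := by
    refine (LipschitzWith.of_dist_le_mul (K := 1) fun z w => ?_).continuous
    simpa [Real.dist_eq] using hδ z w
  -- estimates at a and b
  have haδ : ∀ n, |δ (a n) - ρ| ≤ m := by
    intro n
    obtain ⟨o, ⟨w, hw, hwo⟩, hao⟩ := haG n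
    have h1 := hΦm o _ _ hao hwo
    have h2 := hδ (a n) w
    have h3 := hX1ρ w hw
    obtain ⟨p, hp, hpρ⟩ := hX1m w hw (a n) (hP2B (hXP n (haX n))) (hP2X _ (hXP n (haX n)))
    have h4 := hδ (a n) p
    have h5 : dist p (a n) ≤ dist w (a n) := by
      have hb1 : p ∈ closedBall (a n) (dist w (a n)) :=
        (convex_closedBall _ _).segment_subset (mem_closedBall.2 le_rfl) (mem_closedBall_self dist_nonneg) hp
      exact hb1
    rw [dist_comm p, dist_comm w] at h5
    rw [abs_le] at h2 h4 ⊢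
    constructor <;> linarith
  have ha'δ : |δ a' - ρ| ≤ m :=
    le_of_tendsto (((hδc.sub continuous_const).abs.tendsto a').comp hta) (Eventually.of_forall fun n => haδ _)
  have ha'h : μ / 2 ≤ |Hs (F a') - Hs (F q)| := by
    have := hμE a' ha'E; linarith
  have hb'q : dist b' q ≤ 2 * r :=
    le_of_tendsto (((continuous_id.dist continuous_const).tendsto b').comp htb)
      (Eventually.of_forall fun n => (hG2q _ (hbG _) (hCM _ (hXC _ (hbX _)))).le)
  have hb'h := hrh b' (by linarith)
  -- boundary of the disc
  have hopen : IsOpen (h i '' ball 0 1) := (h i).isOpenMap _ isOpen_ball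
  have hsphere : ∀ z ∈ h i '' closedBall 0 1, ∀ o, (∃ w ∈ Ω, Φ w ∈ hexCell o) → Φ z ∈ hexCell o → z ∈ h i '' sphere 0 1 := by
    intro z hz o ho hzo
    by_contra hns
    have hzb : z ∈ h i '' ball 0 1 := by
      obtain ⟨w, hw, rfl⟩ := hz
      refine ⟨w, ?_, rfl⟩
      rw [mem_ball]
      refine lt_of_le_of_ne hw fun e => hns ⟨w, e, rfl⟩
    obtain ⟨w, hw, hwu⟩ := cell_approx Φ hzo (hopen.mem_nhds hzb)
    obtain ⟨o', ho', hoΩ⟩ := hcell i w (image_mono ball_subset_closedBall hw)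
    obtain ⟨y, hy, hyo⟩ := ho
    rw [hwu o' ho'] at hoΩ
    exact hoΩ y hy hyo
  have hX' : ∀ n, X (k (k2 n)) ⊆ h i '' closedBall 0 1 := fun n => by
    have := hι (k (k2 n)); rwa [hki] at this
  have hcellP : ∀ z ∈ h i '' closedBall 0 1, z ∈ P2 := fun z hz => by
    obtain ⟨o, ho, h2⟩ := hcell i z hz; exact ⟨o, h2, ho⟩
  have has : ∀ n, a (k (k2 n)) ∈ h i '' sphere 0 1 := by
    intro n
    obtain ⟨o, ⟨w, hw, hwo⟩, hao⟩ := haG (k (k2 n))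
    exact hsphere _ (hX' n (haX _)) o ⟨w, Or.inl (Or.inr hw), hwo⟩ hao
  have hbs : ∀ n, b (k (k2 n)) ∈ h i '' sphere 0 1 := by
    intro n
    obtain ⟨o, ⟨w, hw, hwo⟩, hao⟩ := hbG (k (k2 n))
    exact hsphere _ (hX' n (hbX _)) o ⟨w, Or.inr hw, hwo⟩ hao
  have hmem : ∀ (s : Set ℂ) z, z ∈ h i '' s → (h i).symm z ∈ s := by
    rintro s _ ⟨w, hw, rfl⟩; simpa using hw
  have hQ : QData K (F ∘ h i) (fun n => (h i).symm '' X (k (k2 n))) (fun n => (h i).symm (a (k (k2 n))))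
      (fun n => (h i).symm (b (k (k2 n)))) ((h i).symm a') ((h i).symm b') := by
    refine ⟨(hF.comp (h i).continuous).continuousOn, ?_, fun n => (hXc _).image _ (h i).symm.continuous.continuousOn,
      ?_, ?_, fun n => ⟨mem_image_of_mem _ (haX _), hmem _ _ (has n)⟩, fun n => ⟨mem_image_of_mem _ (hbX _), hmem _ _ (hbs n)⟩,
      ((h i).symm.continuous.tendsto _).comp hta, ((h i).symm.continuous.tendsto _).comp htb⟩
    · intro z hz w hw hzw
      have hz' := hcellP _ (mem_image_of_mem (h i) hz)
      have hw' := hcellP _ (mem_image_of_mem (h i) hw)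
      exact (h i).injective (hinj ⟨hP2B hz', by linarith [hP2d _ hz']⟩ ⟨hP2B hw', by linarith [hP2d _ hw']⟩ hzw)
    · rintro n _ ⟨z, hz, rfl⟩
      exact ⟨hmem _ _ (hX' n hz), by simpa using (hCM _ (hXC _ hz)).2⟩
    · intro Z hZ hZc x y h1 h2
      have := hsep (h i '' Z) (by
        rintro _ ⟨z, hz, rfl⟩
        exact ⟨hP2B (hcellP _ (mem_image_of_mem _ (hZ hz).1)), (hZ hz).2⟩)
        (hZc.image _ (h i).continuous.continuousOn) (k (k2 x) + n1) (k (k2 y) + n1) (by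
          obtain ⟨_, hz, w, hw, rfl⟩ := h1
          exact ⟨w, ⟨_, hz, by simp⟩, hXC _ hw⟩) (by
          obtain ⟨_, hz, w, hw, rfl⟩ := h2
          exact ⟨w, ⟨_, hz, by simp⟩, hXC _ hw⟩)
      exact hkk.injective this
  have hrel := quad_lemma hQ hK (Z1 := h i ⁻¹' (G1 ∪ {z | z.im = 0})) (Z2 := h i ⁻¹' (closedBall q (2 * r)))
    ((cG1.union (isClosed_eq Complex.continuous_im continuous_const)).preimage (h i).continuous)
    (isClosed_closedBall.preimage (h i).continuous) (by
      apply Disjoint.preimage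
      rw [disjoint_left]
      rintro z (hz | hz) hzq
      · exact absurd (hG1q z hz) (not_lt.2 hzq)
      · have h1 := Complex.abs_im_le_norm (z - q)
        rw [← dist_eq_norm, Complex.sub_im, hz, zero_sub, abs_neg] at h1
        linarith [le_abs_self q.im, mem_closedBall.1 hzq]) (by
      intro z hz hzK
      have hzP := hcellP _ (mem_image_of_mem (h i) (sphere_subset_closedBall hz))
      have hzB := hP2B hzP
      obtain ⟨o, hoΩ, hzo⟩ := hsph i _ (mem_image_of_mem (h i) hz)
      by_cases ho : 0 ≤ o.2
      · rcases hnear _ hzB o hzo hoΩ ho with h1 | h1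
        · exact Or.inl (Or.inl h1)
        · exact Or.inr (hG2q _ h1 ⟨hzB, hzK⟩).le
      · left; right
        exact le_antisymm (hΦn o _ (not_le.1 ho) hzo) hzB.2.1)
    (fun n => by simpa using Or.inl (haG _))
    (fun n => by simpa using (hG2q _ (hbG _) (hCM _ (hXC _ (hbX _)))).le)
  have := hHK _ hrel
  simp only [Function.comp, Homeomorph.apply_symm_apply] at this
  rw [this] at ha'h
  linarith

lemma cball2_preconn {A : Set ℂ} (hA : A ⊆ closedBall 0 1) (hc : IsPreconnected Aᶜ) :
    IsPreconnected (closedBall (0:ℂ) 2 \ A) := by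
  let r : ℂ → ℂ := fun z => (2:ℝ) • radr ((1/2:ℝ) • z)
  have hr : Continuous r := by
    have := continuous_radr
    fun_prop
  have h1 : closedBall (0:ℂ) 2 \ A = r '' Aᶜ := by
    have hid : ∀ z ∈ closedBall (0:ℂ) 2, r z = z := by
      intro z hz
      simp only [r]
      rw [radr_of_mem, smul_smul]
      · norm_num
      · simp only [mem_closedBall, dist_zero_right] at hz ⊢
        rw [norm_smul]; norm_num; linarith
    apply Subset.antisymm
    · intro z hz
      exact ⟨z, hz.2, hid z hz.1⟩
    · rintro _ ⟨z, hz, rfl⟩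
      by_cases h : z ∈ closedBall (0:ℂ) 2
      · rw [hid z h]; exact ⟨h, hz⟩
      · have hn : ‖r z‖ = 2 := by
          simp only [mem_closedBall, dist_zero_right, not_le] at h
          simp only [r, radr, norm_smul, norm_inv, Real.norm_eq_abs]
          have : max 1 (|1/2| * ‖z‖) = ‖z‖/2 := by
            rw [max_eq_right] <;> norm_num <;> linarith
          rw [this, abs_of_pos (by linarith : 0 < ‖z‖/2)]
          norm_num
          field_simp
        refine ⟨by simp [hn], fun h' => ?_⟩
        have := hA h'
        simp [hn] at this
  rw [h1]
  exact hc.image _ hr.continuousOn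

lemma norm_ge_preconn (r : ℝ) : IsPreconnected {z : ℂ | r ≤ ‖z‖} := by
  have h : {z : ℂ | r ≤ ‖z‖} = (fun p : ℝ × ℝ => (p.1 : ℂ) * Complex.exp (p.2 * Complex.I)) '' (Ici r ×ˢ univ) := by
    ext z
    simp only [mem_ofPred_eq, mem_image, mem_prod, mem_Ici, mem_univ, and_true, Prod.exists]
    constructor
    · intro h
      exact ⟨‖z‖, Complex.arg z, h, Complex.norm_mul_exp_arg_mul_I z⟩
    · rintro ⟨t, θ, ht, rfl⟩
      rw [norm_mul, Complex.norm_exp_ofReal_mul_I, mul_one, Complex.norm_real]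
      exact ht.trans (le_abs_self t)
  rw [h]
  exact (isPreconnected_Ici.prod isPreconnected_univ).image _ (Continuous.continuousOn (by fun_prop))

lemma log_on {A : Set ℂ} (hAk : IsCompact A) (hAc : IsConnected A) (hA : A ⊆ closedBall 0 1)
    (hc : IsPreconnected Aᶜ) {u : ℂ → ℂ} (hu : ContinuousOn u A) (h0 : ∀ z ∈ A, u z ≠ 0) :
    ∃ l : ℂ → ℂ, Continuous l ∧ ∀ z ∈ A, Complex.exp (l z) = u z := by
  obtain ⟨U, hU⟩ := ContinuousMap.exists_restrict_eq (Y := ℂ) hAk.isClosed ⟨A.domRestrict u, continuousOn_iff_continuous_domRestrict.1 hu⟩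
  have hUA : ∀ z ∈ A, U z = u z := fun z hz => by
    have := DFunLike.congr_fun hU ⟨z, hz⟩
    exact this
  have hopen : IsOpen {z | U z ≠ 0} := isOpen_ne_fun U.continuous continuous_const
  obtain ⟨ε', hε', hth⟩ := hAk.exists_thickening_subset_open hopen (fun z hz => by simp [hUA z hz, h0 z hz])
  set ε := min ε' 1
  have hε : 0 < ε := lt_min hε' one_pos
  have hne0 : ∀ z, infDist z A < ε → U z ≠ 0 := by
    intro z hz
    apply hth
    rw [mem_thickening_iff_infDist_lt hAc.nonempty]
    exact hz.trans_le (min_le_left _ _)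
  have hfar : ∀ z : ℂ, 2 ≤ ‖z‖ → 1 ≤ infDist z A := by
    intro z hz
    rw [le_infDist hAc.nonempty]
    intro y hy
    have := hA hy
    simp only [mem_closedBall, dist_zero_right] at this
    rw [dist_eq_norm]
    have := norm_sub_norm_le z y
    linarith
  have hC : IsCompact {z | z ∈ closedBall (0:ℂ) 2 ∧ ε ≤ infDist z A} :=
    (isCompact_closedBall _ _).inter_right (isClosed_le continuous_const (continuous_infDist_pt A))
  set C := {z | z ∈ closedBall (0:ℂ) 2 ∧ ε ≤ infDist z A}
  have h2C : (2:ℂ) ∈ C := ⟨by simp, (min_le_right _ _).trans (hfar 2 (by simp))⟩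
  have hCA : C ⊆ closedBall (0:ℂ) 2 \ A := fun z hz => ⟨hz.1, fun h => by
    have := hz.2; rw [infDist_zero_of_mem h] at this; linarith⟩
  obtain ⟨X, hXk, hXc, hCX, hX⟩ := hull_exists (isCompact_closedBall (0:ℂ) 2) (convex_closedBall _ _) hAk.isClosed
    (cball2_preconn hA hc) ⟨2, hCA h2C⟩ hC hCA
  obtain ⟨zm, hzm, hmin⟩ := hXk.exists_isMinOn hXc.nonempty (continuous_infDist_pt A).continuousOn
  have hmp : 0 < infDist zm A := (hAk.isClosed.notMem_iff_infDist_pos hAc.nonempty).1 (hX hzm).2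
  have hΩ : IsPreconnected (X ∪ {z : ℂ | 2 ≤ ‖z‖}) :=
    IsPreconnected.union (2:ℂ) (hCX h2C) (by simp) hXc.isPreconnected (norm_ge_preconn 2)
  obtain ⟨Φ, hΦ, -⟩ := grid_exists (δ := min (infDist zm A) 1) (lt_min hmp one_pos)
  have hΩd : ∀ z ∈ X ∪ {z : ℂ | 2 ≤ ‖z‖}, min (infDist zm A) 1 ≤ infDist z A := by
    rintro z (hz | hz)
    · exact (min_le_left _ _).trans (hmin hz)
    · exact (min_le_right _ _).trans (hfar z hz)
  obtain ⟨J, -, h, -, h2, h3⟩ := cell_domains Φ hΩ 2 (fun z hz => Or.inr hz.le)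
  obtain ⟨i, hi⟩ := h3 A hAc (fun z hz => by
    obtain ⟨o, ho⟩ := hexCell_cover (Φ z)
    refine ⟨o, ho, fun w hw hwo => ?_⟩
    have a := hΩd w hw
    have b := infDist_le_dist_of_mem (x := w) hz
    have c := hΦ o w z hwo ho
    linarith)
  have hdisc : ∀ z ∈ h i '' closedBall 0 1, U z ≠ 0 := by
    intro z hz
    obtain ⟨o, ho, ho2⟩ := h2 i z hz
    have hzΩ : z ∉ X ∪ {z : ℂ | 2 ≤ ‖z‖} := fun hz => ho2 z hz ho
    apply hne0
    by_contra hcon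
    push Not at hcon
    by_cases h2 : ‖z‖ ≤ 2
    · exact hzΩ (Or.inl (hCX ⟨by simpa using h2, hcon⟩))
    · exact hzΩ (Or.inr (by push Not at h2; exact h2.le))
  obtain ⟨l, hl, hle⟩ := exists_log_retract (h i '' closedBall 0 1) (fun z => h i (radr ((h i).symm z)))
    ((h i).continuous.comp (continuous_radr.comp (h i).symm.continuous)) (fun z => ⟨_, radr_mem _, rfl⟩)
    (by rintro _ ⟨w, hw, rfl⟩; simp [radr_of_mem hw]) U U.continuous.continuousOn hdisc
  exact ⟨l, hl, fun z hz => by rw [hle z (hi hz), hUA z hz]⟩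

lemma tietze_C {A : Set ℂ} (hA : IsClosed A) {u : ℂ → ℂ} (hu : ContinuousOn u A) :
    ∃ U : ℂ → ℂ, Continuous U ∧ ∀ z ∈ A, U z = u z := by
  obtain ⟨U, hU⟩ := ContinuousMap.exists_restrict_eq (Y := ℂ) hA ⟨A.domRestrict u, continuousOn_iff_continuous_domRestrict.1 hu⟩
  exact ⟨U, U.continuous, fun z hz => DFunLike.congr_fun hU ⟨z, hz⟩⟩

lemma nonvan_approx {A : Set ℂ} (hA : IsClosed A) (h0 : MeasureTheory.volume A = 0) {u : ℂ → ℂ} (hu : ContinuousOn u A)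
    {κ : ℝ} (hκ : 0 < κ) : ∃ P : ℂ → ℂ, Continuous P ∧ ∀ z ∈ A, ‖P z - u z‖ ≤ κ ∧ P z ≠ 0 := by
  obtain ⟨U, hU, hUA⟩ := tietze_C hA hu
  obtain ⟨g, hg, hgU, -⟩ := hU.exists_contDiff_approx 1 (ε := fun _ => κ / 2) continuous_const (fun _ => by positivity)
  have hnull : MeasureTheory.volume (g '' A) = 0 :=
    MeasureTheory.addHaar_image_eq_zero_of_differentiableOn_of_addHaar_eq_zero _
      (hg.differentiable (by norm_num)).differentiableOn h0
  obtain ⟨c, hc, hcA⟩ : ∃ c ∈ ball (0:ℂ) (κ/2), c ∉ g '' A := by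
    by_contra hcon
    push Not at hcon
    have h1 := MeasureTheory.measure_mono_null (show ball (0:ℂ) (κ/2) ⊆ g '' A from hcon) hnull
    exact (Metric.measure_ball_pos MeasureTheory.volume (0:ℂ) (by positivity : 0 < κ/2)).ne' h1
  refine ⟨fun z => g z - c, hg.continuous.sub continuous_const, fun z hz => ⟨?_, fun h => hcA ⟨z, hz, sub_eq_zero.1 h⟩⟩⟩
  have h1 := hgU z
  rw [dist_eq_norm, hUA z hz] at h1
  have h2 : ‖c‖ < κ/2 := by simpa using hc
  calc ‖g z - c - u z‖ = ‖(g z - u z) - c‖ := by ring_nf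
    _ ≤ ‖g z - u z‖ + ‖c‖ := norm_sub_le _ _
    _ ≤ κ := by linarith

lemma iter_contOn {A : Set ℂ} {g : ℂ → ℂ} (hg : ContinuousOn g A) (hm : MapsTo g A A) (j : ℕ) :
    ContinuousOn (g^[j]) A := hg.iterate hm j

lemma equiv_step {A : Set ℂ} (hA : IsCompact A) (h0 : MeasureTheory.volume A = 0) {g : ℂ → ℂ} (hg : ContinuousOn g A)
    (hm : MapsTo g A A) {m : ℕ} (hm1 : 1 ≤ m) (hid : ∀ z ∈ A, g^[m] z = z) {ω : ℂ} (hω : ω ^ m = 1) (hω1 : ‖ω‖ = 1)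
    {D : Set ℂ} (hD : IsCompact D) (hDA : D ⊆ A) {u : ℂ → ℂ} (hu : ContinuousOn u A) (hue : ∀ z ∈ A, u (g z) = ω * u z)
    (hu0 : ∀ z ∈ D, u z ≠ 0) {p : ℂ} {r : ℝ} (hr : 0 < r)
    (hfree : ∀ z ∈ A, z ∈ closedBall p (2 * r) → ∀ j, 0 < j → j < m → g^[j] z ∉ closedBall p (2 * r)) :
    ∃ u' : ℂ → ℂ, ContinuousOn u' A ∧ (∀ z ∈ A, u' (g z) = ω * u' z) ∧ (∀ z ∈ D, u' z ≠ 0) ∧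
      ∀ z ∈ A, z ∈ closedBall p r → u' z ≠ 0 := by
  have hω0 : ω ≠ 0 := by rintro rfl; simp at hω1
  obtain ⟨δ, hδ, hδD⟩ : ∃ δ > 0, ∀ z ∈ D, δ ≤ ‖u z‖ := by
    rcases D.eq_empty_or_nonempty with rfl | hne
    · exact ⟨1, one_pos, by simp⟩
    · obtain ⟨z0, hz0, hmin⟩ := hD.exists_isMinOn hne (hu.mono hDA).norm
      exact ⟨‖u z0‖, norm_pos_iff.2 (hu0 z0 hz0), fun z hz => hmin hz⟩
  have hmR : (0:ℝ) < m := by exact_mod_cast hm1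
  obtain ⟨P, hP, hPA⟩ := nonvan_approx hA.isClosed h0 hu (κ := δ / (2 * m)) (by positivity)
  let χ : ℂ → ℝ := fun z => max 0 (min 1 (2 - dist z p / r))
  have hχ : Continuous χ := by
    have : Continuous fun z => dist z p / r := by fun_prop
    fun_prop
  have hχ1 : ∀ z ∈ closedBall p r, χ z = 1 := by
    intro z hz
    have : dist z p / r ≤ 1 := by rw [div_le_one hr]; exact hz
    simp only [χ]; rw [min_eq_left (by linarith)]; simp
  have hχ0 : ∀ z ∉ closedBall p (2 * r), χ z = 0 := by
    intro z hz
    simp only [mem_closedBall, not_le] at hz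
    have : 2 ≤ dist z p / r := by rw [le_div_iff₀ hr]; exact hz.le
    simp only [χ]; rw [max_eq_left]; exact (min_le_right _ _).trans (by linarith)
  have hχb : ∀ z, 0 ≤ χ z ∧ χ z ≤ 1 := fun z => ⟨le_max_left _ _, max_le zero_le_one (min_le_left _ _)⟩
  let g1 : ℂ → ℂ := fun z => χ z * (P z - u z)
  have hg1 : ContinuousOn g1 A := by
    have : Continuous fun z => (χ z : ℂ) := by fun_prop
    exact this.continuousOn.mul (hP.continuousOn.sub hu)
  have hmaps : ∀ j, MapsTo (g^[j]) A A := fun j => hm.iterate j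
  have hg1b : ∀ z ∈ A, ‖g1 z‖ ≤ δ / (2 * m) := by
    intro z hz
    simp only [g1, norm_mul, Complex.norm_real, Real.norm_eq_abs, abs_of_nonneg (hχb z).1]
    calc _ ≤ 1 * ‖P z - u z‖ := by gcongr; exact (hχb z).2
      _ ≤ _ := by rw [one_mul]; exact (hPA z hz).1
  let u' : ℂ → ℂ := fun z => u z + ∑ i ∈ Finset.range m, (ω⁻¹) ^ i * g1 (g^[i] z)
  refine ⟨u', ?_, ?_, ?_, ?_⟩
  · refine hu.add (continuousOn_finsetSum _ fun i _ => continuousOn_const.mul ?_)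
    exact hg1.comp (hg.iterate hm i) (hmaps i)
  · intro z hz
    simp only [u', hue z hz, mul_add, Finset.mul_sum]
    congr 1
    have e : ∀ i, ω⁻¹ ^ i * g1 (g^[i] (g z)) = ω * (ω⁻¹ ^ (i+1) * g1 (g^[i+1] z)) := by
      intro i
      rw [Function.iterate_succ_apply, pow_succ]
      field_simp
    simp only [e, ← Finset.mul_sum]
    congr 1
    have h1 := Finset.sum_range_succ (fun i => ω⁻¹ ^ i * g1 (g^[i] z)) m
    rw [Finset.sum_range_succ'] at h1
    have h2 : ω⁻¹ ^ m * g1 (g^[m] z) = ω⁻¹ ^ 0 * g1 (g^[0] z) := by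
      rw [hid z hz, inv_pow, hω]; simp
    rw [h2] at h1
    exact add_right_cancel h1
  · intro z hz h
    have h1 : ‖∑ i ∈ Finset.range m, (ω⁻¹) ^ i * g1 (g^[i] z)‖ ≤ δ / 2 := by
      calc _ ≤ ∑ i ∈ Finset.range m, δ / (2 * m) := by
            refine norm_sum_le_of_le _ fun i _ => ?_
            rw [norm_mul, norm_pow, norm_inv, hω1]
            simpa using hg1b _ (hmaps i (hDA hz))
        _ = δ / 2 := by simp; field_simp
    have h2 := hδD z hz
    have h3 : u z = - ∑ i ∈ Finset.range m, (ω⁻¹) ^ i * g1 (g^[i] z) := eq_neg_of_add_eq_zero_left h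
    rw [h3, norm_neg] at h2
    linarith
  · intro z hz hzp
    have h1 : ∑ i ∈ Finset.range m, (ω⁻¹) ^ i * g1 (g^[i] z) = g1 z := by
      rw [Finset.sum_eq_single_of_mem 0 (by simp; omega)]
      · simp
      · intro j hj hj0
        have := hfree z hz (closedBall_subset_closedBall (by linarith) hzp) j (by omega) (by simpa using hj)
        simp [g1, hχ0 _ this]
    simp only [u', h1, g1, hχ1 z hzp]
    simpa using (hPA z hz).2

lemma equiv_exists {A : Set ℂ} (hA : IsCompact A) (h0 : MeasureTheory.volume A = 0) {g : ℂ → ℂ} (hg : ContinuousOn g A)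
    (hm : MapsTo g A A) {m : ℕ} (hm1 : 1 ≤ m) (hid : ∀ z ∈ A, g^[m] z = z)
    (hfr : ∀ z ∈ A, ∀ j, 0 < j → j < m → g^[j] z ≠ z) {ω : ℂ} (hω : ω ^ m = 1) (hω1 : ‖ω‖ = 1) :
    ∃ u : ℂ → ℂ, ContinuousOn u A ∧ (∀ z ∈ A, u (g z) = ω * u z) ∧ ∀ z ∈ A, u z ≠ 0 := by
  have hloc : ∀ p ∈ A, ∃ r > 0, ∀ z ∈ A, z ∈ closedBall p (2 * r) → ∀ j, 0 < j → j < m → g^[j] z ∉ closedBall p (2 * r) := by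
    intro p hp
    have h1 : ∀ j ∈ Finset.range m, ∃ r > 0, 0 < j → ∀ z ∈ A, z ∈ closedBall p (2 * r) → g^[j] z ∉ closedBall p (2 * r) := by
      intro j hj
      by_cases hj0 : 0 < j
      · have hne := hfr p hp j hj0 (by simpa using hj)
        set d := dist (g^[j] p) p
        have hd : 0 < d := dist_pos.2 hne
        obtain ⟨ρ, hρ, hρ2⟩ := Metric.continuousWithinAt_iff.1 ((hg.iterate hm j) p hp) (d/2) (by positivity)
        refine ⟨min (ρ/4) (d/8), by positivity, fun _ z hz hzp hgz => ?_⟩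
        have e1 := min_le_left (ρ/4) (d/8)
        have e2 := min_le_right (ρ/4) (d/8)
        simp only [mem_closedBall] at hzp hgz
        have e3 := hρ2 hz (by linarith)
        have := dist_triangle_left (g^[j] p) p (g^[j] z)
        simp only [d] at *
        linarith
      · exact ⟨1, one_pos, fun h => absurd h hj0⟩
    choose! ρ hρ hρ2 using h1
    have hne : (Finset.range m).Nonempty := Finset.nonempty_range_iff.2 (by omega)
    refine ⟨(Finset.range m).inf' hne ρ, ?_, ?_⟩
    · exact (Finset.lt_inf'_iff hne).2 hρ
    · intro z hz hzp j hj hjm hgz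
      have := Finset.inf'_le ρ (Finset.mem_range.2 hjm)
      exact hρ2 j (Finset.mem_range.2 hjm) hj z hz (closedBall_subset_closedBall (by linarith) hzp)
        (closedBall_subset_closedBall (by linarith) hgz)
  choose! r hr hr2 using hloc
  obtain ⟨t, htA, ht⟩ := hA.elim_nhds_subcover (fun p => closedBall p (r p)) (fun p hp => closedBall_mem_nhds _ (hr p hp))
  have key : ∀ t : Finset ℂ, (∀ x ∈ t, x ∈ A) → ∃ u : ℂ → ℂ, ContinuousOn u A ∧ (∀ z ∈ A, u (g z) = ω * u z) ∧
      ∀ z ∈ A, z ∈ ⋃ p ∈ t, closedBall p (r p) → u z ≠ 0 := by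
    intro t
    induction t using Finset.induction_on with
    | empty => exact fun _ => ⟨fun _ => 0, continuousOn_const, by simp, by simp⟩
    | insert p t hp ih =>
      intro htA
      obtain ⟨u, hu, hue, hu0⟩ := ih (fun x hx => htA x (Finset.mem_insert_of_mem hx))
      have hpA := htA p (Finset.mem_insert_self _ _)
      obtain ⟨u', h1, h2, h3, h4⟩ := equiv_step hA h0 hg hm hm1 hid hω hω1 (D := A ∩ ⋃ p ∈ t, closedBall p (r p))
        (hA.inter_right (t.finite_toSet.isClosed_biUnion fun p _ => isClosed_closedBall)) inter_subset_left hu hue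
        (fun z hz => hu0 z hz.1 hz.2) (hr p hpA) (hr2 p hpA)
      refine ⟨u', h1, h2, fun z hz hz2 => ?_⟩
      rw [Finset.set_biUnion_insert] at hz2
      rcases hz2 with hz2 | hz2
      · exact h4 z hz hz2
      · exact h3 z ⟨hz, hz2⟩
  obtain ⟨u, h1, h2, h3⟩ := key t htA
  exact ⟨u, h1, h2, fun z hz => h3 z hz (ht hz)⟩

/-- No free finite-order self-map of a null nonseparating plane continuum. -/
theorem no_free {A : Set ℂ} (hA : IsCompact A) (hAc : IsConnected A) (hAD : A ⊆ closedBall 0 1)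
    (hc : IsPreconnected Aᶜ) (h0 : MeasureTheory.volume A = 0) {g : ℂ → ℂ} (hg : ContinuousOn g A)
    (hm : MapsTo g A A) {m : ℕ} (hm1 : 2 ≤ m) (hid : ∀ z ∈ A, g^[m] z = z)
    (hfr : ∀ z ∈ A, ∀ j, 0 < j → j < m → g^[j] z ≠ z) : False := by
  have hprim := Complex.isPrimitiveRoot_exp m (by omega)
  set ω := Complex.exp (2 * Real.pi * Complex.I / m) with hωd
  obtain ⟨u, hu, hue, hu0⟩ := equiv_exists hA h0 hg hm (by omega) hid hfr hprim.pow_eq_one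
    (Complex.norm_eq_one_of_pow_eq_one hprim.pow_eq_one (by omega))
  obtain ⟨l, hl, hle⟩ := log_on hA hAc hAD hc hu hu0
  obtain ⟨x, hx⟩ := hAc.nonempty
  have hconst : ∀ z ∈ A, l (g z) = l z + (l (g x) - l x) := by
    intro z hz
    have := log_unique hAc.isPreconnected (g1 := fun z => l (g z)) (g2 := fun z => l z + 2 * Real.pi * Complex.I / m)
      (hl.comp_continuousOn hg) (by fun_prop) (fun z hz => by
        rw [hle _ (hm hz), Complex.exp_add, hle z hz, hue z hz, mul_comm]) hx hz
    linear_combination this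
  have hit : ∀ k : ℕ, l (g^[k] x) = l x + k * (l (g x) - l x) := by
    intro k
    induction k with
    | zero => simp
    | succ k ih =>
      rw [Function.iterate_succ_apply', hconst _ (hm.iterate k hx), ih]; push_cast; ring
  have h1 := hit m
  rw [hid x hx] at h1
  have hmC : (m : ℂ) ≠ 0 := by exact_mod_cast (by omega : m ≠ 0)
  have h2 : l (g x) = l x := by
    have : (m:ℂ) * (l (g x) - l x) = 0 := by linear_combination -h1
    exact sub_eq_zero.1 ((mul_eq_zero.1 this).resolve_left hmC)
  have h3 : u (g x) = u x := by rw [← hle _ (hm hx), ← hle _ hx, h2]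
  rw [hue x hx] at h3
  have h4 : ω = 1 := mul_right_cancel₀ (hu0 x hx) (by rw [h3, one_mul])
  exact hprim.ne_one (by omega) h4

lemma norm_gt_preconn : IsPreconnected {z : ℂ | 1 < ‖z‖} := by
  have h : {z : ℂ | 1 < ‖z‖} = (fun p : ℝ × ℝ => (p.1 : ℂ) * Complex.exp (p.2 * Complex.I)) '' (Ioi 1 ×ˢ univ) := by
    ext z
    simp only [mem_ofPred_eq, mem_image, mem_prod, mem_Ioi, mem_univ, and_true, Prod.exists]
    constructor
    · intro h
      exact ⟨‖z‖, Complex.arg z, h, Complex.norm_mul_exp_arg_mul_I z⟩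
    · rintro ⟨t, θ, ht, rfl⟩
      rw [norm_mul, Complex.norm_exp_ofReal_mul_I, mul_one, Complex.norm_real]
      exact ht.trans_le (le_abs_self t)
  rw [h]
  exact (isPreconnected_Ioi.prod isPreconnected_univ).image _ (Continuous.continuousOn (by fun_prop))

lemma disc_sdiff_preconn {A X : Set ℂ} (h0 : MeasureTheory.volume A = 0) (hAc : IsClosed A)
    (hc : IsPreconnected (closedBall (0:ℂ) 1 \ A)) (hX : X ⊆ A) : IsPreconnected (closedBall (0:ℂ) 1 \ X) := by
  refine hc.subset_closure (fun z hz => ⟨hz.1, fun h => hz.2 (hX h)⟩) ?_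
  intro z hz
  have hd : Dense Aᶜ := by
    rw [← interior_eq_empty_iff_dense_compl]
    by_contra hne
    have hne := nonempty_iff_ne_empty.2 hne
    exact (isOpen_interior.measure_pos MeasureTheory.volume hne).ne'
      (MeasureTheory.measure_mono_null interior_subset h0)
  have h1 := hd.open_subset_closure_inter (isOpen_ball (x := (0:ℂ)) (ε := 1))
  have h2 : z ∈ closure (ball (0:ℂ) 1) := by rw [closure_ball _ one_ne_zero]; exact hz.1
  have h3 := closure_mono h1 h2
  rw [closure_closure] at h3
  exact closure_mono (show ball (0:ℂ) 1 ∩ Aᶜ ⊆ closedBall (0:ℂ) 1 \ A from fun w hw => ⟨ball_subset_closedBall hw.1, hw.2⟩) h3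

lemma compl_preconn {X : Set ℂ} (hc : IsPreconnected (closedBall (0:ℂ) 1 \ X)) (hX : X ⊆ closedBall 0 1) {e : ℂ}
    (he : ∀ z ∈ X, ‖z‖ = 1 → z = e) : IsPreconnected Xᶜ := by
  have h1 : IsPreconnected ({z : ℂ | 1 ≤ ‖z‖} \ X) := by
    refine norm_gt_preconn.subset_closure ?_ ?_
    · intro z hz
      refine ⟨le_of_lt (show 1 < ‖z‖ from hz), fun h => ?_⟩
      have := hX h
      simp only [mem_closedBall, dist_zero_right] at this
      exact absurd hz (not_lt.2 this)
    · intro z hz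
      have : {z : ℂ | 1 < ‖z‖} = (closedBall 0 1)ᶜ := by ext; simp
      rw [this, closure_compl, interior_closedBall _ one_ne_zero]
      simpa using hz.1
  have hu : Xᶜ = (closedBall (0:ℂ) 1 \ X) ∪ ({z : ℂ | 1 ≤ ‖z‖} \ X) := by
    ext z
    simp only [mem_compl_iff, mem_union, Set.mem_sdiff, mem_closedBall, dist_zero_right, mem_ofPred_eq]
    have := le_total ‖z‖ 1
    tauto
  obtain ⟨p, hp, hpX⟩ : ∃ p : ℂ, ‖p‖ = 1 ∧ p ∉ X := by
    by_cases h : (1:ℂ) ∈ X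
    · refine ⟨-1, by simp, fun h' => ?_⟩
      have := (he _ h (by simp)).trans (he _ h' (by simp)).symm
      norm_num at this
    · exact ⟨1, by simp, h⟩
  rw [hu]
  exact IsPreconnected.union p ⟨by simp [hp], hpX⟩ ⟨by simp [hp], hpX⟩ hc h1

/-- boundary bumping -/
lemma bumping {X : Type*} [TopologicalSpace X] [T2Space X] {A W O : Set X} (hA : IsPreconnected A)
    (hW : IsCompact W) (hWA : W ⊆ A) (hO : IsOpen O) (hAO : A ∩ O ⊆ W) {x : X} (hx : x ∈ W)
    (hN : connectedComponentIn W x ⊆ O) : A ⊆ W := by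
  obtain ⟨W1, W2, h1, h2, hu, hd, hx1, hO2⟩ := split_compact hW (isClosed_singleton (x := x)) hO.isClosed_compl (by
    rintro C hC hCc ⟨_, hxC, rfl⟩ ⟨y, hyC, hy⟩
    exact hy (hN (hCc.subset_connectedComponentIn hxC hC hyC)))
  have hxW1 : x ∈ W1 := hx1 ⟨hx, rfl⟩
  have hW1O : W1 ⊆ O := by
    intro z hz
    by_contra hzO
    exact hd.ne_of_mem hz (hO2 ⟨hu ▸ Or.inl hz, hzO⟩) rfl
  intro a ha
  by_contra haW
  obtain ⟨z, hzA, ⟨hz1, hz2⟩, hz3⟩ := hA (O ∩ W2ᶜ) (W1ᶜ) (hO.inter h2.isClosed.isOpen_compl) h1.isClosed.isOpen_compl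
    (by
      intro z hz
      by_cases hz1 : z ∈ W1
      · exact Or.inl ⟨hW1O hz1, fun h => hd.ne_of_mem hz1 h rfl⟩
      · exact Or.inr hz1)
    ⟨x, hWA hx, hW1O hxW1, fun h => hd.ne_of_mem hxW1 h rfl⟩ ⟨a, ha, fun h => haW (hu ▸ Or.inl h)⟩
  have : z ∈ W1 ∪ W2 := hu ▸ hAO ⟨hzA, hz1⟩
  exact this.elim hz3 hz2

lemma fiber_finite {S₁ S₂ : Type*} [MetricSpace S₁] [CompactSpace S₁] [MetricSpace S₂] {f : S₁ → S₂}
    (hf : IsCoveringMap f) (y : S₂) : (f ⁻¹' {y}).Finite := by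
  have h1 : IsCompact (f ⁻¹' {y}) := (isClosed_singleton.preimage hf.continuous).isCompact
  have h2 := (hf y).1
  exact h1.finite ⟨h2⟩

structure InjData {S₁ S₂ : Type*} [MetricSpace S₁] [MetricSpace S₂] (f : S₁ → S₂) (φ : ℂ → S₁) (Y2 : Set S₂)
    (A : Set ℂ) (e : ℂ) : Prop where
  cov : IsCoveringMap f
  cont : Continuous φ
  inj : InjOn φ (closedBall 0 1)
  opn : IsOpen (φ '' ball 0 1)
  Acp : IsCompact A
  Aco : IsConnected A
  AD : A ⊆ closedBall 0 1
  AY : ∀ z ∈ A, f (φ z) ∈ Y2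
  amax : ∀ X ⊆ closedBall (0:ℂ) 1, (∀ z ∈ X, f (φ z) ∈ Y2) → IsPreconnected X → (X ∩ A).Nonempty → X ⊆ A
  Ae : ∀ z ∈ A, ‖z‖ = 1 → z = e
  null : MeasureTheory.volume A = 0
  conn : IsPreconnected (closedBall (0:ℂ) 1 \ A)

namespace InjData
variable {S₁ S₂ : Type*} [MetricSpace S₁] [CompactSpace S₁] [MetricSpace S₂] {f : S₁ → S₂} {φ : ℂ → S₁} {Y2 : Set S₂}
    {A : Set ℂ} {e : ℂ}

lemma lift (d : InjData f φ Y2 A e) (z : ℂ) (y : S₁) (h : f y = f (φ z)) :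
    ∃ T : ℂ → S₁, Continuous T ∧ (∀ w, f (T w) = f (φ w)) ∧ T z = y := by
  obtain ⟨F, ⟨h1, h2⟩, -⟩ := d.cov.existsUnique_continuousMap_lifts ⟨fun w => f (φ w), d.cov.continuous.comp d.cont⟩ z y h
  exact ⟨F, F.continuous, fun w => congrFun h2 w, h1⟩

lemma uniq (d : InjData f φ Y2 A e) {X : Set ℂ} (hX : IsPreconnected X) {a b : ℂ → S₁} (ha : ContinuousOn a X)
    (hb : ContinuousOn b X) (hab : ∀ z ∈ X, f (a z) = f (b z)) {x : ℂ} (hx : x ∈ X) (h : a x = b x) :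
    ∀ z ∈ X, a z = b z := fun z hz =>
  d.cov.eqOn_of_comp_eqOn hX ha hb (fun w hw => hab w hw) hx h hz

/-- continuous inverse of φ on the disc -/
lemma inv (d : InjData f φ Y2 A e) : ∃ ψ : S₁ → ℂ, ContinuousOn ψ (φ '' closedBall 0 1) ∧
    ∀ z ∈ closedBall (0:ℂ) 1, ψ (φ z) = z := by
  refine ⟨Function.invFunOn φ (closedBall 0 1), ?_, fun z hz => d.inj.leftInvOn_invFunOn hz⟩
  rw [continuousOn_iff_isClosed]
  intro t ht
  refine ⟨φ '' (t ∩ closedBall 0 1), (((isCompact_closedBall (0:ℂ) 1).inter_left ht).image d.cont).isClosed, ?_⟩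
  ext y
  constructor
  · rintro ⟨hy, ⟨z, hz, rfl⟩⟩
    refine ⟨⟨z, ⟨?_, hz⟩, rfl⟩, ⟨z, hz, rfl⟩⟩
    rw [mem_preimage, d.inj.leftInvOn_invFunOn hz] at hy
    exact hy
  · rintro ⟨⟨z, ⟨hz1, hz2⟩, rfl⟩, hy⟩
    refine ⟨?_, hy⟩
    rw [mem_preimage, d.inj.leftInvOn_invFunOn hz2]
    exact hz1

lemma ffin (d : InjData f φ Y2 A e) (y : S₂) : {w | w ∈ closedBall (0:ℂ) 1 ∧ f (φ w) = y}.Finite := by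
  refine Set.Finite.of_finite_image ((fiber_finite d.cov y).subset ?_) (f := φ) (d.inj.mono fun w hw => hw.1)
  rintro _ ⟨w, hw, rfl⟩
  exact hw.2

lemma nofree (d : InjData f φ Y2 A e) {X : Set ℂ} (hXA : X ⊆ A) (hXk : IsCompact X) (hXc : IsConnected X)
    {T : ℂ → S₁} (hT : Continuous T) (hTf : ∀ w, f (T w) = f (φ w)) (hne : ∀ w, T w ≠ φ w)
    (hTX : ∀ z ∈ X, T z ∈ φ '' X) : False := by
  obtain ⟨ψ, hψ, hψφ⟩ := d.inv
  set g : ℂ → ℂ := fun z => ψ (T z) with hgd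
  have hXD : X ⊆ closedBall 0 1 := hXA.trans d.AD
  have hg1 : ∀ z ∈ X, g z ∈ X ∧ φ (g z) = T z := by
    intro z hz
    obtain ⟨w, hw, hwT⟩ := hTX z hz
    have : g z = w := by simp only [hgd, ← hwT]; exact hψφ w (hXD hw)
    rw [this]; exact ⟨hw, hwT⟩
  have hm : MapsTo g X X := fun z hz => (hg1 z hz).1
  have hgc : ContinuousOn g X := hψ.comp hT.continuousOn fun z hz => image_mono hXD (hTX z hz)
  have hF1 : ∀ z ∈ X, f (φ (g z)) = f (φ z) := fun z hz => by rw [(hg1 z hz).2, hTf]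
  have hF : ∀ k, ∀ z ∈ X, f (φ (g^[k] z)) = f (φ z) := by
    intro k
    induction k with
    | zero => intro z _; rfl
    | succ k ih => intro z hz; rw [Function.iterate_succ_apply', hF1 _ (hm.iterate k hz), ih z hz]
  have huq : ∀ X' ⊆ X, IsPreconnected X' → ∀ i j, (∃ x ∈ X', g^[i] x = g^[j] x) → ∀ z ∈ X', g^[i] z = g^[j] z := by
    rintro X' hX' hc i j ⟨x, hx, hxe⟩ z hz
    have hc1 : ∀ k, ContinuousOn (fun z => φ (g^[k] z)) X' := fun k =>
      d.cont.comp_continuousOn ((hgc.iterate hm k).mono hX')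
    exact d.inj (hXD (hm.iterate i (hX' hz))) (hXD (hm.iterate j (hX' hz)))
      (d.uniq hc (hc1 i) (hc1 j) (fun w hw => by simp only [hF i w (hX' hw), hF j w (hX' hw)]) hx
        (by simp only [hxe]) z hz)
  obtain ⟨x, hx⟩ := hXc.nonempty
  obtain ⟨i, j, hij, hije⟩ : ∃ i j, i < j ∧ g^[i] x = g^[j] x := by
    have := (d.ffin (f (φ x)))
    have hmt : MapsTo (fun k => g^[k] x) univ {w | w ∈ closedBall (0:ℂ) 1 ∧ f (φ w) = f (φ x)} :=
      fun k _ => ⟨hXD (hm.iterate k hx), hF k x hx⟩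
    obtain ⟨i, -, j, -, hne, he⟩ := Set.infinite_univ.exists_ne_map_eq_of_mapsTo hmt this
    rcases lt_or_gt_of_ne hne with h | h
    · exact ⟨i, j, h, he⟩
    · exact ⟨j, i, h, he.symm⟩
  have hall := huq X Subset.rfl hXc.isPreconnected i j ⟨x, hx, hije⟩
  set X' := g^[i] '' X with hX'd
  have hX'X : X' ⊆ X := by rintro _ ⟨z, hz, rfl⟩; exact hm.iterate i hz
  have hgX' : MapsTo g X' X' := by
    rintro _ ⟨z, hz, rfl⟩
    exact ⟨g z, hm hz, by rw [← Function.iterate_succ_apply, Function.iterate_succ_apply' g i z]⟩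
  have hX'c : IsConnected X' := hXc.image _ (hgc.iterate hm i)
  have hX'k : IsCompact X' := hXk.image_of_continuousOn (hgc.iterate hm i)
  have hex : ∃ k, 0 < k ∧ ∀ z ∈ X', g^[k] z = z := by
    refine ⟨j - i, by omega, ?_⟩
    rintro _ ⟨z, hz, rfl⟩
    rw [← Function.iterate_add_apply, show j - i + i = j by omega, ← hall z hz]
  classical
  set m := Nat.find hex
  have hm0 := Nat.find_spec hex
  have hmin : ∀ k, 0 < k → k < m → ∀ z ∈ X', g^[k] z ≠ z := by
    intro k hk hkm z hz he
    exact Nat.find_min hex hkm ⟨hk, huq X' hX'X hX'c.isPreconnected k 0 ⟨z, hz, he⟩⟩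
  have hm2 : 2 ≤ m := by
    by_contra h
    have h1 : m = 1 := by have := hm0.1; omega
    obtain ⟨z, hz⟩ := hX'c.nonempty
    have h2 := hm0.2 z hz
    rw [show Nat.find hex = 1 from h1] at h2
    have h3 := (hg1 z (hX'X hz)).2
    rw [show g z = z from h2] at h3
    exact hne z h3.symm
  have hX'A := hX'X.trans hXA
  exact no_free hX'k hX'c (hX'A.trans d.AD)
    (compl_preconn (disc_sdiff_preconn d.null d.Acp.isClosed d.conn hX'A) (hX'A.trans d.AD) (fun z hz => d.Ae z (hX'A hz)))
    (MeasureTheory.measure_mono_null hX'A d.null) (hgc.mono hX'X) hgX' hm2 hm0.2 (fun z hz k hk hkm => hmin k hk hkm z hz)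

end InjData

namespace InjData
variable {S₁ S₂ : Type*} [MetricSpace S₁] [CompactSpace S₁] [MetricSpace S₂] {f : S₁ → S₂} {φ : ℂ → S₁} {Y2 : Set S₂}
    {A : Set ℂ} {e : ℂ}

/-- connected sets mapped into the disc and touching `φ '' A` are mapped into `φ '' A`. -/
lemma stay (d : InjData f φ Y2 A e) {X : Set ℂ} (hXA : X ⊆ A) (hX : IsPreconnected X) {a : ℂ → S₁}
    (ha : ContinuousOn a X) (haf : ∀ w ∈ X, f (a w) = f (φ w)) (hQ : ∀ w ∈ X, a w ∈ φ '' closedBall 0 1)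
    {x : ℂ} (hx : x ∈ X) (hxA : a x ∈ φ '' A) : ∀ w ∈ X, a w ∈ φ '' A := by
  obtain ⟨ψ, hψ, hψφ⟩ := d.inv
  have hφψ : ∀ w ∈ X, φ (ψ (a w)) = a w ∧ ψ (a w) ∈ closedBall (0:ℂ) 1 := by
    intro w hw
    obtain ⟨z, hz, hze⟩ := hQ w hw
    rw [← hze, hψφ z hz]; exact ⟨rfl, hz⟩
  have h1 := d.amax ((fun w => ψ (a w)) '' X) (by rintro _ ⟨w, hw, rfl⟩; exact (hφψ w hw).2)
    (by
      rintro _ ⟨w, hw, rfl⟩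
      simp only [(hφψ w hw).1, haf w hw]
      exact d.AY w (hXA hw))
    (hX.image _ (hψ.comp ha hQ)) (by
      obtain ⟨b, hb, hbe⟩ := hxA
      exact ⟨b, ⟨x, hx, by simp only [← hbe, hψφ b (d.AD hb)]⟩, hb⟩)
  intro w hw
  exact ⟨ψ (a w), h1 ⟨w, hw, rfl⟩, (hφψ w hw).1⟩

lemma ne_all (d : InjData f φ Y2 A e) {T : ℂ → S₁} (hT : Continuous T) (hTf : ∀ w, f (T w) = f (φ w)) {x : ℂ}
    (hx : T x ≠ φ x) : ∀ w, T w ≠ φ w := by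
  intro w hw
  exact hx (d.uniq isPreconnected_univ hT.continuousOn d.cont.continuousOn (fun z _ => hTf z) (mem_univ w) hw x (mem_univ x))

lemma in_ball (d : InjData f φ Y2 A e) {y : S₁} (hy : y ∈ φ '' A) (hne : ∀ h : e ∈ A, y ≠ φ e) : y ∈ φ '' ball 0 1 := by
  obtain ⟨z, hz, rfl⟩ := hy
  refine ⟨z, ?_, rfl⟩
  have h1 := d.AD hz
  simp only [mem_closedBall, dist_zero_right, mem_ball] at h1 ⊢
  refine lt_of_le_of_ne h1 fun h => ?_
  have h2 := d.Ae z hz h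
  exact hne (h2 ▸ hz) (by rw [h2])

lemma bump1 (d : InjData f φ Y2 A e) {T : ℂ → S₁} (hT : Continuous T) (hTf : ∀ w, f (T w) = f (φ w))
    (hne : ∀ w, T w ≠ φ w) {a : ℂ} (ha : a ∈ A) (haT : T a ∈ φ '' A) :
    e ∈ A ∧ ∃ C ⊆ A, IsPreconnected C ∧ a ∈ C ∧ (∀ z ∈ C, T z ∈ φ '' A) ∧ ∃ a' ∈ C, T a' = φ e := by
  have hQ : IsClosed (φ '' closedBall 0 1) := ((isCompact_closedBall (0:ℂ) 1).image d.cont).isClosed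
  set W := A ∩ T ⁻¹' (φ '' closedBall 0 1) with hW
  have hWk : IsCompact W := d.Acp.inter_right (hQ.preimage hT)
  have haW : a ∈ W := ⟨ha, image_mono d.AD haT⟩
  set C := connectedComponentIn W a with hC
  have hCW : C ⊆ W := connectedComponentIn_subset _ _
  have haC : a ∈ C := mem_connectedComponentIn haW
  have hCA : ∀ z ∈ C, T z ∈ φ '' A := d.stay (hCW.trans inter_subset_left) isPreconnected_connectedComponentIn
    hT.continuousOn (fun w _ => hTf w) (fun w hw => (hCW hw).2) haC haT
  by_cases hex : e ∈ A ∧ ∃ a' ∈ C, T a' = φ e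
  · exact ⟨hex.1, C, hCW.trans inter_subset_left, isPreconnected_connectedComponentIn, haC, hCA, hex.2⟩
  · exfalso
    have hAW : A ⊆ W := bumping d.Aco.isPreconnected hWk inter_subset_left (O := T ⁻¹' (φ '' ball 0 1))
      (d.opn.preimage hT) (fun z hz => ⟨hz.1, image_mono ball_subset_closedBall hz.2⟩) haW (fun z hz =>
        d.in_ball (hCA z hz) fun h h2 => hex ⟨h, z, hz, h2⟩)
    exact d.nofree Subset.rfl d.Acp d.Aco hT hTf hne (d.stay Subset.rfl d.Aco.isPreconnected hT.continuousOn
      (fun w _ => hTf w) (fun w hw => (hAW hw).2) ha haT)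

lemma at_e (d : InjData f φ Y2 A e) {T : ℂ → S₁} (hT : Continuous T) (hTf : ∀ w, f (T w) = f (φ w))
    (hne : ∀ w, T w ≠ φ w) {a : ℂ} (ha : a ∈ A) (haT : T a ∈ φ '' A) : T e ∈ φ '' A := by
  obtain ⟨heA, C0, hC0, -, -, -, a', ha', haTe⟩ := d.bump1 hT hTf hne ha haT
  obtain ⟨V, hV, hVf, hVe⟩ := d.lift e (φ a') (by rw [← hTf, haTe])
  have hVne : V e ≠ φ e := by
    intro h
    have : a' = e := d.inj (d.AD (hC0 ha')) (d.AD heA) (hVe.symm.trans h)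
    rw [this] at haTe
    exact hne e haTe
  obtain ⟨-, C, hCA, hCc, heC, hVC, a'', ha'', hVa⟩ := d.bump1 hV hVf (d.ne_all hV hVf hVne) heA ⟨a', hC0 ha', hVe.symm⟩
  obtain ⟨ψ, hψ, hψφ⟩ := d.inv
  have hφψ : ∀ w ∈ C, φ (ψ (V w)) = V w := by
    intro w hw
    obtain ⟨z, hz, hze⟩ := hVC w hw
    rw [← hze, hψφ z (d.AD hz)]
  have h1 := d.uniq hCc (a := fun w => T (ψ (V w))) (b := φ)
    (hT.comp_continuousOn (hψ.comp hV.continuousOn fun w hw => image_mono d.AD (hVC w hw))) d.cont.continuousOn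
    (fun w hw => by simp only [hTf, hφψ w hw, hVf]) heC (by
      simp only [hVe, hψφ a' (d.AD (hC0 ha'))]; exact haTe) a'' ha''
  simp only [hVa, hψφ e (d.AD heA)] at h1
  exact ⟨a'', hCA ha'', h1.symm⟩

theorem injOn (d : InjData f φ Y2 A e) : InjOn (fun z => f (φ z)) A := by
  intro a ha b hb hab
  by_contra hneab
  obtain ⟨T1, hT1, hT1f, hT1a⟩ := d.lift a (φ b) hab.symm
  have hT1ne := d.ne_all hT1 hT1f (x := a) (by
    rw [hT1a]; exact fun h => hneab (d.inj (d.AD hb) (d.AD ha) h).symm)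
  have heA : e ∈ A := (d.bump1 hT1 hT1f hT1ne ha (hT1a ▸ ⟨b, hb, rfl⟩)).1
  -- the family of lifts
  let Tf : Set (ℂ → S₁) := {T | Continuous T ∧ (∀ w, f (T w) = f (φ w)) ∧ (∀ w, T w ≠ φ w) ∧ T e ∈ φ '' A}
  have hTfin : Tf.Finite := by
    refine Set.Finite.of_finite_image (f := fun T => T e) ((fiber_finite d.cov (f (φ e))).subset ?_) ?_
    · rintro _ ⟨T, hT, rfl⟩
      exact hT.2.1 e
    · intro T hT T' hT' h
      funext w
      exact d.uniq isPreconnected_univ hT.1.continuousOn hT'.1.continuousOn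
        (fun z _ => (hT.2.1 z).trans (hT'.2.1 z).symm) (mem_univ e) h w (mem_univ w)
  have hT1f' : T1 ∈ Tf := ⟨hT1, hT1f, hT1ne, d.at_e hT1 hT1f hT1ne ha (hT1a ▸ ⟨b, hb, rfl⟩)⟩
  have hQ : IsClosed (φ '' closedBall 0 1) := ((isCompact_closedBall (0:ℂ) 1).image d.cont).isClosed
  set W := A ∩ ⋂ T ∈ Tf, T ⁻¹' (φ '' closedBall 0 1) with hW
  have hWk : IsCompact W := d.Acp.inter_right (isClosed_biInter fun T hT => hQ.preimage hT.1)
  have heW : e ∈ W := ⟨heA, mem_iInter₂.2 fun T hT => image_mono d.AD hT.2.2.2⟩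
  set N := connectedComponentIn W e with hN
  have hNW : N ⊆ W := connectedComponentIn_subset _ _
  have hNA : N ⊆ A := hNW.trans inter_subset_left
  have heN : e ∈ N := mem_connectedComponentIn heW
  have hNc : IsConnected N := ⟨⟨e, heN⟩, isPreconnected_connectedComponentIn⟩
  have hNk : IsCompact N := hWk.of_isClosed_subset (isClosed_ccIn hWk.isClosed _) hNW
  have hTN : ∀ T ∈ Tf, ∀ w ∈ N, T w ∈ φ '' A := fun T hT =>
    d.stay hNA hNc.isPreconnected hT.1.continuousOn (fun w _ => hT.2.1 w)
      (fun w hw => mem_iInter₂.1 (hNW hw).2 T hT) heN hT.2.2.2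
  obtain ⟨T0, hT0, z, hzN, hT0z⟩ : ∃ T ∈ Tf, ∃ z ∈ N, T z = φ e := by
    by_contra hcon
    push Not at hcon
    have hAW : A ⊆ W := bumping d.Aco.isPreconnected hWk inter_subset_left (O := ⋂ T ∈ Tf, T ⁻¹' (φ '' ball 0 1))
      (hTfin.isOpen_biInter fun T hT => d.opn.preimage hT.1) (fun z hz => ⟨hz.1, mem_iInter₂.2 fun T hT =>
        image_mono ball_subset_closedBall (mem_iInter₂.1 hz.2 T hT)⟩) heW (fun z hz =>
        mem_iInter₂.2 fun T hT => d.in_ball (hTN T hT z hz) fun h h2 => hcon T hT z hz h2)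
    exact d.nofree Subset.rfl d.Acp d.Aco hT1 hT1f hT1ne (d.stay Subset.rfl d.Aco.isPreconnected hT1.continuousOn
      (fun w _ => hT1f w) (fun w hw => mem_iInter₂.1 (hAW hw).2 T1 hT1f') ha (hT1a ▸ ⟨b, hb, rfl⟩))
  obtain ⟨hT0c, hT0f, hT0ne, hT0e⟩ := id hT0
  -- any lift with a value at `z` in `φ '' A` maps `N` into `φ '' A`
  have hV : ∀ V : ℂ → S₁, Continuous V → (∀ w, f (V w) = f (φ w)) → V z ∈ φ '' A → ∀ w ∈ N, V w ∈ φ '' A := by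
    intro V hVc hVf hVz w hw
    by_cases h : V w = φ w
    · rw [h]; exact ⟨w, hNA hw, rfl⟩
    · have hVne := d.ne_all hVc hVf h
      exact hTN V ⟨hVc, hVf, hVne, d.at_e hVc hVf hVne (hNA hzN) hVz⟩ w hw
  obtain ⟨ψ, hψ, hψφ⟩ := d.inv
  have hψA : ∀ y ∈ φ '' A, ψ y ∈ A ∧ φ (ψ y) = y := by
    rintro _ ⟨w, hw, rfl⟩
    rw [hψφ w (d.AD hw)]; exact ⟨hw, rfl⟩
  set g : ℂ → ℂ := fun w => ψ (T0 w) with hg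
  have hgz : g z = e := by simp only [hg, hT0z, hψφ e (d.AD heA)]
  have ind : ∀ i, ContinuousOn (g^[i]) N ∧ MapsTo (g^[i]) N A ∧ (∀ w ∈ N, f (φ (g^[i] w)) = f (φ w)) ∧
      ∀ w ∈ N, T0 (g^[i] w) ∈ φ '' A := by
    intro i
    induction i with
    | zero => exact ⟨continuousOn_id, hNA, fun _ _ => rfl, hTN T0 hT0⟩
    | succ i ih =>
      obtain ⟨h1, h2, h3, h4⟩ := ih
      have e1 : ∀ w, g^[i+1] w = ψ (T0 (g^[i] w)) := fun w => Function.iterate_succ_apply' g i w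
      have c1 : ContinuousOn (g^[i+1]) N :=
        (hψ.comp (hT0c.comp_continuousOn h1) fun w hw => image_mono d.AD (h4 w hw)).congr fun w _ => e1 w
      have c2 : MapsTo (g^[i+1]) N A := fun w hw => by rw [e1]; exact (hψA _ (h4 w hw)).1
      have c3 : ∀ w ∈ N, f (φ (g^[i+1] w)) = f (φ w) := fun w hw => by
        rw [e1, (hψA _ (h4 w hw)).2, hT0f, h3 w hw]
      refine ⟨c1, c2, c3, ?_⟩
      have hzv : T0 (g^[i+1] z) ∈ φ '' A := by
        rw [Function.iterate_succ_apply, hgz]; exact h4 e heN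
      obtain ⟨V, hVc, hVf, hVz⟩ := d.lift z (T0 (g^[i+1] z)) (by rw [hT0f, c3 z hzN])
      have := d.uniq hNc.isPreconnected (a := fun w => T0 (g^[i+1] w)) (b := V) (hT0c.comp_continuousOn c1)
        hVc.continuousOn (fun w hw => by simp only [hT0f, hVf, c3 w hw]) hzN hVz.symm
      intro w hw
      have h5 := this w hw
      rw [h5]
      exact hV V hVc hVf (hVz ▸ hzv) w hw
  obtain ⟨i, j, hij, hije⟩ : ∃ i j, i < j ∧ g^[i] e = g^[j] e := by
    have := (d.ffin (f (φ e)))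
    have hmt : MapsTo (fun k => g^[k] e) univ {w | w ∈ closedBall (0:ℂ) 1 ∧ f (φ w) = f (φ e)} :=
      fun k _ => ⟨d.AD ((ind k).2.1 heN), (ind k).2.2.1 e heN⟩
    obtain ⟨i, -, j, -, hne, he⟩ := Set.infinite_univ.exists_ne_map_eq_of_mapsTo hmt this
    rcases lt_or_gt_of_ne hne with h | h
    · exact ⟨i, j, h, he⟩
    · exact ⟨j, i, h, he.symm⟩
  have hall : ∀ w ∈ N, g^[i] w = g^[j] w := by
    intro w hw
    exact d.inj (d.AD ((ind i).2.1 hw)) (d.AD ((ind j).2.1 hw)) (d.uniq hNc.isPreconnected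
      (a := fun w => φ (g^[i] w)) (b := fun w => φ (g^[j] w)) (d.cont.comp_continuousOn (ind i).1)
      (d.cont.comp_continuousOn (ind j).1) (fun w hw => by simp only [(ind i).2.2.1 w hw, (ind j).2.2.1 w hw]) heN
      (by simp only [hije]) w hw)
  have hred : ∀ k, ∃ k' < j, ∀ w ∈ N, g^[k] w = g^[k'] w := by
    intro k
    induction k using Nat.strong_induction_on with
    | _ k ih =>
      by_cases hk : k < j
      · exact ⟨k, hk, fun _ _ => rfl⟩
      · obtain ⟨k', hk', h⟩ := ih (k - j + i) (by omega)
        refine ⟨k', hk', fun w hw => ?_⟩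
        rw [← h w hw, Function.iterate_add_apply, hall w hw, ← Function.iterate_add_apply]
        congr 2; omega
  set As := ⋃ k : ℕ, g^[k] '' N with hAs
  have hAsk : IsCompact As := by
    have : As = ⋃ k ∈ Finset.range j, g^[k] '' N := by
      apply Subset.antisymm
      · rintro _ ⟨_, ⟨k, rfl⟩, w, hw, rfl⟩
        obtain ⟨k', hk', h⟩ := hred k
        rw [h w hw]
        exact mem_iUnion₂.2 ⟨k', Finset.mem_range.2 hk', w, hw, rfl⟩
      · exact iUnion₂_subset fun k _ => subset_iUnion (fun k : ℕ => g^[k] '' N) k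
    rw [this]
    exact (Finset.range j).isCompact_biUnion fun k _ => hNk.image_of_continuousOn (ind k).1
  have hAsc : IsConnected As := by
    refine IsConnected.iUnion_of_chain (fun k => hNc.image _ (ind k).1) fun k => ?_
    refine ⟨g^[k] e, ⟨e, heN, rfl⟩, ⟨z, hzN, ?_⟩⟩
    rw [Nat.succ_eq_succ, Nat.succ_eq_add_one, Function.iterate_succ_apply, hgz]
  refine d.nofree (X := As) ?_ hAsk hAsc hT0c hT0f hT0ne ?_
  · rintro _ ⟨_, ⟨k, rfl⟩, w, hw, rfl⟩
    exact (ind k).2.1 hw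
  · rintro _ ⟨_, ⟨k, rfl⟩, w, hw, rfl⟩
    refine ⟨g^[k+1] w, mem_iUnion.2 ⟨k+1, w, hw, rfl⟩, ?_⟩
    rw [Function.iterate_succ_apply']
    exact (hψA _ ((ind k).2.2.2 w hw)).2

end InjData

lemma disc_loc {A : Set ℂ} (hA : IsClosed A) {z : ℂ} (hz : z ∈ closedBall (0:ℂ) 1 \ A) :
    ∃ r > 0, closedBall (0:ℂ) 1 ∩ ball z r ⊆ closedBall (0:ℂ) 1 \ A ∧ IsPreconnected (closedBall (0:ℂ) 1 ∩ ball z r) := by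
  obtain ⟨r, hr, h⟩ := Metric.isOpen_iff.1 hA.isOpen_compl z hz.2
  exact ⟨r, hr, fun w hw => ⟨hw.1, h hw.2⟩, ((convex_closedBall _ _).inter (convex_ball _ _)).isPreconnected⟩

/-- A point outside `A`, in a different component from `x` of the complement, can be joined to `A` off that component. -/
lemma first_hit {A : Set ℂ} (hA : IsClosed A) {u q x : ℂ} (hu : u ∈ closedBall (0:ℂ) 1 \ A)
    (hq : q ∈ A) (hqD : q ∈ closedBall (0:ℂ) 1) (hux : u ∉ connectedComponentIn (closedBall (0:ℂ) 1 \ A) x) :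
    ∃ X : Set ℂ, IsPreconnected X ∧ u ∈ X ∧ (X ∩ A).Nonempty ∧
      ∀ z ∈ X, z ∈ A ∨ z ∈ (closedBall (0:ℂ) 1 \ A) \ connectedComponentIn (closedBall (0:ℂ) 1 \ A) x := by
  let l : ℝ → ℂ := fun t => AffineMap.lineMap u q t
  have hl : Continuous l := AffineMap.lineMap_continuous
  have hk : IsCompact (Icc (0:ℝ) 1 ∩ l ⁻¹' A) := isCompact_Icc.inter_right (hA.preimage hl)
  obtain ⟨t0, ⟨ht0, ht0A⟩, hmin⟩ := hk.exists_isLeast ⟨1, by simp, by simp [l, hq]⟩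
  have hlD : ∀ t ∈ Icc (0:ℝ) 1, l t ∈ closedBall (0:ℂ) 1 := fun t ht =>
    (convex_closedBall (0:ℂ) 1).lineMap_mem hu.1 hqD ht
  have ht0p : 0 < t0 := by
    refine lt_of_le_of_ne ht0.1 fun h => hu.2 ?_
    rw [← h] at ht0A
    simpa [l] using ht0A
  have hsub : l '' Ico 0 t0 ⊆ closedBall (0:ℂ) 1 \ A := by
    rintro _ ⟨t, ht, rfl⟩
    have ht' : t ∈ Icc (0:ℝ) 1 := ⟨ht.1, ht.2.le.trans ht0.2⟩
    exact ⟨hlD t ht', fun h => absurd (hmin ⟨ht', h⟩) (not_le.2 ht.2)⟩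
  have hul : u ∈ l '' Ico 0 t0 := ⟨0, ⟨le_rfl, ht0p⟩, by simp [l]⟩
  refine ⟨l '' Icc 0 t0, isPreconnected_Icc.image _ hl.continuousOn, ⟨0, ⟨le_rfl, ht0p.le⟩, by simp [l]⟩,
    ⟨l t0, ⟨t0, ⟨ht0p.le, le_rfl⟩, rfl⟩, ht0A⟩, ?_⟩
  rintro _ ⟨t, ht, rfl⟩
  rcases eq_or_lt_of_le ht.2 with h | h
  · left; rw [h]; exact ht0A
  · right
    refine ⟨hsub ⟨t, ⟨ht.1, h⟩, rfl⟩, fun hc => hux ?_⟩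
    rw [connectedComponentIn_eq hc]
    exact (isPreconnected_Ico.image _ hl.continuousOn).subset_connectedComponentIn ⟨t, ⟨ht.1, h⟩, rfl⟩ hsub hul

lemma gen_plane {M E : Set ℂ} {h : ℂ → ℝ} (hh : Continuous h) {C : ℕ → Set ℂ} (hM : IsCompact M)
    (hMD : M ⊆ closedBall 0 1) (hCc : ∀ n, IsPreconnected (C n)) (hCM : ∀ n, C n ⊆ M)
    (hsep : ∀ X ⊆ M, IsPreconnected X → ∀ n m, (X ∩ C n).Nonempty → (X ∩ C m).Nonempty → n = m)
    (hEM : E ⊆ M) (hEc : IsPreconnected E)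
    (hEl : ∀ x ∈ E, ∃ z : ℕ → ℂ, (∀ n, z n ∈ C n) ∧ Tendsto z atTop (𝓝 x)) {x y : ℂ} (hx : x ∈ E) (hy : y ∈ E)
    (hxy : h x < h y) {B : Set ℝ} (hB : B.Countable) :
    ∃ s, s ∉ B ∧ s ≠ h x ∧ ∃ q ∈ E, h q = s ∧ ∃ A, A = connectedComponentIn (M ∩ {z | h z = s}) q ∧
      MeasureTheory.volume A = 0 ∧ IsPreconnected (closedBall (0:ℂ) 1 \ A) ∧ 
      ∃ e : ℂ, ‖e‖ = 1 ∧ ∀ z ∈ A, ‖z‖ = 1 → z = e := by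
  have hiv : ∀ s ∈ Ioo (h x) (h y), ∃ q ∈ E, h q = s := by
    intro s hs
    have := hEc.intermediate_value hx hy hh.continuousOn (Ioo_subset_Icc_self hs)
    exact this
  choose! q hqE hqs using hiv
  let A : ℝ → Set ℂ := fun s => connectedComponentIn (M ∩ {z | h z = s}) (q s)
  have hAsub : ∀ s, A s ⊆ M ∩ {z | h z = s} := fun s => connectedComponentIn_subset _ _
  have hYk : ∀ s, IsCompact (M ∩ {z | h z = s}) := fun s => hM.inter_right (isClosed_eq hh continuous_const)
  have hAcl : ∀ s, IsClosed (A s) := fun s => isClosed_ccIn (hYk s).isClosed _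
  have hAk : ∀ s, IsCompact (A s) := fun s => (hYk s).of_isClosed_subset (hAcl s) (hAsub s)
  have hAc : ∀ s, IsPreconnected (A s) := fun s => isPreconnected_connectedComponentIn
  have hAD : ∀ s, A s ⊆ closedBall 0 1 := fun s => (hAsub s).trans (inter_subset_left.trans hMD)
  have hqA : ∀ s ∈ Ioo (h x) (h y), q s ∈ A s := fun s hs => mem_connectedComponentIn ⟨hEM (hqE s hs), hqs s hs⟩
  have hdis : ∀ s t, s ≠ t → Disjoint (A s) (A t) := by
    intro s t hst
    rw [Set.disjoint_left]
    intro z hz hz'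
    exact hst ((hAsub s hz).2.symm.trans (hAsub t hz').2)
  set J := Ioo (h x) (h y) with hJ
  -- null
  have b2 : {s | 0 < MeasureTheory.volume (A s ∩ closedBall 0 1)}.Countable := by
    have hfin : MeasureTheory.IsFiniteMeasure (MeasureTheory.volume.restrict (closedBall (0:ℂ) 1)) :=
      ⟨by rw [MeasureTheory.Measure.restrict_apply_univ]; exact (isCompact_closedBall (0:ℂ) 1).measure_lt_top⟩
    have := MeasureTheory.Measure.countable_meas_pos_of_disjoint_iUnion (μ := MeasureTheory.volume.restrict (closedBall (0:ℂ) 1))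
      (As := A) (fun s => (hAcl s).measurableSet) (fun s t hst => hdis s t hst)
    refine this.mono fun s hs => ?_
    simp only [mem_ofPred_eq] at hs ⊢
    rwa [MeasureTheory.Measure.restrict_apply (hAcl s).measurableSet]
  -- circle
  have b3 : {s | (interior ((Subtype.val : sphere (0:ℂ) 1 → ℂ) ⁻¹' (A s))).Nonempty}.Countable := by
    refine Set.PairwiseDisjoint.countable_of_isOpen (s := fun s => interior ((Subtype.val : sphere (0:ℂ) 1 → ℂ) ⁻¹' (A s)))
      ?_ (fun s _ => isOpen_interior) (fun s hs => hs)
    intro s _ t _ hst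
    exact ((hdis s t hst).preimage _).mono interior_subset interior_subset
  -- separation
  let V : ℝ → Set ℂ := fun s => connectedComponentIn (closedBall (0:ℂ) 1 \ A s) x
  have hxV : ∀ s ∈ J, x ∈ closedBall (0:ℂ) 1 \ A s := fun s hs =>
    ⟨hMD (hEM hx), fun h' => absurd (hAsub s h').2 (ne_of_lt hs.1)⟩
  have hVsub : ∀ s, V s ⊆ closedBall (0:ℂ) 1 \ A s := fun s => connectedComponentIn_subset _ _
  have hVmem : ∀ s ∈ J, ∀ X ⊆ closedBall (0:ℂ) 1 \ A s, IsPreconnected X → (X ∩ V s).Nonempty → X ⊆ V s := by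
    rintro s hs X hX hXc ⟨w, hwX, hwV⟩
    simp only [V]
    rw [connectedComponentIn_eq hwV]
    exact hXc.subset_connectedComponentIn hwX hX
  have hCV : ∀ s ∈ J, ∀ᶠ n in atTop, C n ⊆ V s := by
    intro s hs
    obtain ⟨z, hzC, hz⟩ := hEl x hx
    obtain ⟨r, hr, hr1, hr2⟩ := disc_loc (hAcl s) (hxV s hs)
    have h1 : ∀ᶠ n in atTop, z n ∈ ball x r := hz (ball_mem_nhds x hr)
    have h2 : ∀ᶠ n in atTop, ¬ (A s ∩ C n).Nonempty := by
      by_cases hex : ∃ m, (A s ∩ C m).Nonempty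
      · obtain ⟨m, hm⟩ := hex
        filter_upwards [eventually_gt_atTop m] with n hn hne
        have := hsep (A s) ((hAsub s).trans inter_subset_left) (hAc s) n m hne hm
        omega
      · push Not at hex
        filter_upwards with n
        simp [hex n]
    filter_upwards [h1, h2] with n hn1 hn2
    have hzD : z n ∈ closedBall (0:ℂ) 1 ∩ ball x r := ⟨hMD (hCM n (hzC n)), hn1⟩
    have h3 : z n ∈ V s := hVmem s hs _ hr1 hr2 ⟨x, ⟨hMD (hEM hx), mem_ball_self hr⟩, mem_connectedComponentIn (hxV s hs)⟩ hzD
    exact hVmem s hs _ (fun w hw => ⟨hMD (hCM n hw), fun hA => hn2 ⟨w, hA, hw⟩⟩) (hCc n) ⟨z n, hzC n, h3⟩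
  have hAV : ∀ s ∈ J, ∀ t ∈ J, s ≠ t → A t ⊆ V s := by
    intro s hs t ht hst
    have h1 : A t ⊆ closedBall (0:ℂ) 1 \ A s := fun z hz => ⟨hAD t hz, fun hz' => (hdis s t hst).ne_of_mem hz' hz rfl⟩
    refine hVmem s hs _ h1 (hAc t) ⟨q t, hqA t ht, ?_⟩
    obtain ⟨z, hzC, hz⟩ := hEl (q t) (hqE t ht)
    obtain ⟨r, hr, hr1, hr2⟩ := disc_loc (hAcl s) (h1 (hqA t ht))
    have h2 : ∀ᶠ n in atTop, z n ∈ ball (q t) r := hz (ball_mem_nhds _ hr)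
    obtain ⟨n, hn1, hn2⟩ := (h2.and (hCV s hs)).exists
    exact hVmem s hs _ hr1 hr2 ⟨z n, ⟨hMD (hCM n (hzC n)), hn1⟩, hn2 (hzC n)⟩ ⟨(h1 (hqA t ht)).1, mem_ball_self hr⟩
  have b1 : {s | s ∈ J ∧ ((closedBall (0:ℂ) 1 \ A s) \ V s).Nonempty}.Countable := by
    refine Set.PairwiseDisjoint.countable_of_isOpen
      (s := fun s => (Subtype.val : closedBall (0:ℂ) 1 → ℂ) ⁻¹' ((closedBall (0:ℂ) 1 \ A s) \ V s)) ?_ ?_ ?_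
    · rintro s ⟨hs, -⟩ t ⟨ht, -⟩ hst
      rw [Function.onFun, Set.disjoint_left]
      rintro ⟨u, huD⟩ hus hut
      simp only [mem_preimage] at hus hut
      obtain ⟨X, hXc, huX, ⟨w, hwX, hwA⟩, hX⟩ := first_hit (hAcl t) hut.1 (hqA t ht) (hAD t (hqA t ht)) hut.2
      apply hus.2
      refine hVmem s hs X (fun z hz => ?_) hXc ⟨w, hwX, hAV s hs t ht hst hwA⟩ huX
      rcases hX z hz with h1 | h1
      · exact hVsub s (hAV s hs t ht hst h1)
      · exact ⟨h1.1.1, fun h2 => h1.2 (hAV t ht s hs hst.symm h2)⟩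
    · rintro s ⟨hs, -⟩
      rw [Metric.isOpen_iff]
      rintro ⟨u, huD⟩ hu
      simp only [mem_preimage] at hu
      obtain ⟨r, hr, hr1, hr2⟩ := disc_loc (hAcl s) hu.1
      refine ⟨r, hr, ?_⟩
      rintro ⟨w, hwD⟩ hw
      have hw' : w ∈ closedBall (0:ℂ) 1 ∩ ball u r := ⟨hwD, hw⟩
      exact ⟨hr1 hw', fun hwV => hu.2 (hVmem s hs _ hr1 hr2 ⟨w, hw', hwV⟩ ⟨huD, mem_ball_self hr⟩)⟩
    · rintro s ⟨-, u, hu⟩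
      exact ⟨⟨u, hu.1.1⟩, hu⟩
  obtain ⟨s, hsJ, hs⟩ : ∃ s ∈ J, s ∉ B ∪ ({s | 0 < MeasureTheory.volume (A s ∩ closedBall 0 1)} ∪
      ({s | (interior ((Subtype.val : sphere (0:ℂ) 1 → ℂ) ⁻¹' (A s))).Nonempty} ∪ 
      {s | s ∈ J ∧ ((closedBall (0:ℂ) 1 \ A s) \ V s).Nonempty})) := by
    by_contra hcon
    push Not at hcon
    have h1 : J.Countable := (hB.union (b2.union (b3.union b1))).mono hcon
    exact (Cardinal.Real.Ioo_countable_iff.not.2 (not_le.2 hxy)) h1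
  simp only [mem_union, not_or, mem_ofPred_eq, not_and, hsJ, true_imp_iff] at hs
  obtain ⟨hsB, hs2, hs3, hs1⟩ := hs
  have hconn : IsPreconnected (closedBall (0:ℂ) 1 \ A s) := by
    have : closedBall (0:ℂ) 1 \ A s = V s := by
      apply Subset.antisymm _ (hVsub s)
      intro z hz
      by_contra hzV
      exact hs1 ⟨z, hz, hzV⟩
    rw [this]; exact isPreconnected_connectedComponentIn
  refine ⟨s, hsB, ne_of_gt hsJ.1, q s, hqE s hsJ, hqs s hsJ, A s, rfl, ?_, hconn, ?_⟩
  · rw [inter_eq_left.2 (hAD s)] at hs2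
    simpa using hs2
  · by_cases hex : ∃ e ∈ A s, ‖e‖ = 1
    · obtain ⟨e, heA, he⟩ := hex
      refine ⟨e, he, fun z hz hz1 => ?_⟩
      refine at_most_one (hAk s) ⟨⟨e, heA⟩, hAc s⟩ (hAD s) hconn ?_ hz heA hz1 he
      intro w hw ε hε
      by_contra hcon
      push Not at hcon
      apply hs3
      refine ⟨⟨w, by simpa using hw⟩, ?_⟩
      rw [mem_interior]
      refine ⟨ball ⟨w, by simpa using hw⟩ ε, ?_, isOpen_ball, mem_ball_self hε⟩
      rintro ⟨p, hp⟩ hpw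
      exact hcon p (by simpa using hp) hpw
    · push Not at hex
      exact ⟨1, by simp, fun z hz hz1 => absurd hz1 (hex z hz)⟩

lemma sq_homeo : ∃ R : ℂ ≃ₜ ℂ, ∀ w, ‖R w‖ = max |w.re| |w.im| ∧ ∃ t : ℝ, 0 < t ∧ R w = t • w := by
  refine radial_homeo (fun w => max |w.re| |w.im|) (by fun_prop) ?_ ?_
  · intro t w ht
    simp only [Complex.real_smul, Complex.re_ofReal_mul, Complex.im_ofReal_mul, abs_mul, abs_of_nonneg ht]
    rw [mul_max_of_nonneg _ _ ht]
  · intro w hw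
    rw [lt_max_iff, abs_pos, abs_pos]
    by_contra h
    push Not at h
    exact hw (Complex.ext h.1 h.2)

lemma inj_near {S₁ S₂ : Type*} [MetricSpace S₁] [MetricSpace S₂] {f : S₁ → S₂} (hf : IsCoveringMap f) {φ : ℂ → S₁}
    (hφ : Continuous φ) {D A : Set ℂ} (hi : InjOn φ D) (hA : IsCompact A)
    (hiA : InjOn (fun z => f (φ z)) A) (hne : A.Nonempty) :
    ∃ ε > 0, InjOn (fun z => f (φ z)) {z | z ∈ D ∧ infDist z A < ε} := by
  have h1 : InjOn f (φ '' A) := by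
    rintro _ ⟨a, ha, rfl⟩ _ ⟨b, hb, rfl⟩ h
    rw [hiA ha hb h]
  obtain ⟨U, hU, hUi⟩ := h1.exists_mem_nhdsSet (hA.image hφ) (fun x _ => hf.continuous.continuousAt) (fun x _ => by
    obtain ⟨e, he, hee⟩ := hf.isLocalHomeomorph x
    exact ⟨e.source, e.open_source.mem_nhds he, by rw [hee]; exact e.injOn⟩)
  obtain ⟨V, hV, hAV, hVU⟩ := mem_nhdsSet_iff_exists.1 hU
  obtain ⟨ε, hε, hs⟩ := hA.exists_thickening_subset_open (hV.preimage hφ) (fun z hz => hAV ⟨z, hz, rfl⟩)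
  refine ⟨ε, hε, ?_⟩
  have hm : ∀ z, infDist z A < ε → φ z ∈ U := by
    intro z hz
    refine hVU (hs ?_)
    rw [mem_thickening_iff_infDist_lt hne]; exact hz
  rintro a ⟨ha, ha'⟩ b ⟨hb, hb'⟩ h
  exact hi ha hb (hUi (hm a ha') (hm b hb') h)

lemma disc_coord {e : ℂ} (he : ‖e‖ = 1) : ∃ Ψ : ℂ ≃ₜ ℂ, Ψ e = 0 ∧ ∀ z, ‖z‖ = max |(Ψ z).re| |(Ψ z).im - 1| := by
  obtain ⟨R, hR⟩ := sq_homeo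
  have he0 : e ≠ 0 := by rintro rfl; simp at he
  have hc : (-Complex.I * e⁻¹) ≠ 0 := by simp [he0]
  refine ⟨((Homeomorph.mulLeft₀ _ hc).trans R.symm).trans (Homeomorph.addRight Complex.I), ?_, ?_⟩
  · have h1 : R.symm (-Complex.I) = -Complex.I := by
      rw [Homeomorph.symm_apply_eq]
      obtain ⟨h, t, ht, h2⟩ := hR (-Complex.I)
      rw [h2] at h ⊢
      simp [abs_of_pos ht] at h
      rw [h]; simp
    simp [he0, h1]
  · intro z
    have := (hR (R.symm (-Complex.I * e⁻¹ * z))).1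
    simp [he] at this
    simpa using this

lemma disc_final {S : Type*} [MetricSpace S] [CompactSpace S] {K : Set S} (hK : IsClosed K) {G : ℂ → S}
    (hG : Continuous G) {Hs : S → ℝ} (hHs : Continuous Hs) (hHK : ∀ p ∈ schonfliesRel K, Hs p.1 = Hs p.2)
    {C : ℕ → Set ℂ} (hCk : ∀ n, IsCompact (C n)) (hCc : ∀ n, IsPreconnected (C n))
    (hCM : ∀ n, C n ⊆ closedBall 0 1 ∩ G ⁻¹' K)
    (hsep : ∀ X ⊆ closedBall 0 1 ∩ G ⁻¹' K, IsPreconnected X → ∀ n m, (X ∩ C n).Nonempty → (X ∩ C m).Nonempty → n = m)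
    {qs : ℕ → ℂ} (hqs : ∀ n, qs n ∈ C n) {q : ℂ} (hq : Tendsto qs atTop (𝓝 q)) (hqi : ‖q‖ < 1)
    {E : Set ℂ} (hEk : IsClosed E) (hEM : E ⊆ closedBall 0 1 ∩ G ⁻¹' K)
    (hE : ∀ (k : ℕ → ℕ) (z : ℕ → ℂ) (x : ℂ), StrictMono k → (∀ j, z j ∈ C (k j)) → Tendsto z atTop (𝓝 x) → x ∈ E)
    {A : Set ℂ} (hA : A = connectedComponentIn (E ∩ {z | Hs (G z) = Hs (G q)}) q) {e : ℂ} (he : ‖e‖ = 1)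
    (hAe : ∀ z ∈ A, ‖z‖ = 1 → z = e) (hBA : IsPreconnected (closedBall 0 1 \ A))
    {ε0 : ℝ} (hε0 : 0 < ε0) (hinj : InjOn G {z | z ∈ closedBall 0 1 ∧ infDist z A < ε0})
    (hfar : ∀ n, ∃ z ∈ C n, ε0 ≤ infDist z A) : False := by
  obtain ⟨Ψ, hΨe, hΨ⟩ := disc_coord he
  have hbx : ∀ z, Ψ z ∈ boxB ↔ z ∈ closedBall (0:ℂ) 1 := by
    intro z
    rw [mem_closedBall, dist_zero_right, hΨ z, max_le_iff, abs_le (a := (Ψ z).im - 1)]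
    simp only [boxB, mem_ofPred_eq]
    constructor
    · rintro ⟨a, b, c⟩; exact ⟨a, by linarith, by linarith⟩
    · rintro ⟨a, b, c⟩; exact ⟨a, by linarith, by linarith⟩
  have hbx' : ∀ w, w ∈ boxB ↔ Ψ.symm w ∈ closedBall (0:ℂ) 1 := by
    intro w; rw [← hbx, Homeomorph.apply_symm_apply]
  have hqE : q ∈ E := hE id qs q strictMono_id hqs hq
  have hqA : q ∈ A := by rw [hA]; exact mem_connectedComponentIn ⟨hqE, rfl⟩
  have hAE : A ⊆ E := by rw [hA]; exact (connectedComponentIn_subset _ _).trans inter_subset_left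
  have hAk : IsCompact A := by
    refine (isCompact_closedBall (0:ℂ) 1).of_isClosed_subset ?_ (hAE.trans (hEM.trans inter_subset_left))
    rw [hA]
    exact isClosed_ccIn (hEk.inter (isClosed_eq (hHs.comp hG) continuous_const)) _
  have hA'k : IsCompact (Ψ '' A) := hAk.image Ψ.continuous
  have hO1 : IsOpen {w : ℂ | |w.re| < 1 ∧ w.im < 2} :=
    (isOpen_lt (f := fun w : ℂ => |w.re|) (by fun_prop) continuous_const).and
      (isOpen_lt (f := fun w : ℂ => w.im) (by fun_prop) continuous_const)
  have hO2 : IsOpen {w : ℂ | infDist (Ψ.symm w) A < ε0} :=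
    isOpen_lt ((continuous_infDist_pt A).comp Ψ.symm.continuous) continuous_const
  obtain ⟨ε, hε, hs⟩ := hA'k.exists_thickening_subset_open (hO1.inter hO2) (by
    rintro _ ⟨z, hz, rfl⟩
    refine ⟨?_, ?_⟩
    · have hzD := (hEM (hAE hz)).1
      rw [mem_closedBall, dist_zero_right] at hzD
      rcases hzD.lt_or_eq with h | h
      · rw [hΨ z, max_lt_iff, abs_lt (a := (Ψ z).im - 1)] at h
        exact ⟨h.1, by linarith [h.2.2]⟩
      · rw [hAe z hz h, hΨe]; simp
    · simpa [infDist_zero_of_mem hz] using hε0)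
  have hth : ∀ w, infDist w (Ψ '' A) < ε → (|w.re| < 1 ∧ w.im < 2) ∧ infDist (Ψ.symm w) A < ε0 := by
    intro w hw
    exact hs ((mem_thickening_iff_infDist_lt (Set.Nonempty.image _ ⟨q, hqA⟩)).2 hw)
  have him : Ψ '' (closedBall 0 1 ∩ G ⁻¹' K) = boxB ∩ (G ∘ Ψ.symm) ⁻¹' K := by
    ext w
    constructor
    · rintro ⟨z, hz, rfl⟩; exact ⟨(hbx z).2 hz.1, by simpa using hz.2⟩
    · rintro ⟨h1, h2⟩; exact ⟨Ψ.symm w, ⟨(hbx' w).1 h1, h2⟩, by simp⟩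
  have hback : ∀ X : Set ℂ, ∀ n, (X ∩ Ψ '' C n).Nonempty → (Ψ.symm '' X ∩ C n).Nonempty := by
    rintro X n ⟨_, hx, z, hz, rfl⟩
    exact ⟨z, ⟨_, hx, by simp⟩, hz⟩
  refine final_lemma (F := G ∘ Ψ.symm) (C := fun n => Ψ '' C n) (qs := fun n => Ψ (qs n)) (q := Ψ q) (E := Ψ '' E)
    (A := Ψ '' A) (ε0 := ε) hK (hG.comp Ψ.symm.continuous) hHs hHK (fun n => (hCk n).image Ψ.continuous)
    (fun n => (hCc n).image _ Ψ.continuous.continuousOn) (fun n => him ▸ image_mono (hCM n)) ?_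
    (fun n => mem_image_of_mem _ (hqs n)) ((Ψ.continuous.tendsto q).comp hq) ?_ (Ψ.isClosedMap _ hEk)
    (him ▸ image_mono hEM) ?_ ?_ hε ?_ ?_ ?_ ?_
  · intro X hX hXc n m hn hm
    refine hsep (Ψ.symm '' X) ?_ (hXc.image _ Ψ.symm.continuous.continuousOn) n m (hback X n hn) (hback X m hm)
    rintro _ ⟨w, hw, rfl⟩
    exact ⟨(hbx' w).1 (hX hw).1, (hX hw).2⟩
  · rw [hΨ q, max_lt_iff, abs_lt (a := (Ψ q).im - 1)] at hqi
    linarith [hqi.2.1]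
  · intro k z x hk hz hx
    refine ⟨Ψ.symm x, hE k (fun j => Ψ.symm (z j)) _ hk (fun j => ?_) ((Ψ.symm.continuous.tendsto x).comp hx), by simp⟩
    obtain ⟨w, hw, hwz⟩ := hz j
    rw [← hwz]; simpa using hw
  · have h1 : Ψ '' (E ∩ {z | Hs (G z) = Hs (G q)}) =
        Ψ '' E ∩ {z | Hs ((G ∘ Ψ.symm) z) = Hs ((G ∘ Ψ.symm) (Ψ q))} := by
      ext w
      constructor
      · rintro ⟨z, hz, rfl⟩; exact ⟨⟨z, hz.1, rfl⟩, by simpa using hz.2⟩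
      · rintro ⟨⟨z, hz, rfl⟩, h2⟩; exact ⟨z, ⟨hz, by simpa using h2⟩, rfl⟩
    rw [← h1, hA]
    exact Ψ.image_connectedComponentIn ⟨hqE, rfl⟩
  · intro z hz hzA
    have := (hth z hzA).1
    exact ⟨this.1.le, hz, this.2.le⟩
  · have h1 : boxB \ Ψ '' A = Ψ '' (closedBall 0 1 \ A) := by
      rw [image_sdiff Ψ.injective]
      congr 1
      ext w
      rw [hbx']
      constructor
      · intro h; exact ⟨_, h, by simp⟩
      · rintro ⟨z, hz, rfl⟩; simpa using hz
    rw [h1]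
    exact hBA.image _ Ψ.continuous.continuousOn
  · rintro a ⟨ha, ha'⟩ b ⟨hb, hb'⟩ h
    have := hinj ⟨(hbx' a).1 ha, (hth a ha').2⟩ ⟨(hbx' b).1 hb, (hth b hb').2⟩ h
    exact Ψ.symm.injective this
  · intro n
    obtain ⟨z, hz, hz2⟩ := hfar n
    refine ⟨Ψ z, ⟨z, hz, rfl⟩, ?_⟩
    by_contra h
    push Not at h
    have := (hth _ h).2
    simp at this
    linarith

lemma chart_exists {S : Type*} [TopologicalSpace S] (hS : IsSurfaceLocallyEuclidean S) (x : S) {V : Set S}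
    (hV : V ∈ 𝓝 x) : ∃ χ : ℂ → S, IsOpenEmbedding χ ∧ χ Complex.I = x ∧ χ '' closedBall Complex.I 2 ⊆ V := by
  obtain ⟨U, hU, hxU, ⟨e⟩⟩ := hS x
  let e' : ℂ ≃ₜ U := (e.trans Complex.equivRealProdCLM.symm.toHomeomorph).symm
  let χ0 : ℂ → S := fun z => (e' z : S)
  have hχ0 : IsOpenEmbedding χ0 := hU.isOpenEmbedding_subtypeVal.comp e'.isOpenEmbedding
  let u0 := e'.symm ⟨x, hxU⟩
  have hu0 : χ0 u0 = x := by simp [χ0, u0]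
  have h1 : χ0 ⁻¹' V ∈ 𝓝 u0 := hχ0.continuous.continuousAt.preimage_mem_nhds (by rw [hu0]; exact hV)
  obtain ⟨δ, hδ, hs⟩ := nhds_basis_closedBall.mem_iff.1 h1
  have hc : ((δ / 2 : ℝ) : ℂ) ≠ 0 := by
    rw [Ne, Complex.ofReal_eq_zero]; positivity
  let a : ℂ ≃ₜ ℂ := ((Homeomorph.addRight (-Complex.I)).trans (Homeomorph.mulLeft₀ _ hc)).trans (Homeomorph.addLeft u0)
  have ha : ∀ z, a z = u0 + ((δ / 2 : ℝ) : ℂ) * (z + -Complex.I) := fun z => rfl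
  refine ⟨χ0 ∘ a, hχ0.comp a.isOpenEmbedding, by simp [ha, hu0], ?_⟩
  rintro _ ⟨z, hz, rfl⟩
  refine hs ?_
  rw [mem_closedBall, dist_eq_norm] at hz ⊢
  rw [ha, add_sub_cancel_left, norm_mul, Complex.norm_real, Real.norm_of_nonneg (by positivity), ← sub_eq_add_neg]
  nlinarith

lemma box_sub_ball : boxB ⊆ closedBall Complex.I 2 := by
  rintro z ⟨h1, h2, h3⟩
  rw [mem_closedBall, dist_eq_norm]
  refine (Complex.norm_le_abs_re_add_abs_im _).trans ?_
  have : |(z - Complex.I).im| ≤ 1 := by rw [abs_le]; simp; constructor <;> linarith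
  have h4 : |(z - Complex.I).re| ≤ 1 := by simpa using h1
  linarith

lemma ball_sub_box {z : ℂ} (h : dist z Complex.I < 1 / 4) : z ∈ boxB := by
  rw [dist_eq_norm] at h
  have h1 := (Complex.abs_re_le_norm (z - Complex.I)).trans h.le
  have h2 := (Complex.abs_im_le_norm (z - Complex.I)).trans h.le
  rw [abs_le] at h2
  simp at h1 h2
  exact ⟨by norm_num at h1 ⊢; linarith, by linarith, by linarith⟩

lemma box_punctured : IsPreconnected (boxB \ {Complex.I}) := by
  have h1 : boxR '' {Complex.I}ᶜ = boxB \ {Complex.I} := by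
    ext w
    constructor
    · rintro ⟨z, hz, rfl⟩
      refine ⟨boxR_mem z, fun h => hz ?_⟩
      have hh : boxR z = Complex.I := h
      have hre := congrArg Complex.re hh
      have him := congrArg Complex.im hh
      simp only [boxR, Complex.I_re, Complex.I_im] at hre him
      have h1 : z.re = 0 := by
        rcases max_choice (-1) (min 1 z.re) with h | h <;> rcases min_choice 1 z.re with h' | h' <;> grind
      have h2 : z.im = 1 := by
        rcases max_choice 0 (min 2 z.im) with h | h <;> rcases min_choice 2 z.im with h' | h' <;> grind
      exact Complex.ext (by simpa using h1) (by simpa using h2)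
    · rintro ⟨h1, h2⟩
      exact ⟨w, h2, boxR_id h1⟩
  rw [← h1]
  refine IsPreconnected.image ?_ _ boxR_cont.continuousOn
  exact (isConnected_compl_singleton_of_one_lt_rank (by simp) _).isPreconnected

/-- for all but one index, `C n` has no unit point near `e` -/
lemma ni_eventually {C : ℕ → Set ℂ} (hCk : ∀ n, IsCompact (C n)) (hCc : ∀ n, IsPreconnected (C n))
    (hCD : ∀ n, C n ⊆ closedBall 0 1) (hdis : ∀ n m, (C n ∩ C m).Nonempty → n = m)
    {p p' : ℕ → ℂ} {x y e : ℂ} (hp : ∀ n, p n ∈ C n) (hp' : ∀ n, p' n ∈ C n) (hpn : ∀ n, ‖p n‖ = 1)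
    (hpn' : ∀ n, ‖p' n‖ = 1) (hx : Tendsto p atTop (𝓝 x)) (hy : Tendsto p' atTop (𝓝 y)) (hxy : x ≠ y) (he : ‖e‖ = 1)
    (hxe : x ≠ e) (hye : y ≠ e) : ∃ ε > 0, ∀ᶠ n in atTop, ∀ a ∈ C n, ‖a‖ = 1 → ε ≤ dist a e := by
  have hxn : ‖x‖ = 1 := tendsto_nhds_unique hx.norm (by simp [hpn])
  have hyn : ‖y‖ = 1 := tendsto_nhds_unique hy.norm (by simp [hpn'])
  obtain ⟨ε, hε, H⟩ := ni hxn hyn he hxy hxe hye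
  refine ⟨ε, hε, ?_⟩
  have e1 := hx.eventually (ball_mem_nhds x hε)
  have e2 := hy.eventually (ball_mem_nhds y hε)
  obtain ⟨N, hN⟩ := eventually_atTop.1 (e1.and e2)
  by_cases hex : ∃ n ≥ N, ∃ a ∈ C n, ‖a‖ = 1 ∧ dist a e < ε
  · obtain ⟨n, hn, ha⟩ := hex
    filter_upwards [eventually_gt_atTop n] with m hm a' ha' hn'
    by_contra hcon
    push Not at hcon
    have := hdis n m (H (C n) (C m) ⟨⟨_, hp n⟩, hCc n⟩ ⟨⟨_, hp m⟩, hCc m⟩ (hCk n) (hCk m) (hCD n) (hCD m)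
      ⟨_, hp n, hpn n, (hN n hn).1⟩ ⟨_, hp' n, hpn' n, (hN n hn).2⟩ ha
      ⟨_, hp m, hpn m, (hN m (hn.le.trans hm.le)).1⟩ ⟨_, hp' m, hpn' m, (hN m (hn.le.trans hm.le)).2⟩ ⟨a', ha', hn', hcon⟩)
    omega
  · push Not at hex
    filter_upwards [eventually_ge_atTop N] with n hn a ha han
    exact hex n hn a ha han

lemma case_B {S₁ S₂ : Type*} [MetricSpace S₁] [CompactSpace S₁] [MetricSpace S₂] [CompactSpace S₂]
    (hS₁ : IsSurfaceLocallyEuclidean S₁) {f : S₁ → S₂} (hf : IsCoveringMap f) {K : Set S₂} (hK : IsClosed K)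
    {φ : ℂ → S₁} (hφ : Continuous φ) (hφi : InjOn φ (closedBall 0 1)) (hφo : IsOpen (φ '' ball 0 1))
    {Hs : S₂ → ℝ} (hHs : Continuous Hs) (hHK : ∀ p ∈ schonfliesRel K, Hs p.1 = Hs p.2)
    {M : Set ℂ} (hM : M = closedBall 0 1 ∩ {z | f (φ z) ∈ K})
    {C : ℕ → Set ℂ} (hCk : ∀ n, IsCompact (C n)) (hCc : ∀ n, IsPreconnected (C n))
    (hCM : ∀ n, C n ⊆ M)
    (hmax : ∀ X ⊆ M, IsPreconnected X → ∀ n, (X ∩ C n).Nonempty → X ⊆ C n)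
    (hdis : ∀ n m, (C n ∩ C m).Nonempty → n = m)
    {p p' : ℕ → ℂ} {x y e : ℂ} (hp : ∀ n, p n ∈ C n) (hp' : ∀ n, p' n ∈ C n) (hpn : ∀ n, ‖p n‖ = 1)
    (hpn' : ∀ n, ‖p' n‖ = 1) (hx : Tendsto p atTop (𝓝 x)) (hy : Tendsto p' atTop (𝓝 y)) (hxy : x ≠ y) (he : ‖e‖ = 1)
    (hxe : x ≠ e) (hye : y ≠ e)
    {qs : ℕ → ℂ} (hqs : ∀ n, qs n ∈ C n) (hq : Tendsto qs atTop (𝓝 e))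
    {rs : ℕ → ℂ} (hrs : ∀ n, rs n ∈ C n) {r : ℂ} (hr : Tendsto rs atTop (𝓝 r)) (hrD : r ∈ closedBall (0:ℂ) 1) (hre : r ≠ e)
    {E : Set ℂ} (hEk : IsClosed E) (hEM : E ⊆ M)
    (hE : ∀ (k : ℕ → ℕ) (z : ℕ → ℂ) (x : ℂ), StrictMono k → (∀ j, z j ∈ C (k j)) → Tendsto z atTop (𝓝 x) → x ∈ E)
    (hA : connectedComponentIn (E ∩ {z | Hs (f (φ z)) = Hs (f (φ e))}) e ⊆ {e}) : False := by
  have hMk : IsCompact M := by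
    rw [hM]
    exact (isCompact_closedBall _ _).inter_right (hK.preimage (hf.continuous.comp hφ))
  have hMD : M ⊆ closedBall 0 1 := by rw [hM]; exact inter_subset_left
  obtain ⟨ε, hε, hev⟩ := ni_eventually hCk hCc (fun n => (hCM n).trans hMD) hdis hp hp' hpn hpn' hx hy hxy he hxe hye
  have heD : e ∈ closedBall (0:ℂ) 1 := by simp [he]
  -- the neighbourhood V
  set T : Set ℂ := {z | ‖z‖ = 1 ∧ ε ≤ dist z e} ∪ {r} with hT
  have hTk : IsCompact T := by
    refine IsCompact.union ?_ isCompact_singleton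
    refine (isCompact_closedBall (0:ℂ) 1).of_isClosed_subset ?_ ?_
    · exact (isClosed_eq continuous_norm continuous_const).and (isClosed_le continuous_const (by fun_prop))
    · rintro z ⟨hz, -⟩; simp [hz]
  have hTe : φ e ∉ φ '' T := by
    rintro ⟨z, hz, hze⟩
    rcases hz with ⟨h1, h2⟩ | h
    · rw [hφi (by simp [h1]) heD hze, dist_self] at h2; linarith
    · rw [mem_singleton_iff.1 h] at hze; exact hre (hφi hrD heD hze)
  obtain ⟨lh, hle, hlf⟩ := hf.isLocalHomeomorph (φ e)
  have hV : lh.source ∩ (φ '' T)ᶜ ∈ 𝓝 (φ e) :=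
    inter_mem (lh.open_source.mem_nhds hle) ((hTk.image hφ).isClosed.isOpen_compl.mem_nhds hTe)
  obtain ⟨χ, hχ, hχe, hχV⟩ := chart_exists hS₁ (φ e) hV
  have hχV' : ∀ z ∈ boxB, χ z ∈ lh.source ∩ (φ '' T)ᶜ := fun z hz => hχV ⟨z, box_sub_ball hz, rfl⟩
  have hFi : InjOn (f ∘ χ) boxB := by
    intro a ha b hb h
    refine hχ.injective (lh.injOn (hχV' a ha).1 (hχV' b hb).1 ?_)
    rw [← hlf]; exact h
  have hχi : InjOn χ boxB := hχ.injective.injOn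
  -- eventually conditions
  have hbk : IsCompact (χ '' boxB) := boxB_compact.image hχ.continuous
  have ev2 : ∀ᶠ n in atTop, φ (rs n) ∉ χ '' boxB := by
    refine (((hφ.tendsto r).comp hr).eventually (hbk.isClosed.isOpen_compl.mem_nhds ?_))
    rintro ⟨z, hz, hzr⟩
    exact (hχV' z hz).2 (by rw [hzr]; exact ⟨r, Or.inr rfl, rfl⟩)
  have ev3 : ∀ᶠ n in atTop, φ (qs n) ∈ χ '' ball Complex.I (1/4) := by
    refine ((hφ.tendsto e).comp hq).eventually ((hχ.isOpenMap _ isOpen_ball).mem_nhds ?_)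
    exact ⟨Complex.I, by simp, hχe⟩
  obtain ⟨N, hN⟩ := eventually_atTop.1 (hev.and (ev2.and ev3))
  have hN1 : ∀ n a, a ∈ C (n + N) → ‖a‖ = 1 → ε ≤ dist a e := fun n a => (hN (n+N) (by omega)).1 a
  have hN2 : ∀ n, φ (rs (n + N)) ∉ χ '' boxB := fun n => (hN (n+N) (by omega)).2.1
  have hN3 : ∀ n, ∃ w, dist w Complex.I < 1/4 ∧ χ w = φ (qs (n + N)) := fun n => by
    obtain ⟨w, h1, h2⟩ := (hN (n+N) (by omega)).2.2
    exact ⟨w, h1, h2⟩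
  choose ws hws hws' using hN3
  -- pullback
  have pull : ∀ X ⊆ boxB, IsPreconnected X → χ '' X ⊆ φ '' M →
      ∃ Y ⊆ M, IsPreconnected Y ∧ ∀ z ∈ M, φ z ∈ χ '' X ↔ z ∈ Y := by
    intro X hX hXc hXM
    refine ⟨M ∩ φ ⁻¹' (χ '' X), inter_subset_left, preconn_preimage hMk hφ.continuousOn (hφi.mono hMD)
      (hXc.image _ hχ.continuous.continuousOn) hXM, fun z hz => ⟨fun h => ⟨hz, h⟩, fun h => h.2⟩⟩
  set Z : ℕ → Set ℂ := fun n => boxB ∩ χ ⁻¹' (φ '' C (n + N)) with hZ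
  have hZk : ∀ n, IsCompact (Z n) := fun n =>
    boxB_compact.inter_right (((hCk (n+N)).image hφ).isClosed.preimage hχ.continuous)
  have hwZ : ∀ n, ws n ∈ Z n := fun n => ⟨ball_sub_box (hws n), by
    rw [mem_preimage, hws' n]; exact ⟨_, hqs _, rfl⟩⟩
  have hKM : ∀ z ∈ M, f (φ z) ∈ K := by intro z hz; rw [hM] at hz; exact hz.2
  set C' : ℕ → Set ℂ := fun n => connectedComponentIn (Z n) (ws n) with hC'
  have hC'Z : ∀ n, C' n ⊆ Z n := fun n => connectedComponentIn_subset _ _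
  have hZM : ∀ n, Z n ⊆ boxB ∩ (f ∘ χ) ⁻¹' K := by
    rintro n w ⟨h1, z, hz, hzw⟩
    refine ⟨h1, ?_⟩
    change f (χ w) ∈ K
    rw [← hzw]; exact hKM z (hCM _ hz)
  -- separation
  have hsep : ∀ X ⊆ boxB ∩ (f ∘ χ) ⁻¹' K, IsPreconnected X → ∀ n m, (X ∩ C' n).Nonempty → (X ∩ C' m).Nonempty → n = m := by
    intro X hX hXc n m hn hm
    have hW : IsCompact (boxB ∩ χ ⁻¹' (φ '' M)) :=
      boxB_compact.inter_right ((hMk.image hφ).isClosed.preimage hχ.continuous)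
    obtain ⟨W1, W2, hW1, hW2, hWu, hWd, hs1, hs2⟩ := split_compact hW
      (((hCk (n+N)).image hφ).isClosed.preimage hχ.continuous)
      (((isCompact_sphere (0:ℂ) 1).image hφ).isClosed.preimage hχ.continuous) (by
        rintro Y hY hYc ⟨a, haY, z, hz, hza⟩ ⟨b, hbY, u, hu, hub⟩
        obtain ⟨Y', hY'M, hY'c, hY'⟩ := pull Y (hY.trans inter_subset_left) hYc (by
          rintro _ ⟨w, hw, rfl⟩; exact (hY hw).2)
        have h1 := hmax Y' hY'M hY'c (n+N) ⟨z, (hY' z (hCM _ hz)).1 ⟨a, haY, hza.symm⟩, hz⟩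
        obtain ⟨u', hu', hu'b⟩ := (hY hbY).2
        have huu : u' = u := hφi (hMD hu') (by simpa using (mem_sphere_zero_iff_norm.1 hu).le) (by rw [hu'b, hub])
        subst huu
        have h2 := hN1 n u' (h1 ((hY' u' hu').1 ⟨b, hbY, hu'b.symm⟩)) (mem_sphere_zero_iff_norm.1 hu)
        refine (hχV' b (hY hbY).1).2 ⟨u', Or.inl ⟨mem_sphere_zero_iff_norm.1 hu, h2⟩, hub⟩)
    have hXb : ∀ w ∈ X, w ∈ boxB := fun w hw => (hX hw).1
    have hCnW1 : ∀ w ∈ Z n, w ∈ W1 := by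
      rintro w ⟨h1, z, hz, hzw⟩
      exact hs1 ⟨⟨h1, z, hCM _ hz, hzw⟩, z, hz, hzw⟩
    have hW1b : ∀ w ∈ W1, χ w ∈ φ '' ball 0 1 ∧ w ∉ W2 := by
      intro w hw
      have hw2 : w ∉ W2 := fun h => disjoint_left.1 hWd hw h
      refine ⟨?_, hw2⟩
      obtain ⟨h1, z, hz, hzw⟩ : w ∈ boxB ∩ χ ⁻¹' (φ '' M) := hWu ▸ Or.inl hw
      refine ⟨z, ?_, hzw⟩
      by_contra hzb
      have hzs : z ∈ sphere (0:ℂ) 1 := by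
        have := hMD hz
        rw [mem_closedBall] at this
        rw [mem_ball] at hzb
        rw [mem_sphere]; linarith
      exact hw2 (hs2 ⟨⟨h1, z, hz, hzw⟩, z, hzs, hzw⟩)
    have hXW : X ⊆ W1 := by
      by_contra hcon
      rw [not_subset] at hcon
      obtain ⟨b, hbX, hb⟩ := hcon
      obtain ⟨a, haX, ha⟩ := hn
      obtain ⟨w, hwX, ⟨⟨z, hz, hzw⟩, hw2⟩, hw1⟩ := hXc (χ ⁻¹' (φ '' ball 0 1) ∩ W2ᶜ) W1ᶜ
        ((hφo.preimage hχ.continuous).inter hW2.isClosed.isOpen_compl) hW1.isClosed.isOpen_compl (by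
          intro w hw
          by_cases h : w ∈ W1
          · exact Or.inl (hW1b w h)
          · exact Or.inr h) ⟨a, haX, hW1b a (hCnW1 a (hC'Z n ha))⟩ ⟨b, hbX, hb⟩
      have hzM : z ∈ M := by
        rw [hM]
        refine ⟨ball_subset_closedBall hz, ?_⟩
        have := (hX hwX).2
        change f (χ w) ∈ K at this
        rw [← hzw] at this; exact this
      have : w ∈ W1 ∪ W2 := by rw [hWu]; exact ⟨hXb w hwX, z, hzM, hzw⟩
      exact this.elim hw1 hw2
    have hXφ : χ '' X ⊆ φ '' M := by
      rintro _ ⟨w, hw, rfl⟩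
      have : w ∈ boxB ∩ χ ⁻¹' (φ '' M) := hWu ▸ Or.inl (hXW hw)
      exact this.2
    obtain ⟨Y, hYM, hYc, hY⟩ := pull X hXb hXc hXφ
    have meet : ∀ k, (X ∩ C' k).Nonempty → (Y ∩ C (k + N)).Nonempty := by
      rintro k ⟨w, hwX, hw⟩
      obtain ⟨h1, z, hz, hzw⟩ := hC'Z k hw
      exact ⟨z, (hY z (hCM _ hz)).1 ⟨w, hwX, hzw.symm⟩, hz⟩
    have h1 := hmax Y hYM hYc _ (meet n hn)
    obtain ⟨z, hzY, hzm⟩ := meet m hm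
    have := hdis _ _ ⟨z, h1 hzY, hzm⟩
    omega
  refine final_lemma (F := f ∘ χ) (C := C') (qs := ws) (q := Complex.I) (E := boxB ∩ χ ⁻¹' (φ '' E)) (A := {Complex.I})
    (ε0 := 1/4) hK (hf.continuous.comp hχ.continuous) hHs hHK
    (fun n => (hZk n).of_isClosed_subset (isClosed_ccIn (hZk n).isClosed _) (hC'Z n))
    (fun n => isPreconnected_connectedComponentIn) (fun n => (hC'Z n).trans (hZM n)) hsep
    (fun n => mem_connectedComponentIn (hwZ n)) ?_ (by simp) ?_ ?_ ?_ ?_ (by norm_num) ?_ box_punctured ?_ ?_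
  · have h1 : Tendsto (χ ∘ ws) atTop (𝓝 (χ Complex.I)) := by
      rw [hχe]
      have h2 := ((hφ.tendsto e).comp hq).comp (tendsto_add_atTop_nat N)
      refine h2.congr (fun n => ?_)
      exact (hws' n).symm
    exact hχ.isInducing.tendsto_nhds_iff.2 h1
  · exact boxB_closed.inter ((((hMk.of_isClosed_subset hEk hEM)).image hφ).isClosed.preimage hχ.continuous)
  · rintro w ⟨h1, z, hz, hzw⟩
    refine ⟨h1, ?_⟩
    change f (χ w) ∈ K
    rw [← hzw]; exact hKM z (hEM hz)
  · intro k z x' hk hz hx'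
    refine ⟨boxB_closed.mem_of_tendsto hx' (Eventually.of_forall fun j => (hC'Z _ (hz j)).1), ?_⟩
    choose u hu huz using fun j => (hC'Z _ (hz j)).2
    obtain ⟨u0, hu0, g, hg, hgl⟩ := hMk.tendsto_subseq (fun j => hCM _ (hu j))
    refine ⟨u0, hE (fun j => k (g j) + N) (fun j => u (g j)) u0 ?_ (fun j => hu (g j)) hgl, ?_⟩
    · intro a b hab
      have := hk (hg hab)
      simp only
      omega
    · have h1 := (hφ.tendsto u0).comp hgl
      have h2 := ((hχ.continuous.tendsto x').comp hx').comp hg.tendsto_atTop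
      refine tendsto_nhds_unique h1 (h2.congr fun j => ?_)
      exact (huz (g j)).symm
  · have heE : e ∈ E := hE id qs e strictMono_id hqs hq
    refine (Subset.antisymm ?_ ?_).symm
    · intro w hw
      set X := connectedComponentIn ((boxB ∩ χ ⁻¹' (φ '' E)) ∩ {z | Hs ((f ∘ χ) z) = Hs ((f ∘ χ) Complex.I)}) Complex.I with hXd
      have hXs := connectedComponentIn_subset ((boxB ∩ χ ⁻¹' (φ '' E)) ∩ {z | Hs ((f ∘ χ) z) = Hs ((f ∘ χ) Complex.I)}) Complex.I
      rw [← hXd] at hXs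
      obtain ⟨Y, hYM, hYc, hY⟩ := pull X (fun w hw => (hXs hw).1.1) isPreconnected_connectedComponentIn (by
        rintro _ ⟨w, hw, rfl⟩
        exact image_mono hEM (hXs hw).1.2)
      have hI : Complex.I ∈ X := mem_connectedComponentIn ⟨⟨ball_sub_box (by simp), by
        rw [mem_preimage, hχe]; exact ⟨e, heE, rfl⟩⟩, rfl⟩
      have heY : e ∈ Y := (hY e (hEM heE)).1 ⟨_, hI, hχe⟩
      have hYE : Y ⊆ E ∩ {z | Hs (f (φ z)) = Hs (f (φ e))} := by
        intro z hz
        obtain ⟨w', hw', hwz⟩ := (hY z (hYM hz)).2 hz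
        obtain ⟨⟨-, z', hz', hzw'⟩, h2⟩ := hXs hw'
        have hzz : z' = z := hφi (hMD (hEM hz')) (hMD (hYM hz)) (by rw [hzw', hwz])
        subst hzz
        refine ⟨hz', ?_⟩
        change Hs (f (χ w')) = Hs (f (χ Complex.I)) at h2
        rw [hwz, hχe] at h2
        exact h2
      have hYe := (hYc.subset_connectedComponentIn heY hYE).trans hA
      obtain ⟨z, hz, hzw⟩ := (hXs hw).1.2
      have hze : z = e := hYe ((hY z (hEM hz)).1 ⟨w, hw, hzw.symm⟩)
      exact hχ.injective (by rw [← hzw, hze, hχe])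
    · rintro _ rfl
      exact mem_connectedComponentIn ⟨⟨ball_sub_box (by simp), by
        rw [mem_preimage, hχe]; exact ⟨e, heE, rfl⟩⟩, rfl⟩
  · intro z _ hz
    rw [infDist_singleton] at hz
    exact ball_sub_box hz
  · exact hFi.mono (fun z hz => hz.1)
  · intro n
    by_contra hcon
    push Not at hcon
    simp only [infDist_singleton] at hcon
    have hWk : IsCompact (φ '' C (n+N) ∩ χ '' boxB) := ((hCk _).image hφ).inter hbk
    have hxW : φ (qs (n+N)) ∈ φ '' C (n+N) ∩ χ '' boxB :=
      ⟨⟨_, hqs _, rfl⟩, ws n, (hwZ n).1, hws' n⟩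
    have hb := bumping (A := φ '' C (n+N)) (W := φ '' C (n+N) ∩ χ '' boxB) (O := χ '' ball Complex.I (1/4))
      (x := φ (qs (n+N))) ((hCc _).image _ hφ.continuousOn) hWk inter_subset_left
      (hχ.isOpenMap _ isOpen_ball) (fun s hs => ⟨hs.1, image_mono (fun z hz => ball_sub_box hz) hs.2⟩) hxW (by
        set X := connectedComponentIn (φ '' C (n+N) ∩ χ '' boxB) (φ (qs (n+N))) with hXd
        have hXs := connectedComponentIn_subset (φ '' C (n+N) ∩ χ '' boxB) (φ (qs (n+N)))
        rw [← hXd] at hXs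
        have h1 := preconn_preimage boxB_compact hχ.continuous.continuousOn hχi
          (isPreconnected_connectedComponentIn (F := φ '' C (n+N) ∩ χ '' boxB) (x := φ (qs (n+N))))
          (hXs.trans inter_subset_right)
        rw [← hXd] at h1
        have h2 : boxB ∩ χ ⁻¹' X ⊆ C' n := by
          refine h1.subset_connectedComponentIn ⟨(hwZ n).1, ?_⟩ (fun w hw => ⟨hw.1, (hXs hw.2).1⟩)
          rw [mem_preimage, hws' n]
          exact mem_connectedComponentIn hxW
        intro s hs
        obtain ⟨w, hw, rfl⟩ := (hXs hs).2
        exact ⟨w, hcon w (h2 ⟨hw, hs⟩), rfl⟩)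
    exact hN2 n (hb ⟨_, hrs _, rfl⟩).2

lemma gen_thm {S₁ S₂ : Type*} [MetricSpace S₁] [CompactSpace S₁] [MetricSpace S₂] [CompactSpace S₂]
    (hS₁ : IsSurfaceLocallyEuclidean S₁) {f : S₁ → S₂} (hf : IsCoveringMap f) {K : Set S₂} (hK : IsClosed K)
    {φ : ℂ → S₁} (hφ : Continuous φ) (hφi : InjOn φ (closedBall 0 1)) (hφo : IsOpen (φ '' ball 0 1))
    {Hs : S₂ → ℝ} (hHs : Continuous Hs) (hHK : ∀ p ∈ schonfliesRel K, Hs p.1 = Hs p.2)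
    {M : Set ℂ} (hM : M = closedBall 0 1 ∩ {z | f (φ z) ∈ K})
    {C : ℕ → Set ℂ} (hCk : ∀ n, IsCompact (C n)) (hCc : ∀ n, IsPreconnected (C n))
    (hCM : ∀ n, C n ⊆ M)
    (hmax : ∀ X ⊆ M, IsPreconnected X → ∀ n, (X ∩ C n).Nonempty → X ⊆ C n)
    (hdis : ∀ n m, (C n ∩ C m).Nonempty → n = m)
    {p p' : ℕ → ℂ} {x y : ℂ} (hp : ∀ n, p n ∈ C n) (hp' : ∀ n, p' n ∈ C n) (hpn : ∀ n, ‖p n‖ = 1)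
    (hpn' : ∀ n, ‖p' n‖ = 1) (hx : Tendsto p atTop (𝓝 x)) (hy : Tendsto p' atTop (𝓝 y)) (hxy : x ≠ y)
    {E : Set ℂ} (hEk : IsClosed E) (hEc : IsPreconnected E) (hEM : E ⊆ M)
    (hE : ∀ (k : ℕ → ℕ) (z : ℕ → ℂ) (x : ℂ), StrictMono k → (∀ j, z j ∈ C (k j)) → Tendsto z atTop (𝓝 x) → x ∈ E)
    (hEl : ∀ x ∈ E, ∃ z : ℕ → ℂ, (∀ n, z n ∈ C n) ∧ Tendsto z atTop (𝓝 x))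
    {x1 y1 : ℂ} (hx1 : x1 ∈ E) (hy1 : y1 ∈ E) (h1 : Hs (f (φ x1)) < Hs (f (φ y1))) : False := by
  have hMk : IsCompact M := by
    rw [hM]
    exact (isCompact_closedBall _ _).inter_right (hK.preimage (hf.continuous.comp hφ))
  have hMD : M ⊆ closedBall 0 1 := by rw [hM]; exact inter_subset_left
  have hKM : ∀ z ∈ M, f (φ z) ∈ K := by intro z hz; rw [hM] at hz; exact hz.2
  have hhc : Continuous (fun z => Hs (f (φ z))) := hHs.comp (hf.continuous.comp hφ)
  have hsep : ∀ X ⊆ M, IsPreconnected X → ∀ n m, (X ∩ C n).Nonempty → (X ∩ C m).Nonempty → n = m := by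
    rintro X hX hXc n m hn ⟨z, hzX, hz⟩
    exact hdis n m ⟨z, hmax X hX hXc n hn hzX, hz⟩
  obtain ⟨s, hsB, hsx, q, hqE, hqs, A, hA, hA0, hAD, e, he, hAe⟩ := gen_plane hhc hMk hMD hCc hCM hsep hEM hEc hEl hx1 hy1 h1
    (B := {Hs (f (φ x)), Hs (f (φ y))}) (Set.toFinite _).countable
  have hqM : q ∈ M ∩ {z | Hs (f (φ z)) = s} := ⟨hEM hqE, hqs⟩
  have hcl : IsClosed (M ∩ {z | Hs (f (φ z)) = s}) := hMk.isClosed.inter (isClosed_eq hhc continuous_const)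
  have hAM : A ⊆ M ∩ {z | Hs (f (φ z)) = s} := by rw [hA]; exact connectedComponentIn_subset _ _
  have hAcl : IsClosed A := by rw [hA]; exact isClosed_ccIn hcl _
  have hAk : IsCompact A := hMk.of_isClosed_subset hAcl (hAM.trans inter_subset_left)
  have hinj : InjOn (fun z => f (φ z)) A := by
    refine InjData.injOn (e := e) (Y2 := K ∩ {v | Hs v = s}) ⟨hf, hφ, hφi, hφo, hAk, ?_, ?_, ?_, ?_, hAe, hA0, hAD⟩
    · rw [hA]; exact ⟨⟨q, mem_connectedComponentIn hqM⟩, isPreconnected_connectedComponentIn⟩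
    · exact hAM.trans (inter_subset_left.trans hMD)
    · intro z hz; exact ⟨hKM z (hAM hz).1, (hAM hz).2⟩
    · rintro X hX hXY hXc ⟨z, hzX, hzA⟩
      have hXM : X ⊆ M ∩ {z | Hs (f (φ z)) = s} := by
        intro w hw
        refine ⟨?_, (hXY w hw).2⟩
        rw [hM]; exact ⟨hX hw, (hXY w hw).1⟩
      rw [hA] at hzA ⊢
      rw [connectedComponentIn_eq hzA]
      exact hXc.subset_connectedComponentIn hzX hXM
  set H := connectedComponentIn (E ∩ {z | Hs (f (φ z)) = s}) q with hH
  have hqEs : q ∈ E ∩ {z | Hs (f (φ z)) = s} := ⟨hqE, hqs⟩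
  have hHs' : H ⊆ E ∩ {z | Hs (f (φ z)) = s} := connectedComponentIn_subset _ _
  have hHA : H ⊆ A := by
    rw [hA]
    exact isPreconnected_connectedComponentIn.subset_connectedComponentIn (mem_connectedComponentIn hqEs)
      (hHs'.trans (inter_subset_inter_left _ hEM))
  have hHcl : IsClosed H := isClosed_ccIn (hEk.inter (isClosed_eq hhc continuous_const)) _
  have hHk : IsCompact H := hAk.of_isClosed_subset hHcl hHA
  have hqH : q ∈ H := mem_connectedComponentIn hqEs
  obtain ⟨rs, hrs, hr⟩ := hEl x1 hx1
  by_cases hcase : ∃ q' ∈ H, ‖q'‖ < 1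
  · obtain ⟨q', hq'H, hq'n⟩ := hcase
    obtain ⟨qs, hqs1, hqs2⟩ := hEl q' (hHs' hq'H).1
    obtain ⟨ε1, hε1, hi1⟩ := inj_near hf hφ hφi hHk (hinj.mono hHA) ⟨q, hqH⟩
    have hx1H : x1 ∉ H := fun h => hsx (hHs' h).2.symm
    have hd : 0 < infDist x1 H := (hHcl.notMem_iff_infDist_pos ⟨q, hqH⟩).1 hx1H
    have hε : 0 < min ε1 (infDist x1 H / 2) := lt_min hε1 (by linarith)
    have hev : ∀ᶠ n in atTop, infDist x1 H / 2 < infDist (rs n) H :=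
      (((continuous_infDist_pt H).tendsto x1).comp hr).eventually (lt_mem_nhds (by linarith))
    obtain ⟨N, hN⟩ := eventually_atTop.1 hev
    have hMe : M = closedBall 0 1 ∩ (fun z => f (φ z)) ⁻¹' K := hM
    refine disc_final (G := fun z => f (φ z)) (C := fun n => C (n + N)) (qs := fun n => qs (n + N)) (q := q') (E := E)
      (A := H) (ε0 := min ε1 (infDist x1 H / 2)) hK (hf.continuous.comp hφ) hHs hHK (fun n => hCk _) (fun n => hCc _)
      (fun n => hMe ▸ hCM _) ?_ (fun n => hqs1 _) ((tendsto_add_atTop_iff_nat N).2 hqs2) hq'n hEk (hMe ▸ hEM) ?_ ?_ he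
      (fun z hz => hAe z (hHA hz)) (disc_sdiff_preconn hA0 hAcl hAD hHA) hε
      ?_ ?_
    · intro X hX hXc n m hn hm
      have := hsep X (hMe ▸ hX) hXc _ _ hn hm
      omega
    · intro k z x' hk hz hx'
      refine hE (fun j => k j + N) z x' ?_ hz hx'
      intro a b hab
      have := hk hab
      simp only
      omega
    · rw [hH, connectedComponentIn_eq hq'H, (hHs' hq'H).2]
    · intro a ha b hb hab
      exact hi1 ⟨ha.1, ha.2.trans_le (min_le_left _ _)⟩ ⟨hb.1, hb.2.trans_le (min_le_left _ _)⟩ hab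
    · intro n
      exact ⟨rs (n+N), hrs _, (min_le_right _ _).trans (hN _ (by omega)).le⟩
  · push Not at hcase
    have hHe : ∀ z ∈ H, z = e := by
      intro z hz
      refine hAe z (hHA hz) (le_antisymm ?_ (hcase z hz))
      simpa using hMD (hEM (hHs' hz).1)
    have hqe : q = e := hHe q hqH
    subst hqe
    obtain ⟨qs, hqs1, hqs2⟩ := hEl q hqE
    refine case_B hS₁ hf hK hφ hφi hφo hHs hHK hM hCk hCc hCM hmax hdis hp hp' hpn hpn' hx hy hxy he ?_ ?_ hqs1 hqs2 hrs hr
      (hMD (hEM hx1)) ?_ hEk hEM hE ?_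
    · rintro rfl; exact hsB (by simp [← hqs])
    · rintro rfl; exact hsB (by simp [← hqs])
    · rintro rfl; exact hsx hqs.symm
    · rw [show Hs (f (φ q)) = s from hqs]; exact hHe

lemma disc_param {S : Type*} [MetricSpace S] (hS : IsSurfaceLocallyEuclidean S) {φ : unitInterval × unitInterval → S}
    (hφ : Topology.IsEmbedding φ) : ∃ ψ : ℂ → S, Continuous ψ ∧ InjOn ψ (closedBall 0 1) ∧ IsOpen (ψ '' ball 0 1) ∧
      ψ '' closedBall 0 1 = range φ ∧ ∀ p : unitInterval × unitInterval, (p.2 = 0 ∨ p.2 = 1) → ∃ z, ‖z‖ = 1 ∧ ψ z = φ p := by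
  obtain ⟨R, hR⟩ := sq_homeo
  let ψ : ℂ → S := fun z => φ (projIcc (0:ℝ) 1 zero_le_one (((R.symm z).re + 1) / 2),
    projIcc (0:ℝ) 1 zero_le_one (((R.symm z).im + 1) / 2))
  have hRn : ∀ z, ‖z‖ = max |(R.symm z).re| |(R.symm z).im| := by
    intro z
    have := (hR (R.symm z)).1
    simpa using this
  have hcont : Continuous ψ := by
    refine hφ.continuous.comp (Continuous.prodMk ?_ ?_)
    · exact continuous_projIcc.comp (by fun_prop)
    · exact continuous_projIcc.comp (by fun_prop)
  have hmem : ∀ z ∈ closedBall (0:ℂ) 1, ((R.symm z).re + 1) / 2 ∈ Icc (0:ℝ) 1 ∧ ((R.symm z).im + 1) / 2 ∈ Icc (0:ℝ) 1 := by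
    intro z hz
    rw [mem_closedBall, dist_zero_right, hRn z, max_le_iff, abs_le, abs_le] at hz
    obtain ⟨⟨a, b⟩, c, d⟩ := hz
    exact ⟨⟨by linarith, by linarith⟩, by linarith, by linarith⟩
  have hinj : InjOn ψ (closedBall 0 1) := by
    intro a ha b hb hab
    have h1 := hφ.injective hab
    rw [Prod.mk.injEq, projIcc_of_mem _ (hmem a ha).1, projIcc_of_mem _ (hmem b hb).1, projIcc_of_mem _ (hmem a ha).2,
      projIcc_of_mem _ (hmem b hb).2, Subtype.mk.injEq, Subtype.mk.injEq] at h1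
    apply R.symm.injective
    apply Complex.ext <;> linarith [h1.1, h1.2]
  have hpt : ∀ p : unitInterval × unitInterval, ψ (R ⟨2 * p.1 - 1, 2 * p.2 - 1⟩) = φ p := by
    intro p
    have e1 : (2 * (p.1 : ℝ) - 1 + 1) / 2 = p.1 := by ring
    have e2 : (2 * (p.2 : ℝ) - 1 + 1) / 2 = p.2 := by ring
    simp only [ψ, Homeomorph.symm_apply_apply, e1, e2, projIcc_val]
  have hnorm : ∀ p : unitInterval × unitInterval, |2 * (p.1 : ℝ) - 1| ≤ 1 ∧ |2 * (p.2 : ℝ) - 1| ≤ 1 := by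
    intro p
    have a := p.1.2
    have b := p.2.2
    rw [abs_le, abs_le]
    exact ⟨⟨by linarith [a.1], by linarith [a.2]⟩, by linarith [b.1], by linarith [b.2]⟩
  refine ⟨ψ, hcont, hinj, ?_, ?_, ?_⟩
  · rw [isOpen_iff_mem_nhds]
    rintro _ ⟨z, hz, rfl⟩
    obtain ⟨r, hr, hs⟩ := nhds_basis_closedBall.mem_iff.1 (isOpen_ball.mem_nhds hz)
    exact mem_of_superset (iod_surface hS ψ z r hr hcont.continuousOn (hinj.mono (hs.trans ball_subset_closedBall)))
      (image_mono hs)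
  · apply Subset.antisymm
    · rintro _ ⟨z, -, rfl⟩; exact ⟨_, rfl⟩
    · rintro _ ⟨p, rfl⟩
      refine ⟨_, ?_, hpt p⟩
      rw [mem_closedBall, dist_zero_right, (hR _).1, max_le_iff]
      exact hnorm p
  · intro p hp
    refine ⟨_, ?_, hpt p⟩
    rw [(hR _).1]
    have : |2 * (p.2 : ℝ) - 1| = 1 := by
      rcases hp with h | h <;> simp [h]
      norm_num
    simp only [this]
    exact max_eq_right (hnorm p).1

lemma tendsto_of_inj {X Y : Type*} [TopologicalSpace X] [TopologicalSpace Y] [T2Space Y] {M : Set X}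
    (hM : IsCompact M) {G : X → Y} (hc : ContinuousOn G M) (hi : InjOn G M) {z : ℕ → X} (hz : ∀ n, z n ∈ M) {x : X}
    (hx : x ∈ M) (h : Tendsto (fun n => G (z n)) atTop (𝓝 (G x))) : Tendsto z atTop (𝓝 x) := by
  have : CompactSpace M := isCompact_iff_compactSpace.1 hM
  have hemb : Topology.IsClosedEmbedding (M.domRestrict G) :=
    (continuousOn_iff_continuous_domRestrict.1 hc).isClosedEmbedding (injOn_iff_injective.1 hi)
  have h1 : Tendsto (fun n => (⟨z n, hz n⟩ : M)) atTop (𝓝 ⟨x, hx⟩) := hemb.isInducing.tendsto_nhds_iff.2 h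
  exact (continuous_subtype_val.tendsto _).comp h1

lemma haus_approx {X : Type*} [MetricSpace X] {Q : ℕ → Set X} {L : Set X} (hQ : ∀ n, IsCompact (Q n))
    (hQn : ∀ n, (Q n).Nonempty) (hL : IsCompact L)
    (h : Tendsto (fun n => hausdorffDist (Q n) L) atTop (𝓝 0)) {y : X} (hy : y ∈ L) :
    ∃ x : ℕ → X, (∀ n, x n ∈ Q n) ∧ Tendsto x atTop (𝓝 y) := by
  choose x hx hxd using fun n => (hQ n).exists_infDist_eq_dist (hQn n) y
  refine ⟨x, hx, ?_⟩
  rw [tendsto_iff_dist_tendsto_zero]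
  refine squeeze_zero (fun n => dist_nonneg) (fun n => ?_) h
  rw [dist_comm, ← hxd n, hausdorffDist_comm]
  exact infDist_le_hausdorffDist_of_mem hy
      (hausdorffEDist_ne_top_of_nonempty_of_bounded ⟨y, hy⟩ (hQn n) hL.isBounded (hQ n).isBounded)

lemma proj_le {S₁ S₂ : Type*} [MetricSpace S₁] [CompactSpace S₁] [MetricSpace S₂] [CompactSpace S₂]
    (hS₁ : IsSurfaceLocallyEuclidean S₁) {f : S₁ → S₂} (hf : IsCoveringMap f) {K : Set S₂} (hK : IsClosed K)
    {Hs : S₂ → ℝ} (hHs : Continuous Hs) (hHK : ∀ p ∈ schonfliesRel K, Hs p.1 = Hs p.2) :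
    ∀ p ∈ schonfliesRel (f ⁻¹' K), Hs (f p.2) ≤ Hs (f p.1) := by
  rintro ⟨x0, y0⟩ ⟨-, -, h⟩
  simp only at h ⊢
  rcases h with h | ⟨φ, hφ, hxI, hyI, -, Q, hQd, hQc, hQI, Qi, hQik, hQic, hQl, hxQ, hyQ⟩
  · rw [h]
  by_contra hlt
  push Not at hlt
  obtain ⟨ψ, hψ, hψi, hψo, hψr, hψu⟩ := disc_param hS₁ hφ
  have hrk : IsCompact (range φ) := isCompact_range hφ.continuous
  have hLk : IsClosed (f ⁻¹' K ∩ range φ) := (hK.preimage hf.continuous).inter hrk.isClosed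
  have hQs : ∀ n, Q n ⊆ f ⁻¹' K ∩ range φ := by
    intro n
    obtain ⟨z, hz, h⟩ := hQc n
    rw [h]; exact connectedComponentIn_subset _ _
  have hQp : ∀ n, IsPreconnected (Q n) := by
    intro n
    obtain ⟨z, hz, h⟩ := hQc n
    rw [h]; exact isPreconnected_connectedComponentIn
  have hQk : ∀ n, IsCompact (Q n) := by
    intro n
    obtain ⟨z, hz, h⟩ := hQc n
    rw [h]; exact (isClosed_ccIn hLk _).isCompact
  have hQn : ∀ n, (Q n).Nonempty := fun n => (hQI n).1.mono inter_subset_left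
  have hQm : ∀ n X, X ⊆ f ⁻¹' K ∩ range φ → IsPreconnected X → (X ∩ Q n).Nonempty → X ⊆ Q n := by
    rintro n X hX hXc ⟨w, hwX, hw⟩
    obtain ⟨z, hz, h⟩ := hQc n
    rw [h] at hw ⊢
    rw [connectedComponentIn_eq hw]
    exact hXc.subset_connectedComponentIn hwX hX
  have hQiL : Qi ⊆ f ⁻¹' K ∩ range φ := by
    intro v hv
    obtain ⟨z, hz, hzl⟩ := haus_approx hQk hQn hQik hQl hv
    exact hLk.mem_of_tendsto hzl (Eventually.of_forall fun n => hQs n (hz n))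
  -- unit points
  have hu : ∀ n, ∃ z : ℂ, ‖z‖ = 1 ∧ ψ z ∈ Q n ∧ ψ z ∈ φ '' {q | q.2 = 0} := by
    intro n
    obtain ⟨_, h1, q, hq, rfl⟩ := (hQI n).1
    obtain ⟨z, hz, hzq⟩ := hψu q (Or.inl hq)
    exact ⟨z, hz, hzq ▸ h1, hzq ▸ ⟨q, hq, rfl⟩⟩
  have hu' : ∀ n, ∃ z : ℂ, ‖z‖ = 1 ∧ ψ z ∈ Q n ∧ ψ z ∈ φ '' {q | q.2 = 1} := by
    intro n
    obtain ⟨_, h1, q, hq, rfl⟩ := (hQI n).2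
    obtain ⟨z, hz, hzq⟩ := hψu q (Or.inr hq)
    exact ⟨z, hz, hzq ▸ h1, hzq ▸ ⟨q, hq, rfl⟩⟩
  choose p hpn hpQ hpI using hu
  choose p' hpn' hpQ' hpI' using hu'
  obtain ⟨⟨x, y⟩, hxyS, g, hg, hgl⟩ := ((isCompact_sphere (0:ℂ) 1).prod (isCompact_sphere (0:ℂ) 1)).tendsto_subseq
    (x := fun n => (p n, p' n)) (fun n => ⟨by simp [hpn], by simp [hpn']⟩)
  have hgx : Tendsto (fun n => p (g n)) atTop (𝓝 x) := (continuous_fst.tendsto _).comp hgl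
  have hgy : Tendsto (fun n => p' (g n)) atTop (𝓝 y) := (continuous_snd.tendsto _).comp hgl
  have hxy : x ≠ y := by
    rintro rfl
    have c0 : IsClosed (φ '' {q | q.2 = 0}) :=
      (((isClosed_eq continuous_snd continuous_const).isCompact).image hφ.continuous).isClosed
    have c1 : IsClosed (φ '' {q | q.2 = 1}) :=
      (((isClosed_eq continuous_snd continuous_const).isCompact).image hφ.continuous).isClosed
    have m0 := c0.mem_of_tendsto ((hψ.tendsto x).comp hgx) (Eventually.of_forall fun n => hpI _)
    have m1 := c1.mem_of_tendsto ((hψ.tendsto x).comp hgy) (Eventually.of_forall fun n => hpI' _)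
    obtain ⟨a, ha, haψ⟩ := m0
    obtain ⟨b, hb, hbψ⟩ := m1
    have : a = b := hφ.injective (haψ.trans hbψ.symm)
    subst this
    have h01 : (0 : unitInterval) = 1 := ha.symm.trans hb
    exact zero_ne_one h01
  set D : Set ℂ := closedBall 0 1 with hD
  have hDk : IsCompact D := isCompact_closedBall _ _
  have hsub : ∀ X ⊆ f ⁻¹' K ∩ range φ, X ⊆ ψ '' D := fun X hX => by rw [hψr]; exact hX.trans inter_subset_right
  have huD : ∀ z : ℂ, ‖z‖ = 1 → z ∈ D := fun z hz => by simp [hD, hz]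
  have hTg : Tendsto (fun n => hausdorffDist (Q (g n)) Qi) atTop (𝓝 0) := hQl.comp hg.tendsto_atTop
  have lift : ∀ v ∈ Qi, ∃ z ∈ D ∩ ψ ⁻¹' Qi, ψ z = v := by
    intro v hv
    obtain ⟨z, hz, rfl⟩ := hsub _ hQiL hv
    exact ⟨z, ⟨hz, hv⟩, rfl⟩
  obtain ⟨x1, hx1, hx1e⟩ := lift x0 hxQ
  obtain ⟨y1, hy1, hy1e⟩ := lift y0 hyQ
  refine gen_thm hS₁ hf hK hψ hψi hψo hHs hHK (M := D ∩ {z | f (ψ z) ∈ K}) rfl (C := fun n => D ∩ ψ ⁻¹' (Q (g n)))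
    (fun n => hDk.inter_right ((hQk _).isClosed.preimage hψ))
    (fun n => preconn_preimage hDk hψ.continuousOn hψi (hQp _) (hsub _ (hQs _)))
    (fun n z hz => ⟨hz.1, (hQs _ hz.2).1⟩) ?_ ?_ (p := fun n => p (g n)) (p' := fun n => p' (g n))
    (fun n => ⟨huD _ (hpn _), hpQ _⟩) (fun n => ⟨huD _ (hpn' _), hpQ' _⟩) (fun n => hpn _) (fun n => hpn' _) hgx hgy hxy
    (E := D ∩ ψ ⁻¹' Qi) (hDk.isClosed.inter (hQik.isClosed.preimage hψ))
    (preconn_preimage hDk hψ.continuousOn hψi hQic.isPreconnected (hsub _ hQiL))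
    (fun z hz => ⟨hz.1, (hQiL hz.2).1⟩) ?_ ?_ hx1 hy1 (by rw [hx1e, hy1e]; exact hlt)
  · rintro X hX hXc n ⟨w, hwX, hw⟩
    have h1 := hQm (g n) (ψ '' X) (by
      rintro _ ⟨z, hz, rfl⟩
      exact ⟨(hX hz).2, hψr ▸ ⟨z, (hX hz).1, rfl⟩⟩) (hXc.image _ hψ.continuousOn) ⟨ψ w, ⟨w, hwX, rfl⟩, hw.2⟩
    exact fun z hz => ⟨(hX hz).1, h1 ⟨z, hz, rfl⟩⟩
  · rintro n m ⟨w, h1, h2⟩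
    by_contra hnm
    refine hQd (g n) (g m) (fun h => hnm (hg.injective h)) ?_
    exact Subset.antisymm (hQm _ _ (hQs _) (hQp _) ⟨ψ w, h1.2, h2.2⟩) (hQm _ _ (hQs _) (hQp _) ⟨ψ w, h2.2, h1.2⟩)
  · intro k z w hk hz hw
    refine ⟨hDk.isClosed.mem_of_tendsto hw (Eventually.of_forall fun j => (hz j).1), ?_⟩
    exact haus_lim_mem (Q := fun j => Q (g (k j))) (fun n => hQk _) hQik hQic.nonempty (hTg.comp hk.tendsto_atTop)
      (fun j => (hz j).2) ((hψ.tendsto w).comp hw)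
  · intro w hw
    obtain ⟨v, hv, hvl⟩ := haus_approx (Q := fun j => Q (g j)) (fun n => hQk _) (fun n => hQn _) hQik hTg hw.2
    choose z hzD hz using fun n => hsub _ (hQs _) (hv n)
    refine ⟨z, fun n => ⟨hzD n, by rw [mem_preimage, hz n]; exact hv n⟩, ?_⟩
    refine tendsto_of_inj hDk hψ.continuousOn hψi hzD hw.1 ?_
    simpa [hz] using hvl

lemma proj_eq {S₁ S₂ : Type*} [MetricSpace S₁] [CompactSpace S₁] [MetricSpace S₂] [CompactSpace S₂]
    (hS₁ : IsSurfaceLocallyEuclidean S₁) {f : S₁ → S₂} (hf : IsCoveringMap f) {K : Set S₂} (hK : IsClosed K)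
    {Hs : S₂ → ℝ} (hHs : Continuous Hs) (hHK : ∀ p ∈ schonfliesRel K, Hs p.1 = Hs p.2) :
    ∀ p ∈ schonfliesRel (f ⁻¹' K), Hs (f p.1) = Hs (f p.2) := by
  intro p hp
  refine le_antisymm ?_ (proj_le hS₁ hf hK hHs hHK p hp)
  have := proj_le hS₁ hf hK (Hs := fun v => - Hs v) hHs.neg (fun q hq => by rw [hHK q hq]) p hp
  linarith

lemma urysohn_quot {X : Type*} [TopologicalSpace X] [CompactSpace X] [T2Space X] (r : Setoid X)
    (hr : IsClosed {p : X × X | r p.1 p.2}) {a b : X} (hab : ¬ r a b) :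
    ∃ h : X → ℝ, Continuous h ∧ h a = 0 ∧ h b = 1 ∧ ∀ x y, r x y → h x = h y := by
  let π : X → Quotient r := Quotient.mk r
  have hπ : IsQuotientMap π := isQuotientMap_quot_mk
  have hπc : Continuous π := hπ.continuous
  have hcl : IsClosedMap π := by
    intro F hF
    rw [← hπ.isClosed_preimage]
    have h1 : π ⁻¹' (π '' F) = Prod.snd '' ({p : X × X | r p.1 p.2} ∩ Prod.fst ⁻¹' F) := by
      ext x
      constructor
      · rintro ⟨y, hy, hyx⟩
        exact ⟨(y, x), ⟨Quotient.exact hyx, hy⟩, rfl⟩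
      · rintro ⟨⟨y, x'⟩, ⟨h1, h2⟩, rfl⟩
        exact ⟨y, h2, Quotient.sound h1⟩
    rw [h1]
    exact ((hr.inter (hF.preimage continuous_fst)).isCompact.image continuous_snd).isClosed
  have hN : NormalSpace (Quotient r) := by
    refine ⟨fun s t hs ht hst => ?_⟩
    obtain ⟨U, V, hU, hV, hsU, htV, hUV⟩ := normal_separation (hs.preimage hπc) (ht.preimage hπc) (hst.preimage π)
    refine ⟨(π '' Uᶜ)ᶜ, (π '' Vᶜ)ᶜ, (hcl _ hU.isClosed_compl).isOpen_compl, (hcl _ hV.isClosed_compl).isOpen_compl, ?_, ?_, ?_⟩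
    · rintro q hq ⟨x, hx, rfl⟩; exact hx (hsU hq)
    · rintro q hq ⟨x, hx, rfl⟩; exact hx (htV hq)
    · rw [disjoint_left]
      intro q h1 h2
      obtain ⟨x, rfl⟩ := hπ.surjective q
      have hxU : x ∈ U := by by_contra h; exact h1 ⟨x, h, rfl⟩
      have hxV : x ∈ V := by by_contra h; exact h2 ⟨x, h, rfl⟩
      exact disjoint_left.1 hUV hxU hxV
  have hs : ∀ x, IsClosed ({π x} : Set (Quotient r)) := by
    intro x
    have := hcl {x} isClosed_singleton
    simpa using this
  obtain ⟨g, g0, g1, -⟩ := exists_continuous_zero_one_of_isClosed (hs a) (hs b) (by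
    rw [disjoint_singleton]
    exact fun h => hab (Quotient.exact h))
  refine ⟨fun x => g (π x), g.continuous.comp hπc, g0 rfl, g1 rfl, fun x y hxy => ?_⟩
  have : π x = π y := Quotient.sound hxy
  simp only [this]

lemma schonfliesEquiv_mem {S : Type*} [MetricSpace S] {K : Set S} (hK : IsClosed K) :
    schonfliesEquiv K ∈ closedEquivsOn K (schonfliesRel K) := by
  have h0 : K ×ˢ K ∈ closedEquivsOn K (schonfliesRel K) :=
    ⟨fun p hp => ⟨hp.1, hp.2.1⟩, Subset.rfl, hK.prod hK, fun x hx => ⟨hx, hx⟩, fun x y h => ⟨h.2, h.1⟩,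
      fun x y z h1 h2 => ⟨h1.1, h2.2⟩⟩
  refine ⟨?_, sInter_subset_of_mem h0, ?_, ?_, ?_, ?_⟩
  · exact subset_sInter fun E hE => hE.1
  · exact isClosed_sInter fun E hE => hE.2.2.1
  · exact fun x hx E hE => hE.2.2.2.1 x hx
  · exact fun x y h E hE => hE.2.2.2.2.1 x y (h E hE)
  · exact fun x y z h1 h2 E hE => hE.2.2.2.2.2 x y z (h1 E hE) (h2 E hE)

lemma proj_rel {S₁ S₂ : Type*} [MetricSpace S₁] [CompactSpace S₁] [MetricSpace S₂] [CompactSpace S₂]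
    (hS₁ : IsSurfaceLocallyEuclidean S₁) {f : S₁ → S₂} (hf : IsCoveringMap f) {K : Set S₂} (hK : IsClosed K) :
    ∀ p ∈ schonfliesRel (f ⁻¹' K), (f p.1, f p.2) ∈ schonfliesEquiv K := by
  intro p hp
  obtain ⟨hR, hKK, hEc, hrefl, hsymm, htrans⟩ := schonfliesEquiv_mem hK
  by_contra hcon
  have : CompactSpace K := isCompact_iff_compactSpace.1 hK.isCompact
  let r : Setoid K := ⟨fun a b => ((a : S₂), (b : S₂)) ∈ schonfliesEquiv K,
    ⟨fun a => hrefl a a.2, fun h => hsymm _ _ h, fun h1 h2 => htrans _ _ _ h1 h2⟩⟩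
  obtain ⟨h, hh, h0, h1, hinv⟩ := urysohn_quot r (hEc.preimage (f := fun p : K × K => ((p.1 : S₂), (p.2 : S₂))) (by fun_prop))
    (a := ⟨f p.1, hp.1⟩) (b := ⟨f p.2, hp.2.1⟩) hcon
  obtain ⟨g, hg⟩ := ContinuousMap.exists_restrict_eq hK (⟨h, hh⟩ : C(K, ℝ))
  have hgK : ∀ v (hv : v ∈ K), g v = h ⟨v, hv⟩ := by
    intro v hv
    have := congrArg (fun F : C(K, ℝ) => F ⟨v, hv⟩) hg
    exact this
  have := proj_eq hS₁ hf hK (Hs := g) g.continuous (fun q hq => by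
    rw [hgK _ hq.1, hgK _ hq.2.1]
    exact hinv _ _ (hR hq)) p hp
  rw [hgK _ hp.1, hgK _ hp.2.1, h0, h1] at this
  exact zero_ne_one this

lemma haus_transfer {X Y : Type*} [MetricSpace X] [MetricSpace Y] {M : Set X} (hM : IsCompact M) {G : X → Y}
    (hc : ContinuousOn G M) (hi : InjOn G M) {Q : ℕ → Set Y} {L : Set Y} (hQ : ∀ n, IsCompact (Q n))
    (hQn : ∀ n, (Q n).Nonempty) (hQM : ∀ n, Q n ⊆ G '' M) (hL : IsCompact L) (hLn : L.Nonempty) (hLM : L ⊆ G '' M)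
    (h : Tendsto (fun n => hausdorffDist (Q n) L) atTop (𝓝 0)) :
    Tendsto (fun n => hausdorffDist (M ∩ G ⁻¹' (Q n)) (M ∩ G ⁻¹' L)) atTop (𝓝 0) := by
  have huc : ∀ ε > 0, ∃ δ > 0, ∀ a ∈ M, ∀ b ∈ M, dist (G a) (G b) < δ → dist a b < ε := by
    intro ε hε
    have hP : IsCompact (M ×ˢ M ∩ {p : X × X | ε ≤ dist p.1 p.2}) :=
      (hM.prod hM).inter_right (isClosed_le continuous_const (by fun_prop))
    rcases (M ×ˢ M ∩ {p : X × X | ε ≤ dist p.1 p.2}).eq_empty_or_nonempty with h0 | hne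
    · refine ⟨1, one_pos, fun a ha b hb _ => ?_⟩
      by_contra hcon
      push Not at hcon
      have : (a, b) ∈ (M ×ˢ M ∩ {p : X × X | ε ≤ dist p.1 p.2}) := ⟨⟨ha, hb⟩, hcon⟩
      rw [h0] at this; exact this
    · obtain ⟨p, hp, hmin⟩ := hP.exists_isMinOn (f := fun p => dist (G p.1) (G p.2)) hne (by
        refine continuous_dist.comp_continuousOn (ContinuousOn.prodMk ?_ ?_)
        · exact hc.comp continuous_fst.continuousOn (fun q hq => hq.1.1)
        · exact hc.comp continuous_snd.continuousOn (fun q hq => hq.1.2))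
      refine ⟨dist (G p.1) (G p.2), ?_, ?_⟩
      · rw [gt_iff_lt, dist_pos]
        intro heq
        have h1 := hi hp.1.1 hp.1.2 heq
        have h2 : ε ≤ dist p.1 p.2 := hp.2
        rw [h1, dist_self] at h2
        linarith
      · intro a ha b hb hab
        by_contra hcon
        push Not at hcon
        have := hmin (show (a, b) ∈ M ×ˢ M ∩ {p : X × X | ε ≤ dist p.1 p.2} from ⟨⟨ha, hb⟩, hcon⟩)
        simp only [mem_ofPred_eq] at this
        linarith
  rw [Metric.tendsto_atTop] at h ⊢
  intro ε hε
  obtain ⟨δ, hδ, hd⟩ := huc (ε/2) (by linarith)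
  obtain ⟨N, hN⟩ := h δ hδ
  refine ⟨N, fun n hn => ?_⟩
  have h1 := hN n hn
  rw [Real.dist_0_eq_abs, abs_of_nonneg hausdorffDist_nonneg] at h1 ⊢
  have hfin := hausdorffEDist_ne_top_of_nonempty_of_bounded (hQn n) hLn (hQ n).isBounded hL.isBounded
  refine lt_of_le_of_lt (hausdorffDist_le_of_mem_dist (r := ε/2) (by linarith) ?_ ?_) (by linarith)
  · rintro a ⟨haM, ha⟩
    obtain ⟨b', hb', hab⟩ := exists_dist_lt_of_hausdorffDist_lt (show G a ∈ Q n from ha) h1 hfin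
    obtain ⟨b, hb, rfl⟩ := hLM hb'
    exact ⟨b, ⟨hb, hb'⟩, (hd a haM b hb hab).le⟩
  · rintro a ⟨haM, ha⟩
    obtain ⟨b', hb', hab⟩ := exists_dist_lt_of_hausdorffDist_lt' (show G a ∈ L from ha) h1 hfin
    obtain ⟨b, hb, rfl⟩ := hQM n hb'
    exact ⟨b, ⟨hb, hb'⟩, (hd a haM b hb (by rw [dist_comm]; exact hab)).le⟩

lemma lift_square {S₁ S₂ : Type*} [TopologicalSpace S₁] [TopologicalSpace S₂] {f : S₁ → S₂} (hf : IsCoveringMap f)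
    {φ : unitInterval × unitInterval → S₂} (hφ : Continuous φ) (q : unitInterval × unitInterval) {x : S₁}
    (hx : f x = φ q) : ∃ Φ : unitInterval × unitInterval → S₁, Continuous Φ ∧ (∀ p, f (Φ p) = φ p) ∧ Φ q = x := by
  let e : ℂ → unitInterval × unitInterval := fun z =>
    (projIcc (0:ℝ) 1 zero_le_one z.re, projIcc (0:ℝ) 1 zero_le_one z.im)
  have he : Continuous e := Continuous.prodMk (continuous_projIcc.comp (by fun_prop)) (continuous_projIcc.comp (by fun_prop))
  have hi : ∀ p : unitInterval × unitInterval, e ⟨p.1, p.2⟩ = p := by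
    intro p
    simp [e]
  have hic : Continuous (fun p : unitInterval × unitInterval => (⟨p.1, p.2⟩ : ℂ)) := by
    have : (fun p : unitInterval × unitInterval => (⟨p.1, p.2⟩ : ℂ)) =
        fun p : unitInterval × unitInterval => (((p.1 : ℝ) : ℂ) + ((p.2 : ℝ) : ℂ) * Complex.I) := by
      funext p
      apply Complex.ext <;> simp
    rw [this]
    fun_prop
  obtain ⟨F, ⟨h1, h2⟩, -⟩ := hf.existsUnique_continuousMap_lifts ⟨fun w => φ (e w), hφ.comp he⟩ ⟨q.1, q.2⟩ x (by
    change f x = φ (e _)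
    rw [hi, hx])
  refine ⟨fun p => F ⟨p.1, p.2⟩, F.continuous.comp hic, fun p => ?_, h1⟩
  have := congrFun h2 ⟨p.1, p.2⟩
  simp only [Function.comp_apply, ContinuousMap.coe_mk, hi] at this
  exact this

lemma lift_core {S₁ S₂ : Type*} [MetricSpace S₁] [CompactSpace S₁] [MetricSpace S₂] [CompactSpace S₂]
    {f : S₁ → S₂} (hfc : Continuous f) {K : Set S₂} (hK : IsClosed K)
    {Φ : unitInterval × unitInterval → S₁} (hΦ : Continuous Φ) {p q : unitInterval × unitInterval}
    (hp : p.2 = 0) (hq : q.2 = 1) (hpK : f (Φ p) ∈ K) (hqK : f (Φ q) ∈ K)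
    {φ : unitInterval × unitInterval → S₂} (hφ : Topology.IsEmbedding φ) (hfΦ : ∀ r, f (Φ r) = φ r)
    (hb : K ∩ (φ '' {q | q.1 = 0 ∨ q.1 = 1 ∨ q.2 = 0 ∨ q.2 = 1}) ⊆ (φ '' {q | q.2 = 0}) ∪ (φ '' {q | q.2 = 1}))
    {Q : ℕ → Set S₂} (hQne : ∀ m n, m ≠ n → Q m ≠ Q n)
    (hQ : ∀ n, ∃ z ∈ K ∩ Set.range φ, Q n = connectedComponentIn (K ∩ Set.range φ) z)
    (hQI : ∀ n, (Q n ∩ φ '' {q | q.2 = 0}).Nonempty ∧ (Q n ∩ φ '' {q | q.2 = 1}).Nonempty)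
    {Qinf : Set S₂} (hQc : IsCompact Qinf) (hQconn : IsConnected Qinf)
    (hlim : Filter.Tendsto (fun n => Metric.hausdorffDist (Q n) Qinf) Filter.atTop (nhds 0))
    (hpQ : f (Φ p) ∈ Qinf) (hqQ : f (Φ q) ∈ Qinf) : (Φ p, Φ q) ∈ schonfliesRel (f ⁻¹' K) := by
  have hΦi : Function.Injective Φ := by
    intro a b hab
    apply hφ.injective
    rw [← hfΦ, ← hfΦ, hab]
  have hM : IsCompact (range Φ) := isCompact_range hΦ
  have hfM : f '' range Φ = range φ := by
    rw [← range_comp]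
    congr 1
    funext r; exact hfΦ r
  have hinj : InjOn f (range Φ) := by
    rintro _ ⟨a, rfl⟩ _ ⟨b, rfl⟩ hab
    rw [hfΦ, hfΦ] at hab
    rw [hφ.injective hab]
  have hcl : IsClosed (K ∩ range φ) := hK.inter (isCompact_range hφ.continuous).isClosed
  have hQsub : ∀ n, Q n ⊆ K ∩ range φ := by
    intro n
    obtain ⟨z, hz, h⟩ := hQ n
    rw [h]; exact connectedComponentIn_subset _ _
  have hQcomp : ∀ n, IsCompact (Q n) := by
    intro n
    obtain ⟨z, hz, h⟩ := hQ n
    rw [h]; exact (isClosed_ccIn hcl _).isCompact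
  have hQn : ∀ n, (Q n).Nonempty := fun n => (hQI n).1.mono inter_subset_left
  have hQinf : Qinf ⊆ K ∩ range φ := by
    intro y hy
    obtain ⟨x, hx, hxy⟩ := haus_approx hQcomp hQn hQc hlim hy
    exact hcl.mem_of_tendsto hxy (Eventually.of_forall fun n => hQsub n (hx n))
  have hQM : ∀ n, Q n ⊆ f '' range Φ := fun n => by rw [hfM]; exact (hQsub n).trans inter_subset_right
  have hIM : Qinf ⊆ f '' range Φ := by rw [hfM]; exact hQinf.trans inter_subset_right
  have himg : ∀ n, f '' (range Φ ∩ f ⁻¹' Q n) = Q n := by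
    intro n
    rw [image_inter_preimage, inter_eq_right.2 (hQM n)]
  have hmeet : ∀ n (A : Set (unitInterval × unitInterval)), (Q n ∩ φ '' A).Nonempty →
      ((range Φ ∩ f ⁻¹' Q n) ∩ Φ '' A).Nonempty := by
    rintro n A ⟨_, hy, a, ha, rfl⟩
    exact ⟨Φ a, ⟨⟨a, rfl⟩, by change f (Φ a) ∈ Q n; rw [hfΦ]; exact hy⟩, a, ha, rfl⟩
  refine ⟨hpK, hqK, Or.inr ⟨Φ, (hΦ.isClosedEmbedding hΦi).isEmbedding, ⟨p, hp, rfl⟩, ⟨q, hq, rfl⟩, ?_,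
    fun n => range Φ ∩ f ⁻¹' Q n, ?_, ?_, fun n => ⟨hmeet n _ (hQI n).1, hmeet n _ (hQI n).2⟩, range Φ ∩ f ⁻¹' Qinf, ?_, ⟨?_, ?_⟩,
    haus_transfer hM hfc.continuousOn hinj hQcomp hQn hQM hQc hQconn.nonempty hIM hlim, ⟨⟨p, rfl⟩, hpQ⟩, ⟨⟨q, rfl⟩, hqQ⟩⟩⟩
  · rintro _ ⟨hrK, r, hr, rfl⟩
    have := hb ⟨show f (Φ r) ∈ K from hrK, r, hr, (hfΦ r).symm⟩
    rw [hfΦ] at this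
    rcases this with ⟨s, hs, hsr⟩ | ⟨s, hs, hsr⟩
    · rw [hφ.injective hsr] at hs; exact Or.inl ⟨r, hs, rfl⟩
    · rw [hφ.injective hsr] at hs; exact Or.inr ⟨r, hs, rfl⟩
  · intro m n hmn h
    have h : range Φ ∩ f ⁻¹' Q m = range Φ ∩ f ⁻¹' Q n := h
    apply hQne m n hmn
    rw [← himg m, h, himg n]
  · intro n
    obtain ⟨z, ⟨hzK, w, rfl⟩, hz⟩ := hQ n
    have hwF : Φ w ∈ f ⁻¹' K ∩ range Φ := ⟨by change f (Φ w) ∈ K; rw [hfΦ]; exact hzK, w, rfl⟩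
    refine ⟨Φ w, hwF, ?_⟩
    apply Subset.antisymm
    · refine IsPreconnected.subset_connectedComponentIn ?_ ?_ ?_
      · refine preconn_preimage hM hfc.continuousOn hinj ?_ (hQM n)
        rw [hz]; exact isPreconnected_connectedComponentIn
      · refine ⟨⟨w, rfl⟩, ?_⟩
        change f (Φ w) ∈ Q n
        rw [hfΦ, hz]
        exact mem_connectedComponentIn ⟨hzK, w, rfl⟩
      · exact fun y hy => ⟨(hQsub n hy.2).1, hy.1⟩
    · intro y hy
      refine ⟨(connectedComponentIn_subset _ _ hy).2, ?_⟩
      change f y ∈ Q n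
      rw [hz]
      have : IsPreconnected (f '' connectedComponentIn (f ⁻¹' K ∩ range Φ) (Φ w)) :=
        isPreconnected_connectedComponentIn.image _ hfc.continuousOn
      refine this.subset_connectedComponentIn ⟨Φ w, mem_connectedComponentIn hwF, hfΦ w⟩ ?_ ⟨y, hy, rfl⟩
      rintro _ ⟨v, hv, rfl⟩
      obtain ⟨h1, r, rfl⟩ := connectedComponentIn_subset _ _ hv
      exact ⟨h1, r, (hfΦ r).symm⟩
  · exact hM.inter_right (hQc.isClosed.preimage hfc)
  · exact ⟨Φ p, ⟨p, rfl⟩, hpQ⟩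
  · exact preconn_preimage hM hfc.continuousOn hinj hQconn.isPreconnected hIM

lemma lift_rel {S₁ S₂ : Type*} [MetricSpace S₁] [CompactSpace S₁] [MetricSpace S₂] [CompactSpace S₂]
    {f : S₁ → S₂} (hf : IsCoveringMap f) {K : Set S₂} (hK : IsClosed K) {u v : S₂} (h : (u, v) ∈ schonfliesRel K) :
    (∀ x, f x = u → ∃ y, f y = v ∧ (x, y) ∈ schonfliesRel (f ⁻¹' K)) ∧
    (∀ y, f y = v → ∃ x, f x = u ∧ (x, y) ∈ schonfliesRel (f ⁻¹' K)) := by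
  obtain ⟨hu, hv, h⟩ := h
  rcases h with h | ⟨φ, hφ, ⟨p, hp, hpu⟩, ⟨q, hq, hqv⟩, hb, Q, hQne, hQ, hQI, Qinf, hQc, hQconn, hlim, hpQ, hqQ⟩
  · change u = v at h
    subst h
    constructor
    · intro x hx; exact ⟨x, hx, by change f x ∈ K; rw [hx]; exact hu, by change f x ∈ K; rw [hx]; exact hu, Or.inl rfl⟩
    · intro x hx; exact ⟨x, hx, by change f x ∈ K; rw [hx]; exact hu, by change f x ∈ K; rw [hx]; exact hu, Or.inl rfl⟩
  · change φ p = u at hpu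
    change φ q = v at hqv
    subst hpu
    subst hqv
    constructor
    · intro x hx
      obtain ⟨Φ, hΦ, hfΦ, rfl⟩ := lift_square hf hφ.continuous p hx
      exact ⟨Φ q, hfΦ q, lift_core hf.continuous hK hΦ hp hq (by rw [hfΦ]; exact hu) (by rw [hfΦ]; exact hv) hφ hfΦ hb hQne hQ
        hQI hQc hQconn hlim (by rw [hfΦ]; exact hpQ) (by rw [hfΦ]; exact hqQ)⟩
    · intro x hx
      obtain ⟨Φ, hΦ, hfΦ, rfl⟩ := lift_square hf hφ.continuous q hx
      exact ⟨Φ p, hfΦ p, lift_core hf.continuous hK hΦ hp hq (by rw [hfΦ]; exact hu) (by rw [hfΦ]; exact hv) hφ hfΦ hb hQne hQ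
        hQI hQc hQconn hlim (by rw [hfΦ]; exact hpQ) (by rw [hfΦ]; exact hqQ)⟩

lemma lift_equiv {S₁ S₂ : Type*} [MetricSpace S₁] [CompactSpace S₁] [MetricSpace S₂] [CompactSpace S₂]
    {f : S₁ → S₂} (hf : IsCoveringMap f) {K : Set S₂} (hK : IsClosed K) {x : S₁} {v : S₂}
    (h : (f x, v) ∈ schonfliesEquiv K) : ∃ y, f y = v ∧ (x, y) ∈ schonfliesEquiv (f ⁻¹' K) := by
  obtain ⟨hR, hLL, hEc, hrefl, hsymm, htrans⟩ := schonfliesEquiv_mem (hK.preimage hf.continuous)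
  let Z : Set (S₁ × S₂) := (Prod.map id f) '' schonfliesEquiv (f ⁻¹' K)
  have hZ : IsClosed Z := (hEc.isCompact.image (continuous_id.prodMap hf.continuous)).isClosed
  have hZm : ∀ x v, (x, v) ∈ Z ↔ ∃ y, f y = v ∧ (x, y) ∈ schonfliesEquiv (f ⁻¹' K) := by
    intro x v
    constructor
    · rintro ⟨⟨a, b⟩, hab, heq⟩
      simp only [Prod.map_apply, id, Prod.mk.injEq] at heq
      obtain ⟨rfl, rfl⟩ := heq
      exact ⟨b, rfl, hab⟩
    · rintro ⟨y, rfl, hy⟩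
      exact ⟨(x, y), hy, rfl⟩
  let E1 : Set (S₂ × S₂) := ((Prod.map f id) '' Zᶜ)ᶜ
  have hE1 : IsClosed E1 :=
    ((hf.isOpenMap.prodMap IsOpenMap.id) _ hZ.isOpen_compl).isClosed_compl
  have hE1m : ∀ u v, (u, v) ∈ E1 ↔ ∀ x, f x = u → (x, v) ∈ Z := by
    intro u v
    constructor
    · intro h x hx
      by_contra hc
      exact h ⟨(x, v), hc, by simp [hx]⟩
    · rintro h ⟨⟨a, b⟩, hab, heq⟩
      simp only [Prod.map_apply, id, Prod.mk.injEq] at heq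
      obtain ⟨h1, rfl⟩ := heq
      exact hab (h a h1)
  let E : Set (S₂ × S₂) := (K ×ˢ K) ∩ (E1 ∩ Prod.swap ⁻¹' E1)
  have hE : E ∈ closedEquivsOn K (schonfliesRel K) := by
    refine ⟨?_, inter_subset_left, (hK.prod hK).inter (hE1.inter (hE1.preimage continuous_swap)), ?_, ?_, ?_⟩
    · rintro ⟨u, v⟩ huv
      obtain ⟨h1, h2⟩ := lift_rel hf hK huv
      refine ⟨⟨huv.1, huv.2.1⟩, (hE1m _ _).2 fun x hx => ?_, (hE1m _ _).2 fun y hy => ?_⟩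
      · obtain ⟨y, hy, hxy⟩ := h1 x hx
        exact (hZm _ _).2 ⟨y, hy, hR hxy⟩
      · obtain ⟨x, hx, hxy⟩ := h2 y hy
        exact (hZm _ _).2 ⟨x, hx, hsymm _ _ (hR hxy)⟩
    · intro u hu
      have : (u, u) ∈ E1 := (hE1m _ _).2 fun x hx => (hZm _ _).2 ⟨x, hx, hrefl x (by change f x ∈ K; rw [hx]; exact hu)⟩
      exact ⟨⟨hu, hu⟩, this, this⟩
    · rintro u v ⟨⟨h1, h2⟩, h3, h4⟩
      exact ⟨⟨h2, h1⟩, h4, h3⟩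
    · have key : ∀ u v w, (u, v) ∈ E1 → (v, w) ∈ E1 → (u, w) ∈ E1 := by
        intro u v w h1 h2
        refine (hE1m _ _).2 fun x hx => ?_
        obtain ⟨y, hy, hxy⟩ := (hZm _ _).1 ((hE1m _ _).1 h1 x hx)
        obtain ⟨z, hz, hyz⟩ := (hZm _ _).1 ((hE1m _ _).1 h2 y hy)
        exact (hZm _ _).2 ⟨z, hz, htrans _ _ _ hxy hyz⟩
      rintro u v w ⟨⟨h1, h2⟩, h3, h4⟩ ⟨⟨g1, g2⟩, g3, g4⟩
      exact ⟨⟨h1, g2⟩, key u v w h3 g3, key w v u g4 h4⟩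
  exact (hZm _ _).1 ((hE1m _ _).1 (h E hE).2.1 x rfl)

lemma proj_equiv {S₁ S₂ : Type*} [MetricSpace S₁] [CompactSpace S₁] [MetricSpace S₂] [CompactSpace S₂]
    (hS₁ : IsSurfaceLocallyEuclidean S₁) {f : S₁ → S₂} (hf : IsCoveringMap f) {K : Set S₂} (hK : IsClosed K) {x y : S₁}
    (h : (x, y) ∈ schonfliesEquiv (f ⁻¹' K)) : (f x, f y) ∈ schonfliesEquiv K := by
  obtain ⟨hR, hKK, hEc, hrefl, hsymm, htrans⟩ := schonfliesEquiv_mem hK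
  have hE : (Prod.map f f) ⁻¹' schonfliesEquiv K ∈ closedEquivsOn (f ⁻¹' K) (schonfliesRel (f ⁻¹' K)) := by
    refine ⟨fun p hp => proj_rel hS₁ hf hK p hp, fun p hp => ?_, hEc.preimage (hf.continuous.prodMap hf.continuous), ?_, ?_, ?_⟩
    · have := hKK hp
      exact ⟨this.1, this.2⟩
    · exact fun x hx => hrefl (f x) hx
    · exact fun x y h => hsymm _ _ h
    · exact fun x y z h1 h2 => htrans _ _ _ h1 h2
  exact h _ hE

/-- Let `f : S₁ → S₂` be a (surjective) covering map between closed
surfaces, `K ⊆ S₂` nonempty compact and `L = f⁻¹(K)`. Then the image under `f` of every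
Schönflies class of `L` is exactly a Schönflies class of `K`. -/
theorem image_schonfliesClass_eq_of_coveringMap
    {S₁ S₂ : Type*}
    [MetricSpace S₁] [CompactSpace S₁] [ConnectedSpace S₁] [Nonempty S₁]
    [MetricSpace S₂] [CompactSpace S₂] [ConnectedSpace S₂] [Nonempty S₂]
    (hS₁ : IsSurfaceLocallyEuclidean S₁) (hS₂ : IsSurfaceLocallyEuclidean S₂)
    (f : S₁ → S₂) (hf : IsCoveringMap f) (hfsurj : Function.Surjective f)
    (K : Set S₂) (hK : IsCompact K) (hKne : K.Nonempty)
    (L : Set S₁) (hL : L = f ⁻¹' K) :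
    ∀ x ∈ L, f '' schonfliesClass L x = schonfliesClass K (f x) := by
  subst hL
  intro x hx
  ext v
  constructor
  · rintro ⟨y, hy, rfl⟩
    exact proj_equiv hS₁ hf hK.isClosed hy
  · intro hv
    obtain ⟨y, hy, hxy⟩ := lift_equiv hf hK.isClosed hv
    exact ⟨y, hxy, hy⟩
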